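/- Let d ≥ 3 and d/(d−1) < r ≤ (d²+1)/(d(d−1)). Let 𝔓_d(r) be the closed pentagon in the (1/p,1/q)-plane with vertices Q_1(r) = (1/(rd), 1/(rd)), Q_2 = ((d−1)/d, (d−1)/d), Q_3 = ((d−1)/d, 1/d), P(r) = (1/r, (d+1−r(d−1))/(r(d−1))), Q_4(r) = (1 − (d+1)/(rd(d−1)), 1/(rd)). Then V_r^I A is bounded from L^p(ℝ^d) to L^q(ℝ^d) for every (1/p,1/q) in the interior of 𝔓_d(r), and unbounded for every (1/p,1/q) not in 𝔓_d(r); moreover, V_r^I A : L^p → L^q is bounded for (1/p,1/q) on the half-open line segment (Q_4(r), Q_1(r)] and on the half-open line segment [Q_1(r), Q_2). -/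

import Mathlib

open MeasureTheory Metric Set
open scoped ENNReal NNReal FourierTransform

noncomputable section

/-- Euclidean `d`-space. -/
abbrev Euc (d : ℕ) : Type := EuclideanSpace ℝ (Fin d)

/-- The normalized surface measure `σ` on the unit sphere `S^{d-1} ⊆ ℝ^d`. -/
def sphereMeasure (d : ℕ) : Measure (Euc d) :=
  (((volume : Measure (Euc d)).toSphere Set.univ)⁻¹ : ℝ≥0∞) •
    ((volume : Measure (Euc d)).toSphere.map Subtype.val)

/-- The spherical average `A_t f(x) = ∫_{S^{d-1}} f(x - t y) dσ(y)`. -/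
def sphAvg {d : ℕ} (f : Euc d → ℂ) (t : ℝ) (x : Euc d) : ℂ :=
  ∫ y, f (x - t • y) ∂(sphereMeasure d)

/-- The `r`-variation of the family `t ↦ a t` over the set `E ⊆ ℝ`. -/
def rVar (r : ℝ) (E : Set ℝ) (a : ℝ → ℂ) : ℝ≥0∞ :=
  ⨆ (N : ℕ) (t : Fin (N + 1) → ℝ) (_ : StrictMono t) (_ : ∀ i, t i ∈ E),
    (∑ i : Fin N, (‖a (t i.succ) - a (t i.castSucc)‖₊ : ℝ≥0∞) ^ r) ^ (1 / r)

/-- The global variation operator `V_r A` for the spherical means. -/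
def VrA {d : ℕ} (r : ℝ) (f : Euc d → ℂ) (x : Euc d) : ℝ≥0∞ :=
  rVar r (Set.Ioi 0) (fun t => sphAvg f t x)

/-- The local variation operator `V_r^I A`, `I = [1,2]`. -/
def VrIA {d : ℕ} (r : ℝ) (f : Euc d → ℂ) (x : Euc d) : ℝ≥0∞ :=
  rVar r (Set.Icc 1 2) (fun t => sphAvg f t x)

/-- `L^q` norm (with respect to `μ`) of an `ℝ≥0∞`-valued function, `1 ≤ q ≤ ∞`. -/
def lqNorm {α : Type*} [MeasurableSpace α] (q : ℝ≥0∞) (g : α → ℝ≥0∞)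
    (μ : Measure α) : ℝ≥0∞ :=
  if q = ∞ then essSup g μ else (∫⁻ x, g x ^ q.toReal ∂μ) ^ (1 / q.toReal)

/-- Boundedness `L^p → L^q` of an `ℝ≥0∞`-valued operator (exponents in `ℝ≥0∞`). -/
def IsBddLpLq (d : ℕ) (p q : ℝ≥0∞) (T : (Euc d → ℂ) → Euc d → ℝ≥0∞) : Prop :=
  ∃ C : ℝ≥0, ∀ f : Euc d → ℂ, MemLp f p volume →
    lqNorm q (T f) volume ≤ C * eLpNorm f p volume

/-- `V_r^I A` is bounded from `L^p(ℝ^d)` to `L^q(ℝ^d)` (real exponents). -/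
def IsBddR (d : ℕ) (r p q : ℝ) : Prop :=
  ∃ C : ℝ≥0, ∀ f : Euc d → ℂ, MemLp f (ENNReal.ofReal p) volume →
    lqNorm (ENNReal.ofReal q) (VrIA r f) volume ≤
      C * eLpNorm f (ENNReal.ofReal p) volume

/-- The pentagon `𝔓_d(r)` of Theorem 1.4, with vertices
`Q_1(r), Q_2, Q_3, P(r), Q_4(r)`. -/
def pentagonMid (d : ℕ) (r : ℝ) : Set (ℝ × ℝ) :=
  convexHull ℝ ({(1 / (r * (d : ℝ)), 1 / (r * (d : ℝ))),
    (((d : ℝ) - 1) / d, ((d : ℝ) - 1) / d), (((d : ℝ) - 1) / d, 1 / (d : ℝ)),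
    (1 / r, ((d : ℝ) + 1 - r * ((d : ℝ) - 1)) / (r * ((d : ℝ) - 1))),
    (1 - ((d : ℝ) + 1) / (r * (d : ℝ) * ((d : ℝ) - 1)), 1 / (r * (d : ℝ)))} : Set (ℝ × ℝ))

/-! ## P1: sphere measure -/

open scoped Pointwise in
lemma sphM_apply {d : ℕ} {A : Set (Euc d)} (hA : MeasurableSet A) :
    sphereMeasure d A = ((volume : Measure (Euc d)).toSphere Set.univ)⁻¹ *
      (d * volume (Ioo (0:ℝ) 1 • (A ∩ sphere (0 : Euc d) 1))) := by
  rw [sphereMeasure, Measure.smul_apply, Measure.map_apply measurable_subtype_coe hA,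
    Measure.toSphere_apply' _ (measurable_subtype_coe hA), Subtype.image_preimage_coe]
  simp [Set.inter_comm]

lemma sphC_ne_zero {d : ℕ} (hd : 0 < d) : (volume : Measure (Euc d)).toSphere Set.univ ≠ 0 := by
  haveI : Nonempty (Fin d) := ⟨⟨0, hd⟩⟩
  haveI : Nontrivial (Euc d) := inferInstance
  rw [Measure.measure_univ_ne_zero]; exact Measure.toSphere_ne_zero _

lemma sphC_ne_top {d : ℕ} : (volume : Measure (Euc d)).toSphere Set.univ ≠ ∞ :=
  measure_ne_top _ _

lemma sphM_prob {d : ℕ} (hd : 0 < d) : IsProbabilityMeasure (sphereMeasure d) := by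
  constructor
  rw [sphereMeasure, Measure.smul_apply, Measure.map_apply measurable_subtype_coe MeasurableSet.univ]
  simp only [preimage_univ, smul_eq_mul]
  exact ENNReal.inv_mul_cancel (sphC_ne_zero hd) sphC_ne_top

instance sphM_finite {d : ℕ} : IsFiniteMeasure (sphereMeasure d) := by
  rcases Nat.eq_zero_or_pos d with h | h
  · subst h
    constructor
    have : (volume : Measure (Euc 0)).toSphere = 0 := by
      rw [Measure.toSphere_eq_zero_iff]; infer_instance
    rw [sphereMeasure, this]; simp
  · haveI := sphM_prob h; infer_instance

lemma sphM_ae_norm (d : ℕ) : ∀ᵐ y ∂(sphereMeasure d), ‖y‖ = 1 := by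
  rw [sphereMeasure]
  apply Measure.ae_smul_measure
  rw [ae_map_iff measurable_subtype_coe.aemeasurable
    (measurableSet_eq_fun measurable_norm measurable_const)]
  exact Filter.Eventually.of_forall fun y => by simpa using y.2

lemma toSphere_map_eq {d : ℕ} (hd : 0 < d) :
    (volume : Measure (Euc d)).toSphere.map Subtype.val =
      ((volume : Measure (Euc d)).toSphere Set.univ) • sphereMeasure d := by
  rw [sphereMeasure, smul_smul, ENNReal.mul_inv_cancel (sphC_ne_zero hd) sphC_ne_top, one_smul]

lemma polar_lintegral {d : ℕ} (hd : 0 < d) {g : Euc d → ℝ≥0∞} (hg : Measurable g) :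
    ∫⁻ x, g x = ((volume : Measure (Euc d)).toSphere Set.univ) *
      ∫⁻ t in Ioi (0:ℝ), ENNReal.ofReal (t ^ (d - 1)) * ∫⁻ y, g (t • y) ∂(sphereMeasure d) := by
  haveI : Nonempty (Fin d) := ⟨⟨0, hd⟩⟩
  haveI : Nontrivial (Euc d) := inferInstance
  have hmp := Measure.measurePreserving_homeomorphUnitSphereProd (volume : Measure (Euc d))
  have h1 : ∫⁻ x, g x = ∫⁻ x : ({0}ᶜ : Set (Euc d)), g x ∂(Measure.comap Subtype.val volume) := by
    rw [lintegral_subtype_comap (measurableSet_singleton _).compl (f := g)]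
    rw [restrict_compl_singleton]
  have h2 : ∀ x : ({0}ᶜ : Set (Euc d)), g x =
      (fun z : (sphere (0 : Euc d) 1) × (Ioi (0:ℝ)) => g (z.2.1 • z.1.1))
        (homeomorphUnitSphereProd (Euc d) x) := by
    intro x
    simp only [homeomorphUnitSphereProd_apply_snd_coe, homeomorphUnitSphereProd_apply_fst_coe]
    rw [smul_smul, mul_inv_cancel₀, one_smul]
    have := x.2
    rw [norm_ne_zero_iff]; exact this
  have hm : Measurable (fun z : (sphere (0 : Euc d) 1) × (Ioi (0:ℝ)) => g (z.2.1 • z.1.1)) := by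
    apply hg.comp; fun_prop
  rw [h1]; simp_rw [h2]
  rw [hmp.lintegral_comp hm, lintegral_prod_symm' _ hm, Measure.volumeIoiPow,
    lintegral_withDensity_eq_lintegral_mul]
  · have hfr : Module.finrank ℝ (Euc d) = d := by simp
    rw [hfr]
    simp only [Pi.mul_apply]
    rw [lintegral_subtype_comap measurableSet_Ioi (f := fun t : ℝ => ENNReal.ofReal (t ^ (d-1)) *
      ∫⁻ (x : sphere (0 : Euc d) 1), g (t • x.1) ∂Measure.toSphere volume)]
    rw [← lintegral_const_mul']
    · refine lintegral_congr fun t => ?_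
      rw [mul_left_comm]
      congr 1
      have hgt : Measurable fun y : Euc d => g (t • y) := hg.comp (by fun_prop)
      rw [← smul_eq_mul, ← lintegral_smul_measure, ← toSphere_map_eq hd,
        lintegral_map hgt measurable_subtype_coe]
    · exact sphC_ne_top
  · fun_prop
  · exact hm.lintegral_prod_left'

open scoped Pointwise in
lemma sphM_map_isometry {d : ℕ} (L : Euc d ≃ₗᵢ[ℝ] Euc d) :
    (sphereMeasure d).map L = sphereMeasure d := by
  ext A hA
  have hL : Measurable L := L.continuous.measurable
  rw [Measure.map_apply hL hA, sphM_apply (hL hA), sphM_apply hA]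
  congr 2
  have : Ioo (0:ℝ) 1 • (L ⁻¹' A ∩ sphere (0 : Euc d) 1) =
      L ⁻¹' (Ioo (0:ℝ) 1 • (A ∩ sphere (0 : Euc d) 1)) := by
    ext z
    simp only [Set.mem_smul, mem_preimage, mem_inter_iff, mem_sphere_zero_iff_norm]
    constructor
    · rintro ⟨t, ht, y, ⟨hy, hn⟩, rfl⟩
      exact ⟨t, ht, L y, ⟨hy, by simpa using hn⟩, by simp⟩
    · rintro ⟨t, ht, y, ⟨hy, hn⟩, h⟩
      refine ⟨t, ht, L.symm y, ⟨by simpa using hy, by simpa using hn⟩, ?_⟩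
      apply L.injective; simp [h]
  rw [this]
  have hmp := L.measurePreserving
  exact MeasurePreserving.measure_preimage_equiv (f := L.toHomeomorph.toMeasurableEquiv) hmp _

lemma exists_isometry {d : ℕ} {v w : Euc d} (h : ‖v‖ = ‖w‖) :
    ∃ L : Euc d ≃ₗᵢ[ℝ] Euc d, L v = w :=
  ⟨(ℝ ∙ (v - w))ᗮ.reflection, Submodule.reflection_sub h⟩

/-- unit vector -/
def e0 (d : ℕ) (i : Fin d) : Euc d := EuclideanSpace.single i 1

lemma norm_e0 {d : ℕ} (i : Fin d) : ‖e0 d i‖ = 1 := by simp [e0]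

lemma vol_box {d : ℕ} (i : Fin d) (a b ρ : ℝ) :
    volume {z : Euc d | z i ∈ Icc a b ∧ ∀ k, k ≠ i → z k ∈ Icc (-ρ) ρ} =
      ENNReal.ofReal (b - a) * ENNReal.ofReal (2 * ρ) ^ (d - 1) := by
  have h : {z : Euc d | z i ∈ Icc a b ∧ ∀ k, k ≠ i → z k ∈ Icc (-ρ) ρ} =
     (MeasurableEquiv.toLp 2 (Fin d → ℝ)).symm ⁻¹' (Set.pi univ (fun k => if k = i then Icc a b else Icc (-ρ) ρ)) := by
    ext z
    simp only [Set.mem_ofPred_eq, mem_preimage, Set.mem_pi, mem_univ, forall_true_left]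
    constructor
    · rintro ⟨h1, h2⟩ k
      by_cases hk : k = i
      · subst hk; simpa using h1
      · simpa [hk] using h2 k hk
    · intro h
      refine ⟨by simpa using h i, fun k hk => by simpa [hk] using h k⟩
  rw [h, (EuclideanSpace.volume_preserving_symm_measurableEquiv_toLp (Fin d)).measure_preimage_equiv,
    volume_pi_pi]
  rw [← Finset.mul_prod_erase _ _ (Finset.mem_univ i)]
  congr 1
  · simp
  · rw [Finset.prod_congr rfl (g := fun _ => ENNReal.ofReal (2 * ρ))]
    · simp
    · intro k hk
      rw [if_neg (Finset.ne_of_mem_erase hk), Real.volume_Icc]; ring_nf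

lemma norm_sub_e0_sq {d : ℕ} (i : Fin d) (y : Euc d) : ‖y - e0 d i‖ ^ 2 = ‖y‖ ^ 2 - 2 * y i + 1 := by
  rw [norm_sub_sq_real, norm_e0, e0, EuclideanSpace.inner_single_right]; simp

lemma norm_sq_split {d : ℕ} (i : Fin d) (y : Euc d) :
    ‖y‖ ^ 2 = y i ^ 2 + ∑ k ∈ Finset.univ.erase i, y k ^ 2 := by
  rw [EuclideanSpace.real_norm_sq_eq, ← Finset.add_sum_erase _ _ (Finset.mem_univ i)]

lemma abs_coord_le {d : ℕ} (y : Euc d) (k : Fin d) : |y k| ≤ ‖y‖ := by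
  simpa using PiLp.norm_apply_le y k

open scoped Pointwise in
lemma cap_upper {d : ℕ} (hd : 0 < d) : ∃ C : ℝ≥0, ∀ (ξ : Euc d) (ρ : ℝ), 0 < ρ →
    sphereMeasure d (closedBall ξ ρ) ≤ C * ENNReal.ofReal ρ ^ (d - 1) := by
  let i : Fin d := ⟨0, hd⟩
  set S := (volume : Measure (Euc d)).toSphere Set.univ with hS
  have hS0 : S⁻¹ ≠ ∞ := ENNReal.inv_ne_top.2 (sphC_ne_zero hd)
  -- caps at e0
  have key : ∀ ρ : ℝ, 0 < ρ → sphereMeasure d (closedBall (e0 d i) ρ) ≤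
      (S⁻¹ * d * 2 * 2 ^ (d-1)) * ENNReal.ofReal ρ ^ (d - 1) := by
    intro ρ hρ
    rw [sphM_apply isClosed_closedBall.measurableSet]
    have hsub : Ioo (0:ℝ) 1 • (closedBall (e0 d i) ρ ∩ sphere (0 : Euc d) 1) ⊆
        {z : Euc d | z i ∈ Icc (-1) 1 ∧ ∀ k, k ≠ i → z k ∈ Icc (-ρ) ρ} := by
      intro z hz
      obtain ⟨t, ht, y, ⟨hy, hn⟩, rfl⟩ := Set.mem_smul.1 hz
      rw [mem_sphere_zero_iff_norm] at hn
      rw [mem_closedBall, dist_eq_norm] at hy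
      refine ⟨?_, fun k hk => ?_⟩
      · have := abs_coord_le y i
        rw [hn] at this
        simp only [PiLp.smul_apply, smul_eq_mul]
        rw [mem_Icc, ← abs_le, abs_mul, abs_of_pos ht.1]
        nlinarith [ht.1, ht.2, abs_nonneg (y i)]
      · have h1 := abs_coord_le (y - e0 d i) k
        have h2 : (y - e0 d i) k = y k := by simp [e0, hk]
        rw [h2] at h1
        simp only [PiLp.smul_apply, smul_eq_mul]
        rw [mem_Icc, ← abs_le, abs_mul, abs_of_pos ht.1]
        nlinarith [ht.1, ht.2, abs_nonneg (y k)]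
    calc S⁻¹ * (d * volume (Ioo (0:ℝ) 1 • (closedBall (e0 d i) ρ ∩ sphere (0 : Euc d) 1)))
        ≤ S⁻¹ * (d * volume {z : Euc d | z i ∈ Icc (-1) 1 ∧ ∀ k, k ≠ i → z k ∈ Icc (-ρ) ρ}) := by
          gcongr
      _ = _ := by
          rw [vol_box, ENNReal.ofReal_mul (by norm_num), mul_pow]
          norm_num
          ring
  refine ⟨(S⁻¹ * d * 2 * 2 ^ (d-1) * 2 ^ (d-1)).toNNReal, fun ξ ρ hρ => ?_⟩
  rw [ENNReal.coe_toNNReal (by finiteness)]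
  by_cases hne : (closedBall ξ ρ ∩ sphere (0 : Euc d) 1).Nonempty
  · obtain ⟨w, hw, hw1⟩ := hne
    obtain ⟨L, hL⟩ := exists_isometry (d := d) (v := e0 d i) (w := w) (by
      rw [norm_e0]; simpa using hw1.symm)
    rw [← sphM_map_isometry L, Measure.map_apply L.continuous.measurable
      isClosed_closedBall.measurableSet]
    have hsub : L ⁻¹' closedBall ξ ρ ⊆ closedBall (e0 d i) (2 * ρ) := by
      intro y hy
      rw [mem_preimage, mem_closedBall] at hy
      rw [mem_closedBall] at hw ⊢
      have := dist_triangle_right (L y) w ξ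
      rw [← hL, L.dist_map] at this
      rw [← hL] at hw
      linarith
    calc _ ≤ sphereMeasure d (closedBall (e0 d i) (2 * ρ)) := measure_mono hsub
      _ ≤ _ := key _ (by linarith)
      _ = _ := by rw [ENNReal.ofReal_mul (by norm_num), mul_pow]; norm_num; ring
  · rw [not_nonempty_iff_eq_empty] at hne
    rw [sphM_apply isClosed_closedBall.measurableSet, hne]; simp

open scoped Pointwise in
lemma cap_lower {d : ℕ} (i : Fin d) : ∃ c : ℝ≥0, 0 < c ∧ ∀ ρ : ℝ, 0 < ρ → ρ ≤ 1 / d →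
    c * ENNReal.ofReal ρ ^ (d - 1) ≤
      sphereMeasure d {y | 0 < y i ∧ ∀ k, k ≠ i → |y k| ≤ ρ} := by
  have hd : 0 < d := i.pos
  set S := (volume : Measure (Euc d)).toSphere Set.univ with hS
  have hS0 : S⁻¹ ≠ ∞ := ENNReal.inv_ne_top.2 (sphC_ne_zero hd)
  have hS1 : S⁻¹ ≠ 0 := ENNReal.inv_ne_zero.2 sphC_ne_top
  have hC : S⁻¹ * d * ENNReal.ofReal (1/4) * ENNReal.ofReal (1/2) ^ (d-1) ≠ ∞ := by finiteness
  refine ⟨(S⁻¹ * d * ENNReal.ofReal (1/4) * ENNReal.ofReal (1/2) ^ (d-1)).toNNReal, ?_, fun ρ hρ hρ1 => ?_⟩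
  · rw [ENNReal.toNNReal_pos_iff]
    refine ⟨pos_iff_ne_zero.2 ?_, hC.lt_top⟩
    refine mul_ne_zero (mul_ne_zero (mul_ne_zero hS1 ?_) ?_) (pow_ne_zero _ ?_)
    · exact_mod_cast hd.ne'
    · norm_num
    · norm_num
  · rw [ENNReal.coe_toNNReal hC]
    have hm : MeasurableSet {y : Euc d | 0 < y i ∧ ∀ k, k ≠ i → |y k| ≤ ρ} := by
      have : {y : Euc d | 0 < y i ∧ ∀ k, k ≠ i → |y k| ≤ ρ} =
          {y : Euc d | 0 < y i} ∩ ⋂ k, ⋂ (_ : k ≠ i), {y : Euc d | |y k| ≤ ρ} := by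
        ext; simp
      rw [this]
      refine MeasurableSet.inter (measurableSet_lt measurable_const
        (by fun_prop : Measurable fun y : Euc d => y i)) ?_
      refine MeasurableSet.iInter fun k => MeasurableSet.iInter fun _ => ?_
      exact measurableSet_le (by fun_prop : Measurable fun y : Euc d => |y k|) measurable_const
    rw [sphM_apply hm]
    have hsub : {z : Euc d | z i ∈ Icc (1/4) (1/2) ∧ ∀ k, k ≠ i → z k ∈ Icc (-(ρ/4)) (ρ/4)} ⊆
       Ioo (0:ℝ) 1 • ({y | 0 < y i ∧ ∀ k, k ≠ i → |y k| ≤ ρ} ∩ sphere (0 : Euc d) 1) := by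
      intro z hz
      obtain ⟨h1, h2⟩ := hz
      have hz0 : 0 < ‖z‖ := lt_of_lt_of_le (by linarith [h1.1]) ((le_abs_self _).trans (abs_coord_le z i))
      have hz4 : 1/4 ≤ ‖z‖ := h1.1.trans ((le_abs_self _).trans (abs_coord_le z i))
      have hz1 : ‖z‖ < 1 := by
        have hs := norm_sq_split i z
        have : ∑ k ∈ Finset.univ.erase i, z k ^ 2 ≤ ∑ k ∈ Finset.univ.erase i, (ρ/4)^2 := by
          apply Finset.sum_le_sum
          intro k hk
          exact sq_le_sq' (h2 k (Finset.ne_of_mem_erase hk)).1 (h2 k (Finset.ne_of_mem_erase hk)).2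
        rw [Finset.sum_const, Finset.card_erase_of_mem (Finset.mem_univ _)] at this
        simp only [Finset.card_univ, Fintype.card_fin, nsmul_eq_mul] at this
        have hd' : ((d - 1 : ℕ) : ℝ) ≤ d := by exact_mod_cast Nat.sub_le _ _
        have hdp : (1:ℝ) ≤ d := by exact_mod_cast hd
        have hρd : ρ * d ≤ 1 := by rwa [le_div_iff₀ (by linarith)] at hρ1
        have hρ11 : ρ ≤ 1 := by nlinarith
        have h3 : ((d - 1 : ℕ) : ℝ) * (ρ/4)^2 ≤ 1/16 := by
          calc ((d - 1 : ℕ) : ℝ) * (ρ/4)^2 ≤ d * (ρ/4)^2 := by gcongr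
            _ = (ρ * d) * ρ / 16 := by ring
            _ ≤ 1 * 1 / 16 := by gcongr
            _ = 1/16 := by norm_num
        have h4 : z i ^ 2 ≤ 1/4 := by nlinarith [h1.1, h1.2]
        nlinarith
      refine Set.mem_smul.2 ⟨‖z‖, ⟨hz0, hz1⟩, ‖z‖⁻¹ • z, ⟨⟨?_, fun k hk => ?_⟩, ?_⟩, ?_⟩
      · simp only [PiLp.smul_apply, smul_eq_mul]
        have : 0 < z i := by linarith [h1.1]
        positivity
      · simp only [PiLp.smul_apply, smul_eq_mul]
        rw [abs_mul, abs_of_pos (inv_pos.2 hz0), inv_mul_le_iff₀ hz0]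
        have := abs_le.2 (h2 k hk)
        nlinarith
      · rw [mem_sphere_zero_iff_norm, norm_smul, norm_inv, norm_norm, inv_mul_cancel₀ hz0.ne']
      · rw [smul_smul, mul_inv_cancel₀ hz0.ne', one_smul]
    calc _ = S⁻¹ * (d * volume {z : Euc d | z i ∈ Icc (1/4) (1/2) ∧ ∀ k, k ≠ i → z k ∈ Icc (-(ρ/4)) (ρ/4)}) := by
          rw [vol_box, show 2 * (ρ/4) = (1/2) * ρ by ring, ENNReal.ofReal_mul (p := 1/2) (by norm_num), mul_pow,
            show (1/2 - 1/4 : ℝ) = 1/4 by norm_num]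
          ring
      _ ≤ _ := by gcongr

/-! ## P2: decay of the Fourier transform of the sphere -/

/-- `m(s) = ∫ cos(s y_i) dσ` -/
def mS {d : ℕ} (i : Fin d) (s : ℝ) : ℝ := ∫ y, Real.cos (s * y i) ∂(sphereMeasure d)
/-- minus derivative of `m` -/
def mS1 {d : ℕ} (i : Fin d) (s : ℝ) : ℝ := ∫ y, y i * Real.sin (s * y i) ∂(sphereMeasure d)
/-- second moment -/
def mS2 {d : ℕ} (i k : Fin d) (s : ℝ) : ℝ := ∫ y, y k ^ 2 * Real.cos (s * y i) ∂(sphereMeasure d)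

lemma sph_coord_le (d : ℕ) : ∀ᵐ y ∂(sphereMeasure d), ∀ k, |y k| ≤ 1 := by
  filter_upwards [sphM_ae_norm d] with y hy k
  rw [← hy]; exact abs_coord_le y k

lemma sph_integrable_bdd {d : ℕ} {E : Type*} [NormedAddCommGroup E] {F : Euc d → E} (C : ℝ)
    (hF : AEStronglyMeasurable F (sphereMeasure d))
    (hb : ∀ᵐ y ∂(sphereMeasure d), ‖F y‖ ≤ C) : Integrable F (sphereMeasure d) :=
  Integrable.of_bound hF C hb

lemma sph_hasDerivAt {d : ℕ} (G G' : ℝ → Euc d → ℝ) (C : ℝ)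
    (hG : ∀ s, Continuous (G s)) (hG' : ∀ s, Continuous (G' s))
    (hb : ∀ᵐ y ∂(sphereMeasure d), ∀ s, ‖G' s y‖ ≤ C)
    (hb0 : ∀ s, ∃ C0, ∀ᵐ y ∂(sphereMeasure d), ‖G s y‖ ≤ C0)
    (hd : ∀ s y, HasDerivAt (fun s => G s y) (G' s y) s) (s : ℝ) :
    HasDerivAt (fun s => ∫ y, G s y ∂(sphereMeasure d)) (∫ y, G' s y ∂(sphereMeasure d)) s := by
  refine (hasDerivAt_integral_of_dominated_loc_of_deriv_le (F := G) (F' := G') (bound := fun _ => C) (s := univ) (Filter.univ_mem) ?_ ?_ ?_ ?_ ?_ ?_).2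
  · exact Filter.Eventually.of_forall fun s => (hG s).aestronglyMeasurable
  · obtain ⟨C0, h0⟩ := hb0 s
    exact sph_integrable_bdd C0 (hG s).aestronglyMeasurable h0
  · exact (hG' s).aestronglyMeasurable
  · filter_upwards [hb] with y hy s _ using hy s
  · exact integrable_const C
  · exact Filter.Eventually.of_forall fun y s _ => hd s y

lemma mS_deriv {d : ℕ} (i : Fin d) (s : ℝ) : HasDerivAt (mS i) (-mS1 i s) s := by
  have := sph_hasDerivAt (d := d) (fun s y => Real.cos (s * y i)) (fun s y => -(y i * Real.sin (s * y i))) 1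
    (fun s => by fun_prop) (fun s => by fun_prop) ?_ ?_ ?_ s
  · rw [integral_neg] at this; exact this
  · filter_upwards [sph_coord_le d] with y hy s
    rw [norm_neg, norm_mul, Real.norm_eq_abs, Real.norm_eq_abs]
    exact mul_le_one₀ (hy i) (abs_nonneg _) (Real.abs_sin_le_one _)
  · intro s; exact ⟨1, Filter.Eventually.of_forall fun y => Real.abs_cos_le_one _⟩
  · intro s y
    have := ((hasDerivAt_id' s).mul_const (y i)).cos
    convert this using 1; ring

lemma mS1_deriv {d : ℕ} (i : Fin d) (s : ℝ) : HasDerivAt (mS1 i) (mS2 i i s) s := by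
  have := sph_hasDerivAt (d := d) (fun s y => y i * Real.sin (s * y i)) (fun s y => (y i ^ 2 * Real.cos (s * y i))) 1
    (fun s => by fun_prop) (fun s => by fun_prop) ?_ ?_ ?_ s
  · exact this
  · filter_upwards [sph_coord_le d] with y hy s
    rw [norm_mul, Real.norm_eq_abs, Real.norm_eq_abs, abs_pow]
    exact mul_le_one₀ (pow_le_one₀ (abs_nonneg _) (hy i)) (abs_nonneg _) (Real.abs_cos_le_one _)
  · intro s
    refine ⟨1, ?_⟩
    filter_upwards [sph_coord_le d] with y hy
    rw [norm_mul, Real.norm_eq_abs, Real.norm_eq_abs]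
    exact mul_le_one₀ (hy i) (abs_nonneg _) (Real.abs_sin_le_one _)
  · intro s y
    have := (((hasDerivAt_id' s).mul_const (y i)).sin).const_mul (y i)
    exact this.congr_deriv (by ring)

lemma sph_integral_isometry {d : ℕ} {E : Type*} [NormedAddCommGroup E] [NormedSpace ℝ E]
    (L : Euc d ≃ₗᵢ[ℝ] Euc d) (F : Euc d → E) :
    ∫ y, F (L y) ∂(sphereMeasure d) = ∫ y, F y ∂(sphereMeasure d) := by
  conv_rhs => rw [← sphM_map_isometry L]
  have := MeasureTheory.integral_map_equiv (μ := sphereMeasure d) L.toHomeomorph.toMeasurableEquiv F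
  exact this.symm

lemma sph_lintegral_isometry {d : ℕ}
    (L : Euc d ≃ₗᵢ[ℝ] Euc d) (F : Euc d → ℝ≥0∞) :
    ∫⁻ y, F (L y) ∂(sphereMeasure d) = ∫⁻ y, F y ∂(sphereMeasure d) := by
  conv_rhs => rw [← sphM_map_isometry L]
  have := MeasureTheory.lintegral_map_equiv (μ := sphereMeasure d) F L.toHomeomorph.toMeasurableEquiv
  exact this.symm

lemma exists_rot {d : ℕ} {i k : Fin d} (hik : k ≠ i) (α : ℝ) : ∃ L : Euc d ≃ₗᵢ[ℝ] Euc d,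
    ∀ y, L y i = Real.cos α * y i + Real.sin α * y k ∧
      L y k = Real.sin α * y i - Real.cos α * y k := by
  set u : Euc d := (-Real.sin (α/2)) • e0 d i + Real.cos (α/2) • e0 d k with hu
  have hin : ∀ y : Euc d, inner ℝ u y = -Real.sin (α/2) * y i + Real.cos (α/2) * y k := by
    intro y
    rw [hu, inner_add_left, inner_smul_left, inner_smul_left, e0, e0, EuclideanSpace.inner_single_left,
      EuclideanSpace.inner_single_left]
    simp
  have hui : u i = -Real.sin (α/2) := by simp [hu, e0, hik.symm]
  have huk : u k = Real.cos (α/2) := by simp [hu, e0, hik]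
  have hsc := Real.sin_sq_add_cos_sq (α/2)
  have hn : ‖u‖ = 1 := by
    have : ‖u‖ ^ 2 = 1 := by
      rw [← real_inner_self_eq_norm_sq, hin, hui, huk]; linarith
    have h0 := norm_nonneg u
    nlinarith
  refine ⟨(ℝ ∙ u)ᗮ.reflection, fun y => ?_⟩
  have hr : (ℝ ∙ u)ᗮ.reflection y = y - (2 * inner ℝ u y) • u := by
    rw [Submodule.reflection_orthogonal_apply, Submodule.reflection_singleton_apply, hn]
    simp only [RCLike.ofReal_real_eq_id, id, one_pow, div_one]
    rw [neg_sub, two_smul, ← add_smul, two_mul]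
  have hc : Real.cos α = 2 * Real.cos (α/2)^2 - 1 := by rw [← Real.cos_two_mul]; ring_nf
  have hs : Real.sin α = 2 * Real.sin (α/2) * Real.cos (α/2) := by rw [← Real.sin_two_mul]; ring_nf
  rw [hr, hin]
  simp only [PiLp.sub_apply, PiLp.smul_apply, smul_eq_mul, hui, huk, hc, hs]
  constructor
  · linear_combination (-2 * y i) * hsc
  · ring

lemma mS1_eq {d : ℕ} {i k : Fin d} (hik : k ≠ i) (s : ℝ) : mS1 i s = s * mS2 i k s := by
  have h := sph_hasDerivAt (d := d)
    (fun α y => (Real.sin α * y i - Real.cos α * y k) * Real.sin (s * (Real.cos α * y i + Real.sin α * y k)))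
    (fun α y => (Real.cos α * y i + Real.sin α * y k) * Real.sin (s * (Real.cos α * y i + Real.sin α * y k))
      + (Real.sin α * y i - Real.cos α * y k) * (Real.cos (s * (Real.cos α * y i + Real.sin α * y k)) *
         (s * (-Real.sin α * y i + Real.cos α * y k)))) (2 + 2 * (|s| * 2))
    (fun s => by fun_prop) (fun s => by fun_prop) ?_ ?_ ?_ 0
  · have hc : (fun α => ∫ y, (Real.sin α * y i - Real.cos α * y k) *
        Real.sin (s * (Real.cos α * y i + Real.sin α * y k)) ∂(sphereMeasure d)) =
        fun _ => ∫ y, y k * Real.sin (s * y i) ∂(sphereMeasure d) := by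
      funext α
      obtain ⟨L, hL⟩ := exists_rot hik α
      refine Eq.trans ?_ (sph_integral_isometry L (fun y => y k * Real.sin (s * y i)))
      refine integral_congr_ae (Filter.Eventually.of_forall fun y => ?_)
      simp only [(hL y).1, (hL y).2]
    rw [hc] at h
    have h2 := h.unique (hasDerivAt_const _ _)
    simp only [Real.cos_zero, Real.sin_zero, one_mul, zero_mul, add_zero, zero_sub, neg_zero, zero_add] at h2
    rw [integral_add] at h2
    · have h3 : ∫ y, -y k * (Real.cos (s * y i) * (s * y k)) ∂(sphereMeasure d) = - (s * mS2 i k s) := by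
        rw [mS2, ← integral_const_mul, ← integral_neg]
        congr 1; ext y; ring
      rw [h3] at h2
      unfold mS1; linarith
    · refine sph_integrable_bdd 1 (by fun_prop) ?_
      filter_upwards [sph_coord_le d] with y hy
      rw [norm_mul, Real.norm_eq_abs, Real.norm_eq_abs]
      exact mul_le_one₀ (hy i) (abs_nonneg _) (Real.abs_sin_le_one _)
    · refine sph_integrable_bdd (1 * (1 * (|s| * 1))) (by fun_prop) ?_
      filter_upwards [sph_coord_le d] with y hy
      rw [norm_mul, norm_mul, norm_mul, norm_neg, Real.norm_eq_abs, Real.norm_eq_abs, Real.norm_eq_abs]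
      gcongr
      · exact hy k
      · exact Real.abs_cos_le_one _
      · exact hy k
  · filter_upwards [sph_coord_le d] with y hy α
    have hb : ∀ a b : ℝ, |a| ≤ 1 → |b| ≤ 1 → |a * y i + b * y k| ≤ 2 := by
      intro a b ha hb
      calc |a * y i + b * y k| ≤ |a * y i| + |b * y k| := abs_add_le _ _
        _ ≤ 1 + 1 := by
          rw [abs_mul, abs_mul]
          exact add_le_add (mul_le_one₀ ha (abs_nonneg _) (hy i)) (mul_le_one₀ hb (abs_nonneg _) (hy k))
        _ = 2 := by norm_num
    refine (norm_add_le _ _).trans ?_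
    rw [norm_mul, norm_mul, norm_mul, norm_mul]
    simp only [Real.norm_eq_abs]
    have h1 := hb _ _ (Real.abs_cos_le_one α) (Real.abs_sin_le_one α)
    have h2 := hb (Real.sin α) (-Real.cos α) (Real.abs_sin_le_one α) (by rw [abs_neg]; exact Real.abs_cos_le_one α)
    have h3 := hb (-Real.sin α) (Real.cos α) (by rw [abs_neg]; exact Real.abs_sin_le_one α) (Real.abs_cos_le_one α)
    rw [neg_mul, ← sub_eq_add_neg] at h2
    have h4 := Real.abs_sin_le_one (s * (Real.cos α * y i + Real.sin α * y k))
    have h5 := Real.abs_cos_le_one (s * (Real.cos α * y i + Real.sin α * y k))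
    calc _ ≤ 2 * 1 + 2 * (1 * (|s| * 2)) := by gcongr
      _ = _ := by ring
  · intro α
    refine ⟨2, ?_⟩
    filter_upwards [sph_coord_le d] with y hy
    rw [norm_mul]; simp only [Real.norm_eq_abs]
    have h4 := Real.abs_sin_le_one (s * (Real.cos α * y i + Real.sin α * y k))
    have : |Real.sin α * y i - Real.cos α * y k| ≤ 2 := by
      calc _ ≤ |Real.sin α * y i| + |Real.cos α * y k| := abs_sub _ _
        _ ≤ 1 + 1 := by
          rw [abs_mul, abs_mul]
          exact add_le_add (mul_le_one₀ (Real.abs_sin_le_one α) (abs_nonneg _) (hy i)) (mul_le_one₀ (Real.abs_cos_le_one α) (abs_nonneg _) (hy k))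
        _ = 2 := by norm_num
    calc |Real.sin α * y i - Real.cos α * y k| * |Real.sin (s * (Real.cos α * y i + Real.sin α * y k))| ≤ 2 * 1 := by gcongr
      _ = 2 := by norm_num
  · intro α y
    have e1 : HasDerivAt (fun α => Real.sin α * y i - Real.cos α * y k) (Real.cos α * y i + Real.sin α * y k) α := by
      exact (((Real.hasDerivAt_sin α).mul_const (y i)).sub ((Real.hasDerivAt_cos α).mul_const (y k))).congr_deriv (by ring)
    have e2 : HasDerivAt (fun α => s * (Real.cos α * y i + Real.sin α * y k)) (s * (-Real.sin α * y i + Real.cos α * y k)) α :=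
      (((Real.hasDerivAt_cos α).mul_const (y i)).add ((Real.hasDerivAt_sin α).mul_const (y k))).const_mul s
    exact e1.mul e2.sin

lemma mS_ode {d : ℕ} (i : Fin d) (s : ℝ) : ((d:ℝ) - 1) * mS1 i s = s * (mS i s - mS2 i i s) := by
  have hsum : mS i s = ∑ k, mS2 i k s := by
    unfold mS mS2
    rw [← integral_finsetSum]
    · refine integral_congr_ae ?_
      filter_upwards [sphM_ae_norm d] with y hy
      rw [← Finset.sum_mul, ← EuclideanSpace.real_norm_sq_eq, hy]; ring
    · intro k _
      refine sph_integrable_bdd 1 (by fun_prop) ?_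
      filter_upwards [sph_coord_le d] with y hy
      rw [norm_mul, Real.norm_eq_abs, Real.norm_eq_abs, abs_pow]
      exact mul_le_one₀ (pow_le_one₀ (abs_nonneg _) (hy k)) (abs_nonneg _) (Real.abs_cos_le_one _)
  rw [hsum, ← Finset.add_sum_erase _ _ (Finset.mem_univ i), add_sub_cancel_left, Finset.mul_sum]
  rw [Finset.sum_congr rfl (fun k hk => (mS1_eq (Finset.ne_of_mem_erase hk) s).symm)]
  rw [Finset.sum_const, Finset.card_erase_of_mem (Finset.mem_univ _)]
  simp only [Finset.card_univ, Fintype.card_fin, nsmul_eq_mul]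
  rw [Nat.cast_sub i.pos]; simp

lemma mS_abs_le {d : ℕ} (i : Fin d) (s : ℝ) : |mS i s| ≤ 1 := by
  haveI := sphM_prob i.pos
  have := norm_integral_le_of_norm_le_const (μ := sphereMeasure d) (f := fun y => Real.cos (s * y i)) (C := 1)
    (Filter.Eventually.of_forall fun y => Real.abs_cos_le_one _)
  simpa [mS, mS1] using this

lemma mS1_abs_le {d : ℕ} (i : Fin d) (s : ℝ) : |mS1 i s| ≤ 1 := by
  haveI := sphM_prob i.pos
  have := norm_integral_le_of_norm_le_const (μ := sphereMeasure d) (f := fun y => y i * Real.sin (s * y i)) (C := 1) (by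
    filter_upwards [sph_coord_le d] with y hy
    rw [norm_mul, Real.norm_eq_abs, Real.norm_eq_abs]
    exact mul_le_one₀ (hy i) (abs_nonneg _) (Real.abs_sin_le_one _))
  simpa [mS, mS1] using this

lemma mS_decay {d : ℕ} (hd : 3 ≤ d) (i : Fin d) : ∃ C : ℝ, 0 < C ∧ ∀ s : ℝ, 0 ≤ s →
    s ^ (d - 1) * (mS i s ^ 2 + mS1 i s ^ 2) ≤ C := by
  obtain ⟨n, rfl⟩ : ∃ n, d = n + 2 := ⟨d - 2, by omega⟩
  have hn1 : (1:ℝ) ≤ n := by exact_mod_cast (by omega : 1 ≤ n)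
  set N : ℝ := n + 1 with hN
  have hNd : ((n + 2 : ℕ) : ℝ) - 1 = N := by push_cast; ring
  have hN0 : 0 < N := by linarith
  let E : ℝ → ℝ := fun s => s ^ (n+1) * (mS i s ^ 2 + mS1 i s ^ 2) - N * s ^ n * (mS i s * mS1 i s)
  let E' : ℝ → ℝ := fun s => N * s ^ (n-1) * (mS i s * mS1 i s)
  have hode : ∀ s, N * mS1 i s = s * (mS i s - mS2 i i s) := fun s => by
    have := mS_ode i s; rwa [hNd] at this
  have hE : ∀ s, HasDerivAt E (E' s) s := by
    intro s
    have h1 := ((hasDerivAt_pow (n+1) s).mul (((mS_deriv i s).pow 2).add ((mS1_deriv i s).pow 2)))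
    have h2 := (((hasDerivAt_pow n s).const_mul N).mul ((mS_deriv i s).mul (mS1_deriv i s)))
    refine (h1.sub h2).congr_deriv ?_
    simp only [E']
    obtain ⟨k, rfl⟩ : ∃ k, n = k + 1 := ⟨n - 1, by omega⟩
    have := hode s
    simp only [Nat.add_sub_cancel, Pi.add_apply, Pi.pow_apply, Pi.mul_apply]
    push_cast
    have hk : (k:ℝ) = N - 2 := by rw [hN]; push_cast; ring
    rw [hk]
    simp only [pow_succ]
    linear_combination (2 * s ^ k * s * mS1 i s - N * s ^ k * mS i s) * this
  have hlow : ∀ s, N ≤ s → s ^ (n+1) * (mS i s ^ 2 + mS1 i s ^ 2) ≤ 2 * E s := by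
    intro s hs
    have hs0 : 0 < s := by linarith
    simp only [E]
    have : N * s ^ n * (mS i s * mS1 i s) ≤ s ^ (n+1) * ((mS i s ^ 2 + mS1 i s ^ 2) / 2) := by
      calc N * s ^ n * (mS i s * mS1 i s) ≤ N * s ^ n * ((mS i s ^ 2 + mS1 i s ^ 2) / 2) := by
            gcongr; nlinarith [sq_nonneg (mS i s - mS1 i s)]
        _ ≤ s * s ^ n * ((mS i s ^ 2 + mS1 i s ^ 2) / 2) := by gcongr
        _ = _ := by ring
    linarith
  have hE' : ∀ s, N ≤ s → E' s ≤ N / s ^ 2 * E s := by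
    intro s hs
    have hs0 : 0 < s := by linarith
    have h1 := hlow s hs
    have : E' s ≤ N / s ^ 2 * (s ^ (n+1) * (mS i s ^ 2 + mS1 i s ^ 2) / 2) := by
      simp only [E']
      obtain ⟨k, rfl⟩ : ∃ k, n = k + 1 := ⟨n - 1, by omega⟩
      have : N / s ^ 2 * (s ^ (k+1+1) * (mS i s ^ 2 + mS1 i s ^ 2) / 2) =
        N * s ^ k * ((mS i s ^ 2 + mS1 i s ^ 2) / 2) := by
          field_simp
          ring
      rw [this, Nat.add_sub_cancel]
      gcongr; nlinarith [sq_nonneg (mS i s - mS1 i s)]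
    refine this.trans ?_
    gcongr; linarith
  have hanti : AntitoneOn (fun s => E s * Real.exp (N / s)) (Ici N) := by
    have hder : ∀ s, N ≤ s → HasDerivAt (fun s => E s * Real.exp (N / s))
        (Real.exp (N / s) * (E' s - N / s ^ 2 * E s)) s := by
      intro s hs
      have hs0 : s ≠ 0 := by linarith
      have h2 : HasDerivAt (fun s => N / s) (-(N / s ^ 2)) s := by
        have := (hasDerivAt_inv hs0).const_mul N
        simp only [← div_eq_mul_inv] at this
        exact this.congr_deriv (by ring)
      exact ((hE s).mul h2.exp).congr_deriv (by ring)
    apply antitoneOn_of_deriv_nonpos (convex_Ici N)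
    · intro s hs; exact (hder s hs).continuousAt.continuousWithinAt
    · intro s hs
      exact (hder s (interior_subset hs)).differentiableAt.differentiableWithinAt
    · intro s hs
      rw [(hder s (interior_subset hs)).deriv]
      have := hE' s (interior_subset hs)
      exact mul_nonpos_of_nonneg_of_nonpos (Real.exp_nonneg _) (by linarith)
  refine ⟨2 * (N ^ (n+1)) + 2 * |E N * Real.exp (N / N)| + 1, by positivity, fun s hs => ?_⟩
  have hpos : 0 ≤ |E N * Real.exp (N / N)| := abs_nonneg _
  have hpn : 0 < N ^ (n+1) := by positivity
  show s ^ (n+1) * _ ≤ _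
  rcases le_total s N with h | h
  · have h1 := mS_abs_le i s
    have h2 := mS1_abs_le i s
    have h3 : mS i s ^ 2 ≤ 1 := by rw [← sq_abs]; exact pow_le_one₀ (abs_nonneg _) h1
    have h4 : mS1 i s ^ 2 ≤ 1 := by rw [← sq_abs]; exact pow_le_one₀ (abs_nonneg _) h2
    calc s ^ (n+1) * (mS i s ^ 2 + mS1 i s ^ 2) ≤ N ^ (n+1) * (1 + 1) := by gcongr
      _ ≤ _ := by linarith
  · have h1 := hanti (mem_Ici.2 le_rfl) (mem_Ici.2 h) h
    simp only at h1
    have h2 := hlow s h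
    have hs0 : 0 < s := by linarith
    have h3 : 0 ≤ E s := by
      have : 0 ≤ s ^ (n+1) * (mS i s ^ 2 + mS1 i s ^ 2) := by positivity
      linarith
    have h4 : E s ≤ E s * Real.exp (N / s) := by
      apply le_mul_of_one_le_right h3
      exact Real.one_le_exp (by positivity)
    have := le_abs_self (E N * Real.exp (N / N))
    linarith

/-! ## P3: Plancherel on L1 ∩ L2, Fourier transform of the sphere -/

lemma fourier_ae_eq_L2 {d : ℕ} {v : Euc d → ℂ} (h1 : Integrable v) (h2 : MemLp v 2) :
    ∀ᵐ ξ, (𝓕 (h2.toLp v) : Lp ℂ 2 (volume : Measure (Euc d))) ξ = 𝓕 v ξ := by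
  apply ae_eq_of_integral_contDiff_smul_eq
  · exact (Lp.memLp _).locallyIntegrable (by norm_num)
  · exact (VectorFourier.fourierIntegral_continuous Real.continuous_fourierChar
      (by exact continuous_inner) h1).locallyIntegrable
  · intro g hg hgc
    have hgC : HasCompactSupport (fun x => (g x : ℂ)) := hgc.comp_left (g := fun x : ℝ => (x : ℂ)) (by simp)
    have hgC' : ContDiff ℝ (⊤ : ℕ∞) (fun x => (g x : ℂ)) := Complex.ofRealCLM.contDiff.comp hg
    set G : SchwartzMap (Euc d) ℂ := hgC.toSchwartzMap hgC' with hG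
    have hGx : ∀ x, G x = (g x : ℂ) := fun x => rfl
    have e1 := congrArg (fun T => T G) (Lp.fourier_toTemperedDistribution_eq (h2.toLp v))
    simp only [TemperedDistribution.fourier_apply, Lp.toTemperedDistribution_apply] at e1
    have e2 : ∫ x, g x • (𝓕 (h2.toLp v) : Lp ℂ 2 (volume : Measure (Euc d))) x =
        ∫ x, G x • (𝓕 (h2.toLp v) : Lp ℂ 2 (volume : Measure (Euc d))) x := by
      simp [hGx]
    rw [e2, ← e1]
    have e3 : ∫ x, (𝓕 G) x • (h2.toLp v) x = ∫ x, (𝓕 (fun x => G x)) x • v x := by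
      refine integral_congr_ae ?_
      filter_upwards [h2.coeFn_toLp] with x hx
      rw [hx, SchwartzMap.fourier_coe]
    rw [e3]
    have := VectorFourier.integral_fourierIntegral_smul_eq_flip (e := Real.fourierChar) (μ := volume) (ν := volume)
      (L := innerₗ (Euc d)) (f := fun x => G x) (g := v) Real.continuous_fourierChar
      (by exact continuous_inner) G.integrable h1
    simp only [flip_innerₗ] at this
    refine Eq.trans this ?_
    refine integral_congr_ae (Filter.Eventually.of_forall fun x => ?_)
    simp only [hGx]
    rw [Complex.coe_smul]; rfl

lemma plancherel {d : ℕ} {v : Euc d → ℂ} (h1 : Integrable v) :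
    ∫⁻ ξ, ‖𝓕 v ξ‖ₑ ^ 2 ≤ ∫⁻ x, ‖v x‖ₑ ^ 2 := by
  by_cases hfin : ∫⁻ x, ‖v x‖ₑ ^ 2 = ∞
  · rw [hfin]; exact le_top
  have h2 : MemLp v 2 := by
    refine ⟨h1.1, ?_⟩
    rw [eLpNorm_lt_top_iff_lintegral_rpow_enorm_lt_top (by norm_num) (by norm_num)]
    simpa using lt_top_iff_ne_top.2 hfin
  have hn : eLpNorm (𝓕 v) 2 volume = eLpNorm v 2 volume := by
    rw [← eLpNorm_congr_ae (fourier_ae_eq_L2 h1 h2), ← eLpNorm_congr_ae h2.coeFn_toLp]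
    have := Lp.norm_fourier_eq (h2.toLp v)
    rw [Lp.norm_def, Lp.norm_def] at this
    exact (ENNReal.toReal_eq_toReal_iff' (Lp.eLpNorm_ne_top _) (Lp.eLpNorm_ne_top _)).1 this
  have key : ∀ w : Euc d → ℂ, ∫⁻ x, ‖w x‖ₑ ^ 2 = eLpNorm w 2 volume ^ 2 := by
    intro w
    rw [eLpNorm_eq_lintegral_rpow_enorm_toReal (by norm_num) (by norm_num), ← ENNReal.rpow_natCast, ← ENNReal.rpow_mul]
    norm_num
  rw [key, key, hn]

lemma sph_char {d : ℕ} (i : Fin d) (v : Euc d) :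
    ∫ y, Complex.exp ((inner ℝ y v : ℝ) * Complex.I) ∂(sphereMeasure d) = mS i ‖v‖ := by
  obtain ⟨L, hL⟩ := exists_isometry (d := d) (v := ‖v‖ • e0 d i) (w := v) (by
    rw [norm_smul, norm_norm, norm_e0, mul_one])
  have h0 : ∫ y, Complex.exp ((inner ℝ y v : ℝ) * Complex.I) ∂(sphereMeasure d) =
      ∫ y, Complex.exp ((‖v‖ * y i : ℝ) * Complex.I) ∂(sphereMeasure d) := by
    rw [← sph_integral_isometry L]
    refine integral_congr_ae (Filter.Eventually.of_forall fun y => ?_)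
    have : (inner ℝ (L y) v : ℝ) = ‖v‖ * y i := by
      conv_lhs => rw [← hL]
      rw [L.inner_map_map, inner_smul_right, e0, EuclideanSpace.inner_single_right]; simp
    simp only [this]
  have h1 : ∫ y, Complex.exp ((‖v‖ * y i : ℝ) * Complex.I) ∂(sphereMeasure d) =
      ∫ y, Complex.exp ((-(‖v‖ * y i) : ℝ) * Complex.I) ∂(sphereMeasure d) := by
    rw [← sph_integral_isometry (LinearIsometryEquiv.neg ℝ)]
    refine integral_congr_ae (Filter.Eventually.of_forall fun y => ?_)
    simp
  have hi : ∀ s : ℝ, Integrable (fun y : Euc d => Complex.exp ((s * y i : ℝ) * Complex.I)) (sphereMeasure d) := by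
    intro s
    refine sph_integrable_bdd 1 (by fun_prop) (Filter.Eventually.of_forall fun y => ?_)
    rw [Complex.norm_exp_ofReal_mul_I]
  have h2 : (2:ℂ) * ∫ y, Complex.exp ((inner ℝ y v : ℝ) * Complex.I) ∂(sphereMeasure d) = 2 * mS i ‖v‖ := by
    have e1 : (2:ℂ) * ∫ y, Complex.exp ((inner ℝ y v : ℝ) * Complex.I) ∂(sphereMeasure d) =
      ∫ y, Complex.exp ((‖v‖ * y i : ℝ) * Complex.I) ∂(sphereMeasure d) +
      ∫ y, Complex.exp ((-(‖v‖ * y i) : ℝ) * Complex.I) ∂(sphereMeasure d) := by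
        rw [← h1, ← h0]; ring
    rw [e1, ← integral_add (hi _) (by simpa using hi (-‖v‖)), mS, ← integral_complex_ofReal, ← integral_const_mul]
    refine integral_congr_ae (Filter.Eventually.of_forall fun y => ?_)
    simp only [Complex.ofReal_neg, neg_mul, Complex.ofReal_cos, Complex.cos]
    ring
  exact mul_left_cancel₀ two_ne_zero h2

/-! ## P4: convolution, dilation, the kernel Φ -/

/-- convolution -/
def cv {d : ℕ} (f φ : Euc d → ℂ) (x : Euc d) : ℂ := ∫ t, f t * φ (x - t)

/-- dilation -/
def dil {d : ℕ} {E : Type*} [SMul ℝ E] (a : ℝ) (φ : Euc d → E) (x : Euc d) : E := (a ^ d) • φ (a • x)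

lemma cv_eq {d : ℕ} (f φ : Euc d → ℂ) :
    cv f φ = MeasureTheory.convolution f φ (ContinuousLinearMap.mul ℂ ℂ) volume := rfl

lemma cv_eq' {d : ℕ} (f φ : Euc d → ℂ) :
    cv f φ = MeasureTheory.convolution f φ (ContinuousLinearMap.mul ℝ ℂ) volume := rfl

lemma cv_contDiff {d : ℕ} {f φ : Euc d → ℂ} (hf : Continuous f) (hφ : ContDiff ℝ (⊤ : ℕ∞) φ)
    (hφc : HasCompactSupport φ) : ContDiff ℝ (⊤ : ℕ∞) (cv f φ) := by
  rw [cv_eq']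
  exact hφc.contDiff_convolution_right _ hf.locallyIntegrable hφ

lemma cv_compact {d : ℕ} {f φ : Euc d → ℂ} (hf : HasCompactSupport f)
    (hφc : HasCompactSupport φ) : HasCompactSupport (cv f φ) := by
  rw [cv_eq']; exact HasCompactSupport.convolution _ hf hφc

lemma cv_fourier {d : ℕ} {f φ : Euc d → ℂ} (hf : Integrable f) (hφ : Integrable φ) (ξ : Euc d) :
    𝓕 (cv f φ) ξ = 𝓕 f ξ * 𝓕 φ ξ := by
  rw [cv_eq]; exact Real.fourier_mul_convolution_eq hf hφ ξ

lemma cc_integrable {d : ℕ} {E : Type*} [NormedAddCommGroup E] {f : Euc d → E} (hf : Continuous f)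
    (hfc : HasCompactSupport f) : Integrable f := hf.integrable_of_hasCompactSupport hfc

lemma fourier_one_sub_le {d : ℕ} {φ : Euc d → ℂ} (hφ : Continuous φ) (hφc : HasCompactSupport φ)
    (h1 : ∫ x, φ x = 1) : ∃ C : ℝ, 0 ≤ C ∧ ∀ ξ, ‖1 - 𝓕 φ ξ‖ ≤ C * ‖ξ‖ := by
  have hi : Integrable (fun x => (2 * Real.pi) * (‖x‖ * ‖φ x‖)) :=
    cc_integrable (by fun_prop) ((hφc.norm.mul_left (f := fun x => ‖x‖)).mul_left (f := fun _ => 2 * Real.pi))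
  refine ⟨∫ x, (2 * Real.pi) * (‖x‖ * ‖φ x‖), integral_nonneg fun x => by positivity, fun ξ => ?_⟩
  have hφi := cc_integrable hφ hφc
  have hφi2 : Integrable (fun x => Real.fourierChar (-(inner ℝ x ξ)) • φ x) := by
    simpa using (Real.fourierIntegral_convergent_iff (μ := volume) (f := φ) ξ).2 hφi
  rw [← h1, Real.fourier_eq, ← integral_sub hφi hφi2, ← integral_mul_const]
  refine norm_integral_le_of_norm_le (hi.mul_const _) (Filter.Eventually.of_forall fun x => ?_)
  have : φ x - Real.fourierChar (-(inner ℝ x ξ)) • φ x =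
      -(Complex.exp (Complex.I * ((-(2 * Real.pi * inner ℝ x ξ) : ℝ))) - 1) * φ x := by
    rw [Circle.smul_def, Real.fourierChar_apply, smul_eq_mul]
    push_cast
    rw [show Complex.I * -(2 * Real.pi * (inner ℝ x ξ : ℂ)) = 2 * Real.pi * -(inner ℝ x ξ : ℂ) * Complex.I by ring]
    ring
  rw [this, norm_mul, norm_neg]
  have h2 := Real.norm_exp_I_mul_ofReal_sub_one_le (x := -(2 * Real.pi * inner ℝ x ξ))
  have h3 : ‖(-(2 * Real.pi * inner ℝ x ξ))‖ ≤ 2 * Real.pi * (‖x‖ * ‖ξ‖) := by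
    rw [norm_neg, norm_mul, Real.norm_eq_abs (2 * Real.pi), abs_of_pos (by positivity)]
    gcongr; exact norm_inner_le_norm x ξ
  calc _ ≤ 2 * Real.pi * (‖x‖ * ‖ξ‖) * ‖φ x‖ := by gcongr; exact h2.trans h3
    _ = _ := by ring

lemma exists_phi0 (d : ℕ) : ∃ φ : Euc d → ℂ, ContDiff ℝ (⊤ : ℕ∞) φ ∧ HasCompactSupport φ ∧ ∫ x, φ x = 1 := by
  let b : ContDiffBump (0 : Euc d) := ⟨1, 2, by norm_num, by norm_num⟩
  refine ⟨fun x => ((b.normed volume x : ℝ) : ℂ), ?_, ?_, ?_⟩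
  · exact Complex.ofRealCLM.contDiff.comp b.contDiff_normed
  · exact (b.hasCompactSupport_normed (μ := volume)).comp_left (g := fun x : ℝ => (x : ℂ)) (by simp)
  · rw [integral_complex_ofReal, b.integral_normed]; simp

lemma exists_Phi (d N : ℕ) : ∃ Φ : Euc d → ℂ, ContDiff ℝ (⊤ : ℕ∞) Φ ∧ HasCompactSupport Φ ∧
    ∃ C : ℝ, 0 ≤ C ∧ ∀ ξ, ‖1 - 𝓕 Φ ξ‖ ≤ C * ‖ξ‖ ^ N := by
  obtain ⟨φ, hφ, hφc, h1⟩ := exists_phi0 d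
  have hφi := cc_integrable hφ.continuous hφc
  obtain ⟨C0, hC0, hb⟩ := fourier_one_sub_le hφ.continuous hφc h1
  induction N with
  | zero =>
    refine ⟨fun _ => 0, contDiff_const, HasCompactSupport.zero, 1, zero_le_one, fun ξ => ?_⟩
    rw [Real.fourier_eq]; simp
  | succ M ih =>
    obtain ⟨Φ, hΦ, hΦc, C, hC, hΦb⟩ := ih
    have hΦi := cc_integrable hΦ.continuous hΦc
    have hcv := cv_contDiff hΦ.continuous hφ hφc
    have hcvc := cv_compact hΦc hφc
    have hcvi := cc_integrable hcv.continuous hcvc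
    have hi2 : Integrable (Φ + φ) := hΦi.add hφi
    refine ⟨Φ + φ + (-1 : ℂ) • cv Φ φ, ?_, ?_, C * C0, by positivity, fun ξ => ?_⟩
    · exact (hΦ.add hφ).add (hcv.const_smul (-1 : ℂ) : ContDiff ℝ (⊤ : ℕ∞) (fun y => (-1 : ℂ) • cv Φ φ y))
    · exact (hΦc.add hφc).add (hcvc.smul_left (f := fun _ => (-1 : ℂ)))
    · have hc : ∀ {u : Euc d → ℂ} (_ : Integrable u) (ξ : Euc d),
          Integrable (fun x => Real.fourierChar (-(inner ℝ x ξ)) • u x) := by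
        intro u hu ξ
        simpa using (Real.fourierIntegral_convergent_iff (μ := volume) (f := u) ξ).2 hu
      have : 𝓕 (Φ + φ + (-1 : ℂ) • cv Φ φ) ξ = 𝓕 Φ ξ + 𝓕 φ ξ - 𝓕 Φ ξ * 𝓕 φ ξ := by
        rw [← cv_fourier hΦi hφi]
        simp only [Real.fourier_eq]
        rw [← integral_add (hc hΦi ξ) (hc hφi ξ), ← integral_sub (f := fun a => Real.fourierChar (-(inner ℝ a ξ)) • Φ a + Real.fourierChar (-(inner ℝ a ξ)) • φ a) ((hc hΦi ξ).add (hc hφi ξ)) (hc hcvi ξ)]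
        refine integral_congr_ae (Filter.Eventually.of_forall fun x => ?_)
        simp only [Pi.add_apply, Pi.smul_apply, smul_add, smul_eq_mul, Circle.smul_def]
        ring
      rw [this, show 1 - (𝓕 Φ ξ + 𝓕 φ ξ - 𝓕 Φ ξ * 𝓕 φ ξ) = (1 - 𝓕 Φ ξ) * (1 - 𝓕 φ ξ) by ring, norm_mul]
      calc _ ≤ (C * ‖ξ‖ ^ M) * (C0 * ‖ξ‖) := mul_le_mul (hΦb ξ) (hb ξ) (norm_nonneg _) (by positivity)
        _ = _ := by ring

lemma fourier_rapid {d : ℕ} {Φ : Euc d → ℂ} (hΦ : ContDiff ℝ (⊤ : ℕ∞) Φ) (hΦc : HasCompactSupport Φ)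
    (K : ℕ) : ∃ C : ℝ, 0 ≤ C ∧ ∀ ξ, ‖ξ‖ ^ K * ‖𝓕 Φ ξ‖ ≤ C := by
  set G : SchwartzMap (Euc d) ℂ := hΦc.toSchwartzMap hΦ with hG
  obtain ⟨C, hC⟩ := (𝓕 G).decay K 0
  refine ⟨C, hC.1.le, fun ξ => ?_⟩
  have := hC.2 ξ
  rw [norm_iteratedFDeriv_zero, SchwartzMap.fourier_coe] at this
  exact this

lemma dil_contDiff {d : ℕ} {φ : Euc d → ℂ} (a : ℝ) (hφ : ContDiff ℝ (⊤ : ℕ∞) φ) :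
    ContDiff ℝ (⊤ : ℕ∞) (dil a φ) := by
  unfold dil
  exact (hφ.comp (contDiff_id.const_smul a)).const_smul _

lemma dil_compact {d : ℕ} {φ : Euc d → ℂ} {a : ℝ} (ha : a ≠ 0) (hφ : HasCompactSupport φ) :
    HasCompactSupport (dil a φ) := by
  unfold dil
  exact (hφ.comp_smul ha).smul_left (f := fun _ => a ^ d)

lemma dil_lintegral {d : ℕ} {a : ℝ} (ha : 0 < a) (F : Euc d → ℝ≥0∞) :
    ∫⁻ x, F (a • x) = ENNReal.ofReal (a ^ d)⁻¹ * ∫⁻ x, F x := by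
  have h := Measure.map_addHaar_smul (volume : Measure (Euc d)) ha.ne'
  have e : MeasurableEquiv (Euc d) (Euc d) := (Homeomorph.smulOfNeZero a ha.ne').toMeasurableEquiv
  have h2 : ∫⁻ x, F x ∂(Measure.map (fun x : Euc d => a • x) volume) = ∫⁻ x, F (a • x) :=
    lintegral_map_equiv F (Homeomorph.smulOfNeZero a ha.ne').toMeasurableEquiv
  rw [← h2]
  rw [show (fun x : Euc d => a • x) = (a • ·) from rfl, h, lintegral_smul_measure]
  simp [abs_of_pos ha]

lemma dil_lintegral' {d : ℕ} {a : ℝ} (ha : 0 < a) (F : Euc d → ℝ≥0∞) :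
    ENNReal.ofReal (a ^ d) * ∫⁻ x, F (a • x) = ∫⁻ x, F x := by
  rw [dil_lintegral ha, ← mul_assoc, ← ENNReal.ofReal_mul (by positivity), mul_inv_cancel₀ (by positivity)]
  simp

lemma dil_L1 {d : ℕ} {a : ℝ} (ha : 0 < a) (φ : Euc d → ℂ) : ∫⁻ x, ‖dil a φ x‖ₑ = ∫⁻ x, ‖φ x‖ₑ := by
  rw [← dil_lintegral' ha (fun x => ‖φ x‖ₑ), ← lintegral_const_mul' _ _ ENNReal.ofReal_ne_top]
  congr 1; ext x
  rw [dil, enorm_smul, Real.enorm_of_nonneg (by positivity)]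

lemma dil_fourier {d : ℕ} {a : ℝ} (ha : 0 < a) (φ : Euc d → ℂ) (ξ : Euc d) :
    𝓕 (dil a φ) ξ = 𝓕 φ (a⁻¹ • ξ) := by
  rw [Real.fourier_eq, Real.fourier_eq]
  have h := Measure.integral_comp_smul (volume : Measure (Euc d))
    (fun x => Real.fourierChar (-(inner ℝ x (a⁻¹ • ξ))) • φ x) a
  have h2 : ∀ x : Euc d, Real.fourierChar (-(inner ℝ x ξ)) • dil a φ x =
      (a ^ d) • (Real.fourierChar (-(inner ℝ (a • x) (a⁻¹ • ξ))) • φ (a • x)) := by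
    intro x
    rw [dil, inner_smul_left, inner_smul_right, smul_comm]
    simp only [conj_trivial]
    rw [← mul_assoc, mul_inv_cancel₀ ha.ne', one_mul]
  simp_rw [h2]
  rw [integral_smul, h, smul_smul, finrank_euclideanSpace_fin, abs_of_pos (by positivity),
    mul_inv_cancel₀ (by positivity), one_smul]

lemma dil_fderiv {d : ℕ} {φ : Euc d → ℂ} (hφ : ContDiff ℝ (⊤ : ℕ∞) φ) (a : ℝ) (x : Euc d) :
    fderiv ℝ (dil a φ) x = (a ^ d) • (a • fderiv ℝ φ (a • x)) := by
  have h1 : HasFDerivAt φ (fderiv ℝ φ (a • x)) (a • x) :=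
    (hφ.differentiable (by simp) _).hasFDerivAt
  have h2 : HasFDerivAt (fun x : Euc d => a • x) (a • ContinuousLinearMap.id ℝ (Euc d)) x :=
    (hasFDerivAt_id x).const_smul a
  have h3 := (h1.comp x h2).const_smul (a ^ d)
  have h4 : (fun x => a ^ d • (φ ∘ fun x : Euc d => a • x) x) = dil a φ := rfl
  have h5 := h3.fderiv
  rw [show (a ^ d • φ ∘ fun x : Euc d => a • x) = dil a φ from rfl] at h5
  rw [h5]; simp

lemma dil_grad_L1 {d : ℕ} {a : ℝ} (ha : 0 < a) {φ : Euc d → ℂ} (hφ : ContDiff ℝ (⊤ : ℕ∞) φ) :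
    ∫⁻ x, ‖fderiv ℝ (dil a φ) x‖ₑ = ENNReal.ofReal a * ∫⁻ x, ‖fderiv ℝ φ x‖ₑ := by
  rw [← dil_lintegral' ha (fun x => ‖fderiv ℝ φ x‖ₑ), ← lintegral_const_mul' _ _ ENNReal.ofReal_ne_top,
    ← lintegral_const_mul' _ _ ENNReal.ofReal_ne_top]
  congr 1; ext x
  rw [dil_fderiv hφ, enorm_smul, enorm_smul, Real.enorm_of_nonneg (by positivity), Real.enorm_of_nonneg ha.le]
  ring

lemma cv_fderiv {d : ℕ} {f φ : Euc d → ℂ} (hf : Continuous f) (hφ : ContDiff ℝ (⊤ : ℕ∞) φ)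
    (hφc : HasCompactSupport φ) (x : Euc d) :
    ‖fderiv ℝ (cv f φ) x‖ₑ ≤ ∫⁻ t, ‖f t‖ₑ * ‖fderiv ℝ φ (x - t)‖ₑ := by
  have := hφc.hasFDerivAt_convolution_right (𝕜 := ℝ) (ContinuousLinearMap.mul ℝ ℂ) (μ := volume)
    hf.locallyIntegrable (hφ.of_le (by exact_mod_cast le_top)) x
  rw [cv_eq', this.fderiv, convolution]
  refine (enorm_integral_le_lintegral_enorm _).trans (lintegral_mono fun t => ?_)
  have h1 : ‖(ContinuousLinearMap.precompR (Euc d) (ContinuousLinearMap.mul ℝ ℂ)) (f t) (fderiv ℝ φ (x - t))‖ ≤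
      ‖f t‖ * ‖fderiv ℝ φ (x - t)‖ := by
    refine ContinuousLinearMap.opNorm_le_bound _ (by positivity) fun v => ?_
    show ‖f t * fderiv ℝ φ (x - t) v‖ ≤ _
    rw [norm_mul, mul_assoc]; gcongr
    exact ContinuousLinearMap.le_opNorm _ _
  rw [← ofReal_norm_eq_enorm, ← ofReal_norm_eq_enorm, ← ofReal_norm_eq_enorm, ← ENNReal.ofReal_mul (norm_nonneg _)]
  exact ENNReal.ofReal_le_ofReal h1

lemma conv_L1 {d : ℕ} {F G : Euc d → ℝ≥0∞} (hF : Measurable F) (hG : Measurable G) :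
    ∫⁻ x, ∫⁻ t, F t * G (x - t) = (∫⁻ t, F t) * ∫⁻ x, G x := by
  rw [lintegral_lintegral_swap (by fun_prop)]
  rw [← lintegral_mul_const _ hF]
  refine lintegral_congr fun t => ?_
  rw [lintegral_const_mul _ (by fun_prop), lintegral_sub_right_eq_self G t]

lemma cv_L1 {d : ℕ} {f φ : Euc d → ℂ} (hf : Continuous f) (hφ : Continuous φ) :
    ∫⁻ x, ‖cv f φ x‖ₑ ≤ (∫⁻ t, ‖f t‖ₑ) * ∫⁻ x, ‖φ x‖ₑ := by
  rw [← conv_L1 (by fun_prop) (by fun_prop)]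
  refine lintegral_mono fun x => (enorm_integral_le_lintegral_enorm _).trans ?_
  simp [enorm_mul]

lemma cv_grad_L1 {d : ℕ} {f φ : Euc d → ℂ} (hf : Continuous f) (hφ : ContDiff ℝ (⊤ : ℕ∞) φ)
    (hφc : HasCompactSupport φ) :
    ∫⁻ x, ‖fderiv ℝ (cv f φ) x‖ₑ ≤ (∫⁻ t, ‖f t‖ₑ) * ∫⁻ x, ‖fderiv ℝ φ x‖ₑ := by
  have hc : Continuous (fderiv ℝ φ) := hφ.continuous_fderiv (by simp)
  rw [← conv_L1 (by fun_prop) (by fun_prop)]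
  exact lintegral_mono fun x => cv_fderiv hf hφ hφc x

/-! ## P5: local Tomas–Stein -/

lemma fourier_sq_fubini {d : ℕ} {Ω : Type*} [MeasurableSpace Ω] (μ : Measure Ω) [SFinite μ] {κ : Ω → ℂ}
    (hκ : Integrable κ μ) {θ : Ω → Euc d} (hθ : Measurable θ) {u : Euc d → ℂ} (hu : Integrable u) :
    ∫ w, κ w * (𝓕 u (θ w) * (starRingEnd ℂ) (𝓕 u (θ w))) ∂μ =
      ∫ z : Euc d × Euc d, (u z.1 * (starRingEnd ℂ) (u z.2)) *
        (∫ w, κ w * (Real.fourierChar (-(inner ℝ (z.1 - z.2) (θ w))) : ℂ) ∂μ) := by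
  have e1 : ∀ w, κ w * (𝓕 u (θ w) * (starRingEnd ℂ) (𝓕 u (θ w))) =
      ∫ z : Euc d × Euc d, κ w * ((u z.1 * (starRingEnd ℂ) (u z.2)) *
        (Real.fourierChar (-(inner ℝ (z.1 - z.2) (θ w))) : ℂ)) := by
    intro w
    rw [integral_const_mul, Real.fourier_eq, ← integral_conj, ← integral_prod_mul]
    congr 1
    refine integral_congr_ae (Filter.Eventually.of_forall fun z => ?_)
    simp only [Circle.smul_def, smul_eq_mul, map_mul]
    rw [← Circle.coe_inv_eq_conj, ← AddChar.map_neg_eq_inv, neg_neg]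
    have : (Real.fourierChar (-(inner ℝ (z.1 - z.2) (θ w))) : ℂ) =
      (Real.fourierChar (-(inner ℝ z.1 (θ w)))) * (Real.fourierChar (inner ℝ z.2 (θ w))) := by
      rw [← Circle.coe_mul, ← AddChar.map_add_eq_mul, inner_sub_left]
      congr 2; ring
    rw [this]; ring
  simp_rw [e1]
  rw [integral_integral_swap]
  · refine integral_congr_ae (Filter.Eventually.of_forall fun z => ?_)
    simp only
    rw [← integral_const_mul]
    congr 1; ext w; ring
  · have hu2 : Integrable (fun z : Euc d × Euc d => u z.1 * (starRingEnd ℂ) (u z.2)) (volume.prod volume) := by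
      refine hu.mul_prod (g := fun z => (starRingEnd ℂ) (u z)) ?_
      exact (integrable_norm_iff (by exact (RCLike.continuous_conj.comp_aestronglyMeasurable hu.1))).1
        (by simpa using hu.norm)
    have h3 := hκ.mul_prod hu2
    have h4 : Integrable (fun p : Ω × (Euc d × Euc d) =>
      (Real.fourierChar (-(inner ℝ (p.2.1 - p.2.2) (θ p.1))) : ℂ) * (κ p.1 * (u p.2.1 * (starRingEnd ℂ) (u p.2.2)))) (μ.prod (volume.prod volume)) := by
      refine h3.bdd_mul (c := 1) ?_ ?_
      · have hm : Measurable fun p : Ω × (Euc d × Euc d) => -(inner ℝ (p.2.1 - p.2.2) (θ p.1)) := by fun_prop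
        exact ((continuous_subtype_val.comp Real.continuous_fourierChar).measurable.comp hm).aestronglyMeasurable
      · exact Filter.Eventually.of_forall fun p => (Circle.norm_coe _).le
    refine h4.congr (Filter.Eventually.of_forall fun p => ?_)
    simp only [Function.uncurry]
    ring

lemma sph_fourier {d : ℕ} (i : Fin d) (x : Euc d) :
    ∫ y, (Real.fourierChar (-(inner ℝ x y)) : ℂ) ∂(sphereMeasure d) = mS i (2 * Real.pi * ‖x‖) := by
  have := sph_char i ((-(2 * Real.pi)) • x)
  rw [norm_smul, norm_neg, Real.norm_of_nonneg (by positivity)] at this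
  rw [← this]
  refine integral_congr_ae (Filter.Eventually.of_forall fun y => ?_)
  simp only [Real.fourierChar_apply, inner_smul_right]
  rw [real_inner_comm]
  congr 2
  push_cast; ring

lemma phi_one_sub {d : ℕ} {Φ : Euc d → ℂ} (hΦ : ContDiff ℝ (⊤ : ℕ∞) Φ) (hΦc : HasCompactSupport Φ)
    {C : ℝ} (hC : 0 ≤ C) (hb : ∀ ξ, ‖1 - 𝓕 Φ ξ‖ ≤ C * ‖ξ‖ ^ d) : ∃ C' : ℝ, 0 ≤ C' ∧
    ∀ ξ, ‖1 - 𝓕 Φ ξ‖ ^ 2 ≤ C' * ‖ξ‖ ^ (d - 1) := by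
  obtain ⟨C1, hC1, h1⟩ := fourier_rapid hΦ hΦc 0
  refine ⟨C ^ 2 + (1 + C1) ^ 2, by positivity, fun ξ => ?_⟩
  rcases le_total ‖ξ‖ 1 with h | h
  · calc ‖1 - 𝓕 Φ ξ‖ ^ 2 ≤ (C * ‖ξ‖ ^ d) ^ 2 := by gcongr; exact hb ξ
      _ = C ^ 2 * ‖ξ‖ ^ (d * 2) := by ring
      _ ≤ C ^ 2 * ‖ξ‖ ^ (d - 1) := by
          gcongr ?_ * ?_
          exact pow_le_pow_of_le_one (norm_nonneg _) h (by omega)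
      _ ≤ _ := by
          have : 0 ≤ (1 + C1) ^ 2 * ‖ξ‖ ^ (d-1) := by positivity
          linarith
  · have h2 : ‖1 - 𝓕 Φ ξ‖ ≤ 1 + C1 := by
      refine (norm_sub_le _ _).trans ?_
      have := h1 ξ
      rw [pow_zero, one_mul] at this
      simpa using this
    calc ‖1 - 𝓕 Φ ξ‖ ^ 2 ≤ (1 + C1) ^ 2 * 1 := by rw [mul_one]; gcongr
      _ ≤ (1 + C1) ^ 2 * ‖ξ‖ ^ (d - 1) := by gcongr; exact one_le_pow₀ h
      _ ≤ _ := by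
          have : 0 ≤ C ^ 2 * ‖ξ‖ ^ (d-1) := by positivity
          linarith

/-- `σ * |Φ_R| ≤ C R` -/
lemma sph_conv_bound {d : ℕ} (hd : 0 < d) {Φ : Euc d → ℂ} (hΦ : Continuous Φ) (hΦc : HasCompactSupport Φ) :
    ∃ C : ℝ≥0, ∀ R : ℝ, 0 < R → ∀ ξ, ∫⁻ ω, ‖dil R Φ (ξ - ω)‖ₑ ∂(sphereMeasure d) ≤ C * ENNReal.ofReal R := by
  obtain ⟨C1, h1⟩ := cap_upper hd
  obtain ⟨M, hM⟩ := hΦ.bounded_above_of_compact_support hΦc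
  obtain ⟨c, hc⟩ := hΦc.isBounded.subset_closedBall 0
  set c' := max c 1 with hc'
  have hc'0 : 0 < c' := lt_of_lt_of_le one_pos (le_max_right _ _)
  have hM0 : 0 ≤ M := (norm_nonneg _).trans (hM 0)
  have hz : ∀ x, c' < ‖x‖ → Φ x = 0 := by
    intro x hx
    by_contra h
    have := hc (subset_tsupport _ (Function.mem_support.2 h))
    rw [mem_closedBall, dist_zero_right] at this
    exact absurd (this.trans (le_max_left c 1)) (not_le.2 hx)
  refine ⟨M.toNNReal * C1 * c'.toNNReal ^ (d-1), fun R hR ξ => ?_⟩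
  have : ∀ ω, ‖dil R Φ (ξ - ω)‖ₑ ≤ (closedBall ξ (c' / R)).indicator
      (fun _ => ENNReal.ofReal (R ^ d * M)) ω := by
    intro ω
    by_cases hω : ω ∈ closedBall ξ (c' / R)
    · rw [indicator_of_mem hω, ← ofReal_norm_eq_enorm]
      apply ENNReal.ofReal_le_ofReal
      rw [dil, norm_smul, Real.norm_of_nonneg (by positivity)]
      gcongr; exact hM _
    · rw [indicator_of_notMem hω, dil, hz, smul_zero, enorm_zero]
      rw [mem_closedBall, dist_comm, dist_eq_norm, not_le, div_lt_iff₀ hR] at hω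
      rw [norm_smul, Real.norm_of_nonneg hR.le]; linarith
  calc _ ≤ ∫⁻ ω, (closedBall ξ (c' / R)).indicator (fun _ => ENNReal.ofReal (R ^ d * M)) ω ∂(sphereMeasure d) :=
        lintegral_mono this
    _ = ENNReal.ofReal (R ^ d * M) * sphereMeasure d (closedBall ξ (c' / R)) := by
        rw [lintegral_indicator_const isClosed_closedBall.measurableSet]
    _ ≤ ENNReal.ofReal (R ^ d * M) * (C1 * ENNReal.ofReal (c' / R) ^ (d - 1)) := by
        gcongr; exact h1 _ _ (by positivity)
    _ = _ := by
        have e1 : (C1 : ℝ≥0∞) = ENNReal.ofReal C1 := by simp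
        push_cast
        rw [e1, ← ENNReal.ofReal_pow (by positivity), ← ENNReal.ofReal_mul (by positivity),
          ← ENNReal.ofReal_mul (by positivity),
          show (M.toNNReal : ℝ≥0∞) = ENNReal.ofReal M from rfl,
          show (c'.toNNReal : ℝ≥0∞) = ENNReal.ofReal c' from rfl, ← ENNReal.ofReal_pow (by positivity),
          ← ENNReal.ofReal_mul (by positivity), ← ENNReal.ofReal_mul (by positivity), ← ENNReal.ofReal_mul (by positivity)]
        congr 1
        obtain ⟨n, rfl⟩ : ∃ n, d = n + 1 := ⟨d - 1, by omega⟩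
        rw [Nat.add_sub_cancel, div_pow, pow_succ]
        field_simp

lemma enorm_sq_mul_conj (z : ℂ) : z * (starRingEnd ℂ) z = ((‖z‖ ^ 2 : ℝ) : ℂ) := by
  rw [Complex.mul_conj, Complex.normSq_eq_norm_sq]

lemma fourier_cont {d : ℕ} {u : Euc d → ℂ} (hu : Integrable u) : Continuous (𝓕 u) :=
  VectorFourier.fourierIntegral_continuous Real.continuous_fourierChar (by exact continuous_inner) hu

lemma restriction_R {d : ℕ} (hd : 3 ≤ d) : ∃ C : ℝ≥0, ∀ (R : ℝ), 0 < R → ∀ u : Euc d → ℂ, Integrable u →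
    ∫⁻ ω, ‖𝓕 u ω‖ₑ ^ 2 ∂(sphereMeasure d) ≤ C * ENNReal.ofReal R * (∫⁻ x, ‖u x‖ₑ ^ 2) +
      C * ENNReal.ofReal (R ^ (-(((d:ℝ) - 1) / 2))) * (∫⁻ x, ‖u x‖ₑ) ^ 2 := by
  have hd0 : 0 < d := by omega
  let i : Fin d := ⟨0, hd0⟩
  haveI := sphM_prob hd0
  obtain ⟨Φ, hΦ, hΦc, Cb, hCb, hb⟩ := exists_Phi d d
  obtain ⟨C1, hC1, h1⟩ := phi_one_sub hΦ hΦc hCb hb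
  obtain ⟨C2, h2⟩ := sph_conv_bound hd0 hΦ.continuous hΦc
  obtain ⟨C3, hC3, h3⟩ := mS_decay hd i
  set C4 : ℝ := Real.sqrt (C1 * C3) with hC4
  refine ⟨C2 + C4.toNNReal, fun R hR u hu => ?_⟩
  have hR' : R⁻¹ ≠ 0 := by positivity
  set D : Euc d → ℂ := fun x => (mS i (2 * Real.pi * ‖x‖) : ℂ) * (1 - 𝓕 Φ (R⁻¹ • x)) with hD
  have hDb : ∀ x, ‖D x‖ ≤ C4 * R ^ (-(((d:ℝ) - 1) / 2)) := by
    intro x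
    have hsq : ‖D x‖ ^ 2 ≤ (C4 * R ^ (-(((d:ℝ) - 1) / 2))) ^ 2 := by
      have e1 : (R ^ (-(((d:ℝ) - 1) / 2))) ^ 2 = (R ^ (d-1))⁻¹ := by
        rw [← Real.rpow_natCast, ← Real.rpow_mul hR.le, ← Real.rpow_natCast, ← Real.rpow_neg hR.le]
        congr 1
        push_cast [Nat.cast_sub (by omega : 1 ≤ d)]; ring
      rw [mul_pow, e1, hC4, Real.sq_sqrt (by positivity), hD]
      simp only [norm_mul, mul_pow, Complex.norm_real]
      have e2 := h1 (R⁻¹ • x)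
      rw [norm_smul, Real.norm_of_nonneg (by positivity), mul_pow] at e2
      have e3 := h3 (2 * Real.pi * ‖x‖) (by positivity)
      have e4 : ‖x‖ ^ (d-1) * mS i (2 * Real.pi * ‖x‖) ^ 2 ≤ C3 := by
        refine le_trans ?_ e3
        have : ‖x‖ ≤ 2 * Real.pi * ‖x‖ := by nlinarith [Real.pi_gt_three, norm_nonneg x]
        gcongr
        nlinarith [sq_nonneg (mS1 i (2 * Real.pi * ‖x‖))]
      rw [Real.norm_eq_abs, sq_abs]
      calc mS i (2 * Real.pi * ‖x‖) ^ 2 * ‖1 - 𝓕 Φ (R⁻¹ • x)‖ ^ 2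
          ≤ mS i (2 * Real.pi * ‖x‖) ^ 2 * (C1 * ((R⁻¹) ^ (d-1) * ‖x‖ ^ (d-1))) := by gcongr
        _ = C1 * (R⁻¹) ^ (d-1) * (‖x‖ ^ (d-1) * mS i (2 * Real.pi * ‖x‖) ^ 2) := by ring
        _ ≤ C1 * (R⁻¹) ^ (d-1) * C3 := by gcongr
        _ = _ := by rw [inv_pow]; ring
    exact (pow_le_pow_iff_left₀ (norm_nonneg _) (by positivity) two_ne_zero).1 hsq
  -- two Fubini identities
  have f1 := fourier_sq_fubini (sphereMeasure d) (κ := fun _ => (1:ℂ)) (integrable_const _)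
    (θ := fun w => w) measurable_id hu
  have hΦR : Integrable (dil R Φ) := cc_integrable (dil_contDiff R hΦ).continuous (dil_compact hR.ne' hΦc)
  have hκ : Integrable (fun w : Euc d × Euc d => (1:ℂ) * dil R Φ w.2) ((sphereMeasure d).prod volume) :=
    (integrable_const (1:ℂ)).mul_prod hΦR
  have f2 := fourier_sq_fubini ((sphereMeasure d).prod volume) hκ
    (θ := fun w : Euc d × Euc d => w.1 + w.2) (by fun_prop) hu
  have k1 : ∀ x : Euc d, ∫ w, (1:ℂ) * (Real.fourierChar (-(inner ℝ x w)) : ℂ) ∂(sphereMeasure d) =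
      mS i (2 * Real.pi * ‖x‖) := by
    intro x; simp only [one_mul]; exact sph_fourier i x
  have k2 : ∀ x : Euc d, ∫ w : Euc d × Euc d, ((1:ℂ) * dil R Φ w.2) * (Real.fourierChar (-(inner ℝ x (w.1 + w.2))) : ℂ)
      ∂((sphereMeasure d).prod volume) = mS i (2 * Real.pi * ‖x‖) * 𝓕 Φ (R⁻¹ • x) := by
    intro x
    rw [← dil_fourier hR, ← sph_fourier i x, Real.fourier_eq, ← integral_prod_mul]
    refine integral_congr_ae (Filter.Eventually.of_forall fun w => ?_)
    simp only [Circle.smul_def, smul_eq_mul, inner_add_right]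
    rw [neg_add, AddChar.map_add_eq_mul, Circle.coe_mul, real_inner_comm w.2 x]; ring
  simp only [k1] at f1
  simp only [k2] at f2
  set B : ℂ := ∫ w : Euc d × Euc d, ((1:ℂ) * dil R Φ w.2) * (𝓕 u (w.1 + w.2) * (starRingEnd ℂ) (𝓕 u (w.1 + w.2)))
      ∂((sphereMeasure d).prod volume) with hB
  -- bound for B
  have hBb : ‖B‖ₑ ≤ C2 * ENNReal.ofReal R * ∫⁻ x, ‖u x‖ₑ ^ 2 := by
    calc ‖B‖ₑ ≤ ∫⁻ w : Euc d × Euc d, ‖dil R Φ w.2‖ₑ * ‖𝓕 u (w.1 + w.2)‖ₑ ^ 2 ∂((sphereMeasure d).prod volume) := by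
          refine (enorm_integral_le_lintegral_enorm _).trans (lintegral_mono fun w => ?_)
          simp only [one_mul, enorm_mul, RCLike.enorm_conj, sq]; exact le_rfl
      _ = ∫⁻ ω, (∫⁻ η, ‖dil R Φ η‖ₑ * ‖𝓕 u (ω + η)‖ₑ ^ 2) ∂(sphereMeasure d) := by
          have := fourier_cont hu
          have := (dil_contDiff R hΦ).continuous
          rw [lintegral_prod _ (by fun_prop)]
      _ = ∫⁻ ω, (∫⁻ ξ, ‖dil R Φ (ξ - ω)‖ₑ * ‖𝓕 u ξ‖ₑ ^ 2) ∂(sphereMeasure d) := by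
          refine lintegral_congr fun ω => ?_
          rw [← lintegral_sub_right_eq_self _ ω]
          simp
      _ = ∫⁻ ξ, (∫⁻ ω, ‖dil R Φ (ξ - ω)‖ₑ ∂(sphereMeasure d)) * ‖𝓕 u ξ‖ₑ ^ 2 := by
          have := fourier_cont hu
          have := (dil_contDiff R hΦ).continuous
          rw [lintegral_lintegral_swap (by fun_prop)]
          refine lintegral_congr fun ξ => ?_
          rw [lintegral_mul_const _ (Continuous.measurable (by fun_prop))]
      _ ≤ ∫⁻ ξ, (C2 * ENNReal.ofReal R) * ‖𝓕 u ξ‖ₑ ^ 2 := by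
          refine lintegral_mono fun ξ => ?_
          simp only
          gcongr; exact h2 R hR ξ
      _ = (C2 * ENNReal.ofReal R) * ∫⁻ ξ, ‖𝓕 u ξ‖ₑ ^ 2 := by
          rw [lintegral_const_mul' _ _ (by finiteness)]
      _ ≤ _ := mul_le_mul' le_rfl (plancherel hu)
  -- left side
  have hL : ∫⁻ ω, ‖𝓕 u ω‖ₑ ^ 2 ∂(sphereMeasure d) =
      ‖∫ w, (1:ℂ) * (𝓕 u w * (starRingEnd ℂ) (𝓕 u w)) ∂(sphereMeasure d)‖ₑ := by
    have e1 : ∫ w, (1:ℂ) * (𝓕 u w * (starRingEnd ℂ) (𝓕 u w)) ∂(sphereMeasure d) =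
      ((∫ w, ‖𝓕 u w‖ ^ 2 ∂(sphereMeasure d) : ℝ) : ℂ) := by
      rw [← integral_complex_ofReal]
      simp only [one_mul, enorm_sq_mul_conj]
    have hbd : ∀ w, ‖𝓕 u w‖ ≤ ∫ x, ‖u x‖ := fun w => by
      exact VectorFourier.norm_fourierIntegral_le_integral_norm _ _ _ _ _
    rw [e1, ← ofReal_norm_eq_enorm, Complex.norm_real, Real.norm_of_nonneg (integral_nonneg fun _ => by positivity),
      ofReal_integral_eq_lintegral_ofReal]
    · refine lintegral_congr fun w => ?_
      rw [ENNReal.ofReal_pow (norm_nonneg _), ofReal_norm_eq_enorm]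
    · refine sph_integrable_bdd ((∫ x, ‖u x‖) ^ 2) ((fourier_cont hu).norm.pow 2).aestronglyMeasurable
        (Filter.Eventually.of_forall fun w => ?_)
      rw [Real.norm_of_nonneg (by positivity)]
      gcongr; exact hbd w
    · exact Filter.Eventually.of_forall fun _ => by positivity
  have hu2 : Integrable (fun z : Euc d × Euc d => u z.1 * (starRingEnd ℂ) (u z.2)) (volume.prod volume) := by
    refine hu.mul_prod (g := fun z => (starRingEnd ℂ) (u z)) ?_
    exact (integrable_norm_iff (by exact (RCLike.continuous_conj.comp_aestronglyMeasurable hu.1))).1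
      (by simpa using hu.norm)
  have hmc : Continuous (mS i) := continuous_iff_continuousAt.2 fun s => (mS_deriv i s).continuousAt
  have hΦi : Integrable Φ := cc_integrable hΦ.continuous hΦc
  have hFc := fourier_cont hΦi
  obtain ⟨Cp, hCp, hp⟩ := fourier_rapid hΦ hΦc 0
  have hi1 : Integrable (fun z : Euc d × Euc d => (u z.1 * (starRingEnd ℂ) (u z.2)) * (mS i (2 * Real.pi * ‖z.1 - z.2‖) : ℂ)) (volume.prod volume) := by
    refine hu2.mul_bdd (c := 1) (by fun_prop) (Filter.Eventually.of_forall fun z => ?_)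
    rw [Complex.norm_real]; exact mS_abs_le i _
  have hi2 : Integrable (fun z : Euc d × Euc d => (u z.1 * (starRingEnd ℂ) (u z.2)) *
      ((mS i (2 * Real.pi * ‖z.1 - z.2‖) : ℂ) * 𝓕 Φ (R⁻¹ • (z.1 - z.2)))) (volume.prod volume) := by
    refine hu2.mul_bdd (c := 1 * Cp) (by fun_prop) (Filter.Eventually.of_forall fun z => ?_)
    rw [norm_mul, Complex.norm_real]
    have := hp (R⁻¹ • (z.1 - z.2))
    rw [pow_zero, one_mul] at this
    exact mul_le_mul (mS_abs_le i _) this (norm_nonneg _) zero_le_one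
  have hdiff : ∫ w, (1:ℂ) * (𝓕 u w * (starRingEnd ℂ) (𝓕 u w)) ∂(sphereMeasure d) = B +
      ∫ z : Euc d × Euc d, (u z.1 * (starRingEnd ℂ) (u z.2)) * D (z.1 - z.2) := by
    rw [f1, f2, Measure.volume_eq_prod, eq_comm, ← eq_sub_iff_add_eq', ← integral_sub hi1 hi2]
    refine integral_congr_ae (Filter.Eventually.of_forall fun z => ?_)
    simp only [hD]; ring
  rw [hL, hdiff]
  refine (enorm_add_le _ _).trans ?_
  have hR2 : ‖∫ z : Euc d × Euc d, (u z.1 * (starRingEnd ℂ) (u z.2)) * D (z.1 - z.2)‖ₑ ≤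
      C4.toNNReal * ENNReal.ofReal (R ^ (-(((d:ℝ) - 1) / 2))) * (∫⁻ x, ‖u x‖ₑ) ^ 2 := by
    calc _ ≤ ∫⁻ z : Euc d × Euc d, (‖u z.1‖ₑ * ‖u z.2‖ₑ) * ENNReal.ofReal (C4 * R ^ (-(((d:ℝ) - 1) / 2))) := by
          refine (enorm_integral_le_lintegral_enorm _).trans (lintegral_mono fun z => ?_)
          simp only [enorm_mul, RCLike.enorm_conj]
          gcongr
          rw [← ofReal_norm_eq_enorm]
          exact ENNReal.ofReal_le_ofReal (hDb _)
      _ = (∫⁻ x, ‖u x‖ₑ) * (∫⁻ x, ‖u x‖ₑ) * ENNReal.ofReal (C4 * R ^ (-(((d:ℝ) - 1) / 2))) := by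
          rw [lintegral_mul_const' _ _ ENNReal.ofReal_ne_top, Measure.volume_eq_prod, lintegral_prod_mul hu.1.enorm hu.1.enorm]
      _ = _ := by
          rw [ENNReal.ofReal_mul (Real.sqrt_nonneg _), show (C4.toNNReal : ℝ≥0∞) = ENNReal.ofReal C4 from rfl]; ring
  push_cast
  rw [add_mul, add_mul, add_mul, add_mul]
  refine add_le_add (hBb.trans le_self_add) (hR2.trans le_add_self)

lemma cs_sq {α : Type*} [MeasurableSpace α] (μ : Measure α) {f g : α → ℝ≥0∞} (hf : AEMeasurable f μ)
    (hg : AEMeasurable g μ) : (∫⁻ x, f x * g x ∂μ) ^ 2 ≤ (∫⁻ x, f x ^ 2 ∂μ) * ∫⁻ x, g x ^ 2 ∂μ := by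
  have := ENNReal.lintegral_mul_le_Lp_mul_Lq μ (p := 2) (q := 2) (by constructor <;> norm_num) hf hg
  simp only [Pi.mul_apply, ENNReal.rpow_ofNat] at this
  calc _ ≤ ((∫⁻ x, f x ^ 2 ∂μ) ^ (1 / 2 : ℝ) * (∫⁻ x, g x ^ 2 ∂μ) ^ (1 / 2 : ℝ)) ^ 2 := by gcongr
    _ = _ := by
      rw [mul_pow, ← ENNReal.rpow_natCast, ← ENNReal.rpow_natCast, ← ENNReal.rpow_mul, ← ENNReal.rpow_mul]
      norm_num

lemma cs_set {α : Type*} [MeasurableSpace α] (μ : Measure α) {f : α → ℝ≥0∞} (hf : AEMeasurable f μ)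
    {F : Set α} (hF : MeasurableSet F) (h0 : ∀ x, x ∉ F → f x = 0) :
    (∫⁻ x, f x ∂μ) ^ 2 ≤ μ F * ∫⁻ x, f x ^ 2 ∂μ := by
  have := cs_sq μ (f := F.indicator 1) (g := f) (aemeasurable_const.indicator hF) hf
  have e1 : ∀ x, F.indicator (1 : α → ℝ≥0∞) x * f x = f x := by
    intro x
    by_cases h : x ∈ F
    · simp [h]
    · simp [h, h0 x h]
  have e2 : ∀ x, F.indicator (1 : α → ℝ≥0∞) x ^ 2 = F.indicator 1 x := by
    intro x
    by_cases h : x ∈ F <;> simp [h]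
  simp only [e1, e2] at this
  rwa [lintegral_indicator_one hF] at this

lemma restriction_F {d : ℕ} (hd : 3 ≤ d) : ∃ C : ℝ≥0, ∀ F : Set (Euc d), MeasurableSet F → volume F ≠ ∞ →
    ∀ u : Euc d → ℂ, Integrable u → (∀ x, x ∉ F → u x = 0) →
    ∫⁻ ω, ‖𝓕 u ω‖ₑ ^ 2 ∂(sphereMeasure d) ≤ C * volume F ^ (2 / ((d:ℝ) + 1)) * (∫⁻ x, ‖u x‖ₑ ^ 2) := by
  obtain ⟨C, hC⟩ := restriction_R hd
  refine ⟨2 * C, fun F hF hFt u hu h0 => ?_⟩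
  have hcs := cs_set volume (f := fun x => ‖u x‖ₑ) hu.1.enorm hF (fun x hx => by simp [h0 x hx])
  by_cases hz : volume F = 0
  · have : u =ᵐ[volume] 0 := by
      have : ∀ᵐ x, x ∉ F := measure_eq_zero_iff_ae_notMem.1 hz
      filter_upwards [this] with x hx using h0 x hx
    have h1 : ∀ ω, 𝓕 u ω = 0 := by
      intro ω
      rw [Real.fourier_eq, integral_congr_ae (g := 0)]
      · simp
      · filter_upwards [this] with x hx
        simp [hx]
    simp [h1]
  · set v := (volume F).toReal with hv
    have hv0 : 0 < v := ENNReal.toReal_pos hz hFt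
    have hvF : volume F = ENNReal.ofReal v := (ENNReal.ofReal_toReal hFt).symm
    have h := hC (v ^ (2 / ((d:ℝ) + 1))) (by positivity) u hu
    refine h.trans ?_
    rw [hvF] at hcs ⊢
    have e1 : ENNReal.ofReal ((v ^ (2 / ((d:ℝ) + 1))) ^ (-(((d:ℝ) - 1) / 2))) * ENNReal.ofReal v =
      ENNReal.ofReal v ^ (2 / ((d:ℝ) + 1)) := by
      rw [← ENNReal.ofReal_mul (by positivity), ENNReal.ofReal_rpow_of_pos hv0, ← Real.rpow_mul hv0.le]
      nth_rewrite 2 [← Real.rpow_one v]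
      rw [← Real.rpow_add hv0]
      congr 2
      field_simp; ring
    calc _ ≤ C * ENNReal.ofReal v ^ (2 / ((d:ℝ) + 1)) * (∫⁻ x, ‖u x‖ₑ ^ 2) +
        C * ENNReal.ofReal ((v ^ (2 / ((d:ℝ) + 1))) ^ (-(((d:ℝ) - 1) / 2))) * (ENNReal.ofReal v * ∫⁻ x, ‖u x‖ₑ ^ 2) := by
          rw [ENNReal.ofReal_rpow_of_pos hv0]; gcongr
      _ = C * ENNReal.ofReal v ^ (2 / ((d:ℝ) + 1)) * (∫⁻ x, ‖u x‖ₑ ^ 2) +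
        C * (ENNReal.ofReal ((v ^ (2 / ((d:ℝ) + 1))) ^ (-(((d:ℝ) - 1) / 2))) * ENNReal.ofReal v) * ∫⁻ x, ‖u x‖ₑ ^ 2 := by
          ring
      _ = _ := by rw [e1]; push_cast; ring

def extS {d : ℕ} (h : Euc d → ℂ) (x : Euc d) : ℂ :=
  ∫ ω, h ω * (Real.fourierChar (inner ℝ x ω) : ℂ) ∂(sphereMeasure d)

lemma cont_char {α : Type*} [TopologicalSpace α] {g : α → ℝ} (hg : Continuous g) :
    Continuous fun x => (Real.fourierChar (g x) : ℂ) :=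
  continuous_subtype_val.comp (Real.continuous_fourierChar.comp hg)

lemma sph_bdd_of_cont {d : ℕ} {h : Euc d → ℂ} (hh : Continuous h) : ∃ M : ℝ, 0 ≤ M ∧
    ∀ᵐ ω ∂(sphereMeasure d), ‖h ω‖ ≤ M := by
  obtain ⟨M, hM⟩ := (isCompact_sphere (0 : Euc d) 1).exists_bound_of_continuousOn hh.continuousOn
  refine ⟨max M 0, le_max_right _ _, ?_⟩
  filter_upwards [sphM_ae_norm d] with ω hω
  exact (hM ω (by simpa using hω)).trans (le_max_left _ _)

lemma extS_cont {d : ℕ} {h : Euc d → ℂ} (hh : Continuous h) : Continuous (extS h) := by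
  obtain ⟨M, hM0, hM⟩ := sph_bdd_of_cont hh
  refine continuous_of_dominated (bound := fun _ => M) ?_ ?_ (integrable_const _) ?_
  · intro x
    have := cont_char (g := fun ω : Euc d => inner ℝ x ω) (by fun_prop)
    exact (hh.mul this).aestronglyMeasurable
  · intro x
    filter_upwards [hM] with ω hω
    rw [norm_mul, Circle.norm_coe, mul_one]; exact hω
  · refine Filter.Eventually.of_forall fun ω => ?_
    have := cont_char (g := fun x : Euc d => inner ℝ x ω) (by fun_prop)
    exact continuous_const.mul this

lemma extS_enorm_le {d : ℕ} (h : Euc d → ℂ) (x : Euc d) :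
    ‖extS h x‖ₑ ≤ ∫⁻ ω, ‖h ω‖ₑ ∂(sphereMeasure d) := by
  refine (enorm_integral_le_lintegral_enorm _).trans (lintegral_mono fun ω => ?_)
  simp only [enorm_mul]
  rw [← ofReal_norm_eq_enorm (Real.fourierChar _ : ℂ), Circle.norm_coe]; simp

lemma extension_F {d : ℕ} (hd : 3 ≤ d) : ∃ C : ℝ≥0, ∀ F : Set (Euc d), MeasurableSet F → volume F ≠ ∞ →
    ∀ h : Euc d → ℂ, Continuous h →
    ∫⁻ x in F, ‖extS h x‖ₑ ^ 2 ≤ C * volume F ^ (2 / ((d:ℝ) + 1)) * (∫⁻ ω, ‖h ω‖ₑ ^ 2 ∂(sphereMeasure d)) := by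
  obtain ⟨C, hC⟩ := restriction_F hd
  haveI := sphM_prob (d := d) (by omega)
  refine ⟨C, fun F hF hFt h hh => ?_⟩
  obtain ⟨M, hM0, hM⟩ := sph_bdd_of_cont hh
  set u : Euc d → ℂ := F.indicator (extS h) with hu
  have hub : ∀ x, ‖extS h x‖ₑ ≤ ENNReal.ofReal M := by
    intro x
    refine (extS_enorm_le h x).trans ?_
    calc _ ≤ ∫⁻ ω, ENNReal.ofReal M ∂(sphereMeasure d) := by
          refine lintegral_mono_ae ?_
          filter_upwards [hM] with ω hω
          rw [← ofReal_norm_eq_enorm]; exact ENNReal.ofReal_le_ofReal hω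
      _ = _ := by simp
  have hui : Integrable u := by
    rw [hu, integrable_indicator_iff hF]
    haveI : IsFiniteMeasure (volume.restrict F) := ⟨by simpa using hFt.lt_top⟩
    refine Integrable.of_bound (extS_cont hh).aestronglyMeasurable M (Filter.Eventually.of_forall fun x => ?_)
    have := hub x
    rw [← ofReal_norm_eq_enorm] at this
    exact (ENNReal.ofReal_le_ofReal_iff hM0).1 this
  have hX : ∫⁻ x in F, ‖extS h x‖ₑ ^ 2 = ∫⁻ x, ‖u x‖ₑ ^ 2 := by
    rw [← lintegral_indicator hF]
    refine lintegral_congr fun x => ?_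
    by_cases hx : x ∈ F <;> simp [hu, hx]
  set X := ∫⁻ x, ‖u x‖ₑ ^ 2 with hXd
  have hXt : X ≠ ∞ := by
    rw [← hX]
    refine ne_top_of_le_ne_top (b := ENNReal.ofReal M ^ 2 * volume F) (by finiteness) ?_
    calc _ ≤ ∫⁻ x in F, ENNReal.ofReal M ^ 2 := lintegral_mono fun x => by simp only; gcongr; exact hub x
      _ = _ := by simp
  have hres := hC F hF hFt u hui (fun x hx => by simp [hu, hx])
  have hch : ∀ x, Continuous fun ω : Euc d => (Real.fourierChar (-(inner ℝ x ω)) : ℂ) := fun x => cont_char (by fun_prop)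
  -- duality
  have key : X = ‖∫ ω, (starRingEnd ℂ) (h ω) * 𝓕 u ω ∂(sphereMeasure d)‖ₑ := by
    have e1 : ∫ ω, (starRingEnd ℂ) (h ω) * 𝓕 u ω ∂(sphereMeasure d) = ∫ x, u x * (starRingEnd ℂ) (u x) := by
      have s1 : ∀ ω, (starRingEnd ℂ) (h ω) * 𝓕 u ω = ∫ x, (starRingEnd ℂ) (h ω) * (u x * (Real.fourierChar (-(inner ℝ x ω)) : ℂ)) := by
        intro ω
        rw [integral_const_mul, Real.fourier_eq]
        congr 1
        refine integral_congr_ae (Filter.Eventually.of_forall fun z => ?_)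
        simp only [Circle.smul_def, smul_eq_mul]; ring
      simp_rw [s1]
      rw [integral_integral_swap]
      · refine integral_congr_ae (Filter.Eventually.of_forall fun x => ?_)
        simp only
        by_cases hx : x ∈ F
        · have : u x = extS h x := by simp [hu, hx]
          rw [this]
          nth_rewrite 3 [extS]
          rw [← integral_conj, ← integral_const_mul]
          refine integral_congr_ae (Filter.Eventually.of_forall fun ω => ?_)
          simp only [map_mul]
          rw [← Circle.coe_inv_eq_conj, ← AddChar.map_neg_eq_inv]; ring
        · have : u x = 0 := by simp [hu, hx]
          simp [this]
      · have hhi : Integrable (fun ω => (starRingEnd ℂ) (h ω)) (sphereMeasure d) := by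
          refine sph_integrable_bdd M (RCLike.continuous_conj.comp hh).aestronglyMeasurable ?_
          filter_upwards [hM] with ω hω
          simpa using hω
        have h3 := hhi.mul_prod hui
        have h4 : Integrable (fun p : Euc d × Euc d => (Real.fourierChar (-(inner ℝ p.2 p.1)) : ℂ) *
          ((starRingEnd ℂ) (h p.1) * u p.2)) ((sphereMeasure d).prod volume) := by
          refine h3.bdd_mul (c := 1) ?_ (Filter.Eventually.of_forall fun p => (Circle.norm_coe _).le)
          exact (cont_char (g := fun p : Euc d × Euc d => -(inner ℝ p.2 p.1)) (by fun_prop)).aestronglyMeasurable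
        refine h4.congr (Filter.Eventually.of_forall fun p => ?_)
        simp only [Function.uncurry]; ring
    have e2 : ∫ x, u x * (starRingEnd ℂ) (u x) = ((∫ x, ‖u x‖ ^ 2 : ℝ) : ℂ) := by
      rw [← integral_complex_ofReal]
      simp only [enorm_sq_mul_conj]
    rw [e1, e2, ← ofReal_norm_eq_enorm, Complex.norm_real, Real.norm_of_nonneg (integral_nonneg fun _ => by positivity),
      integral_eq_lintegral_of_nonneg_ae (f := fun x => ‖u x‖ ^ 2) (Filter.Eventually.of_forall fun x => sq_nonneg _) (hui.1.norm.pow 2)]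
    have e3 : ∀ x, ENNReal.ofReal (‖u x‖ ^ 2) = ‖u x‖ₑ ^ 2 := fun x => by
      rw [ENNReal.ofReal_pow (norm_nonneg _), ofReal_norm_eq_enorm]
    simp_rw [e3]
    rw [ENNReal.ofReal_toReal hXt]
  have hb : X ^ 2 ≤ (∫⁻ ω, ‖h ω‖ₑ ^ 2 ∂(sphereMeasure d)) * (C * volume F ^ (2 / ((d:ℝ) + 1)) * X) := by
    have hle : X ≤ ∫⁻ ω, ‖h ω‖ₑ * ‖𝓕 u ω‖ₑ ∂(sphereMeasure d) := by
      conv_lhs => rw [key]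
      refine (enorm_integral_le_lintegral_enorm _).trans (lintegral_mono fun ω => ?_)
      simp only [enorm_mul, RCLike.enorm_conj]; exact le_rfl
    calc X ^ 2 ≤ (∫⁻ ω, ‖h ω‖ₑ * ‖𝓕 u ω‖ₑ ∂(sphereMeasure d)) ^ 2 := by gcongr
      _ ≤ _ := cs_sq _ hh.enorm.measurable.aemeasurable (fourier_cont hui).enorm.measurable.aemeasurable
      _ ≤ _ := by gcongr
  rw [hX]
  by_cases hX0 : X = 0
  · rw [hX0]; exact zero_le
  · have : X * X ≤ (C * volume F ^ (2 / ((d:ℝ) + 1)) * (∫⁻ ω, ‖h ω‖ₑ ^ 2 ∂(sphereMeasure d))) * X := by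
      calc X * X = X ^ 2 := (sq X).symm
        _ ≤ _ := hb
        _ = _ := by ring
    exact (ENNReal.mul_le_mul_iff_left hX0 hXt).1 this

/-! ## P6: variation -/

lemma rVar_le {r : ℝ} {E : Set ℝ} {a : ℝ → ℂ} {B : ℝ≥0∞}
    (h : ∀ (N : ℕ) (t : Fin (N + 1) → ℝ), StrictMono t → (∀ i, t i ∈ E) →
      (∑ i : Fin N, ‖a (t i.succ) - a (t i.castSucc)‖ₑ ^ r) ^ (1 / r) ≤ B) : rVar r E a ≤ B :=
  iSup_le fun N => iSup_le fun t => iSup_le fun ht => iSup_le fun hE => h N t ht hE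

lemma le_rVar {r : ℝ} {E : Set ℝ} {a : ℝ → ℂ} (N : ℕ) (t : Fin (N + 1) → ℝ) (ht : StrictMono t) (hE : ∀ i, t i ∈ E) :
      (∑ i : Fin N, ‖a (t i.succ) - a (t i.castSucc)‖ₑ ^ r) ^ (1 / r) ≤ rVar r E a := by
  refine le_trans ?_ (le_iSup _ N)
  refine le_trans ?_ (le_iSup _ t)
  refine le_trans ?_ (le_iSup _ ht)
  exact le_iSup (fun _ : ∀ i, t i ∈ E => (∑ i : Fin N, ‖a (t i.succ) - a (t i.castSucc)‖ₑ ^ r) ^ (1 / r)) hE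

lemma lp_mono_sum {ι : Type*} (s : Finset ι) (f : ι → ℝ≥0∞) {p q : ℝ} (hp : 0 < p) (hpq : p ≤ q) :
    (∑ i ∈ s, f i ^ q) ^ (1 / q) ≤ (∑ i ∈ s, f i ^ p) ^ (1 / p) := by
  classical
  have hq : 0 < q := hp.trans_le hpq
  induction s using Finset.induction_on with
  | empty => simp [hp, hq]
  | insert i s hi ih =>
    rw [Finset.sum_insert hi, Finset.sum_insert hi]
    have h1 := ENNReal.rpow_add_rpow_le (f i) ((∑ i ∈ s, f i ^ q) ^ (1 / q)) hp hpq
    rw [← ENNReal.rpow_mul, one_div_mul_cancel hq.ne', ENNReal.rpow_one] at h1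
    refine h1.trans ?_
    gcongr
    calc _ ≤ ((∑ i ∈ s, f i ^ p) ^ (1 / p)) ^ p := by gcongr
      _ = _ := by rw [← ENNReal.rpow_mul, one_div_mul_cancel hp.ne', ENNReal.rpow_one]

lemma rVar_anti {s r : ℝ} (hs : 0 < s) (hsr : s ≤ r) (E : Set ℝ) (a : ℝ → ℂ) : rVar r E a ≤ rVar s E a :=
  rVar_le fun N t ht hE => (lp_mono_sum _ _ hs hsr).trans (le_rVar N t ht hE)

lemma rVar_add_le {r : ℝ} (hr : 1 ≤ r) (E : Set ℝ) (a b : ℝ → ℂ) :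
    rVar r E (fun t => a t + b t) ≤ rVar r E a + rVar r E b := by
  refine rVar_le fun N t ht hE => ?_
  calc _ ≤ (∑ i : Fin N, (‖a (t i.succ) - a (t i.castSucc)‖ₑ + ‖b (t i.succ) - b (t i.castSucc)‖ₑ) ^ r) ^ (1 / r) := by
        gcongr with i
        rw [add_sub_add_comm]; exact enorm_add_le _ _
    _ ≤ _ := ENNReal.Lp_add_le _ _ _ hr
    _ ≤ _ := add_le_add (le_rVar N t ht hE) (le_rVar N t ht hE)

lemma rVar_congr {r : ℝ} {E : Set ℝ} {a b : ℝ → ℂ} (h : ∀ t ∈ E, a t = b t) : rVar r E a = rVar r E b := by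
  refine le_antisymm (rVar_le fun N t ht hE => ?_) (rVar_le fun N t ht hE => ?_)
  · simp only [h _ (hE _)]; exact le_rVar N t ht hE
  · simp only [← h _ (hE _)]; exact le_rVar N t ht hE

lemma rVar_sub_le {r : ℝ} (hr : 1 ≤ r) (E : Set ℝ) (a b : ℝ → ℂ) :
    rVar r E a ≤ rVar r E b + rVar r E (fun t => a t - b t) := by
  have := rVar_add_le hr E b (fun t => a t - b t)
  simpa using this

lemma rVar_const {r : ℝ} (hr : 0 < r) (E : Set ℝ) (c : ℂ) : rVar r E (fun _ => c) = 0 := by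
  refine le_antisymm (rVar_le fun N t ht hE => ?_) zero_le
  simp [hr]

lemma rVar_sum_le {r : ℝ} (hr : 1 ≤ r) (E : Set ℝ) {ι : Type*} (s : Finset ι) (a : ι → ℝ → ℂ) :
    rVar r E (fun t => ∑ i ∈ s, a i t) ≤ ∑ i ∈ s, rVar r E (a i) := by
  classical
  induction s using Finset.induction_on with
  | empty => simp [rVar_const (zero_lt_one.trans_le hr)]
  | insert i s hi ih =>
    simp only [Finset.sum_insert hi]
    exact (rVar_add_le hr E _ _).trans (by gcongr)

lemma rVar_lsc {r : ℝ} (hr : 0 < r) (E : Set ℝ) (a : ℝ → ℂ) (b : ℕ → ℝ → ℂ)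
    (h : ∀ t ∈ E, Filter.Tendsto (fun n => b n t) Filter.atTop (nhds (a t))) :
    rVar r E a ≤ Filter.liminf (fun n => rVar r E (b n)) Filter.atTop := by
  refine rVar_le fun N t ht hE => ?_
  have : Filter.Tendsto (fun n => (∑ i : Fin N, ‖b n (t i.succ) - b n (t i.castSucc)‖ₑ ^ r) ^ (1 / r)) Filter.atTop
    (nhds ((∑ i : Fin N, ‖a (t i.succ) - a (t i.castSucc)‖ₑ ^ r) ^ (1 / r))) := by
    refine (ENNReal.continuous_rpow_const.tendsto _).comp (tendsto_finsetSum _ fun i _ => ?_)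
    refine (ENNReal.continuous_rpow_const.tendsto _).comp ?_
    exact (continuous_enorm.tendsto _).comp ((h _ (hE _)).sub (h _ (hE _)))
  rw [← this.liminf_eq]
  exact Filter.liminf_le_liminf (Filter.Eventually.of_forall fun n => le_rVar N t ht hE)

lemma rVar_tsum_le {r : ℝ} (hr : 1 ≤ r) (E : Set ℝ) (a : ℝ → ℂ) (b : ℕ → ℝ → ℂ)
    (h : ∀ t ∈ E, Filter.Tendsto (fun n => ∑ j ∈ Finset.range n, b j t) Filter.atTop (nhds (a t))) :
    rVar r E a ≤ ∑' j, rVar r E (b j) := by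
  refine (rVar_lsc (zero_lt_one.trans_le hr) E a _ h).trans ?_
  refine Filter.liminf_le_of_le (by isBoundedDefault) fun B hB => ?_
  obtain ⟨n, hn⟩ := hB.exists
  exact hn.trans ((rVar_sum_le hr E _ _).trans (ENNReal.sum_le_tsum _))

lemma part_sum {N : ℕ} {t : Fin (N + 1) → ℝ} (ht : StrictMono t) (hE : ∀ i, t i ∈ Icc (1:ℝ) 2) (G : ℝ → ℝ≥0∞) :
    ∑ i : Fin N, ∫⁻ s in Ioc (t i.castSucc) (t i.succ), G s ≤ ∫⁻ s in Icc (1:ℝ) 2, G s := by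
  rw [← lintegral_biUnion_finset]
  · refine lintegral_mono_set (iUnion₂_subset fun i _ => ?_)
    exact Ioc_subset_Icc_self.trans (Icc_subset_Icc (hE _).1 (hE _).2)
  · intro i _ j _ hij
    have key : ∀ i j : Fin N, i < j → Disjoint (Ioc (t i.castSucc) (t i.succ)) (Ioc (t j.castSucc) (t j.succ)) := by
      intro i j hij
      rw [Ioc_disjoint_Ioc]
      refine (min_le_left _ _).trans (le_trans ?_ (le_max_right _ _))
      exact ht.monotone (by rw [Fin.le_def]; simp; exact hij)
    rcases lt_or_gt_of_ne hij with h | h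
    · exact key i j h
    · exact (key j i h).symm
  · intro i _; exact measurableSet_Ioc

lemma ftc_enorm {G : Type*} [NormedAddCommGroup G] [NormedSpace ℝ G] [CompleteSpace G] {a a' : ℝ → G} (h : ∀ t, HasDerivAt a (a' t) t) (hc : Continuous a') {u v : ℝ} (huv : u ≤ v) :
    ‖a v - a u‖ₑ ≤ ∫⁻ s in Ioc u v, ‖a' s‖ₑ := by
  rw [← intervalIntegral.integral_eq_sub_of_hasDerivAt (fun x _ => h x) (hc.intervalIntegrable _ _),
    intervalIntegral.integral_of_le huv]
  exact enorm_integral_le_lintegral_enorm _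

lemma hasDerivAt_mul_abs (x : ℝ) : HasDerivAt (fun x : ℝ => x * |x|) (2 * |x|) x := by
  by_cases hx : x = 0
  · subst hx
    rw [hasDerivAt_iff_isLittleO]
    simp only [zero_mul, sub_zero, abs_zero, mul_zero, smul_zero]
    have : (fun x : ℝ => |x|) =o[nhds 0] (fun _ => (1:ℝ)) := by
      rw [Asymptotics.isLittleO_one_iff]
      simpa using (continuous_abs (G := ℝ)).tendsto 0
    simpa using (Asymptotics.isBigO_refl (fun x : ℝ => x) (nhds 0)).mul_isLittleO this
  · refine ((hasDerivAt_id x).mul (hasDerivAt_abs hx)).congr_deriv ?_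
    simp only [id]
    rw [mul_comm x, sign_mul_self]; ring

lemma sq_le_mul_abs (x y : ℝ) : (x - y) ^ 2 ≤ 2 * abs (x * |x| - y * |y|) := by
  rcases le_total 0 x with hx | hx <;> rcases le_total 0 y with hy | hy
  · rw [abs_of_nonneg hx, abs_of_nonneg hy]
    rcases le_total x y with h | h
    · rw [abs_of_nonpos (by nlinarith)]; nlinarith
    · rw [abs_of_nonneg (by nlinarith)]; nlinarith
  · rw [abs_of_nonneg hx, abs_of_nonpos hy, abs_of_nonneg (by nlinarith)]; nlinarith [sq_nonneg (x+y)]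
  · rw [abs_of_nonpos hx, abs_of_nonneg hy, abs_of_nonpos (by nlinarith)]; nlinarith [sq_nonneg (x+y)]
  · rw [abs_of_nonpos hx, abs_of_nonpos hy]
    rcases le_total x y with h | h
    · rw [abs_of_nonpos (by nlinarith)]; nlinarith
    · rw [abs_of_nonneg (by nlinarith)]; nlinarith

lemma ftc_sq_real {a a' : ℝ → ℝ} (h : ∀ t, HasDerivAt a (a' t) t) (hc : Continuous a') {u v : ℝ} (huv : u ≤ v) :
    ‖a v - a u‖ₑ ^ 2 ≤ 4 * ∫⁻ s in Ioc u v, ‖a s‖ₑ * ‖a' s‖ₑ := by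
  have hac : Continuous a := continuous_iff_continuousAt.2 fun s => (h s).continuousAt
  have h1 := ftc_enorm (a := fun t => a t * |a t|) (a' := fun t => 2 * |a t| * a' t)
    (fun t => (hasDerivAt_mul_abs (a t)).comp t (h t)) (by fun_prop) huv
  have h2 : ‖a v - a u‖ₑ ^ 2 ≤ 2 * ‖a v * |a v| - a u * |a u|‖ₑ := by
    rw [← ofReal_norm_eq_enorm, ← ofReal_norm_eq_enorm, ← ENNReal.ofReal_pow (norm_nonneg _),
      show (2:ℝ≥0∞) = ENNReal.ofReal 2 by simp, ← ENNReal.ofReal_mul (by norm_num), Real.norm_eq_abs, Real.norm_eq_abs, sq_abs]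
    exact ENNReal.ofReal_le_ofReal (sq_le_mul_abs _ _)
  refine h2.trans ?_
  calc _ ≤ 2 * ∫⁻ s in Ioc u v, ‖2 * |a s| * a' s‖ₑ := by gcongr
    _ = 2 * ∫⁻ s in Ioc u v, 2 * (‖a s‖ₑ * ‖a' s‖ₑ) := by
        congr 2; ext s
        rw [enorm_mul, enorm_mul, mul_assoc]
        congr 1
        · rw [← ofReal_norm_eq_enorm]; simp
        · congr 1; rw [← ofReal_norm_eq_enorm, ← ofReal_norm_eq_enorm, norm_abs_eq_norm]
    _ = _ := by
        rw [lintegral_const_mul' _ _ (by simp), ← mul_assoc]; norm_num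

lemma ftc_sq {a a' : ℝ → ℂ} (h : ∀ t, HasDerivAt a (a' t) t) (hc : Continuous a') {u v : ℝ} (huv : u ≤ v) :
    ‖a v - a u‖ₑ ^ 2 ≤ 8 * ∫⁻ s in Ioc u v, ‖a s‖ₑ * ‖a' s‖ₑ := by
  have hr : ∀ t, HasDerivAt (fun t => (a t).re) ((a' t).re) t := fun t =>
    (Complex.reCLM.hasFDerivAt (x := a t)).comp_hasDerivAt t (h t)
  have hi : ∀ t, HasDerivAt (fun t => (a t).im) ((a' t).im) t := fun t =>
    (Complex.imCLM.hasFDerivAt (x := a t)).comp_hasDerivAt t (h t)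
  have h1 := ftc_sq_real hr (Complex.continuous_re.comp hc) huv
  have h2 := ftc_sq_real hi (Complex.continuous_im.comp hc) huv
  have ere : ∀ z : ℂ, ‖z.re‖ₑ ≤ ‖z‖ₑ := fun z => by
    rw [← ofReal_norm_eq_enorm, ← ofReal_norm_eq_enorm]; exact ENNReal.ofReal_le_ofReal (Complex.abs_re_le_norm z)
  have eim : ∀ z : ℂ, ‖z.im‖ₑ ≤ ‖z‖ₑ := fun z => by
    rw [← ofReal_norm_eq_enorm, ← ofReal_norm_eq_enorm]; exact ENNReal.ofReal_le_ofReal (Complex.abs_im_le_norm z)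
  have esq : ∀ z : ℂ, ‖z‖ₑ ^ 2 = ‖z.re‖ₑ ^ 2 + ‖z.im‖ₑ ^ 2 := fun z => by
    simp only [← ofReal_norm_eq_enorm]
    rw [← ENNReal.ofReal_pow (norm_nonneg _), ← ENNReal.ofReal_pow (norm_nonneg _), ← ENNReal.ofReal_pow (norm_nonneg _),
      ← ENNReal.ofReal_add (by positivity) (by positivity), ← Complex.normSq_eq_norm_sq, Complex.normSq_apply]
    simp only [Real.norm_eq_abs, sq_abs]
    congr 1; ring
  rw [esq, Complex.sub_re, Complex.sub_im]
  calc _ ≤ 4 * (∫⁻ s in Ioc u v, ‖a s‖ₑ * ‖a' s‖ₑ) + 4 * (∫⁻ s in Ioc u v, ‖a s‖ₑ * ‖a' s‖ₑ) := by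
        refine add_le_add (h1.trans ?_) (h2.trans ?_)
        · exact mul_le_mul' le_rfl (lintegral_mono fun s => mul_le_mul' (ere _) (ere _))
        · exact mul_le_mul' le_rfl (lintegral_mono fun s => mul_le_mul' (eim _) (eim _))
    _ = _ := by rw [← add_mul]; norm_num

lemma rVar_one_le {a a' : ℝ → ℂ} (h : ∀ t, HasDerivAt a (a' t) t) (hc : Continuous a') :
    rVar 1 (Icc 1 2) a ≤ ∫⁻ s in Icc (1:ℝ) 2, ‖a' s‖ₑ := by
  refine rVar_le fun N t ht hE => ?_
  simp only [ENNReal.rpow_one, div_one]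
  refine le_trans (Finset.sum_le_sum fun i _ => ftc_enorm h hc (ht.monotone ?_)) (part_sum ht hE _)
  exact Fin.castSucc_lt_succ.le

lemma rVar_two_le {a a' : ℝ → ℂ} (h : ∀ t, HasDerivAt a (a' t) t) (hc : Continuous a') :
    rVar 2 (Icc 1 2) a ≤ (8 * ∫⁻ s in Icc (1:ℝ) 2, ‖a s‖ₑ * ‖a' s‖ₑ) ^ (1 / 2 : ℝ) := by
  refine rVar_le fun N t ht hE => ?_
  simp only [ENNReal.rpow_ofNat]
  gcongr
  refine le_trans (Finset.sum_le_sum fun i _ => ftc_sq h hc (ht.monotone ?_)) ?_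
  · exact Fin.castSucc_lt_succ.le
  rw [← Finset.mul_sum]
  exact mul_le_mul' le_rfl (part_sum ht hE _)

lemma holder_sum {N : ℕ} (f g : Fin N → ℝ≥0∞) {p q : ℝ} (hp : 0 ≤ p) (hq : 0 ≤ q) (hpq : p + q = 1) :
    ∑ i, f i ^ p * g i ^ q ≤ (∑ i, f i) ^ p * (∑ i, g i) ^ q := by
  have := ENNReal.lintegral_mul_norm_pow_le (μ := (Measure.count : Measure (Fin N))) (f := f) (g := g)
    (Measurable.of_discrete).aemeasurable (Measurable.of_discrete).aemeasurable hp hq hpq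
  simpa [lintegral_count, tsum_fintype] using this

lemma rVar_interp {s : ℝ} (hs1 : 1 ≤ s) (hs2 : s ≤ 2) (E : Set ℝ) (a : ℝ → ℂ) :
    rVar s E a ≤ rVar 1 E a ^ (2 / s - 1) * rVar 2 E a ^ (2 - 2 / s) := by
  have hs0 : 0 < s := by linarith
  have e1 : 0 ≤ 2 / s - 1 := by rw [sub_nonneg, le_div_iff₀ hs0]; linarith
  have e2 : 0 ≤ 2 - 2 / s := by rw [sub_nonneg, div_le_iff₀ hs0]; linarith
  refine rVar_le fun N t ht hE => ?_
  set δ : Fin N → ℝ≥0∞ := fun i => ‖a (t i.succ) - a (t i.castSucc)‖ₑ with hδ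
  have h1 : ∑ i, δ i ≤ rVar 1 E a := by simpa using le_rVar (r := 1) (a := a) N t ht hE
  have h2 : (∑ i, δ i ^ 2) ^ (1 / 2 : ℝ) ≤ rVar 2 E a := by simpa using le_rVar (r := 2) (a := a) N t ht hE
  have h3 : ∑ i, δ i ^ s ≤ (∑ i, δ i) ^ (2 - s) * (∑ i, δ i ^ 2) ^ (s - 1) := by
    refine le_trans (le_of_eq ?_) (holder_sum _ _ (by linarith) (by linarith) (by ring))
    refine Finset.sum_congr rfl fun i _ => ?_
    rw [← ENNReal.rpow_natCast, ← ENNReal.rpow_mul, ← ENNReal.rpow_add_of_nonneg _ _ (by linarith) (by push_cast; linarith)]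
    congr 1; push_cast; ring
  calc (∑ i, δ i ^ s) ^ (1 / s) ≤ ((∑ i, δ i) ^ (2 - s) * (∑ i, δ i ^ 2) ^ (s - 1)) ^ (1 / s) := by gcongr
    _ = (∑ i, δ i) ^ (2 / s - 1) * ((∑ i, δ i ^ 2) ^ (1 / 2 : ℝ)) ^ (2 - 2 / s) := by
        rw [ENNReal.mul_rpow_of_nonneg _ _ (by positivity), ← ENNReal.rpow_mul, ← ENNReal.rpow_mul, ← ENNReal.rpow_mul]
        congr 2 <;> field_simp
    _ ≤ _ := by gcongr

/-- main variation bound -/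
lemma rVar_main {r θ s : ℝ} (hs1 : 1 ≤ s) (hs2 : s ≤ 2) (hsr : s ≤ r) (hθ1 : θ ≤ 1) (hθs : 1 - θ / 2 ≤ 1 / s) :
    ∃ C : ℝ≥0, ∀ (a a' : ℝ → ℂ), (∀ t, HasDerivAt a (a' t) t) → Continuous a' → ∀ D : ℝ≥0∞, D ≠ 0 → D ≠ ∞ →
    rVar r (Icc 1 2) a ≤ C * D ^ (1 / s) * (∫⁻ t in Icc (1:ℝ) 2, (‖a t‖ₑ + D⁻¹ * ‖a' t‖ₑ)) ^ (1 - θ) *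
      ((∫⁻ t in Icc (1:ℝ) 2, (‖a t‖ₑ ^ 2 + (D⁻¹ * ‖a' t‖ₑ) ^ 2)) ^ (1 / 2 : ℝ)) ^ θ := by
  have hs0 : 0 < s := by linarith
  have e1 : 0 ≤ 2 / s - 1 := by rw [sub_nonneg, le_div_iff₀ hs0]; linarith
  have e2 : 0 ≤ 2 - 2 / s := by rw [sub_nonneg, div_le_iff₀ hs0]; linarith
  have e3 : 0 ≤ 2 / s - 1 - (1 - θ) := by
    have : 2 / s = 2 * (1 / s) := by ring
    linarith
  refine ⟨(8 ^ (1 / 2 : ℝ)) ^ (2 - 2 / s) * (2 ^ (1/2:ℝ)) ^ (2 / s - 1 - (1 - θ)), fun a a' h hc D hD0 hDt => ?_⟩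
  have hac : Continuous a := continuous_iff_continuousAt.2 fun s => (h s).continuousAt
  set S1 := ∫⁻ t in Icc (1:ℝ) 2, (‖a t‖ₑ + D⁻¹ * ‖a' t‖ₑ) with hS1
  set S2 := (∫⁻ t in Icc (1:ℝ) 2, (‖a t‖ₑ ^ 2 + (D⁻¹ * ‖a' t‖ₑ) ^ 2)) with hS2
  have hv1 : rVar 1 (Icc 1 2) a ≤ D * S1 := by
    refine (rVar_one_le h hc).trans ?_
    rw [hS1, ← lintegral_const_mul' _ _ hDt]
    refine lintegral_mono fun t => ?_
    simp only
    rw [mul_add, ← mul_assoc, ENNReal.mul_inv_cancel hD0 hDt, one_mul]; exact le_add_self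
  have hv2 : rVar 2 (Icc 1 2) a ≤ 8 ^ (1 / 2 : ℝ) * D ^ (1 / 2 : ℝ) * S2 ^ (1 / 2 : ℝ) := by
    refine (rVar_two_le h hc).trans ?_
    rw [← ENNReal.mul_rpow_of_nonneg _ _ (by norm_num), ← ENNReal.mul_rpow_of_nonneg _ _ (by norm_num), mul_assoc]
    gcongr
    rw [hS2, ← lintegral_const_mul' _ _ hDt]
    refine lintegral_mono fun t => ?_
    simp only
    have : ‖a t‖ₑ * ‖a' t‖ₑ = D * (‖a t‖ₑ * (D⁻¹ * ‖a' t‖ₑ)) := by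
      rw [show D * (‖a t‖ₑ * (D⁻¹ * ‖a' t‖ₑ)) = (D * D⁻¹) * (‖a t‖ₑ * ‖a' t‖ₑ) by ring, ENNReal.mul_inv_cancel hD0 hDt, one_mul]
    rw [this]
    gcongr
    generalize ‖a t‖ₑ = X
    generalize D⁻¹ * ‖a' t‖ₑ = Y
    rcases le_total X Y with hXY | hXY
    · calc X * Y ≤ Y * Y := by gcongr
        _ ≤ _ := by rw [← sq]; exact le_add_self
    · calc X * Y ≤ X * X := by gcongr
        _ ≤ _ := by rw [← sq]; exact le_self_add
  have hcs : S1 ≤ 2 ^ (1/2:ℝ) * S2 ^ (1 / 2 : ℝ) := by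
    have h1 := cs_sq (volume.restrict (Icc (1:ℝ) 2)) (f := fun _ => 1) (g := fun t => ‖a t‖ₑ + D⁻¹ * ‖a' t‖ₑ)
      aemeasurable_const (by fun_prop)
    simp only [one_mul, one_pow, lintegral_const, Measure.restrict_apply MeasurableSet.univ, univ_inter,
      Real.volume_Icc] at h1
    norm_num at h1
    have h2 : S1 ^ 2 ≤ 2 * S2 := by
      refine h1.trans ?_
      rw [hS2, ← lintegral_const_mul' _ _ (by simp)]
      refine lintegral_mono fun t => ?_
      simp only
      generalize ‖a t‖ₑ = X
      generalize D⁻¹ * ‖a' t‖ₑ = Y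
      have := ENNReal.rpow_add_le_mul_rpow_add_rpow X Y (p := 2) (by norm_num)
      norm_num at this
      simpa using this
    calc S1 = (S1 ^ 2) ^ (1/2:ℝ) := by rw [← ENNReal.rpow_natCast, ← ENNReal.rpow_mul]; norm_num
      _ ≤ (2 * S2) ^ (1/2:ℝ) := by gcongr
      _ = _ := by rw [ENNReal.mul_rpow_of_nonneg _ _ (by norm_num)]
  refine (rVar_anti hs0 hsr _ _).trans ((rVar_interp hs1 hs2 _ _).trans ?_)
  have eS1 : S1 ^ (2 / s - 1) = S1 ^ (1 - θ) * S1 ^ (2 / s - 1 - (1 - θ)) := by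
    rw [← ENNReal.rpow_add_of_nonneg _ _ (by linarith) e3]; congr 1; ring
  have eD : D ^ (1 / s) = D ^ (2 / s - 1) * (D ^ (1 / 2 : ℝ)) ^ (2 - 2 / s) := by
    rw [← ENNReal.rpow_mul, ← ENNReal.rpow_add_of_nonneg _ _ e1 (by linarith)]; congr 1; ring
  have eS2 : (S2 ^ (1/2:ℝ)) ^ θ = (S2 ^ (1/2:ℝ)) ^ (2 / s - 1 - (1 - θ)) * (S2 ^ (1/2:ℝ)) ^ (2 - 2 / s) := by
    rw [← ENNReal.rpow_add_of_nonneg _ _ e3 e2]; congr 1; ring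
  calc _ ≤ (D * S1) ^ (2 / s - 1) * (8 ^ (1 / 2 : ℝ) * D ^ (1 / 2 : ℝ) * S2 ^ (1 / 2 : ℝ)) ^ (2 - 2 / s) := by gcongr
    _ = D ^ (2 / s - 1) * (S1 ^ (1 - θ) * S1 ^ (2 / s - 1 - (1 - θ))) * ((8 ^ (1 / 2 : ℝ)) ^ (2 - 2 / s) *
        (D ^ (1 / 2 : ℝ)) ^ (2 - 2 / s) * (S2 ^ (1 / 2 : ℝ)) ^ (2 - 2 / s)) := by
        rw [ENNReal.mul_rpow_of_nonneg _ _ e1, ENNReal.mul_rpow_of_nonneg _ _ e2, ENNReal.mul_rpow_of_nonneg _ _ e2, eS1]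
    _ ≤ D ^ (2 / s - 1) * (S1 ^ (1 - θ) * (2 ^ (1/2:ℝ) * S2 ^ (1 / 2 : ℝ)) ^ (2 / s - 1 - (1 - θ))) * ((8 ^ (1 / 2 : ℝ)) ^ (2 - 2 / s) *
        (D ^ (1 / 2 : ℝ)) ^ (2 - 2 / s) * (S2 ^ (1 / 2 : ℝ)) ^ (2 - 2 / s)) := by gcongr
    _ = _ := by
        rw [ENNReal.mul_rpow_of_nonneg _ _ e3, eS2, eD]
        have k1 : ((((8:ℝ≥0) ^ (1 / 2 : ℝ)) ^ (2 - 2 / s) * ((2:ℝ≥0) ^ (1/2:ℝ)) ^ (2 / s - 1 - (1 - θ)) : ℝ≥0) : ℝ≥0∞) =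
          (8 ^ (1 / 2 : ℝ)) ^ (2 - 2 / s) * (2 ^ (1/2:ℝ)) ^ (2 / s - 1 - (1 - θ)) := by
          rw [ENNReal.coe_mul, ENNReal.coe_rpow_of_nonneg _ e2, ENNReal.coe_rpow_of_nonneg _ e3,
            ENNReal.coe_rpow_of_nonneg _ (by norm_num), ENNReal.coe_rpow_of_nonneg _ (by norm_num)]
          simp
        rw [k1]; ring

/-! ## P7: polar coordinates, radial Plancherel -/

/-- polar measure -/
def polM (d : ℕ) : Measure (ℝ × Euc d) :=
  ((volume : Measure (Euc d)).toSphere Set.univ) •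
    (((volume.restrict (Ioi (0:ℝ))).withDensity (fun t => ENNReal.ofReal (t ^ (d - 1)))).prod (sphereMeasure d))

lemma polM_lintegral {d : ℕ} {H : ℝ × Euc d → ℝ≥0∞} (hH : Measurable H) :
    ∫⁻ p, H p ∂(polM d) = ((volume : Measure (Euc d)).toSphere Set.univ) *
      ∫⁻ t in Ioi (0:ℝ), ENNReal.ofReal (t ^ (d - 1)) * ∫⁻ y, H (t, y) ∂(sphereMeasure d) := by
  rw [polM, lintegral_smul_measure, lintegral_prod _ hH.aemeasurable,
    lintegral_withDensity_eq_lintegral_mul _ (by fun_prop) (hH.lintegral_prod_right')]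
  rfl

lemma polM_map {d : ℕ} (hd : 0 < d) : Measure.map (fun p : ℝ × Euc d => p.1 • p.2) (polM d) = volume := by
  ext s hs
  rw [← lintegral_indicator_one hs, ← lintegral_indicator_one hs, polar_lintegral hd (measurable_one.indicator hs),
    lintegral_map (measurable_one.indicator hs) (by fun_prop), polM_lintegral]
  exact (measurable_one.indicator hs).comp (by fun_prop)

lemma polar_lintegral2 {d : ℕ} (hd : 0 < d) {g : Euc d → ℝ≥0∞} (hg : Measurable g) :
    ∫⁻ x, g x = ∫⁻ p, g (p.1 • p.2) ∂(polM d) := by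
  conv_lhs => rw [← polM_map hd]
  rw [lintegral_map hg (by fun_prop)]

lemma polar_integral {d : ℕ} (hd : 0 < d) {g : Euc d → ℂ} (hg : Integrable g) :
    ∫ x, g x = (((volume : Measure (Euc d)).toSphere Set.univ).toReal) •
      ∫ t, (∫ y, g (t • y) ∂(sphereMeasure d)) ∂((volume.restrict (Ioi (0:ℝ))).withDensity (fun t => ENNReal.ofReal (t ^ (d - 1)))) := by
  have h1 : Integrable g (Measure.map (fun p : ℝ × Euc d => p.1 • p.2) (polM d)) := by rwa [polM_map hd]
  have h2 := (integrable_map_measure h1.1 (by fun_prop)).1 h1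
  conv_lhs => rw [← polM_map hd]
  rw [integral_map (by fun_prop) h1.1, polM, integral_smul_measure, integral_prod]
  have : (volume : Measure (Euc d)).toSphere Set.univ ≠ 0 := by
    have := sphC_ne_zero (d := d) hd
    exact this
  have h3 : Integrable (g ∘ fun p : ℝ × Euc d => p.1 • p.2) ((volume : Measure (Euc d)).toSphere Set.univ •
    (((volume.restrict (Ioi (0:ℝ))).withDensity (fun t => ENNReal.ofReal (t ^ (d - 1)))).prod (sphereMeasure d))) := h2
  rwa [integrable_smul_measure this (measure_ne_top _ _)] at h3

lemma ae_pol {d : ℕ} (P : ℝ → Prop) (h : ∀ t, 0 < t → P t) :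
    ∀ᵐ t ∂((volume.restrict (Ioi (0:ℝ))).withDensity (fun t => ENNReal.ofReal (t ^ (d - 1)))), P t := by
  have : ∀ᵐ t ∂(volume.restrict (Ioi (0:ℝ))), P t := by
    filter_upwards [self_mem_ae_restrict measurableSet_Ioi] with t ht using h t ht
  exact (withDensity_absolutelyContinuous _ _).ae_le this

lemma radial_lintegral {d : ℕ} (hd : 0 < d) {H : ℝ → ℝ≥0∞} (hH : Measurable H) {K : Euc d → ℝ≥0∞} (hK : Measurable K) :
    ∫⁻ ξ : Euc d, H ‖ξ‖ * ∫⁻ ω, K (‖ξ‖ • ω) ∂(sphereMeasure d) = ∫⁻ ξ, H ‖ξ‖ * K ξ := by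
  haveI := sphM_prob hd
  have hm : Measurable fun ρ : ℝ => ∫⁻ ω, K (ρ • ω) ∂(sphereMeasure d) := by
    have : Measurable fun p : ℝ × Euc d => K (p.1 • p.2) := hK.comp (by fun_prop)
    exact this.lintegral_prod_right'
  have hm' : Measurable fun ξ : Euc d => ∫⁻ ω, K (‖ξ‖ • ω) ∂(sphereMeasure d) := hm.comp measurable_norm
  rw [polar_lintegral hd (by fun_prop), polar_lintegral hd (by fun_prop)]
  congr 1
  refine setLIntegral_congr_fun measurableSet_Ioi fun t ht => ?_
  congr 1
  have e1 : ∀ᵐ y ∂(sphereMeasure d), ‖t • y‖ = t := by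
    filter_upwards [sphM_ae_norm d] with y hy
    rw [norm_smul, hy, mul_one, Real.norm_of_nonneg (le_of_lt ht)]
  calc _ = ∫⁻ y, H t * ∫⁻ ω, K (t • ω) ∂(sphereMeasure d) ∂(sphereMeasure d) :=
        lintegral_congr_ae (by filter_upwards [e1] with y hy; rw [hy])
    _ = ∫⁻ ω, H t * K (t • ω) ∂(sphereMeasure d) := by
        rw [lintegral_const, measure_univ, mul_one, lintegral_const_mul _ (by fun_prop)]
    _ = _ := lintegral_congr_ae (by filter_upwards [e1] with y hy; rw [hy])

/-- shell estimate -/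
lemma shell_bound {d : ℕ} (hd : 0 < d) : ∃ C : ℝ≥0, ∀ H : Euc d → ℝ≥0∞, Measurable H →
    ∫⁻ t in Icc (1:ℝ) 2, (∫⁻ y, H (t • y) ∂(sphereMeasure d)) ≤ C * ∫⁻ x, H x := by
  have h0 := sphC_ne_zero (d := d) hd
  have ht := sphC_ne_top (d := d)
  refine ⟨(((volume : Measure (Euc d)).toSphere Set.univ)⁻¹).toNNReal, fun H hH => ?_⟩
  rw [ENNReal.coe_toNNReal (ENNReal.inv_ne_top.2 h0), polar_lintegral hd hH, ← mul_assoc, ENNReal.inv_mul_cancel h0 ht, one_mul]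
  calc _ ≤ ∫⁻ t in Icc (1:ℝ) 2, ENNReal.ofReal (t ^ (d-1)) * ∫⁻ y, H (t • y) ∂(sphereMeasure d) := by
        refine setLIntegral_mono' measurableSet_Icc fun t ht => ?_
        refine le_mul_of_one_le_left zero_le ?_
        rw [← ENNReal.ofReal_one]
        exact ENNReal.ofReal_le_ofReal (one_le_pow₀ ht.1)
    _ ≤ _ := lintegral_mono_set fun t ht => lt_of_lt_of_le one_pos ht.1

def radG {d : ℕ} (v : Euc d → ℂ) (ξ : Euc d) : ℂ := ∫ ω, v (‖ξ‖ • ω) ∂(sphereMeasure d)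

lemma radG_cont {d : ℕ} {v : Euc d → ℂ} (hv : Continuous v) : Continuous (radG v) := by
  have h : Continuous fun ρ : ℝ => ∫ ω, v (ρ • ω) ∂(sphereMeasure d) := by
    rw [continuous_iff_continuousAt]
    intro ρ0
    obtain ⟨M, hM⟩ := (isCompact_closedBall (0 : Euc d) (|ρ0| + 1)).exists_bound_of_continuousOn hv.continuousOn
    refine continuousAt_of_dominated (bound := fun _ => M) ?_ ?_ (integrable_const _) ?_
    · exact Filter.Eventually.of_forall fun ρ => (hv.comp (by fun_prop)).aestronglyMeasurable
    · have : ∀ᶠ ρ in nhds ρ0, |ρ| < |ρ0| + 1 := continuous_abs.continuousAt.eventually_lt continuousAt_const (by simp)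
      filter_upwards [this] with ρ hρ
      filter_upwards [sphM_ae_norm d] with ω hω
      refine hM _ ?_
      rw [mem_closedBall, dist_zero_right, norm_smul, hω, mul_one]; exact hρ.le
    · refine Filter.Eventually.of_forall fun ω => ?_
      exact (hv.comp (by fun_prop : Continuous fun ρ : ℝ => ρ • ω)).continuousAt
  exact h.comp continuous_norm

lemma radG_enorm_le {d : ℕ} (v : Euc d → ℂ) (ξ : Euc d) :
    ‖radG v ξ‖ₑ ≤ ∫⁻ ω, ‖v (‖ξ‖ • ω)‖ₑ ∂(sphereMeasure d) := enorm_integral_le_lintegral_enorm _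

lemma radG_integrable {d : ℕ} (hd : 0 < d) {v : Euc d → ℂ} (hv : Continuous v) (hi : Integrable v) :
    Integrable (radG v) := by
  refine ⟨(radG_cont hv).aestronglyMeasurable, ?_⟩
  have := radial_lintegral hd (H := fun _ => 1) measurable_const (K := fun ξ => ‖v ξ‖ₑ) (by fun_prop)
  simp only [one_mul] at this
  calc _ ≤ ∫⁻ ξ, ∫⁻ ω, ‖v (‖ξ‖ • ω)‖ₑ ∂(sphereMeasure d) := lintegral_mono fun ξ => radG_enorm_le v ξ
    _ = _ := this
    _ < ∞ := hi.2

lemma radG_integrable1 {d : ℕ} (hd : 0 < d) {v : Euc d → ℂ} (hv : Continuous v)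
    (hi : Integrable fun ξ => ‖ξ‖ * ‖v ξ‖) : Integrable (fun ξ => ‖ξ‖ * ‖radG v ξ‖) := by
  have := radG_cont hv
  refine ⟨(by fun_prop : Continuous _).aestronglyMeasurable, ?_⟩
  have := radial_lintegral hd (H := fun t => ‖t‖ₑ) measurable_enorm (K := fun ξ => ‖v ξ‖ₑ) (by fun_prop)
  simp only [enorm_norm] at this
  calc _ ≤ ∫⁻ ξ, ‖ξ‖ₑ * ∫⁻ ω, ‖v (‖ξ‖ • ω)‖ₑ ∂(sphereMeasure d) := by
        refine lintegral_mono fun ξ => ?_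
        simp only [enorm_mul, enorm_norm]
        gcongr; exact radG_enorm_le v ξ
    _ = _ := this
    _ < ∞ := by simpa [HasFiniteIntegral, enorm_mul] using hi.2

lemma radG_fourier {d : ℕ} (i : Fin d) {v : Euc d → ℂ} (hv : Continuous v) (hi : Integrable v) {t : ℝ} (ht : 0 < t)
    {η : Euc d} (hη : ‖η‖ = 1) : 𝓕 (radG v) (t • η) = ∫ ξ, v ξ * (mS i (2 * Real.pi * (t * ‖ξ‖)) : ℂ) := by
  have hd := i.pos
  haveI := sphM_prob hd
  have hmc : Continuous (mS i) := continuous_iff_continuousAt.2 fun s => (mS_deriv i s).continuousAt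
  have hG := radG_integrable hd hv hi
  rw [Real.fourier_eq, polar_integral hd, polar_integral hd]
  · congr 1
    refine integral_congr_ae (ae_pol _ fun ρ hρ => ?_)
    have e1 : ∀ᵐ y ∂(sphereMeasure d), ‖ρ • y‖ = ρ := by
      filter_upwards [sphM_ae_norm d] with y hy
      rw [norm_smul, hy, mul_one, Real.norm_of_nonneg hρ.le]
    set I := ∫ ω, v (ρ • ω) ∂(sphereMeasure d) with hI
    have hL : ∫ y, Real.fourierChar (-(inner ℝ (ρ • y) (t • η))) • radG v (ρ • y) ∂(sphereMeasure d) =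
      (mS i (2 * Real.pi * (t * ρ)) : ℂ) * I := by
      calc _ = ∫ y, (Real.fourierChar (-(inner ℝ ((ρ * t) • η) y)) : ℂ) * I ∂(sphereMeasure d) := by
            refine integral_congr_ae ?_
            filter_upwards [e1] with y hy
            rw [radG, hy, Circle.smul_def, smul_eq_mul, inner_smul_left, inner_smul_right, inner_smul_left,
              real_inner_comm y]
            simp only [conj_trivial, mul_assoc]; rfl
        _ = _ := by
            rw [integral_mul_const, sph_fourier i, norm_smul, hη, mul_one, Real.norm_of_nonneg (by positivity), mul_comm ρ t]
    have hRr : ∫ y, v (ρ • y) * (mS i (2 * Real.pi * (t * ‖ρ • y‖)) : ℂ) ∂(sphereMeasure d) =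
      I * (mS i (2 * Real.pi * (t * ρ)) : ℂ) := by
      rw [hI, ← integral_mul_const]
      refine integral_congr_ae ?_
      filter_upwards [e1] with y hy
      rw [hy]
    simp only
    rw [hL, hRr, mul_comm]
  · refine hi.mul_bdd (c := 1) (by fun_prop) (Filter.Eventually.of_forall fun ξ => ?_)
    rw [Complex.norm_real]; exact mS_abs_le i _
  · exact (Real.fourierIntegral_convergent_iff (t • η)).2 hG

lemma sq_lint_sph {d : ℕ} (hd : 0 < d) : ∃ C : ℝ≥0, ∀ (b : ℝ → ℂ) (H : Euc d → ℝ≥0∞), Measurable H →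
    (∀ t, 0 < t → ∀ η : Euc d, ‖η‖ = 1 → ‖b t‖ₑ ^ 2 ≤ H (t • η)) →
    ∫⁻ t in Icc (1:ℝ) 2, ‖b t‖ₑ ^ 2 ≤ C * ∫⁻ ξ, H ξ := by
  haveI := sphM_prob hd
  obtain ⟨C, hC⟩ := shell_bound hd
  refine ⟨C, fun b H hH h => le_trans ?_ (hC H hH)⟩
  refine setLIntegral_mono' measurableSet_Icc fun t ht => ?_
  calc ‖b t‖ₑ ^ 2 = ∫⁻ y, ‖b t‖ₑ ^ 2 ∂(sphereMeasure d) := by simp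
    _ ≤ _ := lintegral_mono_ae (by
      filter_upwards [sphM_ae_norm d] with y hy
      exact h t (by linarith [ht.1]) y hy)

/-- radial Plancherel -/
lemma radial_plancherel {d : ℕ} (i : Fin d) : ∃ C : ℝ≥0, ∀ v : Euc d → ℂ, Continuous v → Integrable v →
    (Integrable fun ξ => ‖ξ‖ * ‖v ξ‖) → ∀ b b' : ℝ → ℂ,
    (∀ t, b t = ∫ ξ, v ξ * (mS i (2 * Real.pi * (t * ‖ξ‖)) : ℂ)) → (∀ t, HasDerivAt b (b' t) t) →
    ∫⁻ t in Icc (1:ℝ) 2, ‖b t‖ₑ ^ 2 ≤ C * ∫⁻ ξ, ‖radG v ξ‖ₑ ^ 2 ∧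
    ∫⁻ t in Icc (1:ℝ) 2, ‖b' t‖ₑ ^ 2 ≤ C * ∫⁻ ξ, ‖ξ‖ₑ ^ 2 * ‖radG v ξ‖ₑ ^ 2 := by
  have hd := i.pos
  obtain ⟨C, hC⟩ := sq_lint_sph hd
  set c2 : ℝ≥0 := (2 * Real.pi).toNNReal ^ 2 with hc2
  refine ⟨C * (1 + d * c2), fun v hv hi hi1 b b' hb hb' => ?_⟩
  have hGc := radG_cont hv
  have hG := radG_integrable hd hv hi
  have hG1 := radG_integrable1 hd hv hi1
  have hF := fourier_cont hG
  constructor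
  · refine (hC b (fun ξ => ‖𝓕 (radG v) ξ‖ₑ ^ 2) (by fun_prop) fun t ht η hη => ?_).trans ?_
    · rw [radG_fourier i hv hi ht hη, hb t]
    · refine mul_le_mul' ?_ (plancherel hG)
      push_cast
      exact le_mul_of_one_le_right zero_le le_self_add
  · set V : Fin d → Euc d → ℂ := fun k ξ => (ξ k : ℂ) * radG v ξ with hV
    have hVi : ∀ k, Integrable (V k) := fun k => by
      refine hG1.mono (by fun_prop) (Filter.Eventually.of_forall fun ξ => ?_)
      simp only [hV, norm_mul, Complex.norm_real, norm_norm]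
      gcongr; exact abs_coord_le ξ k
    have hVc : ∀ k, Continuous (𝓕 (V k)) := fun k => fourier_cont (hVi k)
    have hderiv : ∀ t, 0 < t → ∀ η : Euc d, ‖η‖ = 1 → b' t = -(2 * Real.pi * Complex.I) * ∑ k, (η k : ℂ) * 𝓕 (V k) (t • η) := by
      intro t ht η hη
      have h1 : HasFDerivAt (𝓕 (radG v)) (𝓕 (VectorFourier.fourierSMulRight (innerSL ℝ) (radG v)) (t • η)) (t • η) :=
        Real.hasFDerivAt_fourier hG hG1 (t • η)
      have h2 : HasDerivAt (fun s : ℝ => s • η) η t := by simpa using (hasDerivAt_id t).smul_const η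
      have h3 := h1.comp_hasDerivAt t h2
      have h4 : HasDerivAt b (𝓕 (VectorFourier.fourierSMulRight (innerSL ℝ) (radG v)) (t • η) η) t := by
        refine h3.congr_of_eventuallyEq ?_
        filter_upwards [lt_mem_nhds ht] with s hs
        simp only [Function.comp]
        rw [radG_fourier i hv hi hs hη, hb s]
      rw [(hb' t).unique h4]
      have hintg : Integrable (VectorFourier.fourierSMulRight (innerSL ℝ) (radG v)) := by
        refine (hG1.const_mul (2 * Real.pi * ‖innerSL ℝ (E := Euc d)‖)).mono' ?_ ?_
        · exact hGc.aestronglyMeasurable.fourierSMulRight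
        · exact Filter.Eventually.of_forall fun ξ => (VectorFourier.norm_fourierSMulRight_le _ _ _).trans (le_of_eq (by ring))
      rw [Real.fourier_eq, ContinuousLinearMap.integral_apply ((Real.fourierIntegral_convergent_iff (t • η)).2 hintg)]
      have hk : ∀ k, Integrable fun ξ => (η k : ℂ) * (Real.fourierChar (-(inner ℝ ξ (t • η))) • V k ξ) := fun k =>
        ((Real.fourierIntegral_convergent_iff (t • η)).2 (hVi k)).const_mul _
      simp_rw [Real.fourier_eq, ← integral_const_mul]
      rw [← integral_finsetSum _ (fun k _ => hk k), ← integral_const_mul]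
      refine integral_congr_ae (Filter.Eventually.of_forall fun ξ => ?_)
      simp only [hV, ContinuousLinearMap.smul_apply, VectorFourier.fourierSMulRight_apply, Circle.smul_def, smul_eq_mul,
        Complex.real_smul]
      have : ((innerSL ℝ) ξ) η = ∑ k, η k * ξ k := by
        show inner ℝ ξ η = _
        rw [PiLp.inner_apply]; simp
      rw [this]
      generalize ((Real.fourierChar (-(inner ℝ ξ (t • η))) : Circle) : ℂ) = z
      push_cast
      rw [Finset.sum_mul, Finset.mul_sum, Finset.mul_sum, Finset.mul_sum]
      refine Finset.sum_congr rfl fun k _ => ?_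
      ring
    have hbd : ∀ t, 0 < t → ∀ η : Euc d, ‖η‖ = 1 → ‖b' t‖ₑ ^ 2 ≤ (d * c2) * ∑ k, ‖𝓕 (V k) (t • η)‖ₑ ^ 2 := by
      intro t ht η hη
      rw [hderiv t ht η hη, enorm_mul, mul_pow]
      have e1 : ‖-(2 * Real.pi * Complex.I)‖ₑ ^ 2 = c2 := by
        rw [hc2, enorm_eq_nnnorm]
        norm_cast
        congr 1
        ext
        simp [abs_of_pos Real.pi_pos]
        positivity
      have e2 : ‖∑ k, (η k : ℂ) * 𝓕 (V k) (t • η)‖ₑ ^ 2 ≤ d * ∑ k, ‖𝓕 (V k) (t • η)‖ₑ ^ 2 := by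
        calc _ ≤ (∑ k, ‖𝓕 (V k) (t • η)‖ₑ) ^ 2 := by
              gcongr
              refine (enorm_sum_le _ _).trans (Finset.sum_le_sum fun k _ => ?_)
              rw [enorm_mul]
              refine mul_le_of_le_one_left zero_le ?_
              rw [← ofReal_norm_eq_enorm, Complex.norm_real, ← ENNReal.ofReal_one]
              exact ENNReal.ofReal_le_ofReal ((abs_coord_le η k).trans hη.le)
          _ ≤ _ := by
              have := ENNReal.rpow_sum_le_const_mul_sum_rpow Finset.univ (fun k => ‖𝓕 (V k) (t • η)‖ₑ) (p := 2) (by norm_num)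
              norm_num at this
              simpa using this
      rw [e1]
      calc _ ≤ c2 * (d * ∑ k, ‖𝓕 (V k) (t • η)‖ₑ ^ 2) := by gcongr
        _ = _ := by ring
    refine (hC b' (fun ξ => (d * c2) * ∑ k, ‖𝓕 (V k) ξ‖ₑ ^ 2) ?_ hbd).trans ?_
    · have : ∀ k, Measurable (𝓕 (V k)) := fun k => (hVc k).measurable
      fun_prop
    · rw [lintegral_const_mul _ (by have : ∀ k, Measurable (𝓕 (V k)) := fun k => (hVc k).measurable
                                    fun_prop), lintegral_finsetSum _ (fun k _ => by have := (hVc k).measurable; fun_prop)]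
      have e3 : ∑ k, ∫⁻ ξ, ‖𝓕 (V k) ξ‖ₑ ^ 2 ≤ ∫⁻ ξ, ‖ξ‖ₑ ^ 2 * ‖radG v ξ‖ₑ ^ 2 := by
        calc _ ≤ ∑ k, ∫⁻ ξ, ‖V k ξ‖ₑ ^ 2 := Finset.sum_le_sum fun k _ => plancherel (hVi k)
          _ = ∫⁻ ξ, ∑ k, ‖V k ξ‖ₑ ^ 2 := by
              rw [lintegral_finsetSum]
              intro k _; fun_prop
          _ = _ := by
              refine lintegral_congr fun ξ => ?_
              simp only [hV, enorm_mul, mul_pow]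
              rw [← Finset.sum_mul]
              congr 1
              have : ‖ξ‖ ^ 2 = ∑ k, ‖ξ k‖ ^ 2 := EuclideanSpace.norm_sq_eq ξ
              rw [← ofReal_norm_eq_enorm, ← ENNReal.ofReal_pow (norm_nonneg _), this, ENNReal.ofReal_sum_of_nonneg (fun _ _ => by positivity)]
              refine Finset.sum_congr rfl fun k _ => ?_
              rw [ENNReal.ofReal_pow (norm_nonneg _), ← ofReal_norm_eq_enorm, Complex.norm_real]
      calc _ ≤ C * ((d * c2) * ∫⁻ ξ, ‖ξ‖ₑ ^ 2 * ‖radG v ξ‖ₑ ^ 2) := by gcongr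
        _ ≤ _ := by
          push_cast
          rw [← mul_assoc]
          gcongr
          exact le_add_self

/-! ## P8: square function estimates for smooth functions -/

def sphD {d : ℕ} (g : Euc d → ℂ) (t : ℝ) (x : Euc d) : ℂ :=
  ∫ y, fderiv ℝ g (x - t • y) (-y) ∂(sphereMeasure d)

lemma cc_bdd {d : ℕ} {E : Type*} [NormedAddCommGroup E] {g : Euc d → E} (hg : Continuous g) (hgc : HasCompactSupport g) :
    ∃ M : ℝ, 0 ≤ M ∧ ∀ x, ‖g x‖ ≤ M := by
  obtain ⟨M, hM⟩ := hgc.exists_bound_of_continuous hg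
  exact ⟨M, (norm_nonneg _).trans (hM 0), hM⟩

lemma sphAvg_cont {d : ℕ} {g : Euc d → ℂ} (hg : Continuous g) (hgc : HasCompactSupport g) :
    Continuous fun p : ℝ × Euc d => sphAvg g p.1 p.2 := by
  obtain ⟨M, _, hM⟩ := cc_bdd hg hgc
  refine continuous_of_dominated (bound := fun _ => M) ?_ ?_ (integrable_const _) ?_
  · exact fun p => (by fun_prop : Continuous _).aestronglyMeasurable
  · exact fun p => Filter.Eventually.of_forall fun y => hM _
  · exact Filter.Eventually.of_forall fun y => by fun_prop

lemma fderiv_cc {d : ℕ} {g : Euc d → ℂ} (hg : ContDiff ℝ (⊤ : ℕ∞) g) (hgc : HasCompactSupport g) :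
    Continuous (fderiv ℝ g) ∧ HasCompactSupport (fderiv ℝ g) :=
  ⟨hg.continuous_fderiv (by simp), hgc.fderiv ℝ⟩

lemma sphD_cont {d : ℕ} {g : Euc d → ℂ} (hg : ContDiff ℝ (⊤ : ℕ∞) g) (hgc : HasCompactSupport g) :
    Continuous fun p : ℝ × Euc d => sphD g p.1 p.2 := by
  obtain ⟨h1, h2⟩ := fderiv_cc hg hgc
  obtain ⟨M, hM0, hM⟩ := cc_bdd h1 h2
  refine continuous_of_dominated (bound := fun _ => M) ?_ ?_ (integrable_const _) ?_
  · exact fun p => (by fun_prop : Continuous _).aestronglyMeasurable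
  · refine fun p => ?_
    filter_upwards [sphM_ae_norm d] with y hy
    refine (ContinuousLinearMap.le_opNorm _ _).trans ?_
    rw [norm_neg, hy, mul_one]; exact hM _
  · exact Filter.Eventually.of_forall fun y => by fun_prop

lemma sphAvg_deriv {d : ℕ} {g : Euc d → ℂ} (hg : ContDiff ℝ (⊤ : ℕ∞) g) (hgc : HasCompactSupport g) (x : Euc d) (t : ℝ) :
    HasDerivAt (fun t => sphAvg g t x) (sphD g t x) t := by
  obtain ⟨h1, h2⟩ := fderiv_cc hg hgc
  obtain ⟨M, hM0, hM⟩ := cc_bdd h1 h2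
  obtain ⟨M0, _, hM1⟩ := cc_bdd hg.continuous hgc
  have hgcont := hg.continuous
  refine (hasDerivAt_integral_of_dominated_loc_of_deriv_le (F := fun t y => g (x - t • y))
    (F' := fun t y => fderiv ℝ g (x - t • y) (-y)) (bound := fun _ => M) (s := Set.univ) Filter.univ_mem
    ?_ ?_ ?_ ?_ (integrable_const _) ?_).2
  · exact Filter.Eventually.of_forall fun p => (by fun_prop : Continuous _).aestronglyMeasurable
  · exact sph_integrable_bdd M0 (by fun_prop : Continuous _).aestronglyMeasurable (Filter.Eventually.of_forall fun y => hM1 _)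
  · exact (by fun_prop : Continuous _).aestronglyMeasurable
  · filter_upwards [sphM_ae_norm d] with y hy t _
    refine (ContinuousLinearMap.le_opNorm _ _).trans ?_
    rw [norm_neg, hy, mul_one]; exact hM _
  · refine Filter.Eventually.of_forall fun y t _ => ?_
    have e1 : HasFDerivAt g (fderiv ℝ g (x - t • y)) (x - t • y) := (hg.differentiable (by simp) _).hasFDerivAt
    have e2 : HasDerivAt (fun s : ℝ => x - s • y) (-y) t := by
      simpa using ((hasDerivAt_id t).smul_const y).const_sub x
    exact e1.comp_hasDerivAt t e2

lemma fourier_sch {d : ℕ} {g : Euc d → ℂ} (hg : ContDiff ℝ (⊤ : ℕ∞) g) (hgc : HasCompactSupport g) :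
    Continuous (𝓕 g) ∧ Integrable (𝓕 g) ∧ Integrable (fun ξ => ‖ξ‖ * ‖𝓕 g ξ‖) := by
  set G : SchwartzMap (Euc d) ℂ := hgc.toSchwartzMap hg with hG
  have hGx : (G : Euc d → ℂ) = g := rfl
  have e : 𝓕 g = (𝓕 G : SchwartzMap (Euc d) ℂ) := by rw [← hGx, SchwartzMap.fourier_coe]
  rw [e]
  refine ⟨(𝓕 G).continuous, (𝓕 G).integrable, ?_⟩
  have := (𝓕 G).integrable_pow_mul (volume : Measure (Euc d)) 1
  simpa using this

lemma mS_even {d : ℕ} (i : Fin d) (s : ℝ) : mS i (-s) = mS i s := by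
  unfold mS; simp

lemma fourier_inv_pt {d : ℕ} {g : Euc d → ℂ} (hg : ContDiff ℝ (⊤ : ℕ∞) g) (hgc : HasCompactSupport g) (x : Euc d) :
    g x = ∫ ξ, 𝓕 g ξ * (Real.fourierChar (inner ℝ ξ x) : ℂ) := by
  have h := Continuous.fourierInv_fourier_eq hg.continuous (cc_integrable hg.continuous hgc) (fourier_sch hg hgc).2.1
  conv_lhs => rw [← h]
  rw [Real.fourierInv_eq]
  refine integral_congr_ae (Filter.Eventually.of_forall fun ξ => ?_)
  simp only [Circle.smul_def, smul_eq_mul]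
  rw [mul_comm]

lemma sphAvg_rep {d : ℕ} (i : Fin d) {g : Euc d → ℂ} (hg : ContDiff ℝ (⊤ : ℕ∞) g) (hgc : HasCompactSupport g) (t : ℝ) (x : Euc d) :
    sphAvg g t x = ∫ ξ, (𝓕 g ξ * (Real.fourierChar (inner ℝ ξ x) : ℂ)) * (mS i (2 * Real.pi * (t * ‖ξ‖)) : ℂ) := by
  haveI := sphM_prob i.pos
  obtain ⟨hc, hi, _⟩ := fourier_sch hg hgc
  have e1 : sphAvg g t x = ∫ y, (∫ ξ, 𝓕 g ξ * (Real.fourierChar (inner ℝ ξ (x - t • y)) : ℂ)) ∂(sphereMeasure d) := by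
    unfold sphAvg
    refine integral_congr_ae (Filter.Eventually.of_forall fun y => ?_)
    exact fourier_inv_pt hg hgc _
  rw [e1, integral_integral_swap]
  · refine integral_congr_ae (Filter.Eventually.of_forall fun ξ => ?_)
    have : ∀ y, 𝓕 g ξ * (Real.fourierChar (inner ℝ ξ (x - t • y)) : ℂ) =
        (𝓕 g ξ * (Real.fourierChar (inner ℝ ξ x) : ℂ)) * (Real.fourierChar (-(inner ℝ (t • ξ) y)) : ℂ) := by
      intro y
      rw [mul_assoc, ← Circle.coe_mul, ← AddChar.map_add_eq_mul, inner_sub_right, inner_smul_right, inner_smul_left]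
      simp [sub_eq_add_neg]
    simp only [this]
    rw [integral_const_mul, sph_fourier i, norm_smul, Real.norm_eq_abs]
    congr 2
    rcases le_total 0 t with h | h
    · rw [abs_of_nonneg h]
    · rw [abs_of_nonpos h, ← mS_even]; congr 1; ring
  · have hp : Integrable (fun p : Euc d × Euc d => 𝓕 g p.2) ((sphereMeasure d).prod volume) := by
      simpa using hi.comp_snd (sphereMeasure d)
    refine hp.norm.mono' ?_ ?_
    · have := cont_char (g := fun p : Euc d × Euc d => inner ℝ p.2 (x - t • p.1)) (by fun_prop)
      exact (by fun_prop : Continuous _).aestronglyMeasurable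
    · refine Filter.Eventually.of_forall fun p => ?_
      simp only [Function.uncurry, norm_mul, Circle.norm_coe, mul_one, le_refl]

lemma mS_cont {d : ℕ} (i : Fin d) : Continuous (mS i) := continuous_iff_continuousAt.2 fun s => (mS_deriv i s).continuousAt
lemma mS1_cont {d : ℕ} (i : Fin d) : Continuous (mS1 i) := continuous_iff_continuousAt.2 fun s => (mS1_deriv i s).continuousAt

lemma sphD_rep {d : ℕ} (i : Fin d) {g : Euc d → ℂ} (hg : ContDiff ℝ (⊤ : ℕ∞) g) (hgc : HasCompactSupport g) (t : ℝ) (x : Euc d) :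
    sphD g t x = ∫ ξ, (𝓕 g ξ * (Real.fourierChar (inner ℝ ξ x) : ℂ)) *
      ((-(2 * Real.pi * ‖ξ‖) * mS1 i (2 * Real.pi * (t * ‖ξ‖)) : ℝ) : ℂ) := by
  obtain ⟨hc, hi, hi1⟩ := fourier_sch hg hgc
  have hch := cont_char (g := fun ξ : Euc d => inner ℝ ξ x) (by fun_prop)
  have hm := mS_cont i
  have hm1 := mS1_cont i
  refine (sphAvg_deriv hg hgc x t).unique ?_
  have hfun : (fun t => sphAvg g t x) = fun t => ∫ ξ, (𝓕 g ξ * (Real.fourierChar (inner ℝ ξ x) : ℂ)) * (mS i (2 * Real.pi * (t * ‖ξ‖)) : ℂ) := by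
    ext t; exact sphAvg_rep i hg hgc t x
  rw [hfun]
  refine (hasDerivAt_integral_of_dominated_loc_of_deriv_le (s := Set.univ) Filter.univ_mem
    (F := fun t ξ => (𝓕 g ξ * (Real.fourierChar (inner ℝ ξ x) : ℂ)) * (mS i (2 * Real.pi * (t * ‖ξ‖)) : ℂ))
    (F' := fun t ξ => (𝓕 g ξ * (Real.fourierChar (inner ℝ ξ x) : ℂ)) *
      ((-(2 * Real.pi * ‖ξ‖) * mS1 i (2 * Real.pi * (t * ‖ξ‖)) : ℝ) : ℂ))
    (bound := fun ξ => 2 * Real.pi * (‖ξ‖ * ‖𝓕 g ξ‖)) ?_ ?_ ?_ ?_ (hi1.const_mul _) ?_).2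
  · exact Filter.Eventually.of_forall fun p => (by fun_prop : Continuous _).aestronglyMeasurable
  · refine hi.norm.mono' (by fun_prop : Continuous _).aestronglyMeasurable (Filter.Eventually.of_forall fun ξ => ?_)
    rw [norm_mul, norm_mul, Circle.norm_coe, mul_one, Complex.norm_real]
    exact mul_le_of_le_one_right (norm_nonneg _) (mS_abs_le i _)
  · exact (by fun_prop : Continuous _).aestronglyMeasurable
  · refine Filter.Eventually.of_forall fun ξ t _ => ?_
    rw [norm_mul, norm_mul, Circle.norm_coe, mul_one, Complex.norm_real, norm_mul, norm_neg, Real.norm_of_nonneg (by positivity)]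
    calc _ ≤ ‖𝓕 g ξ‖ * (2 * Real.pi * ‖ξ‖ * 1) := by
          gcongr; exact mS1_abs_le i _
      _ = _ := by ring
  · refine Filter.Eventually.of_forall fun ξ t _ => ?_
    have h2 : HasDerivAt (fun t : ℝ => 2 * Real.pi * (t * ‖ξ‖)) (2 * Real.pi * ‖ξ‖) t := by
      simpa using ((hasDerivAt_id t).mul_const ‖ξ‖).const_mul (2 * Real.pi)
    have h3 := (mS_deriv i (2 * Real.pi * (t * ‖ξ‖))).comp t h2
    have h4 := h3.ofReal_comp.const_mul (𝓕 g ξ * (Real.fourierChar (inner ℝ ξ x) : ℂ))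
    refine h4.congr_deriv ?_
    congr 2; ring

/-- Plancherel for multipliers -/
lemma mult_plancherel {d : ℕ} {g : Euc d → ℂ} (hg : ContDiff ℝ (⊤ : ℕ∞) g) (hgc : HasCompactSupport g)
    (μ : Euc d → ℝ) (hμ : Continuous μ) (C : ℝ) (hb : ∀ ξ, |μ ξ| ≤ C * ‖ξ‖ + C) (T : Euc d → ℂ)
    (hT : ∀ x, T x = ∫ ξ, (𝓕 g ξ * (Real.fourierChar (inner ℝ ξ x) : ℂ)) * (μ ξ : ℂ)) :
    ∫⁻ x, ‖T x‖ₑ ^ 2 ≤ ∫⁻ ξ, ‖𝓕 g ξ‖ₑ ^ 2 * ‖μ ξ‖ₑ ^ 2 := by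
  obtain ⟨hc, hi, hi1⟩ := fourier_sch hg hgc
  have hv : Integrable (fun ξ => 𝓕 g ξ * (μ ξ : ℂ)) := by
    refine ((hi1.const_mul C).add (hi.norm.const_mul C)).mono' (by fun_prop : Continuous _).aestronglyMeasurable
      (Filter.Eventually.of_forall fun ξ => ?_)
    rw [norm_mul, Complex.norm_real]
    calc _ ≤ ‖𝓕 g ξ‖ * (C * ‖ξ‖ + C) := by gcongr; exact hb ξ
      _ = _ := by simp only [Pi.add_apply]; ring
  have e : ∀ x, T x = 𝓕 (fun ξ => 𝓕 g ξ * (μ ξ : ℂ)) (-x) := by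
    intro x
    rw [hT, Real.fourier_eq]
    refine integral_congr_ae (Filter.Eventually.of_forall fun ξ => ?_)
    simp only [inner_neg_right, neg_neg, Circle.smul_def, smul_eq_mul]
    ring
  simp_rw [e]
  rw [lintegral_neg_eq_self (f := fun x => ‖𝓕 (fun ξ => 𝓕 g ξ * (μ ξ : ℂ)) x‖ₑ ^ 2)]
  refine (plancherel hv).trans (le_of_eq (lintegral_congr fun ξ => ?_))
  rw [enorm_mul, mul_pow, ← ofReal_norm_eq_enorm (μ ξ : ℂ), Complex.norm_real, ofReal_norm_eq_enorm]

def Wt {d : ℕ} (α : ℝ) (D : ℝ≥0∞) (g : Euc d → ℂ) : ℝ≥0∞ :=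
  ∫⁻ ξ, (1 + (D⁻¹ * ‖ξ‖ₑ) ^ 2) * ‖ξ‖ₑ ^ (-α) * ‖𝓕 g ξ‖ₑ ^ 2

def S2 {d : ℕ} (D : ℝ≥0∞) (g : Euc d → ℂ) (x : Euc d) : ℝ≥0∞ :=
  ∫⁻ t in Icc (1:ℝ) 2, (‖sphAvg g t x‖ₑ ^ 2 + (D⁻¹ * ‖sphD g t x‖ₑ) ^ 2)

def S1 {d : ℕ} (D : ℝ≥0∞) (g : Euc d → ℂ) (x : Euc d) : ℝ≥0∞ :=
  ∫⁻ t in Icc (1:ℝ) 2, (‖sphAvg g t x‖ₑ + D⁻¹ * ‖sphD g t x‖ₑ)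

lemma mS_decay_e {d : ℕ} (hd : 3 ≤ d) (i : Fin d) : ∃ C : ℝ≥0, ∀ t ∈ Icc (1:ℝ) 2, ∀ ξ : Euc d,
    ‖mS i (2 * Real.pi * (t * ‖ξ‖))‖ₑ ^ 2 ≤ C * ‖ξ‖ₑ ^ (-((d:ℝ) - 1)) ∧
    ‖mS1 i (2 * Real.pi * (t * ‖ξ‖))‖ₑ ^ 2 ≤ C * ‖ξ‖ₑ ^ (-((d:ℝ) - 1)) := by
  obtain ⟨C, hC0, hC⟩ := mS_decay hd i
  have hd1 : ((d - 1 : ℕ) : ℝ) = (d:ℝ) - 1 := by rw [Nat.cast_sub (by omega)]; simp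
  have key : ∀ t ∈ Icc (1:ℝ) 2, ∀ ξ : Euc d, ∀ u : ℝ, (2 * Real.pi * (t * ‖ξ‖)) ^ (d - 1) * u ^ 2 ≤ C →
      ‖u‖ₑ ^ 2 ≤ C.toNNReal * ‖ξ‖ₑ ^ (-((d:ℝ) - 1)) := by
    intro t ht ξ u hu
    by_cases h0 : ξ = 0
    · rw [h0, enorm_zero, ENNReal.zero_rpow_of_neg (by
        have : (3:ℝ) ≤ d := by exact_mod_cast hd
        linarith), ENNReal.mul_top (by simpa using hC0)]
      exact le_top
    · have hpos : ‖ξ‖ₑ ≠ 0 := by simpa using h0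
      rw [ENNReal.rpow_neg, ← div_eq_mul_inv, ENNReal.le_div_iff_mul_le (Or.inl (by
        rw [← hd1, ENNReal.rpow_natCast]; exact pow_ne_zero _ hpos)) (Or.inl (by
        rw [← hd1, ENNReal.rpow_natCast]; exact ENNReal.pow_ne_top (by simp))), ← hd1, ENNReal.rpow_natCast]
      have : ‖ξ‖ ^ (d - 1) * u ^ 2 ≤ C := by
        refine le_trans ?_ hu
        gcongr
        have h1 : 1 ≤ 2 * Real.pi * t := by nlinarith [Real.pi_gt_three, ht.1]
        nlinarith [norm_nonneg ξ]
      rw [← ofReal_norm_eq_enorm, ← ofReal_norm_eq_enorm, ← ENNReal.ofReal_pow (by positivity), ← ENNReal.ofReal_pow (by positivity),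
        ← ENNReal.ofReal_mul (by positivity)]
      refine ENNReal.ofReal_le_ofReal ?_
      rw [Real.norm_eq_abs, sq_abs, mul_comm]; exact this
  refine ⟨C.toNNReal, fun t ht ξ => ?_⟩
  have hnn : 0 ≤ 2 * Real.pi * (t * ‖ξ‖) := by have := ht.1; positivity
  have h := hC (2 * Real.pi * (t * ‖ξ‖)) hnn
  have hp : 0 ≤ (2 * Real.pi * (t * ‖ξ‖)) ^ (d - 1) := by positivity
  constructor
  · refine key t ht ξ _ (le_trans ?_ h)
    nlinarith [mul_nonneg hp (sq_nonneg (mS1 i (2 * Real.pi * (t * ‖ξ‖))))]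
  · refine key t ht ξ _ (le_trans ?_ h)
    nlinarith [mul_nonneg hp (sq_nonneg (mS i (2 * Real.pi * (t * ‖ξ‖))))]

lemma B2 {d : ℕ} (hd : 3 ≤ d) : ∃ C : ℝ≥0, ∀ (D : ℝ≥0∞) (g : Euc d → ℂ), ContDiff ℝ (⊤ : ℕ∞) g → HasCompactSupport g →
    ∫⁻ x, S2 D g x ≤ C * Wt ((d:ℝ) - 1) D g := by
  let i : Fin d := ⟨0, by omega⟩
  obtain ⟨C, hC⟩ := mS_decay_e hd i
  refine ⟨C * (1 + (2 * Real.pi).toNNReal ^ 2), fun D g hg hgc => ?_⟩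
  obtain ⟨hc, hi, hi1⟩ := fourier_sch hg hgc
  have ha := (sphAvg_cont hg.continuous hgc).measurable
  have hD := (sphD_cont hg hgc).measurable
  have hm := mS_cont i
  have hm1 := mS1_cont i
  have hmeas : Measurable fun p : Euc d × ℝ => ‖sphAvg g p.2 p.1‖ₑ ^ 2 + (D⁻¹ * ‖sphD g p.2 p.1‖ₑ) ^ 2 := by
    have h1 : Measurable fun p : Euc d × ℝ => sphAvg g p.2 p.1 := ha.comp measurable_swap
    have h2 : Measurable fun p : Euc d × ℝ => sphD g p.2 p.1 := hD.comp measurable_swap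
    fun_prop
  unfold S2
  rw [lintegral_lintegral_swap hmeas.aemeasurable]
  have hpt : ∀ t ∈ Icc (1:ℝ) 2, ∫⁻ x, (‖sphAvg g t x‖ₑ ^ 2 + (D⁻¹ * ‖sphD g t x‖ₑ) ^ 2) ≤
      (C * (1 + (2 * Real.pi).toNNReal ^ 2) : ℝ≥0) * Wt ((d:ℝ) - 1) D g := by
    intro t ht
    have ha' : Measurable fun x => sphAvg g t x := ha.comp (by fun_prop : Measurable fun x : Euc d => (t, x))
    have hD' : Measurable fun x => sphD g t x := hD.comp (by fun_prop : Measurable fun x : Euc d => (t, x))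
    rw [lintegral_add_left (by fun_prop)]
    simp_rw [mul_pow]
    rw [lintegral_const_mul _ (by fun_prop)]
    have e1 := mult_plancherel hg hgc (fun ξ => mS i (2 * Real.pi * (t * ‖ξ‖))) (by fun_prop) 1
      (fun ξ => by have := mS_abs_le i (2 * Real.pi * (t * ‖ξ‖)); linarith [norm_nonneg ξ]) (fun x => sphAvg g t x)
      (fun x => sphAvg_rep i hg hgc t x)
    have e2 := mult_plancherel hg hgc (fun ξ => -(2 * Real.pi * ‖ξ‖) * mS1 i (2 * Real.pi * (t * ‖ξ‖))) (by fun_prop) (2 * Real.pi)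
      (fun ξ => by
        rw [abs_mul, abs_neg, abs_of_nonneg (by positivity)]
        have := mS1_abs_le i (2 * Real.pi * (t * ‖ξ‖))
        have h0 : 0 ≤ 2 * Real.pi * ‖ξ‖ := by positivity
        nlinarith [Real.pi_pos]) (fun x => sphD g t x)
      (fun x => sphD_rep i hg hgc t x)
    refine (add_le_add e1 (mul_le_mul' le_rfl e2)).trans ?_
    rw [← lintegral_const_mul _ (by fun_prop), ← lintegral_add_left (by fun_prop), Wt, ← lintegral_const_mul _ (by fun_prop)]
    refine lintegral_mono fun ξ => ?_
    obtain ⟨b1, b2⟩ := hC t ht ξ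
    have e3 : ‖-(2 * Real.pi * ‖ξ‖) * mS1 i (2 * Real.pi * (t * ‖ξ‖))‖ₑ ^ 2 =
        ((2 * Real.pi).toNNReal : ℝ≥0∞) ^ 2 * ‖ξ‖ₑ ^ 2 * ‖mS1 i (2 * Real.pi * (t * ‖ξ‖))‖ₑ ^ 2 := by
      rw [enorm_mul, enorm_neg, enorm_mul, Real.enorm_of_nonneg (by positivity : 0 ≤ 2 * Real.pi), enorm_norm]
      rw [mul_pow, mul_pow]; rfl
    simp only [e3]
    set M := ‖ξ‖ₑ ^ (-((d:ℝ) - 1))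
    set P : ℝ≥0∞ := ((2 * Real.pi).toNNReal : ℝ≥0∞) ^ 2
    calc _ ≤ ‖𝓕 g ξ‖ₑ ^ 2 * (C * M) + D⁻¹ ^ 2 * (‖𝓕 g ξ‖ₑ ^ 2 * (P * ‖ξ‖ₑ ^ 2 * (C * M))) := by gcongr
      _ ≤ ‖𝓕 g ξ‖ₑ ^ 2 * (C * M) + D⁻¹ ^ 2 * (‖𝓕 g ξ‖ₑ ^ 2 * (P * ‖ξ‖ₑ ^ 2 * (C * M))) +
          (P * (‖𝓕 g ξ‖ₑ ^ 2 * (C * M)) + D⁻¹ ^ 2 * (‖𝓕 g ξ‖ₑ ^ 2 * (‖ξ‖ₑ ^ 2 * (C * M)))) := le_self_add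
      _ = _ := by push_cast; ring
  calc _ ≤ ∫⁻ t in Icc (1:ℝ) 2, (C * (1 + (2 * Real.pi).toNNReal ^ 2) : ℝ≥0) * Wt ((d:ℝ) - 1) D g :=
        setLIntegral_mono' measurableSet_Icc hpt
    _ = _ := by
        rw [lintegral_const]; simp; norm_num

/-- pointwise reduction through radial Plancherel -/
lemma S2_ext {d : ℕ} (hd : 3 ≤ d) : ∃ C : ℝ≥0, ∀ (D : ℝ≥0∞) (g : Euc d → ℂ), ContDiff ℝ (⊤ : ℕ∞) g → HasCompactSupport g →
    ∀ x, S2 D g x ≤ C * ∫⁻ ξ : Euc d, (1 + (D⁻¹ * ‖ξ‖ₑ) ^ 2) * ‖extS (fun ω => 𝓕 g (‖ξ‖ • ω)) (‖ξ‖ • x)‖ₑ ^ 2 := by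
  let i : Fin d := ⟨0, by omega⟩
  obtain ⟨C, hC⟩ := radial_plancherel i
  refine ⟨C, fun D g hg hgc x => ?_⟩
  obtain ⟨hc, hi, hi1⟩ := fourier_sch hg hgc
  have hch := cont_char (g := fun ξ : Euc d => inner ℝ ξ x) (by fun_prop)
  have hn : ∀ ξ, ‖𝓕 g ξ * (Real.fourierChar (inner ℝ ξ x) : ℂ)‖ = ‖𝓕 g ξ‖ := fun ξ => by
    rw [norm_mul, Circle.norm_coe, mul_one]
  obtain ⟨h1, h2⟩ := hC (fun ξ => 𝓕 g ξ * (Real.fourierChar (inner ℝ ξ x) : ℂ)) (by fun_prop)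
    (hi.norm.mono' (by fun_prop : Continuous _).aestronglyMeasurable (Filter.Eventually.of_forall fun ξ => (hn ξ).le))
    (by simpa only [hn] using hi1) (fun t => sphAvg g t x) (fun t => sphD g t x)
    (fun t => sphAvg_rep i hg hgc t x) (fun t => sphAvg_deriv hg hgc x t)
  have hr : ∀ ξ, radG (fun ξ => 𝓕 g ξ * (Real.fourierChar (inner ℝ ξ x) : ℂ)) ξ = extS (fun ω => 𝓕 g (‖ξ‖ • ω)) (‖ξ‖ • x) := by
    intro ξ
    unfold radG extS
    refine integral_congr_ae (Filter.Eventually.of_forall fun ω => ?_)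
    simp only [inner_smul_left, real_inner_comm]
  have hrc := radG_cont (d := d) (v := fun ξ => 𝓕 g ξ * (Real.fourierChar (inner ℝ ξ x) : ℂ)) (by fun_prop)
  simp_rw [← hr]
  unfold S2
  have ha : Measurable fun t => sphAvg g t x := ((sphAvg_cont hg.continuous hgc).comp (by fun_prop : Continuous fun t : ℝ => (t, x))).measurable
  have hD : Measurable fun t => sphD g t x := ((sphD_cont hg hgc).comp (by fun_prop : Continuous fun t : ℝ => (t, x))).measurable
  rw [lintegral_add_left (by fun_prop)]
  simp_rw [mul_pow]
  rw [lintegral_const_mul _ (by fun_prop)]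
  refine (add_le_add h1 (mul_le_mul' le_rfl h2)).trans (le_of_eq ?_)
  simp_rw [add_mul, one_mul]
  rw [lintegral_add_left (by fun_prop), mul_add]
  simp_rw [mul_assoc]
  rw [lintegral_const_mul _ (by fun_prop)]
  ring

lemma B3' {d : ℕ} (hd : 3 ≤ d) : ∃ C : ℝ≥0, ∀ (D : ℝ≥0∞) (g : Euc d → ℂ), ContDiff ℝ (⊤ : ℕ∞) g → HasCompactSupport g →
    ∀ x, S2 D g x ≤ C * Wt 0 D g := by
  obtain ⟨C, hC⟩ := S2_ext hd
  haveI := sphM_prob (d := d) (by omega)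
  refine ⟨C, fun D g hg hgc x => (hC D g hg hgc x).trans ?_⟩
  obtain ⟨hc, hi, hi1⟩ := fourier_sch hg hgc
  gcongr
  have hr := radial_lintegral (d := d) (by omega) (H := fun t => (1 + (D⁻¹ * ‖t‖ₑ) ^ 2)) (by fun_prop) (K := fun ξ => ‖𝓕 g ξ‖ₑ ^ 2) (by fun_prop)
  simp only [enorm_norm] at hr
  have : Wt 0 D g = ∫⁻ ξ, (1 + (D⁻¹ * ‖ξ‖ₑ) ^ 2) * ‖𝓕 g ξ‖ₑ ^ 2 := by simp [Wt]
  rw [this, ← hr]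
  refine lintegral_mono fun ξ => mul_le_mul' le_rfl ?_
  calc _ ≤ (∫⁻ ω, ‖𝓕 g (‖ξ‖ • ω)‖ₑ ∂(sphereMeasure d)) ^ 2 := by gcongr; exact extS_enorm_le _ _
    _ ≤ _ := by
      have := cs_sq (sphereMeasure d) (f := fun ω => ‖𝓕 g (‖ξ‖ • ω)‖ₑ) (g := fun _ => 1) (by fun_prop) (by fun_prop)
      simpa using this

lemma extS_smul_cont {d : ℕ} {h : Euc d → ℂ} (hh : Continuous h) :
    Continuous fun p : Euc d × Euc d => extS (fun ω => h (‖p.2‖ • ω)) (‖p.2‖ • p.1) := by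
  rw [continuous_iff_continuousAt]
  intro p0
  obtain ⟨M, hM⟩ := (isCompact_closedBall (0 : Euc d) (‖p0.2‖ + 1)).exists_bound_of_continuousOn hh.continuousOn
  refine continuousAt_of_dominated (bound := fun _ => M) ?_ ?_ (integrable_const _) ?_
  · refine Filter.Eventually.of_forall fun p => ?_
    have := cont_char (g := fun ω : Euc d => inner ℝ (‖p.2‖ • p.1) ω) (by fun_prop)
    exact (by fun_prop : Continuous _).aestronglyMeasurable
  · have : ∀ᶠ p : Euc d × Euc d in nhds p0, ‖p.2‖ < ‖p0.2‖ + 1 :=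
      (by fun_prop : Continuous fun p : Euc d × Euc d => ‖p.2‖).continuousAt.eventually_lt continuousAt_const (by simp)
    filter_upwards [this] with p hp
    filter_upwards [sphM_ae_norm d] with ω hω
    rw [norm_mul, Circle.norm_coe, mul_one]
    refine hM _ ?_
    rw [mem_closedBall, dist_zero_right, norm_smul, hω, mul_one, norm_norm]; exact hp.le
  · refine Filter.Eventually.of_forall fun ω => ?_
    have := cont_char (g := fun p : Euc d × Euc d => inner ℝ (‖p.2‖ • p.1) ω) (by fun_prop)
    exact (by fun_prop : Continuous _).continuousAt

open scoped Pointwise in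
lemma ext_scaled {d : ℕ} (hd : 3 ≤ d) : ∃ C : ℝ≥0, ∀ F : Set (Euc d), MeasurableSet F → volume F ≠ ∞ →
    ∀ h : Euc d → ℂ, Continuous h → ∀ ρ : ℝ, 0 < ρ →
    ∫⁻ x in F, ‖extS h (ρ • x)‖ₑ ^ 2 ≤ C * volume F ^ (2 / ((d:ℝ) + 1)) *
      (‖ρ‖ₑ ^ (-((d:ℝ) * (d - 1) / (d + 1))) * (∫⁻ ω, ‖h ω‖ₑ ^ 2 ∂(sphereMeasure d))) := by
  obtain ⟨C, hC⟩ := extension_F hd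
  refine ⟨C, fun F hF hFt h hh ρ hρ => ?_⟩
  have hsm : MeasurableSet (ρ • F) := hF.const_smul₀ ρ
  have hvol : volume (ρ • F) = ENNReal.ofReal (ρ ^ d) * volume F := by
    rw [Measure.addHaar_smul]; simp [abs_of_pos hρ]
  have h1 : ∫⁻ x in F, ‖extS h (ρ • x)‖ₑ ^ 2 = ENNReal.ofReal (ρ ^ d)⁻¹ * ∫⁻ x in ρ • F, ‖extS h x‖ₑ ^ 2 := by
    rw [← lintegral_indicator hF, ← lintegral_indicator hsm, ← dil_lintegral hρ]
    refine lintegral_congr fun x => ?_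
    by_cases hx : x ∈ F
    · rw [indicator_of_mem hx, indicator_of_mem (smul_mem_smul_set hx)]
    · rw [indicator_of_notMem hx, indicator_of_notMem (by rwa [smul_mem_smul_set_iff₀ hρ.ne'])]
  rw [h1]
  refine (mul_le_mul' le_rfl (hC _ hsm (by rw [hvol]; exact ENNReal.mul_ne_top ENNReal.ofReal_ne_top hFt) h hh)).trans (le_of_eq ?_)
  rw [hvol, ENNReal.mul_rpow_of_nonneg _ _ (by positivity)]
  have hd0 : (0:ℝ) ≤ d := by positivity
  have e : ENNReal.ofReal (ρ ^ d)⁻¹ * ENNReal.ofReal (ρ ^ d) ^ (2 / ((d:ℝ) + 1)) = ‖ρ‖ₑ ^ (-((d:ℝ) * (d - 1) / (d + 1))) := by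
    rw [Real.enorm_of_nonneg hρ.le, ENNReal.ofReal_rpow_of_pos (by positivity), ENNReal.ofReal_rpow_of_pos hρ, ← ENNReal.ofReal_mul (by positivity)]
    congr 1
    rw [← Real.rpow_natCast, ← Real.rpow_neg hρ.le, ← Real.rpow_mul hρ.le, ← Real.rpow_add hρ]
    congr 1
    field_simp; ring
  rw [← e]; ring

lemma B3_swap {d : ℕ} {h : Euc d → ℂ} (hh : Continuous h) (D C : ℝ≥0∞) (hC : C ≠ ∞) (F : Set (Euc d)) :
    ∫⁻ x in F, C * ∫⁻ ξ : Euc d, (1 + (D⁻¹ * ‖ξ‖ₑ) ^ 2) * ‖extS (fun ω => h (‖ξ‖ • ω)) (‖ξ‖ • x)‖ₑ ^ 2 =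
    C * ∫⁻ ξ : Euc d, (1 + (D⁻¹ * ‖ξ‖ₑ) ^ 2) * (∫⁻ x in F, ‖extS (fun ω => h (‖ξ‖ • ω)) (‖ξ‖ • x)‖ₑ ^ 2) := by
  have hec := (extS_smul_cont hh).measurable
  rw [lintegral_const_mul' _ _ hC, lintegral_lintegral_swap]
  · congr 1
    refine lintegral_congr fun ξ => ?_
    rw [lintegral_const_mul]
    exact ((hec.comp (by fun_prop : Measurable fun x : Euc d => (x, ξ))).enorm).pow_const 2
  · refine Measurable.aemeasurable (Measurable.mul (by fun_prop) (hec.enorm.pow_const 2))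

lemma B3 {d : ℕ} (hd : 3 ≤ d) : ∃ C : ℝ≥0, ∀ (D : ℝ≥0∞) (g : Euc d → ℂ), ContDiff ℝ (⊤ : ℕ∞) g → HasCompactSupport g →
    ∀ F : Set (Euc d), MeasurableSet F → volume F ≠ ∞ →
    ∫⁻ x in F, S2 D g x ≤ C * volume F ^ (2 / ((d:ℝ) + 1)) * Wt ((d:ℝ) * (d - 1) / (d + 1)) D g := by
  obtain ⟨C, hC⟩ := S2_ext hd
  obtain ⟨C', hC'⟩ := ext_scaled hd
  refine ⟨C * C', fun D g hg hgc F hF hFt => ?_⟩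
  obtain ⟨hc, hi, hi1⟩ := fourier_sch hg hgc
  have hr := radial_lintegral (d := d) (by omega) (H := fun t => (1 + (D⁻¹ * ‖t‖ₑ) ^ 2) * ‖t‖ₑ ^ (-((d:ℝ) * (d - 1) / (d + 1)))) (by fun_prop) (K := fun ξ => ‖𝓕 g ξ‖ₑ ^ 2) (by fun_prop)
  simp only [enorm_norm] at hr
  refine (lintegral_mono fun x => hC D g hg hgc x).trans ?_
  rw [B3_swap hc D C (by simp) F]
  rw [Wt, ← hr, ENNReal.coe_mul, mul_assoc, mul_assoc, ← lintegral_const_mul' _ _ (ENNReal.rpow_ne_top_of_nonneg (by positivity) hFt), ← lintegral_const_mul' (C' : ℝ≥0∞) _ (by simp)]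
  refine mul_le_mul' le_rfl (lintegral_mono_ae ?_)
  haveI : Nonempty (Fin d) := ⟨⟨0, by omega⟩⟩
  have hne : ∀ᵐ ξ : Euc d, ξ ≠ 0 := Measure.ae_ne volume 0
  filter_upwards [hne] with ξ hξ
  have hρ : 0 < ‖ξ‖ := norm_pos_iff.2 hξ
  have h5 := hC' F hF hFt (fun ω => 𝓕 g (‖ξ‖ • ω)) (by fun_prop) ‖ξ‖ hρ
  rw [enorm_norm] at h5
  generalize ∫⁻ x in F, ‖extS (fun ω => 𝓕 g (‖ξ‖ • ω)) (‖ξ‖ • x)‖ₑ ^ 2 = Y at h5 ⊢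
  refine (mul_le_mul' le_rfl h5).trans (le_of_eq ?_)
  generalize ∫⁻ ω, ‖𝓕 g (‖ξ‖ • ω)‖ₑ ^ 2 ∂(sphereMeasure d) = Z
  ring

/-- L1 type bounds -/
lemma B1 {d : ℕ} (hd : 3 ≤ d) : ∃ C : ℝ≥0, ∀ (D : ℝ≥0∞) (g : Euc d → ℂ), D ≠ 0 → ContDiff ℝ (⊤ : ℕ∞) g → HasCompactSupport g →
    (∀ x, S1 D g x ≤ C * ((∫⁻ z, ‖g z‖ₑ) + D⁻¹ * ∫⁻ z, ‖fderiv ℝ g z‖ₑ)) ∧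
    ∫⁻ x, S1 D g x ≤ C * ((∫⁻ z, ‖g z‖ₑ) + D⁻¹ * ∫⁻ z, ‖fderiv ℝ g z‖ₑ) := by
  have hd0 : 0 < d := by omega
  haveI := sphM_prob (d := d) hd0
  obtain ⟨C, hC⟩ := shell_bound hd0
  refine ⟨C + 1, fun D g hD0 hg hgc => ?_⟩
  obtain ⟨hfc, _⟩ := fderiv_cc hg hgc
  have hgcont := hg.continuous
  have hDi : D⁻¹ ≠ ∞ := ENNReal.inv_ne_top.2 hD0
  set u : Euc d → ℝ≥0∞ := fun z => ‖g z‖ₑ + D⁻¹ * ‖fderiv ℝ g z‖ₑ with hu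
  have hum : Measurable u := by fun_prop
  have hS : ∀ x, S1 D g x ≤ ∫⁻ t in Icc (1:ℝ) 2, (∫⁻ y, u (x - t • y) ∂(sphereMeasure d)) := by
    intro x
    refine lintegral_mono fun t => ?_
    simp only [hu]
    rw [lintegral_add_left (by fun_prop : Continuous fun y => ‖g (x - t • y)‖ₑ).measurable, lintegral_const_mul' _ _ hDi]
    refine add_le_add (enorm_integral_le_lintegral_enorm _) (mul_le_mul' le_rfl ?_)
    refine (enorm_integral_le_lintegral_enorm _).trans (lintegral_mono_ae ?_)
    filter_upwards [sphM_ae_norm d] with y hy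
    have := ContinuousLinearMap.le_opNorm_enorm (fderiv ℝ g (x - t • y)) (-y)
    rwa [enorm_neg, ← ofReal_norm_eq_enorm y, hy, ENNReal.ofReal_one, mul_one] at this
  have hI : ∫⁻ z, u z = (∫⁻ z, ‖g z‖ₑ) + D⁻¹ * ∫⁻ z, ‖fderiv ℝ g z‖ₑ := by
    rw [hu, lintegral_add_left (by fun_prop), lintegral_const_mul' _ _ hDi]
  rw [← hI]
  constructor
  · intro x
    refine (hS x).trans ((hC (fun z => u (x - z)) (by fun_prop)).trans ?_)
    rw [lintegral_sub_left_eq_self u x]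
    push_cast
    gcongr; exact le_self_add
  · calc _ ≤ ∫⁻ x, ∫⁻ t in Icc (1:ℝ) 2, (∫⁻ y, u (x - t • y) ∂(sphereMeasure d)) := lintegral_mono hS
      _ = ∫⁻ t in Icc (1:ℝ) 2, (∫⁻ x, (∫⁻ y, u (x - t • y) ∂(sphereMeasure d))) := by
          rw [lintegral_lintegral_swap]
          have : Measurable fun p : (Euc d × ℝ) × Euc d => u (p.1.1 - p.1.2 • p.2) := by fun_prop
          exact this.lintegral_prod_right'.aemeasurable
      _ = ∫⁻ t in Icc (1:ℝ) 2, (∫⁻ z, u z) := by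
          refine lintegral_congr fun t => ?_
          rw [lintegral_lintegral_swap (by fun_prop)]
          have : ∀ y : Euc d, ∫⁻ x, u (x - t • y) = ∫⁻ z, u z := fun y => lintegral_sub_right_eq_self u _
          simp [this]
      _ ≤ _ := by
          rw [lintegral_const]
          simp only [MeasurableSet.univ, Measure.restrict_apply, univ_inter, Real.volume_Icc]
          norm_num
          rw [add_mul]; simp

/-! ## P9: Littlewood-Paley pieces -/

def PhiF (d : ℕ) : Euc d → ℂ := (exists_Phi d d).choose
lemma PhiF_cd (d : ℕ) : ContDiff ℝ (⊤ : ℕ∞) (PhiF d) := (exists_Phi d d).choose_spec.1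
lemma PhiF_cs (d : ℕ) : HasCompactSupport (PhiF d) := (exists_Phi d d).choose_spec.2.1
lemma PhiF_one (d : ℕ) : ∃ C : ℝ, 0 ≤ C ∧ ∀ ξ, ‖1 - 𝓕 (PhiF d) ξ‖ ≤ C * ‖ξ‖ ^ d := (exists_Phi d d).choose_spec.2.2
lemma PhiF_int (d : ℕ) : Integrable (PhiF d) := cc_integrable (PhiF_cd d).continuous (PhiF_cs d)

def psiF (d : ℕ) : Euc d → ℂ := fun x => PhiF d x - dil (1/2) (PhiF d) x
lemma psiF_cd (d : ℕ) : ContDiff ℝ (⊤ : ℕ∞) (psiF d) := (PhiF_cd d).sub (dil_contDiff _ (PhiF_cd d))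
lemma psiF_cs (d : ℕ) : HasCompactSupport (psiF d) := (PhiF_cs d).sub (dil_compact (by norm_num) (PhiF_cs d))
lemma psiF_int (d : ℕ) : Integrable (psiF d) := cc_integrable (psiF_cd d).continuous (psiF_cs d)

lemma psiF_fourier (d : ℕ) (ξ : Euc d) : 𝓕 (psiF d) ξ = 𝓕 (PhiF d) ξ - 𝓕 (PhiF d) ((2:ℝ) • ξ) := by
  have h1 := PhiF_int d
  have h2 : Integrable (dil (1/2) (PhiF d)) := cc_integrable (dil_contDiff _ (PhiF_cd d)).continuous (dil_compact (by norm_num) (PhiF_cs d))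
  have h3 := dil_fourier (a := 1/2) (by norm_num) (PhiF d) ξ
  rw [show ((1/2 : ℝ))⁻¹ = 2 by norm_num] at h3
  rw [← h3]
  simp only [Real.fourier_eq, psiF, smul_sub]
  exact integral_sub ((Real.fourierIntegral_convergent_iff ξ).2 h1) ((Real.fourierIntegral_convergent_iff ξ).2 h2)

lemma psiF_small (d : ℕ) : ∃ C : ℝ, 0 ≤ C ∧ ∀ ξ, ‖𝓕 (psiF d) ξ‖ ≤ C * ‖ξ‖ ^ d := by
  obtain ⟨C, hC0, hC⟩ := PhiF_one d
  refine ⟨C + C * 2 ^ d, by positivity, fun ξ => ?_⟩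
  rw [psiF_fourier]
  calc _ = ‖(1 - 𝓕 (PhiF d) ((2:ℝ) • ξ)) - (1 - 𝓕 (PhiF d) ξ)‖ := by congr 1; ring
    _ ≤ _ := norm_sub_le _ _
    _ ≤ C * ‖(2:ℝ) • ξ‖ ^ d + C * ‖ξ‖ ^ d := add_le_add (hC _) (hC _)
    _ = _ := by rw [norm_smul, mul_pow]; norm_num; ring

def wF {d : ℕ} (η : Euc d) : ℝ≥0∞ := min ‖η‖ₑ ‖η‖ₑ⁻¹

lemma wF_meas {d : ℕ} : Measurable (wF (d := d)) := by unfold wF; fun_prop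

lemma wF_le_one {d : ℕ} (η : Euc d) : wF η ≤ 1 := by
  unfold wF
  rcases le_total ‖η‖ₑ 1 with h | h
  · exact (min_le_left _ _).trans h
  · exact (min_le_right _ _).trans (ENNReal.inv_le_one.2 h)

lemma weight_psi {d : ℕ} (hd : 1 ≤ d) (α : ℝ) (hα0 : 0 ≤ α) (hα : α ≤ d) : ∃ C : ℝ≥0, ∀ η : Euc d,
    (1 + ‖η‖ₑ ^ 2) * ‖η‖ₑ ^ (-α) * ‖𝓕 (psiF d) η‖ₑ ^ 2 ≤ C * wF η := by
  obtain ⟨C1, hC10, hC1⟩ := psiF_small d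
  obtain ⟨C2, hC20, hC2⟩ := fourier_rapid (psiF_cd d) (psiF_cs d) 2
  refine ⟨(2 * C1 ^ 2 + 2 * C2 ^ 2).toNNReal, fun η => ?_⟩
  by_cases h0 : η = 0
  · have : 𝓕 (psiF d) η = 0 := by
      have := hC1 η
      rw [h0, norm_zero, zero_pow (by omega), mul_zero] at this
      rw [h0]; exact norm_le_zero_iff.1 this
    rw [this]; simp
  have hρ : 0 < ‖η‖ := norm_pos_iff.2 h0
  set ρ := ‖η‖ with hρd
  have key : (1 + ρ ^ 2) * ρ ^ (-α) * ‖𝓕 (psiF d) η‖ ^ 2 ≤ (2 * C1 ^ 2 + 2 * C2 ^ 2) * min ρ ρ⁻¹ := by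
    rcases le_total ρ 1 with h1 | h1
    · have e : min ρ ρ⁻¹ = ρ := min_eq_left (h1.trans ((one_le_inv₀ hρ).2 h1))
      rw [e]
      have a1 : ‖𝓕 (psiF d) η‖ ^ 2 ≤ (C1 * ρ ^ d) ^ 2 := by gcongr; exact hC1 η
      have a2 : ρ ^ (-α) * (ρ ^ d) ^ 2 ≤ ρ := by
        rw [← pow_mul, ← Real.rpow_natCast, ← Real.rpow_add hρ]
        conv_rhs => rw [← Real.rpow_one ρ]
        refine Real.rpow_le_rpow_of_exponent_ge hρ h1 ?_
        push_cast
        have : (1:ℝ) ≤ d := by exact_mod_cast hd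
        linarith
      have a3 : 1 + ρ ^ 2 ≤ 2 := by nlinarith
      calc _ ≤ 2 * ρ ^ (-α) * (C1 * ρ ^ d) ^ 2 := by gcongr
        _ = 2 * C1 ^ 2 * (ρ ^ (-α) * (ρ ^ d) ^ 2) := by ring
        _ ≤ 2 * C1 ^ 2 * ρ := by gcongr
        _ ≤ _ := by nlinarith [sq_nonneg C2]
    · have e : min ρ ρ⁻¹ = ρ⁻¹ := min_eq_right ((inv_le_one_of_one_le₀ h1).trans h1)
      rw [e]
      have a1 : ‖𝓕 (psiF d) η‖ ≤ C2 / ρ ^ 2 := by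
        rw [le_div_iff₀ (by positivity), mul_comm]; exact hC2 η
      have a2 : ρ ^ (-α) ≤ 1 := Real.rpow_le_one_of_one_le_of_nonpos h1 (by linarith)
      have a3 : 1 + ρ ^ 2 ≤ 2 * ρ ^ 2 := by nlinarith
      calc _ ≤ (2 * ρ ^ 2) * 1 * (C2 / ρ ^ 2) ^ 2 := by gcongr
        _ = 2 * C2 ^ 2 * (ρ⁻¹ * ρ⁻¹) := by field_simp
        _ ≤ 2 * C2 ^ 2 * (ρ⁻¹ * 1) := by gcongr; exact inv_le_one_of_one_le₀ h1
        _ ≤ _ := by nlinarith [sq_nonneg C1, inv_pos.2 hρ, mul_nonneg (sq_nonneg C1) (inv_pos.2 hρ).le]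
  have := ENNReal.ofReal_le_ofReal key
  rw [ENNReal.ofReal_mul (by positivity), ENNReal.ofReal_mul (by positivity), ENNReal.ofReal_mul (by positivity), ENNReal.ofReal_add (by positivity) (by positivity),
    ENNReal.ofReal_pow hρ.le, ENNReal.ofReal_pow (norm_nonneg _), ENNReal.ofReal_one, ← ENNReal.ofReal_rpow_of_pos hρ, ofReal_norm_eq_enorm, hρd, ofReal_norm_eq_enorm, ENNReal.ofReal_min,
    ENNReal.ofReal_inv_of_pos hρ, ofReal_norm_eq_enorm] at this
  exact this

/-- Littlewood-Paley piece -/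
def LP {d : ℕ} (j : ℕ) (f : Euc d → ℂ) : Euc d → ℂ := cv f (dil (2 ^ j) (psiF d))

lemma LP_cd {d : ℕ} (j : ℕ) {f : Euc d → ℂ} (hf : Continuous f) : ContDiff ℝ (⊤ : ℕ∞) (LP j f) :=
  cv_contDiff hf (dil_contDiff _ (psiF_cd d)) (dil_compact (by positivity) (psiF_cs d))
lemma LP_cs {d : ℕ} (j : ℕ) {f : Euc d → ℂ} (hfc : HasCompactSupport f) : HasCompactSupport (LP j f) :=
  cv_compact hfc (dil_compact (by positivity) (psiF_cs d))

lemma LP_fourier {d : ℕ} (j : ℕ) {f : Euc d → ℂ} (hf : Continuous f) (hfc : HasCompactSupport f) (ξ : Euc d) :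
    𝓕 (LP j f) ξ = 𝓕 f ξ * 𝓕 (psiF d) (((2:ℝ) ^ j)⁻¹ • ξ) := by
  rw [LP, cv_fourier (cc_integrable hf hfc) (cc_integrable (dil_contDiff _ (psiF_cd d)).continuous (dil_compact (by positivity) (psiF_cs d))),
    dil_fourier (by positivity)]

def cj {d : ℕ} (j : ℕ) (f : Euc d → ℂ) : ℝ≥0∞ := ∫⁻ ξ, ‖𝓕 f ξ‖ₑ ^ 2 * wF (((2:ℝ) ^ j)⁻¹ • ξ)

def Dj (j : ℕ) : ℝ≥0∞ := 2 ^ j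

lemma Dj_ne_zero (j : ℕ) : Dj j ≠ 0 := by unfold Dj; simp
lemma Dj_ne_top (j : ℕ) : Dj j ≠ ∞ := by unfold Dj; simp

lemma enorm_smul_j {d : ℕ} (j : ℕ) (ξ : Euc d) : ‖((2:ℝ) ^ j)⁻¹ • ξ‖ₑ = (Dj j)⁻¹ * ‖ξ‖ₑ := by
  rw [enorm_smul, enorm_inv (by positivity), enorm_pow, Real.enorm_of_nonneg (by norm_num)]
  simp [Dj]

lemma Wt_LP {d : ℕ} (hd : 1 ≤ d) (α : ℝ) (hα0 : 0 ≤ α) (hα : α ≤ d) : ∃ C : ℝ≥0, ∀ (j : ℕ) (f : Euc d → ℂ), Continuous f → HasCompactSupport f →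
    Wt α (Dj j) (LP j f) ≤ C * Dj j ^ (-α) * cj j f := by
  obtain ⟨C, hC⟩ := weight_psi hd α hα0 hα
  refine ⟨C, fun j f hf hfc => ?_⟩
  have hDa : Dj j ^ (-α) ≠ ∞ := by
    refine ENNReal.rpow_ne_top_of_ne_zero (Dj_ne_zero j) (Dj_ne_top j)
  rw [Wt, cj, ← lintegral_const_mul' _ _ (ENNReal.mul_ne_top (by simp) hDa)]
  refine lintegral_mono fun ξ => ?_
  have h := hC (((2:ℝ) ^ j)⁻¹ • ξ)
  rw [LP_fourier j hf hfc, enorm_mul, mul_pow]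
  rw [enorm_smul_j] at h
  have e : ‖ξ‖ₑ ^ (-α) = Dj j ^ (-α) * ((Dj j)⁻¹ * ‖ξ‖ₑ) ^ (-α) := by
    rw [← ENNReal.mul_rpow_of_ne_top (Dj_ne_top j) (ENNReal.mul_ne_top (ENNReal.inv_ne_top.2 (Dj_ne_zero j)) (by simp)), ← mul_assoc,
      ENNReal.mul_inv_cancel (Dj_ne_zero j) (Dj_ne_top j), one_mul]
  rw [e]
  calc _ = Dj j ^ (-α) * ‖𝓕 f ξ‖ₑ ^ 2 * ((1 + ((Dj j)⁻¹ * ‖ξ‖ₑ) ^ 2) * ((Dj j)⁻¹ * ‖ξ‖ₑ) ^ (-α) * ‖𝓕 (psiF d) (((2:ℝ) ^ j)⁻¹ • ξ)‖ₑ ^ 2) := by ring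
    _ ≤ Dj j ^ (-α) * ‖𝓕 f ξ‖ₑ ^ 2 * (C * wF (((2:ℝ) ^ j)⁻¹ • ξ)) := by gcongr
    _ = _ := by ring

/-- two sided geometric sum -/
lemma geom_sum (μ : ℝ) (hμ : 1 < μ) : ∃ C : ℝ≥0, ∀ Y : ℝ≥0∞,
    ∑' j : ℕ, min (ENNReal.ofReal μ ^ j / Y) (Y / ENNReal.ofReal μ ^ j) ≤ C := by
  have hμ0 : 0 < μ := by linarith
  have hs : Summable fun k : ℤ => μ * (μ⁻¹) ^ k.natAbs := by
    refine Summable.mul_left _ ?_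
    have hg := summable_geometric_of_lt_one (inv_nonneg.2 hμ0.le) (inv_lt_one_of_one_lt₀ hμ)
    refine Summable.of_nat_of_neg ?_ ?_
    · simpa using hg
    · simpa using hg
  refine ⟨(∑' k : ℤ, μ * (μ⁻¹) ^ k.natAbs).toNNReal, fun Y => ?_⟩
  by_cases hY0 : Y = 0
  · simp [hY0]
  by_cases hYt : Y = ∞
  · simp [hYt, ENNReal.div_top]
  have hy : 0 < Y.toReal := ENNReal.toReal_pos hY0 hYt
  obtain ⟨n, hn1, hn2⟩ := exists_mem_Ico_zpow hy hμ
  have hYe : Y = ENNReal.ofReal Y.toReal := (ENNReal.ofReal_toReal hYt).symm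
  set y := Y.toReal
  have hterm : ∀ j : ℕ, min (ENNReal.ofReal μ ^ j / Y) (Y / ENNReal.ofReal μ ^ j) ≤ ENNReal.ofReal (μ * (μ⁻¹) ^ ((j:ℤ) - n).natAbs) := by
    intro j
    rw [hYe, ← ENNReal.ofReal_pow hμ0.le, ← ENNReal.ofReal_div_of_pos hy, ← ENNReal.ofReal_div_of_pos (by positivity), ← ENNReal.ofReal_min]
    refine ENNReal.ofReal_le_ofReal ?_
    rcases le_total (j:ℤ) n with h | h
    · refine (min_le_left _ _).trans ?_
      have e : (μ⁻¹) ^ ((j:ℤ) - n).natAbs = μ ^ ((j:ℤ) - n) := by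
        rw [← zpow_natCast, inv_zpow', Int.natCast_natAbs, abs_of_nonpos (by linarith)]; congr 1; ring
      rw [e, zpow_sub₀ hμ0.ne', zpow_natCast]
      calc μ ^ j / y ≤ μ ^ j / μ ^ n := by gcongr
        _ ≤ _ := le_mul_of_one_le_left (by positivity) hμ.le
    · refine (min_le_right _ _).trans ?_
      have e : (μ⁻¹) ^ ((j:ℤ) - n).natAbs = μ ^ (n - (j:ℤ)) := by
        rw [← zpow_natCast, inv_zpow', Int.natCast_natAbs, abs_of_nonneg (by linarith)]; congr 1; ring
      rw [e, zpow_sub₀ hμ0.ne', zpow_natCast, div_le_iff₀ (by positivity)]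
      rw [zpow_add_one₀ hμ0.ne'] at hn2
      have : μ * (μ ^ n / μ ^ j) * μ ^ j = μ ^ n * μ := by field_simp
      rw [this]; exact hn2.le
  calc _ ≤ ∑' j : ℕ, ENNReal.ofReal (μ * (μ⁻¹) ^ ((j:ℤ) - n).natAbs) := ENNReal.tsum_le_tsum hterm
    _ ≤ ∑' k : ℤ, ENNReal.ofReal (μ * (μ⁻¹) ^ k.natAbs) :=
        ENNReal.tsum_comp_le_tsum_of_injective (f := fun j : ℕ => (j:ℤ) - n) (fun a b h => by simpa using h) _
    _ = _ := by rw [← ENNReal.ofReal_tsum_of_nonneg (fun k => by positivity) hs]; rfl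

lemma cj_sum (d : ℕ) : ∃ C : ℝ≥0, ∀ f : Euc d → ℂ, Continuous f → HasCompactSupport f →
    ∑' j, cj j f ≤ C * ∫⁻ x, ‖f x‖ₑ ^ 2 := by
  obtain ⟨C, hC⟩ := geom_sum 2 (by norm_num)
  refine ⟨C, fun f hf hfc => ?_⟩
  have hF := (fourier_cont (cc_integrable hf hfc)).measurable
  have hw := wF_meas (d := d)
  unfold cj
  rw [← lintegral_tsum (fun j => by fun_prop)]
  calc _ ≤ ∫⁻ ξ, C * ‖𝓕 f ξ‖ₑ ^ 2 := by
        refine lintegral_mono fun ξ => ?_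
        rw [ENNReal.tsum_mul_left, mul_comm]
        gcongr
        refine le_trans (ENNReal.tsum_le_tsum fun j => ?_) (hC ‖ξ‖ₑ)
        rw [wF, enorm_smul_j, min_comm]
        rw [ENNReal.ofReal_ofNat, Dj, div_eq_mul_inv, div_eq_mul_inv, mul_comm ‖ξ‖ₑ, ENNReal.mul_inv (by simp) (by simp), inv_inv]
    _ = C * ∫⁻ ξ, ‖𝓕 f ξ‖ₑ ^ 2 := lintegral_const_mul' _ _ (by simp)
    _ ≤ _ := mul_le_mul' le_rfl (plancherel (cc_integrable hf hfc))

lemma cj_le {d : ℕ} (j : ℕ) {f : Euc d → ℂ} (hf : Continuous f) (hfc : HasCompactSupport f) :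
    cj j f ≤ ∫⁻ x, ‖f x‖ₑ ^ 2 := by
  refine le_trans ?_ (plancherel (cc_integrable hf hfc))
  unfold cj
  exact lintegral_mono fun ξ => mul_le_of_le_one_right zero_le (wF_le_one _)

lemma cc_L2_fin {d : ℕ} {f : Euc d → ℂ} (hf : Continuous f) (hfc : HasCompactSupport f) :
    ∫⁻ x, ‖f x‖ₑ ^ 2 ≠ ∞ := by
  have h : Integrable (fun x => ‖f x‖ ^ 2) := cc_integrable (by fun_prop) 
    (hfc.comp_left (g := fun z : ℂ => ‖z‖ ^ 2) (by simp))
  have := h.2.ne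
  simpa [HasFiniteIntegral, enorm_pow] using this

lemma cc_L1_fin {d : ℕ} {f : Euc d → ℂ} (hf : Continuous f) (hfc : HasCompactSupport f) :
    ∫⁻ x, ‖f x‖ₑ ≠ ∞ := (cc_integrable hf hfc).2.ne

lemma LP_L1 (d : ℕ) : ∃ C : ℝ≥0, ∀ (j : ℕ) (f : Euc d → ℂ), Continuous f → HasCompactSupport f →
    (∫⁻ z, ‖LP j f z‖ₑ) + (Dj j)⁻¹ * (∫⁻ z, ‖fderiv ℝ (LP j f) z‖ₑ) ≤ C * ∫⁻ x, ‖f x‖ₑ := by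
  have h1 : ∫⁻ x, ‖psiF d x‖ₑ ≠ ∞ := cc_L1_fin (psiF_cd d).continuous (psiF_cs d)
  have h2 : ∫⁻ x, ‖fderiv ℝ (psiF d) x‖ₑ ≠ ∞ := by
    obtain ⟨a, b⟩ := fderiv_cc (psiF_cd d) (psiF_cs d)
    exact (cc_integrable a b).2.ne
  refine ⟨(∫⁻ x, ‖psiF d x‖ₑ).toNNReal + (∫⁻ x, ‖fderiv ℝ (psiF d) x‖ₑ).toNNReal, fun j f hf hfc => ?_⟩
  rw [ENNReal.coe_add, ENNReal.coe_toNNReal h1, ENNReal.coe_toNNReal h2]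
  have hp : (0:ℝ) < 2 ^ j := by positivity
  have e1 := cv_L1 hf (dil_contDiff (2 ^ j) (psiF_cd d)).continuous
  rw [dil_L1 hp] at e1
  have e2 := cv_grad_L1 hf (dil_contDiff (2 ^ j) (psiF_cd d)) (dil_compact hp.ne' (psiF_cs d))
  rw [dil_grad_L1 hp (psiF_cd d)] at e2
  have e3 : ENNReal.ofReal (2 ^ j) = Dj j := by rw [ENNReal.ofReal_pow (by norm_num)]; simp [Dj]
  rw [e3] at e2
  calc _ ≤ (∫⁻ t, ‖f t‖ₑ) * (∫⁻ x, ‖psiF d x‖ₑ) + (Dj j)⁻¹ * ((∫⁻ t, ‖f t‖ₑ) * (Dj j * ∫⁻ x, ‖fderiv ℝ (psiF d) x‖ₑ)) :=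
        add_le_add e1 (mul_le_mul' le_rfl e2)
    _ = (∫⁻ t, ‖f t‖ₑ) * (∫⁻ x, ‖psiF d x‖ₑ) + ((Dj j)⁻¹ * Dj j) * ((∫⁻ t, ‖f t‖ₑ) * (∫⁻ x, ‖fderiv ℝ (psiF d) x‖ₑ)) := by ring
    _ = _ := by rw [ENNReal.inv_mul_cancel (Dj_ne_zero j) (Dj_ne_top j)]; ring

/-! ## P10: bounds for the pieces -/

lemma layercake {d : ℕ} {κ Q : ℝ} (hκ : 0 < κ) (hQ : κ < Q) : ∃ C : ℝ≥0∞, C ≠ ∞ ∧ ∀ (h : Euc d → ℝ≥0∞), Measurable h →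
    ∀ A B : ℝ≥0∞, B ≠ ∞ → (∀ x, h x ≤ B) → (∀ l : ℝ≥0∞, l ≠ 0 → l ≠ ∞ → volume {x | l < h x} ≤ A * l ^ (-κ)) →
    ∫⁻ x, h x ^ Q ≤ C * A * B ^ (Q - κ) := by
  have hQ0 : 0 < Q := hκ.trans hQ
  have hw0 : (2⁻¹ : ℝ≥0∞) ≠ 0 := by simp
  have hwt : (2⁻¹ : ℝ≥0∞) ≠ ∞ := by simp
  have hwlt : (2⁻¹ : ℝ≥0∞) ^ (Q - κ) < 1 := ENNReal.rpow_lt_one (by simp) (by linarith)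
  refine ⟨(2⁻¹ : ℝ≥0∞) ^ (-κ) * (1 - (2⁻¹ : ℝ≥0∞) ^ (Q - κ))⁻¹, ENNReal.mul_ne_top (ENNReal.rpow_ne_top_of_ne_zero hw0 hwt) ?_, ?_⟩
  · rw [ENNReal.inv_ne_top]; exact (tsub_pos_of_lt hwlt).ne'
  intro h hm A B hB hhB hweak
  by_cases hB0 : B = 0
  · have : ∀ x, h x ^ Q = 0 := fun x => by
      have := hhB x; rw [hB0] at this
      rw [le_antisymm this zero_le, ENNReal.zero_rpow_of_pos hQ0]
    simp [this]
  have hpt : ∀ x, h x ^ Q ≤ ∑' k : ℕ, indicator {x | B * 2⁻¹ ^ (k + 1) < h x} (fun _ => (B * 2⁻¹ ^ k) ^ Q) x := by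
    intro x
    by_cases hx0 : h x = 0
    · rw [hx0, ENNReal.zero_rpow_of_pos hQ0]; exact zero_le
    have hex : ∃ k : ℕ, B * 2⁻¹ ^ (k + 1) < h x := by
      obtain ⟨n, hn⟩ := ENNReal.exists_inv_two_pow_lt (a := h x / B) (ENNReal.div_ne_zero.2 ⟨hx0, hB⟩)
      refine ⟨n, ?_⟩
      rw [ENNReal.lt_div_iff_mul_lt (Or.inl hB0) (Or.inl hB)] at hn
      refine lt_of_le_of_lt ?_ hn
      rw [mul_comm]
      exact mul_le_mul' (pow_le_pow_right_of_le_one' (by simp) (by omega)) le_rfl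
    classical
    have h1 := Nat.find_spec hex
    set k := Nat.find hex with hk
    have h2 : h x ≤ B * 2⁻¹ ^ k := by
      rcases Nat.eq_zero_or_pos k with h0 | h0
      · rw [h0]; simpa using hhB x
      · have := Nat.find_min hex (m := k - 1) (by omega)
        rw [Nat.sub_add_cancel h0] at this
        exact not_lt.1 this
    refine le_trans ?_ (ENNReal.le_tsum k)
    rw [indicator_of_mem (show x ∈ {x | B * 2⁻¹ ^ (k + 1) < h x} from h1)]
    exact ENNReal.rpow_le_rpow h2 hQ0.le
  have hms : ∀ k : ℕ, MeasurableSet {x | B * 2⁻¹ ^ (k + 1) < h x} := fun k => measurableSet_lt measurable_const hm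
  calc _ ≤ ∫⁻ x, ∑' k : ℕ, indicator {x | B * 2⁻¹ ^ (k + 1) < h x} (fun _ => (B * 2⁻¹ ^ k) ^ Q) x := lintegral_mono hpt
    _ = ∑' k : ℕ, (B * 2⁻¹ ^ k) ^ Q * volume {x | B * 2⁻¹ ^ (k + 1) < h x} := by
        rw [lintegral_tsum fun k => (measurable_const.indicator (hms k)).aemeasurable]
        congr 1; ext k; rw [lintegral_indicator_const (hms k)]
    _ ≤ ∑' k : ℕ, (2⁻¹ : ℝ≥0∞) ^ (-κ) * A * B ^ (Q - κ) * (2⁻¹ ^ (Q - κ)) ^ k := by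
        refine ENNReal.tsum_le_tsum fun k => ?_
        have hk0 : (2⁻¹ : ℝ≥0∞) ^ k ≠ 0 := pow_ne_zero _ hw0
        have hkt : (2⁻¹ : ℝ≥0∞) ^ k ≠ ∞ := ENNReal.pow_ne_top hwt
        have hBk0 : B * 2⁻¹ ^ k ≠ 0 := mul_ne_zero hB0 hk0
        have hBkt : B * 2⁻¹ ^ k ≠ ∞ := ENNReal.mul_ne_top hB hkt
        refine (mul_le_mul' le_rfl (hweak _ (mul_ne_zero hB0 (pow_ne_zero _ hw0)) (ENNReal.mul_ne_top hB (ENNReal.pow_ne_top hwt)))).trans ?_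
        have e : (B * 2⁻¹ ^ (k + 1)) ^ (-κ) = (B * 2⁻¹ ^ k) ^ (-κ) * (2⁻¹ : ℝ≥0∞) ^ (-κ) := by
          rw [pow_succ, ← mul_assoc, ENNReal.mul_rpow_of_ne_zero hBk0 hw0]
        have e2 : (B * 2⁻¹ ^ k) ^ Q * (B * 2⁻¹ ^ k) ^ (-κ) = B ^ (Q - κ) * (2⁻¹ ^ (Q - κ)) ^ k := by
          rw [← ENNReal.rpow_add _ _ hBk0 hBkt, ← sub_eq_add_neg, ENNReal.mul_rpow_of_ne_zero hB0 hk0, ← ENNReal.rpow_natCast, ← ENNReal.rpow_natCast,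
            ← ENNReal.rpow_mul, ← ENNReal.rpow_mul, mul_comm (k:ℝ)]
        rw [e]
        calc _ = (2⁻¹ : ℝ≥0∞) ^ (-κ) * A * ((B * 2⁻¹ ^ k) ^ Q * (B * 2⁻¹ ^ k) ^ (-κ)) := by ring
          _ ≤ _ := by rw [e2, mul_assoc _ (B ^ _)]
    _ = _ := by rw [ENNReal.tsum_mul_left, ENNReal.tsum_geometric]; ring

lemma S_meas_aux {d : ℕ} (D : ℝ≥0∞) (u v : ℝ × Euc d → ℂ) (hu : Continuous u) (hv : Continuous v) :
    Measurable (fun x => ∫⁻ t in Icc (1:ℝ) 2, (‖u (t, x)‖ₑ ^ 2 + (D⁻¹ * ‖v (t, x)‖ₑ) ^ 2)) ∧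
    Measurable (fun x => ∫⁻ t in Icc (1:ℝ) 2, (‖u (t, x)‖ₑ + D⁻¹ * ‖v (t, x)‖ₑ)) := by
  have h1 := hu.measurable
  have h2 := hv.measurable
  constructor
  · exact Measurable.lintegral_prod_left' (μ := volume.restrict (Icc (1:ℝ) 2)) (f := fun p : ℝ × Euc d => ‖u p‖ₑ ^ 2 + (D⁻¹ * ‖v p‖ₑ) ^ 2) (by fun_prop)
  · exact Measurable.lintegral_prod_left' (μ := volume.restrict (Icc (1:ℝ) 2)) (f := fun p : ℝ × Euc d => ‖u p‖ₑ + D⁻¹ * ‖v p‖ₑ) (by fun_prop)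

lemma S2_meas {d : ℕ} (D : ℝ≥0∞) {g : Euc d → ℂ} (hg : ContDiff ℝ (⊤ : ℕ∞) g) (hgc : HasCompactSupport g) : Measurable (S2 D g) :=
  (S_meas_aux D _ _ (sphAvg_cont hg.continuous hgc) (sphD_cont hg hgc)).1

lemma S1_meas {d : ℕ} (D : ℝ≥0∞) {g : Euc d → ℂ} (hg : ContDiff ℝ (⊤ : ℕ∞) g) (hgc : HasCompactSupport g) : Measurable (S1 D g) :=
  (S_meas_aux D _ _ (sphAvg_cont hg.continuous hgc) (sphD_cont hg hgc)).2

def S1j {d : ℕ} (j : ℕ) (f : Euc d → ℂ) : Euc d → ℝ≥0∞ := S1 (Dj j) (LP j f)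
def S2j {d : ℕ} (j : ℕ) (f : Euc d → ℂ) : Euc d → ℝ≥0∞ := S2 (Dj j) (LP j f)

section
variable {d : ℕ} {f : Euc d → ℂ}

lemma S1j_meas (j : ℕ) (hf : Continuous f) (hfc : HasCompactSupport f) : Measurable (S1j j f) := S1_meas _ (LP_cd j hf) (LP_cs j hfc)
lemma S2j_meas (j : ℕ) (hf : Continuous f) (hfc : HasCompactSupport f) : Measurable (S2j j f) := S2_meas _ (LP_cd j hf) (LP_cs j hfc)
end

lemma E1 {d : ℕ} (hd : 3 ≤ d) : ∃ C : ℝ≥0∞, C ≠ ∞ ∧ ∀ (j : ℕ) (f : Euc d → ℂ), Continuous f → HasCompactSupport f →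
    (∀ x, S1j j f x ≤ C * ∫⁻ x, ‖f x‖ₑ) ∧ ∫⁻ x, S1j j f x ≤ C * ∫⁻ x, ‖f x‖ₑ := by
  obtain ⟨C, hC⟩ := B1 hd
  obtain ⟨C', hC'⟩ := LP_L1 d
  refine ⟨C * C', by finiteness, fun j f hf hfc => ?_⟩
  obtain ⟨h1, h2⟩ := hC (Dj j) (LP j f) (Dj_ne_zero j) (LP_cd j hf) (LP_cs j hfc)
  have h3 := hC' j f hf hfc
  rw [mul_assoc]
  exact ⟨fun x => (h1 x).trans (mul_le_mul' le_rfl h3), h2.trans (mul_le_mul' le_rfl h3)⟩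

lemma E2 {d : ℕ} (hd : 3 ≤ d) : ∃ C : ℝ≥0∞, C ≠ ∞ ∧ ∀ (j : ℕ) (f : Euc d → ℂ), Continuous f → HasCompactSupport f →
    ∫⁻ x, S2j j f x ≤ C * Dj j ^ (-((d:ℝ) - 1)) * cj j f := by
  have hd' : (3:ℝ) ≤ d := by exact_mod_cast hd
  obtain ⟨C, hC⟩ := B2 hd
  obtain ⟨C', hC'⟩ := Wt_LP (d := d) (by omega) ((d:ℝ) - 1) (by linarith) (by linarith)
  refine ⟨C * C', by finiteness, fun j f hf hfc => ?_⟩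
  rw [mul_assoc, mul_assoc, ← mul_assoc (C' : ℝ≥0∞)]
  exact (hC _ _ (LP_cd j hf) (LP_cs j hfc)).trans (mul_le_mul' le_rfl (hC' j f hf hfc))

lemma E3' {d : ℕ} (hd : 3 ≤ d) : ∃ C : ℝ≥0∞, C ≠ ∞ ∧ ∀ (j : ℕ) (f : Euc d → ℂ), Continuous f → HasCompactSupport f →
    ∀ x, S2j j f x ≤ C * cj j f := by
  obtain ⟨C, hC⟩ := B3' hd
  obtain ⟨C', hC'⟩ := Wt_LP (d := d) (by omega) 0 (by linarith) (by positivity)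
  refine ⟨C * C', by finiteness, fun j f hf hfc x => ?_⟩
  refine (hC _ _ (LP_cd j hf) (LP_cs j hfc) x).trans ?_
  rw [mul_assoc]
  have := hC' j f hf hfc
  rw [neg_zero, ENNReal.rpow_zero, mul_one] at this
  exact (mul_le_mul' le_rfl this)

lemma E4 {d : ℕ} (hd : 3 ≤ d) {Q : ℝ} (hQ : ((d:ℝ) + 1) / (d - 1) < Q) : ∃ C : ℝ≥0∞, C ≠ ∞ ∧ ∀ (j : ℕ) (f : Euc d → ℂ), Continuous f → HasCompactSupport f →
    ∫⁻ x, S2j j f x ^ Q ≤ C * Dj j ^ (-(d:ℝ)) * cj j f ^ Q := by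
  have hd' : (3:ℝ) ≤ d := by exact_mod_cast hd
  set κ : ℝ := ((d:ℝ) + 1) / (d - 1) with hκ
  have hκ0 : 0 < κ := by apply div_pos <;> linarith
  have hκ1 : ((d:ℝ) - 1) / (d + 1) * κ = 1 := by
    rw [hκ]; have : (d:ℝ) - 1 ≠ 0 := by linarith
    field_simp
  obtain ⟨CL, hCL, HL⟩ := layercake (d := d) hκ0 hQ
  obtain ⟨C2, hC2, H2⟩ := E2 hd
  obtain ⟨C3, hC3, H3'⟩ := E3' hd
  obtain ⟨C, hC⟩ := B3 hd
  obtain ⟨C', hC'⟩ := Wt_LP (d := d) (by omega) ((d:ℝ) * (d - 1) / (d + 1)) (by apply div_nonneg <;> nlinarith) (by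
    rw [div_le_iff₀ (by linarith)]; nlinarith)
  refine ⟨CL * (C * C') ^ κ * C3 ^ (Q - κ), ?_, fun j f hf hfc => ?_⟩
  · exact ENNReal.mul_ne_top (ENNReal.mul_ne_top hCL (ENNReal.rpow_ne_top_of_nonneg hκ0.le (by finiteness))) (ENNReal.rpow_ne_top_of_nonneg (by linarith) hC3)
  have hcf : cj j f ≠ ∞ := ne_top_of_le_ne_top (cc_L2_fin hf hfc) (cj_le j hf hfc)
  have hm := S2j_meas j hf hfc
  have hDt : ∀ z : ℝ, Dj j ^ z ≠ ∞ := fun z => ENNReal.rpow_ne_top_of_ne_zero (Dj_ne_zero j) (Dj_ne_top j)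
  have key := HL (S2j j f) hm ((C * C') ^ κ * Dj j ^ (-(d:ℝ)) * cj j f ^ κ) (C3 * cj j f) (ENNReal.mul_ne_top hC3 hcf) (H3' j f hf hfc) ?_
  · refine key.trans (le_of_eq ?_)
    rw [ENNReal.mul_rpow_of_nonneg _ _ (by linarith : 0 ≤ Q - κ)]
    have : cj j f ^ Q = cj j f ^ κ * cj j f ^ (Q - κ) := by
      rw [← ENNReal.rpow_add_of_nonneg _ _ hκ0.le (by linarith)]; congr 1; ring
    rw [this]; ring
  intro l hl0 hlt
  have hFm : MeasurableSet {x | l < S2j j f x} := measurableSet_lt measurable_const hm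
  have hF1 : l * volume {x | l < S2j j f x} ≤ ∫⁻ x in {x | l < S2j j f x}, S2j j f x := by
    rw [← setLIntegral_const]
    exact setLIntegral_mono hm fun x hx => le_of_lt hx
  have hFt : volume {x | l < S2j j f x} ≠ ∞ := by
    intro h
    have : l * volume {x | l < S2j j f x} ≠ ∞ := ne_top_of_le_ne_top (ENNReal.mul_ne_top (ENNReal.mul_ne_top hC2 (hDt _)) hcf)
      (hF1.trans ((setLIntegral_le_lintegral _ _).trans (H2 j f hf hfc)))
    rw [h, ENNReal.mul_top hl0] at this; exact this rfl
  have h1 := hC (Dj j) (LP j f) (LP_cd j hf) (LP_cs j hfc) _ hFm hFt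
  have h2 := hF1.trans (h1.trans (mul_le_mul' le_rfl (hC' j f hf hfc)))
  generalize volume {x | l < S2j j f x} = V at h2 hFt
  by_cases hV0 : V = 0
  · rw [hV0]; exact zero_le
  have h3 : V ^ (((d:ℝ) - 1) / (d + 1)) ≤ (C * C') * Dj j ^ (-((d:ℝ) * (d - 1) / (d + 1))) * cj j f * l⁻¹ := by
    have hVp0 : V ^ (2 / ((d:ℝ) + 1)) ≠ 0 := by
      rw [Ne, ENNReal.rpow_eq_zero_iff]; push Not; exact ⟨fun h => absurd h hV0, fun h => absurd h hFt⟩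
    have hVpt : V ^ (2 / ((d:ℝ) + 1)) ≠ ∞ := ENNReal.rpow_ne_top_of_ne_zero hV0 hFt
    have e : V = V ^ (2 / ((d:ℝ) + 1)) * V ^ (((d:ℝ) - 1) / (d + 1)) := by
      rw [← ENNReal.rpow_add _ _ hV0 hFt, ← add_div, show (2 + ((d:ℝ) - 1)) / (d + 1) = 1 by field_simp; ring, ENNReal.rpow_one]
    rw [← div_eq_mul_inv, ENNReal.le_div_iff_mul_le (Or.inl hl0) (Or.inl hlt)]
    rw [← ENNReal.mul_le_mul_iff_right hVp0 hVpt]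
    calc _ = l * (V ^ (2 / ((d:ℝ) + 1)) * V ^ (((d:ℝ) - 1) / (d + 1))) := by ring
      _ = l * V := by rw [← e]
      _ ≤ _ := h2
      _ = _ := by ring
  have h4 := ENNReal.rpow_le_rpow h3 hκ0.le
  rw [← ENNReal.rpow_mul, hκ1, ENNReal.rpow_one] at h4
  refine h4.trans (le_of_eq ?_)
  rw [ENNReal.mul_rpow_of_nonneg _ _ hκ0.le, ENNReal.mul_rpow_of_nonneg _ _ hκ0.le, ENNReal.mul_rpow_of_nonneg (C * C' : ℝ≥0∞) _ hκ0.le, ← ENNReal.rpow_mul, ENNReal.rpow_neg l, ENNReal.inv_rpow]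
  congr 4
  rw [neg_mul]; congr 1
  rw [mul_div_assoc, mul_assoc, hκ1, mul_one]

lemma pow_sum {q ε : ℝ} (hq : 0 < q) (hε : 0 < ε) : ∃ C : ℝ≥0∞, C ≠ ∞ ∧ ∀ g : ℕ → ℝ≥0∞,
    (∑' j, g j) ^ q ≤ C * ∑' j, Dj j ^ ε * g j ^ q := by
  have hlt : (2:ℝ≥0∞) ^ (-(ε / q)) < 1 := ENNReal.rpow_lt_one_of_one_lt_of_neg (by norm_num) (by rw [neg_lt_zero]; positivity)
  refine ⟨((1 - (2:ℝ≥0∞) ^ (-(ε / q)))⁻¹) ^ q, ENNReal.rpow_ne_top_of_nonneg hq.le ?_, fun g => ?_⟩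
  · rw [ENNReal.inv_ne_top]; exact (tsub_pos_of_lt hlt).ne'
  set M := ∑' j, Dj j ^ ε * g j ^ q
  have h : ∀ j, g j ≤ ((2:ℝ≥0∞) ^ (-(ε / q))) ^ j * M ^ (1 / q) := by
    intro j
    have h1 : Dj j ^ ε * g j ^ q ≤ M := ENNReal.le_tsum j
    have h2 := ENNReal.rpow_le_rpow h1 (by positivity : 0 ≤ 1 / q)
    rw [ENNReal.mul_rpow_of_nonneg _ _ (by positivity), ← ENNReal.rpow_mul, ← ENNReal.rpow_mul, mul_one_div_cancel hq.ne', ENNReal.rpow_one] at h2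
    have e : ((2:ℝ≥0∞) ^ (-(ε / q))) ^ j = (Dj j ^ (ε * (1 / q)))⁻¹ := by
      rw [← ENNReal.rpow_natCast, ← ENNReal.rpow_mul, Dj, ← ENNReal.rpow_natCast, ← ENNReal.rpow_mul, ← ENNReal.rpow_neg]
      congr 1; ring
    rw [e, mul_comm, ← div_eq_mul_inv, ENNReal.le_div_iff_mul_le]
    · rwa [mul_comm]
    · left; rw [Ne, ENNReal.rpow_eq_zero_iff]; push Not; exact ⟨fun h => absurd h (Dj_ne_zero j), fun h => absurd h (Dj_ne_top j)⟩
    · left; exact ENNReal.rpow_ne_top_of_ne_zero (Dj_ne_zero j) (Dj_ne_top j)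
  calc _ ≤ (∑' j, ((2:ℝ≥0∞) ^ (-(ε / q))) ^ j * M ^ (1 / q)) ^ q := ENNReal.rpow_le_rpow (ENNReal.tsum_le_tsum h) hq.le
    _ = _ := by rw [ENNReal.tsum_mul_right, ENNReal.tsum_geometric, ENNReal.mul_rpow_of_nonneg _ _ hq.le, ← ENNReal.rpow_mul, one_div_mul_cancel hq.ne', ENNReal.rpow_one]

/-! ## P11: restricted type bounds -/

def n1 {d : ℕ} (f : Euc d → ℂ) : ℝ≥0∞ := ∫⁻ x, ‖f x‖ₑ
def n2 {d : ℕ} (f : Euc d → ℂ) : ℝ≥0∞ := ∫⁻ x, ‖f x‖ₑ ^ 2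

lemma V_piece {d : ℕ} {r θ s : ℝ} (hs1 : 1 ≤ s) (hs2 : s ≤ 2) (hsr : s ≤ r) (hθ1 : θ ≤ 1) (hθs : 1 - θ / 2 ≤ 1 / s) :
    ∃ C : ℝ≥0∞, C ≠ ∞ ∧ ∀ (j : ℕ) (f : Euc d → ℂ), Continuous f → HasCompactSupport f → ∀ x,
    VrIA r (LP j f) x ≤ C * Dj j ^ (1 / s) * S1j j f x ^ (1 - θ) * S2j j f x ^ (θ / 2) := by
  obtain ⟨C, hC⟩ := rVar_main hs1 hs2 hsr hθ1 hθs
  refine ⟨C, by simp, fun j f hf hfc x => ?_⟩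
  have hg := LP_cd j hf
  have hgc := LP_cs j hfc
  have h1 := sphD_cont hg hgc
  have := hC (fun t => sphAvg (LP j f) t x) (fun t => sphD (LP j f) t x) (fun t => sphAvg_deriv hg hgc x t)
    (h1.comp (by fun_prop : Continuous fun t : ℝ => (t, x))) (Dj j) (Dj_ne_zero j) (Dj_ne_top j)
  rw [← ENNReal.rpow_mul, one_div_mul_eq_div] at this
  exact this

lemma Dj_rpow_ne_top (j : ℕ) (z : ℝ) : Dj j ^ z ≠ ∞ := ENNReal.rpow_ne_top_of_ne_zero (Dj_ne_zero j) (Dj_ne_top j)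
lemma Dj_rpow_ne_zero (j : ℕ) (z : ℝ) : Dj j ^ z ≠ 0 := by
  rw [Ne, ENNReal.rpow_eq_zero_iff]; push Not; exact ⟨fun h => absurd h (Dj_ne_zero j), fun h => absurd h (Dj_ne_top j)⟩
lemma Dj_add (j : ℕ) (a b : ℝ) : Dj j ^ (a + b) = Dj j ^ a * Dj j ^ b := ENNReal.rpow_add _ _ (Dj_ne_zero j) (Dj_ne_top j)

lemma V_pow {C D a b V : ℝ≥0∞} {s θ q : ℝ} (hq : 0 < q) (h : V ≤ C * D ^ (1 / s) * a ^ (1 - θ) * b ^ (θ / 2)) :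
    V ^ q ≤ C ^ q * D ^ (q / s) * a ^ ((1 - θ) * q) * b ^ (θ * q / 2) := by
  refine (ENNReal.rpow_le_rpow h hq.le).trans (le_of_eq ?_)
  rw [ENNReal.mul_rpow_of_nonneg _ _ hq.le, ENNReal.mul_rpow_of_nonneg _ _ hq.le, ENNReal.mul_rpow_of_nonneg _ _ hq.le, ← ENNReal.rpow_mul, ← ENNReal.rpow_mul,
    ← ENNReal.rpow_mul, show 1 / s * q = q / s by ring, show θ / 2 * q = θ * q / 2 by ring]

lemma M_caseA {d : ℕ} (hd : 3 ≤ d) {r s q θ : ℝ} (hs1 : 1 ≤ s) (hs2 : s ≤ 2) (hsr : s ≤ r) (hθ0 : 0 ≤ θ) (hθ1 : θ ≤ 1)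
    (hθs : 1 - θ / 2 ≤ 1 / s) (hq : 0 < q) (h1 : 1 ≤ q * (1 - θ / 2)) (h2 : θ * q / 2 ≤ 1) (h3 : 1 / s < (d - 1) * θ / 2) :
    ∃ C : ℝ≥0∞, C ≠ ∞ ∧ ∃ ε : ℝ, 0 < ε ∧ ∀ (j : ℕ) (f : Euc d → ℂ), Continuous f → HasCompactSupport f →
    ∫⁻ x, VrIA r (LP j f) x ^ q ≤ C * Dj j ^ (-ε) * (n1 f ^ ((1 - θ) * q) * n2 f ^ (θ * q / 2)) := by
  obtain ⟨C, hC, HV⟩ := V_piece (d := d) hs1 hs2 hsr hθ1 hθs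
  obtain ⟨C1, hC1, H1⟩ := E1 hd
  obtain ⟨C2, hC2, H2⟩ := E2 hd
  set A := θ * q / 2 with hA
  have hA0 : 0 ≤ A := by positivity
  have hθq : 0 ≤ (1 - θ) * q := mul_nonneg (by linarith) hq.le
  refine ⟨C ^ q * C1 ^ ((1 - θ) * q) * C2 ^ A, ?_, (d - 1) * A - q / s, ?_, fun j f hf hfc => ?_⟩
  · exact ENNReal.mul_ne_top (ENNReal.mul_ne_top (ENNReal.rpow_ne_top_of_nonneg hq.le hC) (ENNReal.rpow_ne_top_of_nonneg hθq hC1)) (ENNReal.rpow_ne_top_of_nonneg hA0 hC2)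
  · have := mul_lt_mul_of_pos_left h3 hq
    have e : q / s = q * (1 / s) := by ring
    rw [e, hA]; linarith
  obtain ⟨Ha, Ha'⟩ := H1 j f hf hfc
  have Hb := H2 j f hf hfc
  have hn1 : n1 f ≠ ∞ := cc_L1_fin hf hfc
  have he : 0 ≤ (1 - θ) * q - (1 - A) := by rw [hA]; linarith
  have hcj : cj j f ≤ n2 f := cj_le j hf hfc
  change ∀ x, S1j j f x ≤ C1 * n1 f at Ha
  change ∫⁻ x, S1j j f x ≤ C1 * n1 f at Ha'
  have hb := S2j_meas j hf hfc
  have ha := S1j_meas j hf hfc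
  have hconst : C ^ q * Dj j ^ (q / s) * (C1 * n1 f) ^ ((1 - θ) * q - (1 - A)) ≠ ∞ :=
    ENNReal.mul_ne_top (ENNReal.mul_ne_top (ENNReal.rpow_ne_top_of_nonneg hq.le hC) (Dj_rpow_ne_top _ _)) (ENNReal.rpow_ne_top_of_nonneg he (ENNReal.mul_ne_top hC1 hn1))
  calc _ ≤ ∫⁻ x, (C ^ q * Dj j ^ (q / s) * (C1 * n1 f) ^ ((1 - θ) * q - (1 - A))) * (S2j j f x ^ A * S1j j f x ^ (1 - A)) := by
        refine lintegral_mono fun x => (V_pow hq (HV j f hf hfc x)).trans ?_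
        have e : S1j j f x ^ ((1 - θ) * q) = S1j j f x ^ ((1 - θ) * q - (1 - A)) * S1j j f x ^ (1 - A) := by
          rw [← ENNReal.rpow_add_of_nonneg _ _ he (by linarith)]; congr 1; ring
        rw [e]
        calc _ = C ^ q * Dj j ^ (q / s) * S1j j f x ^ ((1 - θ) * q - (1 - A)) * (S2j j f x ^ A * S1j j f x ^ (1 - A)) := by ring
          _ ≤ _ := mul_le_mul' (mul_le_mul' le_rfl (ENNReal.rpow_le_rpow (Ha x) he)) le_rfl
    _ = (C ^ q * Dj j ^ (q / s) * (C1 * n1 f) ^ ((1 - θ) * q - (1 - A))) * ∫⁻ x, (S2j j f x ^ A * S1j j f x ^ (1 - A)) := lintegral_const_mul' _ _ hconst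
    _ ≤ (C ^ q * Dj j ^ (q / s) * (C1 * n1 f) ^ ((1 - θ) * q - (1 - A))) * ((C2 * Dj j ^ (-((d:ℝ) - 1)) * n2 f) ^ A * (C1 * n1 f) ^ (1 - A)) := by
        refine mul_le_mul' le_rfl ((ENNReal.lintegral_mul_norm_pow_le hb.aemeasurable ha.aemeasurable hA0 (by linarith) (by ring)).trans (mul_le_mul' (ENNReal.rpow_le_rpow (Hb.trans (mul_le_mul' le_rfl hcj)) hA0) (ENNReal.rpow_le_rpow Ha' (by linarith))))
    _ = (C ^ q * Dj j ^ (q / s)) * ((C1 * n1 f) ^ ((1 - θ) * q - (1 - A)) * (C1 * n1 f) ^ (1 - A)) * (C2 * Dj j ^ (-((d:ℝ) - 1)) * n2 f) ^ A := by ring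
    _ = _ := by
        rw [← ENNReal.rpow_add_of_nonneg _ _ he (by linarith), sub_add_cancel, ENNReal.mul_rpow_of_nonneg _ _ hθq, ENNReal.mul_rpow_of_nonneg _ _ hA0,
          ENNReal.mul_rpow_of_nonneg _ _ hA0, ← ENNReal.rpow_mul, show -((d - 1) * A - q / s) = q / s + -((d:ℝ) - 1) * A by ring, Dj_add]
        ring

lemma M_caseB {d : ℕ} (hd : 3 ≤ d) {r s q θ : ℝ} (hs1 : 1 ≤ s) (hs2 : s ≤ 2) (hsr : s ≤ r) (hθ0 : 0 ≤ θ) (hθ1 : θ ≤ 1)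
    (hθs : 1 - θ / 2 ≤ 1 / s) (hq : 0 < q) (h2 : 1 ≤ θ * q / 2) (h2' : θ * q / 2 < ((d:ℝ) + 1) / (d - 1)) (h3 : 1 / s < (d - 1) / 2 * (1 / q + θ / 2)) :
    ∃ C : ℝ≥0∞, C ≠ ∞ ∧ ∃ ε : ℝ, 0 < ε ∧ ∀ (j : ℕ) (f : Euc d → ℂ), Continuous f → HasCompactSupport f →
    ∫⁻ x, VrIA r (LP j f) x ^ q ≤ C * Dj j ^ (-ε) * (n1 f ^ ((1 - θ) * q) * n2 f ^ (θ * q / 2)) := by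
  have hd' : (3:ℝ) ≤ d := by exact_mod_cast hd
  obtain ⟨C, hC, HV⟩ := V_piece (d := d) hs1 hs2 hsr hθ1 hθs
  obtain ⟨C1, hC1, H1⟩ := E1 hd
  obtain ⟨C2, hC2, H2⟩ := E2 hd
  set A := θ * q / 2 with hA
  set κ : ℝ := ((d:ℝ) + 1) / (d - 1) with hκ
  have hκ1 : κ - 1 = 2 / (d - 1) := by
    rw [hκ]; have : (d:ℝ) - 1 ≠ 0 := by linarith
    field_simp; ring
  have hκ0 : 0 < κ - 1 := by rw [hκ1]; apply div_pos <;> linarith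
  have hA0 : 0 ≤ A := by positivity
  have hθq : 0 ≤ (1 - θ) * q := mul_nonneg (by linarith) hq.le
  obtain ⟨Q, hQκ, hQ⟩ : ∃ Q, κ < Q ∧ q / s - (d - 1) < (A - 1) / (Q - 1) := by
    have hlim : q / s - (d - 1) < (A - 1) / (κ - 1) := by
      rw [hκ1]
      have := mul_lt_mul_of_pos_left h3 hq
      have e : q / s = q * (1 / s) := by ring
      have e2 : q * ((d - 1) / 2 * (1 / q + θ / 2)) = (d - 1) / 2 * (1 + A) := by rw [hA]; field_simp
      have e3 : (A - 1) / (2 / ((d:ℝ) - 1)) = (d - 1) / 2 * (A - 1) := by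
        rw [div_div_eq_mul_div]; ring
      rw [e, e3]; rw [e2] at this; linarith
    have hc : ContinuousAt (fun Q => (A - 1) / (Q - 1)) κ := by
      have : κ - 1 ≠ 0 := hκ0.ne'
      fun_prop (disch := assumption)
    have ev := (hc.eventually (lt_mem_nhds hlim)).filter_mono (nhdsWithin_le_nhds (s := Ioi κ))
    obtain ⟨Q, h, h'⟩ := (ev.and self_mem_nhdsWithin).exists
    exact ⟨Q, h', h⟩
  obtain ⟨C4, hC4, H4⟩ := E4 hd hQκ
  set τ := (A - 1) / (Q - 1) with hτ
  have hQ1 : 0 < Q - 1 := by linarith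
  have hτ0 : 0 ≤ τ := div_nonneg (by linarith) hQ1.le
  have hτ1 : τ ≤ 1 := by rw [hτ, div_le_one hQ1]; linarith
  have hAe : A = (1 - τ) + Q * τ := by
    have : τ * (Q - 1) = A - 1 := by rw [hτ]; field_simp
    linarith
  refine ⟨C ^ q * C1 ^ ((1 - θ) * q) * (C2 ^ (1 - τ) * C4 ^ τ), ?_, (d - 1) + τ - q / s, by linarith, fun j f hf hfc => ?_⟩
  · exact ENNReal.mul_ne_top (ENNReal.mul_ne_top (ENNReal.rpow_ne_top_of_nonneg hq.le hC) (ENNReal.rpow_ne_top_of_nonneg hθq hC1)) (ENNReal.mul_ne_top (ENNReal.rpow_ne_top_of_nonneg (by linarith) hC2) (ENNReal.rpow_ne_top_of_nonneg hτ0 hC4))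
  obtain ⟨Ha, -⟩ := H1 j f hf hfc
  have Hb := H2 j f hf hfc
  have Hq := H4 j f hf hfc
  have hn1 : n1 f ≠ ∞ := cc_L1_fin hf hfc
  have hcj : cj j f ≤ n2 f := cj_le j hf hfc
  change ∀ x, S1j j f x ≤ C1 * n1 f at Ha
  have hb := S2j_meas j hf hfc
  have hconst : C ^ q * Dj j ^ (q / s) * (C1 * n1 f) ^ ((1 - θ) * q) ≠ ∞ :=
    ENNReal.mul_ne_top (ENNReal.mul_ne_top (ENNReal.rpow_ne_top_of_nonneg hq.le hC) (Dj_rpow_ne_top _ _)) (ENNReal.rpow_ne_top_of_nonneg hθq (ENNReal.mul_ne_top hC1 hn1))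
  calc _ ≤ ∫⁻ x, (C ^ q * Dj j ^ (q / s) * (C1 * n1 f) ^ ((1 - θ) * q)) * (S2j j f x ^ (1 - τ) * (S2j j f x ^ Q) ^ τ) := by
        refine lintegral_mono fun x => (V_pow hq (HV j f hf hfc x)).trans ?_
        rw [← ENNReal.rpow_mul, ← ENNReal.rpow_add_of_nonneg _ _ (by linarith) (mul_nonneg (by linarith) hτ0), ← hAe]
        exact mul_le_mul' (mul_le_mul' le_rfl (ENNReal.rpow_le_rpow (Ha x) hθq)) le_rfl
    _ = (C ^ q * Dj j ^ (q / s) * (C1 * n1 f) ^ ((1 - θ) * q)) * ∫⁻ x, (S2j j f x ^ (1 - τ) * (S2j j f x ^ Q) ^ τ) := lintegral_const_mul' _ _ hconst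
    _ ≤ (C ^ q * Dj j ^ (q / s) * (C1 * n1 f) ^ ((1 - θ) * q)) * ((C2 * Dj j ^ (-((d:ℝ) - 1)) * n2 f) ^ (1 - τ) * (C4 * Dj j ^ (-(d:ℝ)) * n2 f ^ Q) ^ τ) := by
        refine mul_le_mul' le_rfl ((ENNReal.lintegral_mul_norm_pow_le hb.aemeasurable (hb.pow_const Q).aemeasurable (by linarith) hτ0 (by ring)).trans (mul_le_mul' (ENNReal.rpow_le_rpow (Hb.trans (mul_le_mul' le_rfl hcj)) (by linarith)) (ENNReal.rpow_le_rpow (Hq.trans (mul_le_mul' le_rfl (ENNReal.rpow_le_rpow hcj (by linarith)))) hτ0)))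
    _ = _ := by
        have h1τ : 0 ≤ 1 - τ := by linarith
        have hn : n2 f ^ A = n2 f ^ (1 - τ) * n2 f ^ (Q * τ) := by
          rw [← ENNReal.rpow_add_of_nonneg _ _ (by linarith) (mul_nonneg (by linarith) hτ0), ← hAe]
        rw [hn, ENNReal.mul_rpow_of_nonneg _ _ hθq, ENNReal.mul_rpow_of_nonneg _ _ h1τ,
          ENNReal.mul_rpow_of_nonneg _ _ h1τ, ENNReal.mul_rpow_of_nonneg _ _ hτ0, ENNReal.mul_rpow_of_nonneg _ _ hτ0, ← ENNReal.rpow_mul, ← ENNReal.rpow_mul, ← ENNReal.rpow_mul, show -((d - 1) + τ - q / s) = q / s + (-((d:ℝ) - 1) * (1 - τ) + -(d:ℝ) * τ) by ring, Dj_add, Dj_add]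
        ring

/-- Summed bound over the Littlewood-Paley pieces. -/
def MBound (d : ℕ) (r q θ : ℝ) : Prop := ∃ C : ℝ≥0∞, C ≠ ∞ ∧ ∀ (f : Euc d → ℂ), Continuous f → HasCompactSupport f →
    ∫⁻ x, (∑' j, VrIA r (LP j f) x) ^ q ≤ C * (n1 f ^ ((1 - θ) * q) * n2 f ^ (θ * q / 2))

lemma rVar_lsc_meas {d : ℕ} {r : ℝ} (hr : 0 < r) {g : Euc d → ℂ} (hg : Continuous g) (hgc : HasCompactSupport g) : Measurable (VrIA r g) := by
  have h := sphAvg_cont hg hgc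
  have : LowerSemicontinuous (VrIA r g) := by
    unfold VrIA rVar
    refine lowerSemicontinuous_iSup fun N => lowerSemicontinuous_iSup fun t => lowerSemicontinuous_iSup fun _ => lowerSemicontinuous_iSup fun _ => ?_
    refine Continuous.lowerSemicontinuous ?_
    have h2 : ∀ s : ℝ, Continuous fun x => sphAvg g s x := fun s => h.comp (by fun_prop : Continuous fun x : Euc d => (s, x))
    refine (ENNReal.continuous_rpow_const).comp (continuous_finset_sum _ fun i _ => (ENNReal.continuous_rpow_const).comp ?_)
    exact ENNReal.continuous_coe.comp (((h2 _).sub (h2 _)).nnnorm)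
  exact this.measurable

lemma MBound_of_pieces {d : ℕ} {r q θ : ℝ} (hr : 0 < r) (hq : 0 < q)
    (h : ∃ C : ℝ≥0∞, C ≠ ∞ ∧ ∃ ε : ℝ, 0 < ε ∧ ∀ (j : ℕ) (f : Euc d → ℂ), Continuous f → HasCompactSupport f →
      ∫⁻ x, VrIA r (LP j f) x ^ q ≤ C * Dj j ^ (-ε) * (n1 f ^ ((1 - θ) * q) * n2 f ^ (θ * q / 2))) : MBound d r q θ := by
  obtain ⟨C, hC, ε, hε, H⟩ := h
  obtain ⟨C', hC', H'⟩ := pow_sum hq (half_pos hε)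
  have hlt : (2:ℝ≥0∞) ^ (-(ε / 2)) < 1 := ENNReal.rpow_lt_one_of_one_lt_of_neg (by norm_num) (by linarith)
  refine ⟨C' * C * (1 - (2:ℝ≥0∞) ^ (-(ε / 2)))⁻¹, ENNReal.mul_ne_top (ENNReal.mul_ne_top hC' hC) ?_, fun f hf hfc => ?_⟩
  · rw [ENNReal.inv_ne_top]; exact (tsub_pos_of_lt hlt).ne'
  have hm : ∀ j, Measurable (VrIA r (LP j f)) := fun j => rVar_lsc_meas hr (LP_cd j hf).continuous (LP_cs j hfc)
  generalize hN : n1 f ^ ((1 - θ) * q) * n2 f ^ (θ * q / 2) = N at *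
  calc _ ≤ ∫⁻ x, C' * ∑' j, Dj j ^ (ε / 2) * VrIA r (LP j f) x ^ q := lintegral_mono fun x => H' _
    _ = C' * ∑' j, Dj j ^ (ε / 2) * ∫⁻ x, VrIA r (LP j f) x ^ q := by
        rw [lintegral_const_mul' _ _ hC', lintegral_tsum fun j => (((hm j).pow_const q).const_mul _).aemeasurable]
        congr 2; ext j; rw [lintegral_const_mul' _ _ (Dj_rpow_ne_top _ _)]
    _ ≤ C' * ∑' j, C * N * ((2:ℝ≥0∞) ^ (-(ε / 2))) ^ j := by
        refine mul_le_mul' le_rfl (ENNReal.tsum_le_tsum fun j => ?_)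
        refine (mul_le_mul' le_rfl (H j f hf hfc)).trans (le_of_eq ?_)
        have e : ((2:ℝ≥0∞) ^ (-(ε / 2))) ^ j = Dj j ^ (ε / 2) * Dj j ^ (-ε) := by
          rw [← Dj_add, ← ENNReal.rpow_natCast, ← ENNReal.rpow_mul, Dj, ← ENNReal.rpow_natCast, ← ENNReal.rpow_mul]
          congr 1; ring
        rw [e, hN]; ring
    _ = _ := by rw [ENNReal.tsum_mul_left, ENNReal.tsum_geometric]; ring

lemma M_main {d : ℕ} (hd : 3 ≤ d) {r q θ : ℝ} (hr1 : 1 ≤ r) (hr2 : r ≤ 2) (hθ0 : 0 ≤ θ) (hθ1 : θ ≤ 1) (hq : 0 < q) (h1 : 1 ≤ q * (1 - θ / 2))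
    (h2 : θ * q / 2 < ((d:ℝ) + 1) / (d - 1)) (h3 : 1 / r < (d - 1) * θ / 2) (h4 : 1 - θ / 2 < (d - 1) * θ / 2)
    (h5 : 1 / r < (d - 1) / 2 * (1 / q + θ / 2)) (h6 : 1 - θ / 2 < (d - 1) / 2 * (1 / q + θ / 2)) : MBound d r q θ := by
  have hr0 : 0 < r := by linarith
  set m := max (1 / r) (1 - θ / 2) with hm
  have hm1 : m ≤ 1 := max_le ((div_le_one hr0).2 hr1) (by linarith)
  have hm2 : 1 / 2 ≤ m := le_max_of_le_right (by linarith)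
  have hm0 : 0 < m := by linarith
  have hs : 1 / (1 / m) = m := by simp
  have hs1 : 1 ≤ 1 / m := (one_le_div hm0).2 hm1
  have hs2 : 1 / m ≤ 2 := by rw [div_le_iff₀ hm0]; linarith
  have hsr : 1 / m ≤ r := by rw [div_le_comm₀ hm0 hr0]; exact le_max_left _ _
  have hθs : 1 - θ / 2 ≤ 1 / (1 / m) := by rw [hs]; exact le_max_right _ _
  apply MBound_of_pieces hr0 hq
  rcases le_total (θ * q / 2) 1 with h | h
  · exact M_caseA hd hs1 hs2 hsr hθ0 hθ1 hθs hq h1 h (by rw [hs]; exact max_lt h3 h4)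
  · exact M_caseB hd hs1 hs2 hsr hθ0 hθ1 hθs hq h h2 (by rw [hs]; exact max_lt h5 h6)

lemma endpoint_pt {δ q ε : ℝ} (hδ : 0 < δ) (hε : 0 < ε) (hεq : ε < q) : ∃ C : ℝ≥0∞, C ≠ ∞ ∧ ∀ v : ℕ → ℝ≥0∞,
    (∑' j, Dj j ^ (δ / q) * v j) ^ q ≤ C * ∑' j, Dj j ^ δ * (v j ^ (q + ε) + v j ^ (q - ε)) := by
  have hq : 0 < q := hε.trans hεq
  set β := ε / (q + ε) with hβ
  have hβ0 : 0 < β := by positivity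
  set μ : ℝ := 2 ^ (δ / q * β) with hμ
  obtain ⟨C, hC⟩ := geom_sum μ (Real.one_lt_rpow (by norm_num) (by positivity))
  refine ⟨C ^ q + 1, by simp [hq.le], fun v => ?_⟩
  generalize hM : ∑' j, Dj j ^ δ * (v j ^ (q + ε) + v j ^ (q - ε)) = M
  by_cases hMt : M = ∞
  · rw [hMt, ENNReal.mul_top (by simp)]; exact le_top
  have hle : ∀ j, Dj j ^ δ * (v j ^ (q + ε) + v j ^ (q - ε)) ≤ M := fun j => hM ▸ ENNReal.le_tsum j
  by_cases hM0 : M = 0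
  · have : ∀ j, v j = 0 := by
      intro j
      have h := hle j
      rw [hM0, nonpos_iff_eq_zero, mul_eq_zero] at h
      have h' := (add_eq_zero.1 (h.resolve_left (Dj_rpow_ne_zero _ _))).1
      exact (ENNReal.rpow_eq_zero_iff_of_pos (by linarith)).1 h'
    simp [this, hq]
  set X := M ^ (1 / q) with hX
  have hX0 : X ≠ 0 := by rw [hX, Ne, ENNReal.rpow_eq_zero_iff_of_pos (by positivity)]; exact hM0
  have hXt : X ≠ ∞ := ENNReal.rpow_ne_top_of_nonneg (by positivity) hMt
  have hXq : X ^ q = M := by rw [hX, ← ENNReal.rpow_mul, one_div_mul_cancel hq.ne', ENNReal.rpow_one]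
  have key : ∀ j, Dj j ^ (δ / q) * v j ≤ X * min (ENNReal.ofReal μ ^ j / X ^ β) (X ^ β / ENNReal.ofReal μ ^ j) := by
    intro j
    set h := Dj j ^ (δ / q) with hh
    have hh0 : h ≠ 0 := Dj_rpow_ne_zero _ _
    have hht : h ≠ ∞ := Dj_rpow_ne_top _ _
    have hhq : h ^ q = Dj j ^ δ := by rw [hh, ← ENNReal.rpow_mul, div_mul_cancel₀ _ hq.ne']
    have hhβ : ENNReal.ofReal μ ^ j = h ^ β := by
      rw [hh, hμ, ← ENNReal.ofReal_rpow_of_pos (by norm_num), Dj, ← ENNReal.rpow_natCast, ← ENNReal.rpow_natCast, ← ENNReal.rpow_mul, ← ENNReal.rpow_mul, ← ENNReal.rpow_mul]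
      rw [ENNReal.ofReal_ofNat]; congr 1; ring
    rw [hhβ, ← ENNReal.div_rpow_of_nonneg _ _ hβ0.le, ← ENNReal.div_rpow_of_nonneg _ _ hβ0.le]
    set u := h / X with hu
    have hu0 : u ≠ 0 := ENNReal.div_ne_zero.2 ⟨hh0, hXt⟩
    have hut : u ≠ ∞ := ENNReal.div_ne_top hht hX0
    have hui : X / h = u⁻¹ := by rw [hu, ENNReal.inv_div (Or.inl hXt) (Or.inl hX0)]
    have hhX : h = X * u := by rw [hu, ENNReal.mul_div_cancel hX0 hXt]
    have gen : ∀ z : ℝ, 0 < z → Dj j ^ δ * v j ^ z ≤ M → v j ≤ u ^ (-(q / z)) := by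
      intro z hz hle
      rw [← hXq, ← hhq, mul_comm, ← ENNReal.le_div_iff_mul_le (Or.inl (by rw [hhq]; exact Dj_rpow_ne_zero _ _)) (Or.inl (by rw [hhq]; exact Dj_rpow_ne_top _ _)),
        ← ENNReal.div_rpow_of_nonneg _ _ hq.le, hui, ENNReal.inv_rpow, ← ENNReal.rpow_neg] at hle
      have := ENNReal.rpow_le_rpow hle (by positivity : 0 ≤ 1 / z)
      rw [← ENNReal.rpow_mul, ← ENNReal.rpow_mul, mul_one_div_cancel hz.ne', ENNReal.rpow_one] at this
      refine this.trans (le_of_eq ?_); congr 1; ring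
    have g1 := gen (q + ε) (by linarith) (le_trans (mul_le_mul' le_rfl le_self_add) (hle j))
    have g2 := gen (q - ε) (by linarith) (le_trans (mul_le_mul' le_rfl le_add_self) (hle j))
    have e1 : h * u ^ (-(q / (q + ε))) = X * u ^ β := by
      rw [hhX, mul_assoc]; congr 1
      nth_rewrite 1 [← ENNReal.rpow_one u]
      rw [← ENNReal.rpow_add _ _ hu0 hut]; congr 1; rw [hβ]; field_simp; ring
    have e2 : h * u ^ (-(q / (q - ε))) = X * u⁻¹ ^ (ε / (q - ε)) := by
      rw [hhX, mul_assoc]; congr 1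
      nth_rewrite 1 [← ENNReal.rpow_one u]
      have : q - ε ≠ 0 := by linarith
      rw [← ENNReal.rpow_add _ _ hu0 hut, ENNReal.inv_rpow, ← ENNReal.rpow_neg]; congr 1; field_simp; ring
    have k1 : h * v j ≤ X * u ^ β := e1 ▸ mul_le_mul' le_rfl g1
    have k2 : h * v j ≤ X * u⁻¹ ^ (ε / (q - ε)) := e2 ▸ mul_le_mul' le_rfl g2
    rw [hui]
    rcases le_total u 1 with hu1 | hu1
    · rw [min_eq_left (ENNReal.rpow_le_rpow (hu1.trans (ENNReal.one_le_inv.2 hu1)) hβ0.le)]; exact k1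
    · rw [min_eq_right (ENNReal.rpow_le_rpow ((ENNReal.inv_le_one.2 hu1).trans hu1) hβ0.le)]
      refine k2.trans (mul_le_mul' le_rfl (ENNReal.rpow_le_rpow_of_exponent_ge (ENNReal.inv_le_one.2 hu1) ?_))
      rw [hβ]; exact div_le_div_of_nonneg_left hε.le (by linarith) (by linarith)
  calc _ ≤ (∑' j, X * min (ENNReal.ofReal μ ^ j / X ^ β) (X ^ β / ENNReal.ofReal μ ^ j)) ^ q := ENNReal.rpow_le_rpow (ENNReal.tsum_le_tsum key) hq.le
    _ ≤ (X * C) ^ q := by rw [ENNReal.tsum_mul_left]; exact ENNReal.rpow_le_rpow (mul_le_mul' le_rfl (hC _)) hq.le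
    _ = C ^ q * M := by rw [ENNReal.mul_rpow_of_nonneg _ _ hq.le, hXq, mul_comm]
    _ ≤ _ := mul_le_mul' le_self_add le_rfl

lemma M_end {d : ℕ} (hd : 3 ≤ d) {r θ : ℝ} (hr1 : 1 ≤ r) (hr2 : r ≤ 2) (hθ1 : θ ≤ 1) (hθs : 1 - θ / 2 ≤ 1 / r)
    (h2 : ((d:ℝ) + 1) / (d - 1) < θ * (r * d) / 2) : MBound d r (r * d) θ := by
  have hd' : (3:ℝ) ≤ d := by exact_mod_cast hd
  have hr0 : 0 < r := by linarith
  set q := r * d with hq'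
  have hq : 0 < q := by positivity
  set κ : ℝ := ((d:ℝ) + 1) / (d - 1) with hκ
  have hκ1 : 1 < κ := by rw [hκ, one_lt_div (by linarith)]; linarith
  have hθ0 : 0 < θ := by
    by_contra h; push Not at h
    nlinarith [mul_nonpos_of_nonpos_of_nonneg h hq.le]
  obtain ⟨C, hC, HV⟩ := V_piece (d := d) hr1 hr2 le_rfl hθ1 hθs
  obtain ⟨C1, hC1, H1⟩ := E1 hd
  obtain ⟨C3, hC3, H3⟩ := E3' hd
  set ε := (θ * q / 2 - κ) / θ with hε
  have hε0 : 0 < ε := div_pos (by linarith) hθ0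
  have hεθ : θ * ε = θ * q / 2 - κ := by rw [hε]; field_simp
  have hεq : ε < q := by
    by_contra h; push Not at h
    nlinarith [mul_le_mul_of_nonneg_left h hθ0.le, mul_pos hθ0 hq]
  obtain ⟨Cp, hCp, Hp⟩ := endpoint_pt (δ := d) (q := q) (by linarith) hε0 hεq
  have hQ1 : κ < θ / 2 * (q + ε) := by nlinarith
  have hQ2 : κ < θ / 2 * (q - ε) := by nlinarith
  obtain ⟨Ca, hCa, Ha⟩ := E4 hd hQ1
  obtain ⟨Cb, hCb, Hb⟩ := E4 hd hQ2
  obtain ⟨Cs, Hs⟩ := cj_sum d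
  have hθq : 0 ≤ (1 - θ) * q := mul_nonneg (by linarith) hq.le
  refine ⟨C ^ q * C1 ^ ((1 - θ) * q) * (Cp * ((Ca + Cb) * Cs)), ?_, fun f hf hfc => ?_⟩
  · exact ENNReal.mul_ne_top (ENNReal.mul_ne_top (ENNReal.rpow_ne_top_of_nonneg hq.le hC) (ENNReal.rpow_ne_top_of_nonneg hθq hC1)) (by finiteness)
  have hn1 : n1 f ≠ ∞ := cc_L1_fin hf hfc
  have hn2 : n2 f ≠ ∞ := cc_L2_fin hf hfc
  have hsum : ∑' j, cj j f ≤ Cs * n2 f := Hs f hf hfc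
  have hcj : ∀ j, cj j f ≤ n2 f := fun j => cj_le j hf hfc
  have Hs1 : ∀ j x, S1j j f x ≤ C1 * n1 f := fun j => (H1 j f hf hfc).1
  have hm2 := fun j => S2j_meas j hf hfc
  have hV : ∀ j x, VrIA r (LP j f) x ≤ C * (C1 * n1 f) ^ (1 - θ) * (Dj j ^ (d / q) * S2j j f x ^ (θ / 2)) := by
    intro j x
    refine (HV j f hf hfc x).trans ?_
    have e : (d:ℝ) / q = 1 / r := by rw [hq']; field_simp
    rw [e]
    calc _ = C * S1j j f x ^ (1 - θ) * (Dj j ^ (1 / r) * S2j j f x ^ (θ / 2)) := by ring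
      _ ≤ _ := mul_le_mul' (mul_le_mul' le_rfl (ENNReal.rpow_le_rpow (Hs1 j x) (by linarith))) le_rfl
  by_cases h0 : n2 f = 0
  · have : ∀ x j, VrIA r (LP j f) x = 0 := by
      intro x j
      have h := H3 j f hf hfc x
      rw [le_antisymm ((hcj j).trans h0.le) zero_le, mul_zero] at h
      have h' := hV j x
      rw [le_antisymm h zero_le, ENNReal.zero_rpow_of_pos (by positivity), mul_zero, mul_zero] at h'
      exact le_antisymm h' zero_le
    simp [this, hq]
  set N := n2 f with hN
  set v : Euc d → ℕ → ℝ≥0∞ := fun x j => (S2j j f x / N) ^ (θ / 2) with hv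
  have hpt : ∀ x, (∑' j, VrIA r (LP j f) x) ^ q ≤ (C ^ q * (C1 * n1 f) ^ ((1 - θ) * q) * N ^ (θ * q / 2) * Cp) * ∑' j, Dj j ^ (d:ℝ) * (v x j ^ (q + ε) + v x j ^ (q - ε)) := by
    intro x
    have h1 : ∑' j, VrIA r (LP j f) x ≤ (C * (C1 * n1 f) ^ (1 - θ) * N ^ (θ / 2)) * ∑' j, Dj j ^ (d / q) * v x j := by
      rw [← ENNReal.tsum_mul_left]
      refine ENNReal.tsum_le_tsum fun j => (hV j x).trans (le_of_eq ?_)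
      have e : S2j j f x ^ (θ / 2) = N ^ (θ / 2) * v x j := by
        rw [hv, ← ENNReal.mul_rpow_of_nonneg _ _ (by positivity), ENNReal.mul_div_cancel h0 hn2]
      rw [e]; ring
    refine (ENNReal.rpow_le_rpow h1 hq.le).trans ?_
    rw [ENNReal.mul_rpow_of_nonneg _ _ hq.le, ENNReal.mul_rpow_of_nonneg _ _ hq.le, ENNReal.mul_rpow_of_nonneg _ _ hq.le, ← ENNReal.rpow_mul, ← ENNReal.rpow_mul,
      show θ / 2 * q = θ * q / 2 by ring, mul_assoc _ Cp]
    exact mul_le_mul' le_rfl (Hp _)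
  have hconst : C ^ q * (C1 * n1 f) ^ ((1 - θ) * q) * N ^ (θ * q / 2) * Cp ≠ ∞ :=
    ENNReal.mul_ne_top (ENNReal.mul_ne_top (ENNReal.mul_ne_top (ENNReal.rpow_ne_top_of_nonneg hq.le hC) (ENNReal.rpow_ne_top_of_nonneg hθq (ENNReal.mul_ne_top hC1 hn1)))
      (ENNReal.rpow_ne_top_of_nonneg (by positivity) hn2)) hCp
  have hpiece : ∀ (Q : ℝ), κ < θ / 2 * Q → ∀ Ca : ℝ≥0∞, (∀ (j : ℕ) (f : Euc d → ℂ), Continuous f → HasCompactSupport f →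
      ∫⁻ x, S2j j f x ^ (θ / 2 * Q) ≤ Ca * Dj j ^ (-(d:ℝ)) * cj j f ^ (θ / 2 * Q)) → ∀ j, Dj j ^ (d:ℝ) * ∫⁻ x, v x j ^ Q ≤ Ca * (cj j f / N) := by
    intro Q hQ Ca Ha j
    have e : ∀ x, v x j ^ Q = S2j j f x ^ (θ / 2 * Q) * (N ^ (θ / 2 * Q))⁻¹ := by
      intro x
      rw [hv, ← ENNReal.rpow_mul, ENNReal.div_rpow_of_nonneg _ _ (by linarith), div_eq_mul_inv]
    simp only [e]
    rw [lintegral_mul_const _ ((hm2 j).pow_const _)]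
    calc _ ≤ Dj j ^ (d:ℝ) * ((Ca * Dj j ^ (-(d:ℝ)) * cj j f ^ (θ / 2 * Q)) * (N ^ (θ / 2 * Q))⁻¹) := mul_le_mul' le_rfl (mul_le_mul' (Ha j f hf hfc) le_rfl)
      _ = (Dj j ^ (d:ℝ) * Dj j ^ (-(d:ℝ))) * Ca * (cj j f / N) ^ (θ / 2 * Q) := by
          rw [ENNReal.div_rpow_of_nonneg _ _ (by linarith), ENNReal.div_eq_inv_mul]; ring
      _ = Ca * (cj j f / N) ^ (θ / 2 * Q) := by rw [← Dj_add, add_neg_cancel, ENNReal.rpow_zero, one_mul]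
      _ ≤ Ca * (cj j f / N) ^ (1:ℝ) := mul_le_mul' le_rfl (ENNReal.rpow_le_rpow_of_exponent_ge (ENNReal.div_le_of_le_mul (by rw [one_mul]; exact hcj j)) (by linarith))
      _ = _ := by rw [ENNReal.rpow_one]
  have hvm : ∀ j, Measurable fun x => v x j := fun j => ((hm2 j).div_const _).pow_const _
  have hmeas : ∀ j, Measurable fun x => Dj j ^ (d:ℝ) * (v x j ^ (q + ε) + v x j ^ (q - ε)) := fun j => by
    have := hvm j; fun_prop
  calc _ ≤ ∫⁻ x, (C ^ q * (C1 * n1 f) ^ ((1 - θ) * q) * N ^ (θ * q / 2) * Cp) * ∑' j, Dj j ^ (d:ℝ) * (v x j ^ (q + ε) + v x j ^ (q - ε)) := lintegral_mono hpt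
    _ = (C ^ q * (C1 * n1 f) ^ ((1 - θ) * q) * N ^ (θ * q / 2) * Cp) * ∑' j, (Dj j ^ (d:ℝ) * (∫⁻ x, v x j ^ (q + ε)) + Dj j ^ (d:ℝ) * ∫⁻ x, v x j ^ (q - ε)) := by
        rw [lintegral_const_mul' _ _ hconst, lintegral_tsum fun j => (hmeas j).aemeasurable]
        congr 2; ext j
        rw [lintegral_const_mul' _ _ (Dj_rpow_ne_top _ _), lintegral_add_left ((hvm j).pow_const _), mul_add]
    _ ≤ (C ^ q * (C1 * n1 f) ^ ((1 - θ) * q) * N ^ (θ * q / 2) * Cp) * ∑' j, (Ca + Cb) * N⁻¹ * cj j f := by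
        refine mul_le_mul' le_rfl (ENNReal.tsum_le_tsum fun j => (add_le_add (hpiece _ hQ1 Ca Ha j) (hpiece _ hQ2 Cb Hb j)).trans (le_of_eq ?_))
        rw [div_eq_mul_inv]; ring
    _ ≤ (C ^ q * (C1 * n1 f) ^ ((1 - θ) * q) * N ^ (θ * q / 2) * Cp) * ((Ca + Cb) * N⁻¹ * (Cs * N)) := by
        rw [ENNReal.tsum_mul_left]; exact mul_le_mul' le_rfl (mul_le_mul' le_rfl hsum)
    _ = (C ^ q * (C1 * n1 f) ^ ((1 - θ) * q) * N ^ (θ * q / 2) * Cp) * ((Ca + Cb) * Cs) := by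
        congr 1
        calc _ = (Ca + Cb) * Cs * (N⁻¹ * N) := by ring
          _ = _ := by rw [ENNReal.inv_mul_cancel h0 hn2, mul_one]
    _ = _ := by rw [ENNReal.mul_rpow_of_nonneg _ _ hθq]; ring

/-! ## P12: the bound for continuous compactly supported functions -/

lemma PhiF_integral {d : ℕ} (hd : 1 ≤ d) : ∫ x, PhiF d x = 1 := by
  obtain ⟨C, _, h⟩ := PhiF_one d
  have h0 := h 0
  rw [norm_zero, zero_pow (by omega), mul_zero] at h0
  have h1 := norm_le_zero_iff.1 h0
  rw [sub_eq_zero, Real.fourier_eq] at h1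
  simpa using h1.symm

lemma cv_dil {d : ℕ} (f : Euc d → ℂ) {a : ℝ} (ha : 0 < a) (φ : Euc d → ℂ) (x : Euc d) :
    cv f (dil a φ) x = ∫ v, f (x - a⁻¹ • v) * φ v := by
  have h1 : cv f (dil a φ) x = ∫ u, f (x - u) * dil a φ u := by
    unfold cv
    rw [← integral_sub_left_eq_self _ _ x]
    simp
  rw [h1]
  have h2 := Measure.integral_comp_smul (volume : Measure (Euc d)) (fun v => f (x - a⁻¹ • v) * φ v) a
  rw [abs_of_pos (by positivity)] at h2
  simp only [finrank_euclideanSpace, Fintype.card_fin] at h2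
  have h3 : ∫ v, f (x - a⁻¹ • v) * φ v = (a ^ d) • ∫ u, f (x - a⁻¹ • a • u) * φ (a • u) := by
    rw [h2, smul_smul, mul_inv_cancel₀ (by positivity), one_smul]
  rw [h3, ← integral_smul]
  congr 1; ext u
  rw [smul_smul, inv_mul_cancel₀ ha.ne', one_smul, dil]
  simp only [Complex.real_smul]
  ring

lemma cv_dil_bdd {d : ℕ} {f : Euc d → ℂ} {M : ℝ} (hM : ∀ x, ‖f x‖ ≤ M) {a : ℝ} (ha : 0 < a) {φ : Euc d → ℂ} (hφ : Integrable φ) (x : Euc d) :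
    ‖cv f (dil a φ) x‖ ≤ M * ∫ v, ‖φ v‖ := by
  rw [cv_dil f ha, ← integral_const_mul]
  refine norm_integral_le_of_norm_le (hφ.norm.const_mul M) (Filter.Eventually.of_forall fun v => ?_)
  rw [norm_mul]; exact mul_le_mul_of_nonneg_right (hM _) (norm_nonneg _)

lemma cv_dil_tendsto {d : ℕ} (hd : 1 ≤ d) {f : Euc d → ℂ} (hf : Continuous f) (hfc : HasCompactSupport f) (x : Euc d) :
    Filter.Tendsto (fun n : ℕ => cv f (dil ((2:ℝ) ^ n * (1/2)) (PhiF d)) x) Filter.atTop (nhds (f x)) := by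
  obtain ⟨M, hM0, hM⟩ := cc_bdd hf hfc
  have hΦ := (PhiF_cd d).continuous
  have e : f x = ∫ v, f x * PhiF d v := by rw [integral_const_mul, PhiF_integral hd, mul_one]
  rw [e]
  simp_rw [fun n : ℕ => cv_dil f (show (0:ℝ) < 2 ^ n * (1/2) by positivity) (PhiF d) x]
  refine tendsto_integral_of_dominated_convergence (fun v => M * ‖PhiF d v‖) ?_ ((PhiF_int d).norm.const_mul M) ?_ ?_
  · exact fun n => (by fun_prop : Continuous _).aestronglyMeasurable
  · exact fun n => Filter.Eventually.of_forall fun v => by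
      rw [norm_mul]; exact mul_le_mul_of_nonneg_right (hM _) (norm_nonneg _)
  · refine Filter.Eventually.of_forall fun v => Filter.Tendsto.mul_const _ ?_
    have : Filter.Tendsto (fun n : ℕ => ((2:ℝ) ^ n * (1/2))⁻¹) Filter.atTop (nhds 0) := by
      refine Filter.Tendsto.inv_tendsto_atTop ?_
      exact (tendsto_pow_atTop_atTop_of_one_lt (by norm_num)).atTop_mul_const (by norm_num)
    have h2 : Filter.Tendsto (fun n : ℕ => x - ((2:ℝ) ^ n * (1/2))⁻¹ • v) Filter.atTop (nhds x) := by
      simpa using (this.smul_const v).const_sub x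
    exact (hf.tendsto x).comp h2

lemma dil_psi {d : ℕ} (j : ℕ) (x : Euc d) : dil ((2:ℝ) ^ j) (psiF d) x =
    dil ((2:ℝ) ^ (j+1) * (1/2)) (PhiF d) x - dil ((2:ℝ) ^ j * (1/2)) (PhiF d) x := by
  have e : (2:ℝ) ^ (j+1) * (1/2) = 2 ^ j := by rw [pow_succ]; ring
  rw [e]
  unfold dil psiF dil
  rw [smul_sub, smul_smul, smul_smul, ← mul_pow, mul_comm (1/2 : ℝ)]

lemma cv_integrable {d : ℕ} {f φ : Euc d → ℂ} (hf : Continuous f) (hfc : HasCompactSupport f) (hφ : Continuous φ) (x : Euc d) :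
    Integrable fun t => f t * φ (x - t) :=
  cc_integrable (by fun_prop) hfc.mul_right

lemma LP_sum {d : ℕ} {f : Euc d → ℂ} (hf : Continuous f) (hfc : HasCompactSupport f) (n : ℕ) (x : Euc d) :
    ∑ j ∈ Finset.range n, LP j f x = cv f (dil ((2:ℝ) ^ n * (1/2)) (PhiF d)) x - cv f (dil (1/2) (PhiF d)) x := by
  have h : ∀ j : ℕ, LP j f x = cv f (dil ((2:ℝ) ^ (j+1) * (1/2)) (PhiF d)) x - cv f (dil ((2:ℝ) ^ j * (1/2)) (PhiF d)) x := by
    intro j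
    unfold LP cv
    rw [← integral_sub (cv_integrable hf hfc (dil_contDiff _ (PhiF_cd d)).continuous x) (cv_integrable hf hfc (dil_contDiff _ (PhiF_cd d)).continuous x)]
    congr 1; ext t
    rw [dil_psi]; ring
  simp_rw [h]
  rw [Finset.sum_range_sub (fun n : ℕ => cv f (dil ((2:ℝ) ^ n * (1/2)) (PhiF d)) x)]
  norm_num

def g0 {d : ℕ} (f : Euc d → ℂ) : Euc d → ℂ := cv f (dil (1/2) (PhiF d))

lemma g0_cd {d : ℕ} {f : Euc d → ℂ} (hf : Continuous f) : ContDiff ℝ (⊤ : ℕ∞) (g0 f) :=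
  cv_contDiff hf (dil_contDiff _ (PhiF_cd d)) (dil_compact (by norm_num) (PhiF_cs d))
lemma g0_cs {d : ℕ} {f : Euc d → ℂ} (hfc : HasCompactSupport f) : HasCompactSupport (g0 f) :=
  cv_compact hfc (dil_compact (by norm_num) (PhiF_cs d))

lemma sph_int_cc {d : ℕ} {g : Euc d → ℂ} (hg : Continuous g) (hgc : HasCompactSupport g) (t : ℝ) (x : Euc d) :
    Integrable (fun y => g (x - t • y)) (sphereMeasure d) := by
  obtain ⟨M, _, hM⟩ := cc_bdd hg hgc
  exact sph_integrable_bdd M (by fun_prop : Continuous _).aestronglyMeasurable (Filter.Eventually.of_forall fun y => hM _)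

lemma V_decomp {d : ℕ} (hd : 1 ≤ d) {r : ℝ} (hr : 1 ≤ r) {f : Euc d → ℂ} (hf : Continuous f) (hfc : HasCompactSupport f) (x : Euc d) :
    VrIA r f x ≤ VrIA r (g0 f) x + ∑' j, VrIA r (LP j f) x := by
  unfold VrIA
  refine (rVar_sub_le hr _ _ (fun t => sphAvg (g0 f) t x)).trans (add_le_add le_rfl ?_)
  refine rVar_tsum_le hr _ _ _ fun t _ => ?_
  have e : ∀ n, ∑ j ∈ Finset.range n, sphAvg (LP j f) t x = sphAvg (cv f (dil ((2:ℝ) ^ n * (1/2)) (PhiF d))) t x - sphAvg (g0 f) t x := by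
    intro n
    unfold sphAvg
    rw [← integral_finsetSum _ fun j _ => sph_int_cc (LP_cd j hf).continuous (LP_cs j hfc) t x]
    rw [← integral_sub (sph_int_cc (cv_contDiff hf (dil_contDiff _ (PhiF_cd d)) (dil_compact (by positivity) (PhiF_cs d))).continuous (cv_compact hfc (dil_compact (by positivity) (PhiF_cs d))) t x) (sph_int_cc (g0_cd hf).continuous (g0_cs hfc) t x)]
    congr 1; ext y
    rw [LP_sum hf hfc]; rfl
  simp_rw [e]
  refine Filter.Tendsto.sub_const ?_ _
  obtain ⟨M, hM0, hM⟩ := cc_bdd hf hfc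
  unfold sphAvg
  refine tendsto_integral_of_dominated_convergence (fun v => M * ∫ v, ‖PhiF d v‖) ?_ (integrable_const _) ?_ ?_
  · intro n
    have := (cv_contDiff hf (dil_contDiff ((2:ℝ) ^ n * (1/2)) (PhiF_cd d)) (dil_compact (by positivity) (PhiF_cs d))).continuous
    exact (by fun_prop : Continuous _).aestronglyMeasurable
  · exact fun n => Filter.Eventually.of_forall fun v => cv_dil_bdd hM (by positivity) (PhiF_int d) _
  · exact Filter.Eventually.of_forall fun v => cv_dil_tendsto hd hf hfc _

lemma base_piece {d : ℕ} (hd : 3 ≤ d) {r q : ℝ} (hr : 1 ≤ r) (hq : 1 ≤ q) : ∃ C : ℝ≥0∞, C ≠ ∞ ∧ ∀ (f : Euc d → ℂ), Continuous f → HasCompactSupport f →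
    ∫⁻ x, VrIA r (g0 f) x ^ q ≤ C * n1 f ^ q := by
  obtain ⟨C, hC⟩ := B1 hd
  have h1 : ∫⁻ x, ‖PhiF d x‖ₑ ≠ ∞ := cc_L1_fin (PhiF_cd d).continuous (PhiF_cs d)
  have h2 : ∫⁻ x, ‖fderiv ℝ (PhiF d) x‖ₑ ≠ ∞ := by
    obtain ⟨a, b⟩ := fderiv_cc (PhiF_cd d) (PhiF_cs d)
    exact (cc_integrable a b).2.ne
  obtain ⟨K, hK⟩ : ∃ K : ℝ≥0∞, C * ((∫⁻ x, ‖PhiF d x‖ₑ) + ENNReal.ofReal (1/2) * ∫⁻ x, ‖fderiv ℝ (PhiF d) x‖ₑ) = K := ⟨_, rfl⟩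
  have hKt : K ≠ ∞ := by
    rw [← hK]; exact ENNReal.mul_ne_top (by simp) (ENNReal.add_ne_top.2 ⟨h1, ENNReal.mul_ne_top (by simp) h2⟩)
  refine ⟨K ^ q, ENNReal.rpow_ne_top_of_nonneg (by linarith) hKt, fun f hf hfc => ?_⟩
  obtain ⟨H1, H2⟩ := hC 1 (g0 f) (by simp) (g0_cd hf) (g0_cs hfc)
  have hp : (0:ℝ) < 1/2 := by positivity
  have e1 := cv_L1 hf (dil_contDiff (1/2) (PhiF_cd d)).continuous
  rw [dil_L1 hp] at e1
  have e2 := cv_grad_L1 hf (dil_contDiff (1/2) (PhiF_cd d)) (dil_compact hp.ne' (PhiF_cs d))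
  rw [dil_grad_L1 hp (PhiF_cd d)] at e2
  have e3 : (C:ℝ≥0∞) * ((∫⁻ z, ‖g0 f z‖ₑ) + (1:ℝ≥0∞)⁻¹ * ∫⁻ z, ‖fderiv ℝ (g0 f) z‖ₑ) ≤ K * n1 f := by
    rw [← hK, inv_one, one_mul, mul_assoc, add_mul, mul_comm _ (n1 f), mul_comm _ (n1 f)]
    exact mul_le_mul' le_rfl (add_le_add e1 e2)
  have H1' : ∀ x, S1 1 (g0 f) x ≤ K * n1 f := fun x => (H1 x).trans e3
  have H2' := H2.trans e3
  have hV : ∀ x, VrIA r (g0 f) x ≤ S1 1 (g0 f) x := by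
    intro x
    refine (rVar_anti zero_lt_one hr _ _).trans ?_
    refine (rVar_one_le (fun t => sphAvg_deriv (g0_cd hf) (g0_cs hfc) x t) ?_).trans ?_
    · exact (sphD_cont (g0_cd hf) (g0_cs hfc)).comp (by fun_prop : Continuous fun t : ℝ => (t, x))
    · unfold S1
      refine lintegral_mono fun t => ?_
      simp
  have hn : K * n1 f ≠ ∞ := ENNReal.mul_ne_top hKt (cc_L1_fin hf hfc)
  rw [← ENNReal.mul_rpow_of_nonneg _ _ (by linarith)]
  clear e3
  generalize K * n1 f = Y at *
  calc _ ≤ ∫⁻ x, S1 1 (g0 f) x * Y ^ (q - 1) := by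
        refine lintegral_mono fun x => (ENNReal.rpow_le_rpow (hV x) (by linarith)).trans ?_
        have : S1 1 (g0 f) x ^ q = S1 1 (g0 f) x ^ (1 + (q - 1)) := by congr 1; ring
        rw [this, ENNReal.rpow_add_of_nonneg _ _ zero_le_one (by linarith), ENNReal.rpow_one]
        exact mul_le_mul' le_rfl (ENNReal.rpow_le_rpow (H1' x) (by linarith))
    _ = (∫⁻ x, S1 1 (g0 f) x) * Y ^ (q - 1) := lintegral_mul_const' _ _ (ENNReal.rpow_ne_top_of_nonneg (by linarith) hn)
    _ ≤ Y ^ (1:ℝ) * Y ^ (q - 1) := by rw [ENNReal.rpow_one]; exact mul_le_mul' H2' le_rfl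
    _ = Y ^ q := by rw [← ENNReal.rpow_add_of_nonneg _ _ zero_le_one (by linarith)]; congr 1; ring

lemma star_bound {d : ℕ} (hd : 3 ≤ d) {r q θ : ℝ} (hr : 1 ≤ r) (hq : 1 ≤ q) (h : MBound d r q θ) : ∃ C : ℝ≥0∞, C ≠ ∞ ∧ ∀ (f : Euc d → ℂ), Continuous f → HasCompactSupport f →
    ∫⁻ x, VrIA r f x ^ q ≤ C * (n1 f ^ q + n1 f ^ ((1 - θ) * q) * n2 f ^ (θ * q / 2)) := by
  obtain ⟨C1, hC1, H1⟩ := base_piece hd hr hq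
  obtain ⟨C2, hC2, H2⟩ := h
  refine ⟨2 ^ (q - 1) * (C1 + C2), ENNReal.mul_ne_top (ENNReal.rpow_ne_top_of_nonneg (by linarith) (by simp)) (ENNReal.add_ne_top.2 ⟨hC1, hC2⟩), fun f hf hfc => ?_⟩
  have hm := rVar_lsc_meas (r := r) (by linarith) (g0_cd hf).continuous (g0_cs hfc)
  calc _ ≤ ∫⁻ x, 2 ^ (q - 1) * (VrIA r (g0 f) x ^ q + (∑' j, VrIA r (LP j f) x) ^ q) := by
        refine lintegral_mono fun x => ?_
        refine (ENNReal.rpow_le_rpow (V_decomp (by omega) hr hf hfc x) (by linarith)).trans ?_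
        exact ENNReal.rpow_add_le_mul_rpow_add_rpow _ _ hq
    _ = 2 ^ (q - 1) * ((∫⁻ x, VrIA r (g0 f) x ^ q) + ∫⁻ x, (∑' j, VrIA r (LP j f) x) ^ q) := by
        rw [lintegral_const_mul' _ _ (ENNReal.rpow_ne_top_of_nonneg (by linarith) (by simp)), lintegral_add_left (hm.pow_const q)]
    _ ≤ 2 ^ (q - 1) * (C1 * n1 f ^ q + C2 * (n1 f ^ ((1 - θ) * q) * n2 f ^ (θ * q / 2))) :=
        mul_le_mul' le_rfl (add_le_add (H1 f hf hfc) (H2 f hf hfc))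
    _ ≤ 2 ^ (q - 1) * ((C1 + C2) * n1 f ^ q + (C1 + C2) * (n1 f ^ ((1 - θ) * q) * n2 f ^ (θ * q / 2))) := by
        refine mul_le_mul' le_rfl (add_le_add (mul_le_mul' le_self_add le_rfl) (mul_le_mul' le_add_self le_rfl))
    _ = _ := by ring

/-! ## P13: level decomposition -/

/-- truncation at height `l` -/
def trunc {d : ℕ} (l : ℝ) (f : Euc d → ℂ) (x : Euc d) : ℂ := (l / max l ‖f x‖) • f x

lemma trunc_cont {d : ℕ} {l : ℝ} (hl : 0 < l) {f : Euc d → ℂ} (hf : Continuous f) : Continuous (trunc l f) := by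
  unfold trunc
  refine Continuous.smul (Continuous.div continuous_const (continuous_const.max hf.norm) fun x => ?_) hf
  exact (lt_of_lt_of_le hl (le_max_left _ _)).ne'

lemma trunc_cs {d : ℕ} {l : ℝ} {f : Euc d → ℂ} (hf : HasCompactSupport f) : HasCompactSupport (trunc l f) := by
  unfold trunc
  exact HasCompactSupport.smul_left (f := fun x => l / max l ‖f x‖) hf

lemma trunc_eq {d : ℕ} {l : ℝ} (hl : 0 < l) {f : Euc d → ℂ} {x : Euc d} (h : ‖f x‖ ≤ l) : trunc l f x = f x := by
  rw [trunc, max_eq_left h, div_self hl.ne', one_smul]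

lemma trunc_le {d : ℕ} {l : ℝ} (hl : 0 < l) (f : Euc d → ℂ) (x : Euc d) : ‖trunc l f x‖ ≤ l := by
  have hm : 0 < max l ‖f x‖ := lt_of_lt_of_le hl (le_max_left _ _)
  rw [trunc, norm_smul, Real.norm_of_nonneg (by positivity), div_mul_eq_mul_div, div_le_iff₀ hm]
  exact mul_le_mul_of_nonneg_left (le_max_right _ _) hl.le

lemma trunc_diff {d : ℕ} {l : ℝ} (hl : 0 < l) (f : Euc d → ℂ) (x : Euc d) :
    ‖trunc (2 * l) f x - trunc l f x‖ ≤ l ∧ (‖f x‖ ≤ l → trunc (2 * l) f x - trunc l f x = 0) := by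
  have h0 : ‖f x‖ ≤ l → trunc (2 * l) f x - trunc l f x = 0 := fun h => by
    rw [trunc_eq hl h, trunc_eq (by positivity) (by linarith), sub_self]
  refine ⟨?_, h0⟩
  rcases le_or_gt ‖f x‖ l with h | h
  · rw [h0 h, norm_zero]; exact hl.le
  · have hf : 0 < ‖f x‖ := hl.trans h
    unfold trunc
    rw [← sub_smul, norm_smul, max_eq_right h.le]
    have h1 : l / ‖f x‖ ≤ 2 * l / max (2 * l) ‖f x‖ := by
      rcases le_total (2 * l) ‖f x‖ with h' | h'
      · rw [max_eq_right h']; gcongr; linarith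
      · rw [max_eq_left h', div_self (by positivity), div_le_one hf]; exact h.le
    have h2 : 2 * l / max (2 * l) ‖f x‖ ≤ 2 * l / ‖f x‖ := by
      gcongr; exact le_max_right _ _
    rw [Real.norm_of_nonneg (by linarith)]
    have : (2 * l / max (2 * l) ‖f x‖ - l / ‖f x‖) * ‖f x‖ ≤ (2 * l / ‖f x‖ - l / ‖f x‖) * ‖f x‖ := by gcongr
    refine this.trans (le_of_eq ?_)
    field_simp; ring

lemma trunc_diff_e {d : ℕ} {l p : ℝ} (hl : 0 < l) (hp : 0 < p) (f : Euc d → ℂ) (x : Euc d) (m : ℕ) (hm : m ≠ 0) :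
    ‖trunc (2 * l) f x - trunc l f x‖ₑ ^ m ≤ ENNReal.ofReal l ^ ((m:ℝ) - p) * ‖f x‖ₑ ^ p := by
  obtain ⟨h1, h2⟩ := trunc_diff hl f x
  rcases le_or_gt ‖f x‖ l with h | h
  · rw [h2 h]; simp [hm]
  have hL0 : ENNReal.ofReal l ≠ 0 := by simpa using hl
  rw [ENNReal.rpow_sub _ _ hL0 ENNReal.ofReal_ne_top, ENNReal.rpow_natCast]
  have e1 : ‖trunc (2 * l) f x - trunc l f x‖ₑ ≤ ENNReal.ofReal l := by
    rw [← ofReal_norm_eq_enorm]; exact ENNReal.ofReal_le_ofReal h1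
  have e2 : ENNReal.ofReal l ≤ ‖f x‖ₑ := by
    rw [← ofReal_norm_eq_enorm]; exact ENNReal.ofReal_le_ofReal h.le
  have hLp0 : ENNReal.ofReal l ^ p ≠ 0 := by simp [ENNReal.rpow_eq_zero_iff, hl, hp.le]
  have hLpt : ENNReal.ofReal l ^ p ≠ ∞ := ENNReal.rpow_ne_top_of_nonneg hp.le ENNReal.ofReal_ne_top
  calc _ ≤ ENNReal.ofReal l ^ m := pow_le_pow_left' e1 m
    _ = ENNReal.ofReal l ^ m / ENNReal.ofReal l ^ p * ENNReal.ofReal l ^ p := by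
        rw [ENNReal.div_mul_cancel hLp0 hLpt]
    _ ≤ _ := mul_le_mul' le_rfl (ENNReal.rpow_le_rpow e2 hp.le)

/-- the `k`th level piece -/
def lev {d : ℕ} (A : ℝ) (f : Euc d → ℂ) (k : ℕ) (x : Euc d) : ℂ := trunc (2 * (A * 2 ^ k)) f x - trunc (A * 2 ^ k) f x

lemma lev_cont {d : ℕ} {A : ℝ} (hA : 0 < A) {f : Euc d → ℂ} (hf : Continuous f) (k : ℕ) : Continuous (lev A f k) :=
  (trunc_cont (by positivity) hf).sub (trunc_cont (by positivity) hf)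
lemma lev_cs {d : ℕ} {A : ℝ} {f : Euc d → ℂ} (hf : HasCompactSupport f) (k : ℕ) : HasCompactSupport (lev A f k) :=
  (trunc_cs hf).sub (trunc_cs hf)

lemma lev_sum {d : ℕ} {A : ℝ} (f : Euc d → ℂ) (K : ℕ) (x : Euc d) :
    ∑ k ∈ Finset.range K, lev A f k x = trunc (A * 2 ^ K) f x - trunc A f x := by
  have : ∀ k : ℕ, lev A f k x = trunc (A * 2 ^ (k+1)) f x - trunc (A * 2 ^ k) f x := by
    intro k; unfold lev; rw [show 2 * (A * 2 ^ k) = A * 2 ^ (k+1) by ring]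
  simp_rw [this]
  rw [Finset.sum_range_sub (fun k : ℕ => trunc (A * 2 ^ k) f x)]
  norm_num

lemma lev_decomp {d : ℕ} {r : ℝ} (hr : 1 ≤ r) {A : ℝ} (hA : 0 < A) {f : Euc d → ℂ} (hf : Continuous f) (hfc : HasCompactSupport f) (x : Euc d) :
    VrIA r f x ≤ VrIA r (trunc A f) x + ∑' k, VrIA r (lev A f k) x := by
  obtain ⟨M, hM0, hM⟩ := cc_bdd hf hfc
  obtain ⟨K, hK⟩ := pow_unbounded_of_one_lt (M / A) (show (1:ℝ) < 2 by norm_num)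
  rw [div_lt_iff₀ hA] at hK
  unfold VrIA
  refine (rVar_sub_le hr _ _ (fun t => sphAvg (trunc A f) t x)).trans (add_le_add le_rfl ?_)
  refine le_trans (le_of_eq ?_) ((rVar_sum_le hr (Icc 1 2) (Finset.range K) (fun k t => sphAvg (lev A f k) t x)).trans (ENNReal.sum_le_tsum _))
  refine rVar_congr fun t _ => ?_
  unfold sphAvg
  rw [← integral_finsetSum _ fun k _ => sph_int_cc (lev_cont hA hf k) (lev_cs hfc k) t x]
  rw [← integral_sub (sph_int_cc hf hfc t x) (sph_int_cc (trunc_cont hA hf) (trunc_cs hfc) t x)]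
  congr 1; ext y
  rw [lev_sum, trunc_eq (l := A * 2 ^ K) (by positivity)]
  exact (hM _).trans (by linarith)

lemma lev_n {d : ℕ} {p A : ℝ} (hA : 0 < A) (hp : 0 < p) (f : Euc d → ℂ)
    (hN : ∫⁻ x, ‖f x‖ₑ ^ p ≤ ENNReal.ofReal A ^ p) (k m : ℕ) (hm : m ≠ 0) :
    ∫⁻ x, ‖lev A f k x‖ₑ ^ m ≤ ENNReal.ofReal A ^ m * Dj k ^ ((m:ℝ) - p) := by
  have hl : 0 < A * 2 ^ k := by positivity
  have hA0 : ENNReal.ofReal A ≠ 0 := by simpa using hA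
  have e : ENNReal.ofReal (A * 2 ^ k) = ENNReal.ofReal A * Dj k := by
    rw [ENNReal.ofReal_mul hA.le, ENNReal.ofReal_pow (by norm_num)]; simp [Dj]
  calc _ ≤ ∫⁻ x, ENNReal.ofReal (A * 2 ^ k) ^ ((m:ℝ) - p) * ‖f x‖ₑ ^ p := lintegral_mono fun x => trunc_diff_e hl hp f x m hm
    _ = ENNReal.ofReal (A * 2 ^ k) ^ ((m:ℝ) - p) * ∫⁻ x, ‖f x‖ₑ ^ p :=
        lintegral_const_mul' _ _ (ENNReal.rpow_ne_top_of_ne_zero (by simpa using hl) ENNReal.ofReal_ne_top)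
    _ ≤ ENNReal.ofReal (A * 2 ^ k) ^ ((m:ℝ) - p) * ENNReal.ofReal A ^ p := mul_le_mul' le_rfl hN
    _ = (ENNReal.ofReal A ^ ((m:ℝ) - p) * ENNReal.ofReal A ^ p) * Dj k ^ ((m:ℝ) - p) := by
        rw [e, ENNReal.mul_rpow_of_ne_top ENNReal.ofReal_ne_top (Dj_ne_top k)]; ring
    _ = _ := by
        rw [← ENNReal.rpow_add _ _ hA0 ENNReal.ofReal_ne_top, sub_add_cancel, ENNReal.rpow_natCast]

lemma Dj_one_le (k : ℕ) : 1 ≤ Dj k := one_le_pow₀ (by norm_num)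

lemma Dj_summable {ε : ℝ} (hε : 0 < ε) : ∑' k, Dj k ^ (-ε) ≠ ∞ := by
  have hlt : (2:ℝ≥0∞) ^ (-ε) < 1 := ENNReal.rpow_lt_one_of_one_lt_of_neg (by norm_num) (by linarith)
  have : ∀ k, Dj k ^ (-ε) = ((2:ℝ≥0∞) ^ (-ε)) ^ k := fun k => by
    rw [← ENNReal.rpow_natCast, ← ENNReal.rpow_mul, Dj, ← ENNReal.rpow_natCast, ← ENNReal.rpow_mul]
    congr 1; ring
  simp_rw [this]
  rw [ENNReal.tsum_geometric, ENNReal.inv_ne_top]; exact (tsub_pos_of_lt hlt).ne'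

lemma level_bound {d : ℕ} (hd : 3 ≤ d) {r p q θ : ℝ} (hr : 1 ≤ r) (hq : 1 ≤ q) (hθ0 : 0 ≤ θ) (hθ1 : θ ≤ 1) (hp : 0 < p)
    (hpx : 1 < p * (1 - θ / 2)) (h : MBound d r q θ) (R : ℝ) :
    ∃ C : ℝ≥0∞, C ≠ ∞ ∧ ∀ (f : Euc d → ℂ), Continuous f → HasCompactSupport f → (∀ x, R < ‖x‖ → f x = 0) → ∀ A : ℝ, 0 < A →
      ∫⁻ x, ‖f x‖ₑ ^ p ≤ ENNReal.ofReal A ^ p →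
      ∫⁻ x, VrIA r f x ^ q ≤ C * ENNReal.ofReal A ^ q := by
  obtain ⟨C, hC, H⟩ := star_bound hd hr hq h
  have hε : 0 < (p * (1 - θ / 2) - 1) * q / 2 := by
    have : 0 < (p * (1 - θ / 2) - 1) * q := mul_pos (by linarith) (by linarith)
    linarith
  generalize hεd : (p * (1 - θ / 2) - 1) * q / 2 = ε at *
  obtain ⟨C', hC', H'⟩ := pow_sum (q := q) (by linarith) hε
  obtain ⟨b, hb⟩ : ∃ b, volume (closedBall (0 : Euc d) R) = b := ⟨_, rfl⟩
  have hbt : b ≠ ∞ := by rw [← hb]; exact measure_closedBall_lt_top.ne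
  have hq0 : 0 ≤ q := by linarith
  have hs := Dj_summable hε
  generalize hS : ∑' k, Dj k ^ (-ε) = S at hs
  have hE1 : 0 ≤ (1 - θ) * q := mul_nonneg (by linarith) hq0
  have hE2 : 0 ≤ θ * q / 2 := by positivity
  refine ⟨2 ^ (q - 1) * (C * (b ^ q + b ^ ((1 - θ) * q) * b ^ (θ * q / 2)) + C' * (2 * C * S)), ?_, fun f hf hfc hfs A hA hN => ?_⟩
  · have i1 := ENNReal.rpow_ne_top_of_nonneg hq0 hbt
    have i2 := ENNReal.rpow_ne_top_of_nonneg hE1 hbt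
    have i3 := ENNReal.rpow_ne_top_of_nonneg hE2 hbt
    have i4 : (2:ℝ≥0∞) ^ (q - 1) ≠ ∞ := ENNReal.rpow_ne_top_of_nonneg (by linarith) (by simp)
    finiteness
  obtain ⟨a, ha⟩ : ∃ a, ENNReal.ofReal A = a := ⟨_, rfl⟩
  have ha0 : a ≠ 0 := by rw [← ha]; simpa using hA
  have hat : a ≠ ∞ := by rw [← ha]; exact ENNReal.ofReal_ne_top
  have haq : a ^ ((1 - θ) * q) * (a ^ 2) ^ (θ * q / 2) = a ^ q := by
    rw [← ENNReal.rpow_natCast, ← ENNReal.rpow_mul, ← ENNReal.rpow_add _ _ ha0 hat]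
    congr 1; push_cast; ring
  -- base piece
  have hT : ∫⁻ x, VrIA r (trunc A f) x ^ q ≤ C * (b ^ q + b ^ ((1 - θ) * q) * b ^ (θ * q / 2)) * a ^ q := by
    have hm : ∀ m : ℕ, m ≠ 0 → ∫⁻ x, ‖trunc A f x‖ₑ ^ m ≤ b * a ^ m := by
      intro m hm0
      have e1 : ∀ x, ‖trunc A f x‖ₑ ^ m ≤ (closedBall (0 : Euc d) R).indicator (fun _ => a ^ m) x := by
        intro x
        by_cases hx : x ∈ closedBall (0 : Euc d) R
        · rw [indicator_of_mem hx]
          refine pow_le_pow_left' ?_ m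
          rw [← ofReal_norm_eq_enorm, ← ha]; exact ENNReal.ofReal_le_ofReal (trunc_le hA f x)
        · rw [indicator_of_notMem hx]
          have : f x = 0 := hfs x (by simpa using hx)
          simp [trunc, this, hm0]
      refine (lintegral_mono e1).trans ?_
      rw [lintegral_indicator measurableSet_closedBall, setLIntegral_const, hb, mul_comm]
    have hm1 : n1 (trunc A f) ≤ b * a := by simpa [n1] using hm 1 one_ne_zero
    have hm2 : n2 (trunc A f) ≤ b * a ^ 2 := hm 2 two_ne_zero
    refine (H _ (trunc_cont hA hf) (trunc_cs hfc)).trans ?_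
    rw [mul_assoc]
    refine mul_le_mul' le_rfl ?_
    rw [add_mul]
    refine add_le_add ?_ ?_
    · rw [← ENNReal.mul_rpow_of_nonneg _ _ hq0]; exact ENNReal.rpow_le_rpow hm1 hq0
    · refine (mul_le_mul' (ENNReal.rpow_le_rpow hm1 hE1) (ENNReal.rpow_le_rpow hm2 hE2)).trans (le_of_eq ?_)
      rw [ENNReal.mul_rpow_of_nonneg _ _ hE1, ENNReal.mul_rpow_of_nonneg _ _ hE2, ← haq]; ring
  -- level pieces
  have hL : ∀ k, ∫⁻ x, VrIA r (lev A f k) x ^ q ≤ 2 * C * a ^ q * Dj k ^ (-(2 * ε)) := by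
    intro k
    have hm1 : n1 (lev A f k) ≤ a * Dj k ^ (1 - p) := by simpa [n1, ha] using lev_n hA hp f hN k 1 one_ne_zero
    have hm2 : n2 (lev A f k) ≤ a ^ 2 * Dj k ^ (2 - p) := by simpa [n2, ha] using lev_n hA hp f hN k 2 two_ne_zero
    refine (H _ (lev_cont hA hf k) (lev_cs hfc k)).trans ?_
    have i1 : n1 (lev A f k) ^ q ≤ a ^ q * Dj k ^ (-(2 * ε)) := by
      refine (ENNReal.rpow_le_rpow hm1 hq0).trans ?_
      rw [ENNReal.mul_rpow_of_nonneg _ _ hq0, ← ENNReal.rpow_mul]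
      refine mul_le_mul' le_rfl (ENNReal.rpow_le_rpow_of_exponent_le (Dj_one_le k) ?_)
      have : p * (θ / 2) * q ≥ 0 := by positivity
      rw [← hεd]; nlinarith
    have i2 : n1 (lev A f k) ^ ((1 - θ) * q) * n2 (lev A f k) ^ (θ * q / 2) ≤ a ^ q * Dj k ^ (-(2 * ε)) := by
      refine (mul_le_mul' (ENNReal.rpow_le_rpow hm1 hE1) (ENNReal.rpow_le_rpow hm2 hE2)).trans (le_of_eq ?_)
      rw [ENNReal.mul_rpow_of_nonneg _ _ hE1, ENNReal.mul_rpow_of_nonneg _ _ hE2, ← ENNReal.rpow_mul, ← ENNReal.rpow_mul, ← haq]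
      have : -(2 * ε) = (1 - p) * ((1 - θ) * q) + (2 - p) * (θ * q / 2) := by rw [← hεd]; ring
      rw [this, Dj_add]; ring
    refine (mul_le_mul' le_rfl (add_le_add i1 i2)).trans (le_of_eq ?_)
    ring
  have hm := rVar_lsc_meas (r := r) (by linarith) (trunc_cont hA hf) (trunc_cs hfc)
  have hmk : ∀ k, Measurable (VrIA r (lev A f k)) := fun k => rVar_lsc_meas (by linarith) (lev_cont hA hf k) (lev_cs hfc k)
  have hLs : ∫⁻ x, (∑' k, VrIA r (lev A f k) x) ^ q ≤ C' * (2 * C * S) * a ^ q := by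
    calc _ ≤ ∫⁻ x, C' * ∑' j, Dj j ^ ε * VrIA r (lev A f j) x ^ q := lintegral_mono fun x => H' _
      _ = C' * ∑' j, Dj j ^ ε * ∫⁻ x, VrIA r (lev A f j) x ^ q := by
          rw [lintegral_const_mul' _ _ hC', lintegral_tsum fun j => (((hmk j).pow_const q).const_mul _).aemeasurable]
          congr 2; ext j; rw [lintegral_const_mul' _ _ (Dj_rpow_ne_top _ _)]
      _ ≤ C' * ∑' j, (2 * C * a ^ q) * Dj j ^ (-ε) := by
          refine mul_le_mul' le_rfl (ENNReal.tsum_le_tsum fun j => ?_)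
          refine (mul_le_mul' le_rfl (hL j)).trans (le_of_eq ?_)
          have : -ε = ε + (-(2 * ε)) := by ring
          rw [this, Dj_add]; ring
      _ = _ := by rw [ENNReal.tsum_mul_left, hS]; ring
  rw [ha]
  calc _ ≤ ∫⁻ x, 2 ^ (q - 1) * (VrIA r (trunc A f) x ^ q + (∑' j, VrIA r (lev A f j) x) ^ q) := by
        refine lintegral_mono fun x => ?_
        refine (ENNReal.rpow_le_rpow (lev_decomp hr hA hf hfc x) (by linarith)).trans ?_
        exact ENNReal.rpow_add_le_mul_rpow_add_rpow _ _ hq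
    _ = 2 ^ (q - 1) * ((∫⁻ x, VrIA r (trunc A f) x ^ q) + ∫⁻ x, (∑' j, VrIA r (lev A f j) x) ^ q) := by
        rw [lintegral_const_mul' _ _ (ENNReal.rpow_ne_top_of_nonneg (by linarith) (by simp)), lintegral_add_left (hm.pow_const q)]
    _ ≤ 2 ^ (q - 1) * (C * (b ^ q + b ^ ((1 - θ) * q) * b ^ (θ * q / 2)) * a ^ q + C' * (2 * C * S) * a ^ q) :=
        mul_le_mul' le_rfl (add_le_add hT hLs)
    _ = _ := by ring

lemma VrIA_zero {d : ℕ} {r : ℝ} (hr : 0 < r) (x : Euc d) : VrIA r (fun _ : Euc d => (0:ℂ)) x = 0 := by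
  unfold VrIA sphAvg
  simp only [integral_zero]
  exact rVar_const hr _ 0

/-- local strong type bound on `C_c` -/
def LocBd (d : ℕ) (r p q : ℝ) : Prop := ∀ R : ℝ, ∃ C : ℝ≥0∞, C ≠ ∞ ∧ ∀ (f : Euc d → ℂ), Continuous f → HasCompactSupport f → (∀ x, R < ‖x‖ → f x = 0) →
      ∫⁻ x, VrIA r f x ^ q ≤ C * (∫⁻ x, ‖f x‖ₑ ^ p) ^ (q / p)

lemma loc_bd {d : ℕ} (hd : 3 ≤ d) {r p q θ : ℝ} (hr : 1 ≤ r) (hq : 1 ≤ q) (hθ0 : 0 ≤ θ) (hθ1 : θ ≤ 1) (hp : 0 < p)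
    (hpx : 1 < p * (1 - θ / 2)) (h : MBound d r q θ) : LocBd d r p q := by
  intro R
  obtain ⟨C, hC, H⟩ := level_bound hd hr hq hθ0 hθ1 hp hpx h R
  refine ⟨C, hC, fun f hf hfc hfs => ?_⟩
  have hN : ∫⁻ x, ‖f x‖ₑ ^ p ≠ ∞ := by
    have hc : Continuous fun x => ‖f x‖ ^ p := hf.norm.rpow_const fun x => Or.inr hp.le
    have hcc : HasCompactSupport fun x => ‖f x‖ ^ p := hfc.mono (fun x hx hx0 => hx (by
      simp only [hx0, norm_zero]; exact Real.zero_rpow hp.ne'))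
    have := (cc_integrable hc hcc).2
    rw [HasFiniteIntegral] at this
    refine ne_of_lt (lt_of_le_of_lt (lintegral_mono fun x => le_of_eq ?_) this)
    rw [Real.enorm_of_nonneg (by positivity), ← ofReal_norm_eq_enorm, ENNReal.ofReal_rpow_of_nonneg (norm_nonneg _) hp.le]
  generalize hNd : ∫⁻ x, ‖f x‖ₑ ^ p = N at *
  rcases eq_or_ne N 0 with h0 | h0
  · have hm : Measurable fun x => ‖f x‖ₑ ^ p := by fun_prop
    rw [h0, lintegral_eq_zero_iff hm] at hNd
    have h1 : f =ᵐ[volume] fun _ => (0:ℂ) := by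
      filter_upwards [hNd] with x hx
      simpa [ENNReal.rpow_eq_zero_iff, hp, hp.not_gt] using hx
    have h2 : f = fun _ => (0:ℂ) := (Continuous.ae_eq_iff_eq volume hf continuous_const).1 h1
    subst h2
    simp only [VrIA_zero (show 0 < r by linarith)]
    rw [ENNReal.zero_rpow_of_pos (by linarith)]; simp
  · have hNp : 0 < N.toReal := ENNReal.toReal_pos h0 hN
    have e : ENNReal.ofReal (N.toReal ^ (1/p)) = N ^ (1/p) := by
      rw [← ENNReal.ofReal_rpow_of_pos hNp, ENNReal.ofReal_toReal hN]
    have := H f hf hfc hfs (N.toReal ^ (1/p)) (by positivity) (by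
      rw [e, ← ENNReal.rpow_mul, one_div_mul_cancel hp.ne', ENNReal.rpow_one, hNd])
    rw [e, ← ENNReal.rpow_mul] at this
    rwa [show 1 / p * q = q / p by ring] at this

/-! ## P14: localization -/

lemma cc_Lp_fin {d : ℕ} {E : Type*} [NormedAddCommGroup E] {f : Euc d → E} (hf : Continuous f) (hfc : HasCompactSupport f) {p : ℝ} (hp : 0 < p) :
    ∫⁻ x, ‖f x‖ₑ ^ p ≠ ∞ := by
  have hc : Continuous fun x => ‖f x‖ ^ p := hf.norm.rpow_const fun x => Or.inr hp.le
  have hcc : HasCompactSupport fun x => ‖f x‖ ^ p := hfc.mono (fun x hx hx0 => hx (by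
    simp only [hx0, norm_zero]; exact Real.zero_rpow hp.ne'))
  have := (cc_integrable hc hcc).2
  rw [HasFiniteIntegral] at this
  refine ne_of_lt (lt_of_le_of_lt (lintegral_mono fun x => le_of_eq ?_) this)
  rw [Real.enorm_of_nonneg (by positivity), ← ofReal_norm_eq_enorm, ENNReal.ofReal_rpow_of_nonneg (norm_nonneg _) hp.le]

/-- continuous cutoff: `1` on `‖w‖ ≤ 3`, `0` for `‖w‖ ≥ 4` -/
def cutoff {d : ℕ} (w : Euc d) : ℝ := max 0 (min 1 (4 - ‖w‖))

lemma cutoff_cont {d : ℕ} : Continuous (cutoff (d := d)) := by unfold cutoff; fun_prop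
lemma cutoff_one {d : ℕ} {w : Euc d} (h : ‖w‖ ≤ 3) : cutoff w = 1 := by
  unfold cutoff; rw [min_eq_left (by linarith), max_eq_right (by norm_num)]
lemma cutoff_zero {d : ℕ} {w : Euc d} (h : 4 ≤ ‖w‖) : cutoff w = 0 := by
  unfold cutoff; rw [max_eq_left]; exact (min_le_right _ _).trans (by linarith)
lemma cutoff_mem {d : ℕ} (w : Euc d) : 0 ≤ cutoff w ∧ cutoff w ≤ 1 := by
  unfold cutoff; exact ⟨le_max_left _ _, max_le (by norm_num) (min_le_left _ _)⟩

/-- global strong type bound on `C_c` -/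
def GlobBd (d : ℕ) (r p q : ℝ) : Prop := ∃ C : ℝ≥0∞, C ≠ ∞ ∧ ∀ (f : Euc d → ℂ), Continuous f → HasCompactSupport f →
      ∫⁻ x, VrIA r f x ^ q ≤ C * (∫⁻ x, ‖f x‖ₑ ^ p) ^ (q / p)

lemma V_local {d : ℕ} (r : ℝ) (f : Euc d → ℂ) (x z : Euc d) (hx : ‖x - z‖ ≤ 1) :
    VrIA r f x = VrIA r (fun w => cutoff w • f (w + z)) (x - z) := by
  unfold VrIA
  refine rVar_congr fun t ht => ?_
  unfold sphAvg
  refine integral_congr_ae ?_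
  filter_upwards [sphM_ae_norm d] with y hy
  have h1 : ‖x - z - t • y‖ ≤ 3 := by
    refine (norm_sub_le _ _).trans ?_
    rw [norm_smul, hy, Real.norm_of_nonneg (by linarith [ht.1])]; linarith [ht.2]
  simp only [cutoff_one h1, one_smul]
  congr 1; abel

lemma swap_ind {d : ℕ} {I W : Euc d → ℝ≥0∞} (hI : Measurable I) (hW : Measurable W) :
    ∫⁻ z, (∫⁻ x, I (x - z) * W x) = (∫⁻ x, I x) * ∫⁻ x, W x := by
  rw [lintegral_lintegral_swap (by fun_prop), ← lintegral_const_mul _ hW]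
  refine lintegral_congr fun x => ?_
  rw [lintegral_mul_const _ (by fun_prop), lintegral_sub_left_eq_self]

lemma swap_ind' {d : ℕ} {I W : Euc d → ℝ≥0∞} (hI : Measurable I) (hW : Measurable W) :
    ∫⁻ z, (∫⁻ x, I x * W (x + z)) = (∫⁻ x, I x) * ∫⁻ x, W x := by
  rw [lintegral_lintegral_swap (by fun_prop), ← lintegral_mul_const _ hI]
  refine lintegral_congr fun x => ?_
  rw [lintegral_const_mul _ (by fun_prop), lintegral_add_left_eq_self W x]

lemma glob_of_loc {d : ℕ} {r p q : ℝ} (hr : 1 ≤ r) (hp : 0 < p) (hpq : p ≤ q) (h : LocBd d r p q) : GlobBd d r p q := by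
  obtain ⟨C, hC, H⟩ := h 4
  have hq : 0 < q := by linarith
  have hc0 : volume (closedBall (0 : Euc d) 1) ≠ 0 := (measure_closedBall_pos _ _ one_pos).ne'
  have hct : volume (closedBall (0 : Euc d) 1) ≠ ∞ := measure_closedBall_lt_top.ne
  have hbt : volume (closedBall (0 : Euc d) 4) ≠ ∞ := measure_closedBall_lt_top.ne
  refine ⟨(volume (closedBall (0 : Euc d) 1))⁻¹ * (C * volume (closedBall (0 : Euc d) 4)), by finiteness, fun f hf hfc => ?_⟩
  have hV := (rVar_lsc_meas (r := r) (by linarith) hf hfc).pow_const q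
  have hN := cc_Lp_fin hf hfc hp
  have hmf : Measurable fun x => ‖f x‖ₑ ^ p := by fun_prop
  have hB : MeasurableSet (closedBall (0 : Euc d) 1) := measurableSet_closedBall
  have hB4 : MeasurableSet (closedBall (0 : Euc d) 4) := measurableSet_closedBall
  -- step 1
  have h1 : volume (closedBall (0 : Euc d) 1) * ∫⁻ x, VrIA r f x ^ q =
      ∫⁻ z, (∫⁻ x, (closedBall (0 : Euc d) 1).indicator 1 (x - z) * VrIA r f x ^ q) := by
    rw [swap_ind (measurable_one.indicator hB) hV, lintegral_indicator_one hB]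
  -- step 2
  have h2 : ∀ z, ∫⁻ x, (closedBall (0 : Euc d) 1).indicator 1 (x - z) * VrIA r f x ^ q ≤
      C * (∫⁻ w, (closedBall (0 : Euc d) 4).indicator 1 w * ‖f (w + z)‖ₑ ^ p) ^ (q / p) := by
    intro z
    have hgc : Continuous fun w => cutoff w • f (w + z) := cutoff_cont.smul (by fun_prop)
    have hgs : ∀ w : Euc d, 4 < ‖w‖ → cutoff w • f (w + z) = 0 := fun w hw => by rw [cutoff_zero hw.le, zero_smul]
    have hgcs : HasCompactSupport fun w => cutoff w • f (w + z) :=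
      HasCompactSupport.intro (isCompact_closedBall (0 : Euc d) 4) fun w hw => hgs w (by simpa using hw)
    calc _ ≤ ∫⁻ x, VrIA r (fun w => cutoff w • f (w + z)) (x - z) ^ q := by
          refine lintegral_mono fun x => ?_
          by_cases hx : x - z ∈ closedBall (0 : Euc d) 1
          · rw [indicator_of_mem hx, Pi.one_apply, one_mul, V_local r f x z (by simpa using hx)]
          · rw [indicator_of_notMem hx, zero_mul]; exact zero_le
      _ = ∫⁻ x, VrIA r (fun w => cutoff w • f (w + z)) x ^ q :=
          lintegral_sub_right_eq_self (fun x => VrIA r (fun w => cutoff w • f (w + z)) x ^ q) z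
      _ ≤ C * (∫⁻ w, ‖cutoff w • f (w + z)‖ₑ ^ p) ^ (q / p) := H _ hgc hgcs hgs
      _ ≤ _ := by
          refine mul_le_mul' le_rfl (ENNReal.rpow_le_rpow (lintegral_mono fun w => ?_) (by positivity))
          by_cases hw : w ∈ closedBall (0 : Euc d) 4
          · rw [indicator_of_mem hw, Pi.one_apply, one_mul]
            refine ENNReal.rpow_le_rpow ?_ hp.le
            rw [enorm_smul]
            refine mul_le_of_le_one_left zero_le ?_
            rw [Real.enorm_of_nonneg (cutoff_mem w).1]; exact ENNReal.ofReal_le_one.2 (cutoff_mem w).2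
          · rw [indicator_of_notMem hw, zero_mul, hgs w (by simpa using hw)]; simp [hp]
  -- step 3
  have h3 : ∫⁻ z, (∫⁻ w, (closedBall (0 : Euc d) 4).indicator 1 w * ‖f (w + z)‖ₑ ^ p) ^ (q / p) ≤
      volume (closedBall (0 : Euc d) 4) * (∫⁻ x, ‖f x‖ₑ ^ p) ^ (q / p) := by
    have hmi : Measurable ((closedBall (0 : Euc d) 4).indicator (1 : Euc d → ℝ≥0∞)) := measurable_one.indicator hB4
    have hle : ∀ z, ∫⁻ w, (closedBall (0 : Euc d) 4).indicator 1 w * ‖f (w + z)‖ₑ ^ p ≤ ∫⁻ x, ‖f x‖ₑ ^ p := by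
      intro z
      rw [← lintegral_add_right_eq_self (fun x => ‖f x‖ₑ ^ p) z]
      refine lintegral_mono fun w => mul_le_of_le_one_left zero_le ?_
      exact indicator_le_self' (fun _ _ => zero_le) w
    have hintg : ∫⁻ z, (∫⁻ w, (closedBall (0 : Euc d) 4).indicator 1 w * ‖f (w + z)‖ₑ ^ p) = volume (closedBall (0 : Euc d) 4) * ∫⁻ x, ‖f x‖ₑ ^ p := by
      rw [swap_ind' hmi hmf, lintegral_indicator_one hB4]
    have hqp : 0 ≤ q / p - 1 := by rw [sub_nonneg, one_le_div hp]; exact hpq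
    generalize ∫⁻ x, ‖f x‖ₑ ^ p = N at *
    calc _ ≤ ∫⁻ z, (∫⁻ w, (closedBall (0 : Euc d) 4).indicator 1 w * ‖f (w + z)‖ₑ ^ p) * N ^ (q / p - 1) := by
          refine lintegral_mono fun z => ?_
          have hz := hle z
          generalize ∫⁻ w, (closedBall (0 : Euc d) 4).indicator 1 w * ‖f (w + z)‖ₑ ^ p = F at *
          have : F ^ (q / p) = F ^ (1 + (q / p - 1)) := by congr 1; ring
          rw [this, ENNReal.rpow_add_of_nonneg _ _ zero_le_one hqp, ENNReal.rpow_one]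
          exact mul_le_mul' le_rfl (ENNReal.rpow_le_rpow hz hqp)
      _ = volume (closedBall (0 : Euc d) 4) * N ^ (1:ℝ) * N ^ (q / p - 1) := by
          rw [lintegral_mul_const' _ _ (ENNReal.rpow_ne_top_of_nonneg hqp hN), hintg, ENNReal.rpow_one]
      _ = _ := by
          rw [mul_assoc, ← ENNReal.rpow_add_of_nonneg _ _ zero_le_one hqp]
          congr 2; ring
  calc ∫⁻ x, VrIA r f x ^ q = (volume (closedBall (0 : Euc d) 1))⁻¹ * (volume (closedBall (0 : Euc d) 1) * ∫⁻ x, VrIA r f x ^ q) := by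
        rw [← mul_assoc, ENNReal.inv_mul_cancel hc0 hct, one_mul]
    _ ≤ (volume (closedBall (0 : Euc d) 1))⁻¹ * (C * (volume (closedBall (0 : Euc d) 4) * (∫⁻ x, ‖f x‖ₑ ^ p) ^ (q / p))) := by
        refine mul_le_mul' le_rfl ?_
        rw [h1]
        refine (lintegral_mono h2).trans ?_
        rw [lintegral_const_mul' _ _ hC]
        exact mul_le_mul' le_rfl h3
    _ = _ := by ring

/-! ## P15: extension to `L^p` -/

/-- local maximal function -/
def Mx {d : ℕ} (h : Euc d → ℝ≥0∞) (x : Euc d) : ℝ≥0∞ := ⨆ t ∈ Icc (1:ℝ) 2, ∫⁻ y, h (x - t • y) ∂(sphereMeasure d)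

lemma local_pow {d : ℕ} {I W : Euc d → ℝ≥0∞} (hI : Measurable I) (hW : Measurable W) (hI1 : ∀ x, I x ≤ 1) {s : ℝ} (hs : 1 ≤ s)
    (hN : ∫⁻ x, W x ≠ ∞) : ∫⁻ x, (∫⁻ w, I w * W (x - w)) ^ s ≤ (∫⁻ x, I x) * (∫⁻ x, W x) ^ s := by
  have hle : ∀ x, ∫⁻ w, I w * W (x - w) ≤ ∫⁻ x, W x := by
    intro x
    rw [← lintegral_sub_left_eq_self W x]
    exact lintegral_mono fun w => mul_le_of_le_one_left zero_le (hI1 w)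
  have hintg := conv_L1 hI hW
  generalize ∫⁻ x, W x = N at *
  calc _ ≤ ∫⁻ x, (∫⁻ w, I w * W (x - w)) * N ^ (s - 1) := by
        refine lintegral_mono fun z => ?_
        have hz := hle z
        generalize ∫⁻ w, I w * W (z - w) = F at *
        have : F ^ s = F ^ (1 + (s - 1)) := by congr 1; ring
        rw [this, ENNReal.rpow_add_of_nonneg _ _ zero_le_one (by linarith), ENNReal.rpow_one]
        exact mul_le_mul' le_rfl (ENNReal.rpow_le_rpow hz (by linarith))
    _ = (∫⁻ x, I x) * N ^ (1:ℝ) * N ^ (s - 1) := by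
        rw [lintegral_mul_const' _ _ (ENNReal.rpow_ne_top_of_nonneg (by linarith) hN), hintg, ENNReal.rpow_one]
    _ = _ := by
        rw [mul_assoc, ← ENNReal.rpow_add_of_nonneg _ _ zero_le_one (by linarith)]
        congr 2; ring

lemma U_bound {d : ℕ} (hd : 0 < d) {p q : ℝ} (hp : 1 ≤ p) (hpq : p ≤ q) : ∃ C : ℝ≥0∞, C ≠ ∞ ∧ ∀ h : Euc d → ℝ≥0∞, Measurable h →
    ∫⁻ x, h x ^ p ≠ ∞ → ∫⁻ x, (∫⁻ t in Icc (1:ℝ) 2, (∫⁻ y, h (x - t • y) ∂(sphereMeasure d))) ^ q ≤ C * (∫⁻ x, h x ^ p) ^ (q / p) := by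
  obtain ⟨C, hC⟩ := shell_bound hd
  have hp0 : 0 < p := by linarith
  have hq0 : 0 < q := by linarith
  have hp1 : 0 ≤ 1 - 1 / p := by rw [sub_nonneg, div_le_one hp0]; exact hp
  have hB : MeasurableSet (closedBall (0 : Euc d) 2) := measurableSet_closedBall
  obtain ⟨I, hId⟩ : ∃ I : Euc d → ℝ≥0∞, (closedBall (0 : Euc d) 2).indicator (1 : Euc d → ℝ≥0∞) = I := ⟨_, rfl⟩
  have hI : Measurable I := by rw [← hId]; exact measurable_one.indicator hB
  have hI1 : ∀ x, I x ≤ 1 := fun x => by rw [← hId]; exact indicator_le_self' (fun _ _ => zero_le) x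
  have hI01 : ∀ x, I x = 0 ∨ I x = 1 := fun x => by
    rw [← hId]; by_cases hx : x ∈ closedBall (0 : Euc d) 2
    · right; simp [hx]
    · left; rw [indicator_of_notMem hx]
  have hIb : ∀ w : Euc d, ‖w‖ ≤ 2 → I w = 1 := fun w hw => by
    rw [← hId, indicator_of_mem (by simpa using hw)]; rfl
  have hb : ∫⁻ x, I x ≠ ∞ := by rw [← hId, lintegral_indicator_one hB]; exact measure_closedBall_lt_top.ne
  refine ⟨((C:ℝ≥0∞) * (∫⁻ x, I x) ^ (1 - 1 / p)) ^ q * ∫⁻ x, I x, ?_, fun h hh hN => ?_⟩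
  · have i1 := ENNReal.rpow_ne_top_of_nonneg hp1 hb
    exact ENNReal.mul_ne_top (ENNReal.rpow_ne_top_of_nonneg hq0.le (ENNReal.mul_ne_top (by simp) i1)) hb
  have key : ∀ x, ∫⁻ t in Icc (1:ℝ) 2, (∫⁻ y, h (x - t • y) ∂(sphereMeasure d)) ≤
      C * (∫⁻ x, I x) ^ (1 - 1 / p) * (∫⁻ w, I w * h (x - w) ^ p) ^ (1 / p) := by
    intro x
    have e1 : ∫⁻ t in Icc (1:ℝ) 2, (∫⁻ y, h (x - t • y) ∂(sphereMeasure d)) =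
        ∫⁻ t in Icc (1:ℝ) 2, (∫⁻ y, I (t • y) * h (x - t • y) ∂(sphereMeasure d)) := by
      refine setLIntegral_congr_fun measurableSet_Icc fun t ht => lintegral_congr_ae ?_
      filter_upwards [sphM_ae_norm d] with y hy
      rw [hIb, one_mul]
      rw [norm_smul, hy, Real.norm_of_nonneg (by linarith [ht.1])]; linarith [ht.2]
    rw [e1, mul_assoc]
    refine (hC (fun w => I w * h (x - w)) (by fun_prop)).trans (mul_le_mul' le_rfl ?_)
    refine le_trans (lintegral_mono fun w => ?_) (ENNReal.lintegral_mul_norm_pow_le (f := I) (g := fun w => I w * h (x - w) ^ p) hI.aemeasurable (by fun_prop) hp1 (by positivity) (by ring))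
    rcases hI01 w with h0 | h1
    · rw [h0]; simp
    · simp only [h1, one_mul, ENNReal.one_rpow]
      rw [← ENNReal.rpow_mul, mul_one_div_cancel hp0.ne', ENNReal.rpow_one]
  calc _ ≤ ∫⁻ x, ((C:ℝ≥0∞) * (∫⁻ x, I x) ^ (1 - 1 / p)) ^ q * (∫⁻ w, I w * h (x - w) ^ p) ^ (q / p) := by
        refine lintegral_mono fun x => (ENNReal.rpow_le_rpow (key x) hq0.le).trans (le_of_eq ?_)
        rw [ENNReal.mul_rpow_of_nonneg _ _ hq0.le, ← ENNReal.rpow_mul]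
        congr 2; ring
    _ ≤ ((C:ℝ≥0∞) * (∫⁻ x, I x) ^ (1 - 1 / p)) ^ q * ((∫⁻ x, I x) * (∫⁻ x, h x ^ p) ^ (q / p)) := by
        rw [lintegral_const_mul' _ _ (ENNReal.rpow_ne_top_of_nonneg hq0.le (ENNReal.mul_ne_top (by simp) (ENNReal.rpow_ne_top_of_nonneg hp1 hb)))]
        refine mul_le_mul' le_rfl (local_pow hI (hh.pow_const p) hI1 ?_ hN)
        rw [one_le_div hp0]; exact hpq
    _ = _ := by ring

lemma diff_le_rVar {r : ℝ} (hr : 0 < r) {E : Set ℝ} (a : ℝ → ℂ) {s t : ℝ} (hs : s ∈ E) (ht : t ∈ E) : ‖a t - a s‖ₑ ≤ rVar r E a := by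
  wlog hst : s < t generalizing s t
  · rcases eq_or_lt_of_le (not_lt.1 hst) with h | h
    · rw [h]; simp
    · rw [enorm_sub_rev]; exact this ht hs h
  have := le_rVar (r := r) (E := E) (a := a) 1 ![s, t] (by
    intro i j hij; fin_cases i <;> fin_cases j <;> simp_all) (by intro i; fin_cases i <;> simp [hs, ht])
  simpa [← ENNReal.rpow_mul, mul_inv_cancel₀ hr.ne'] using this

lemma sph_lint_real {d : ℕ} {h : Euc d → ℝ} (hc : Continuous h) (hcc : HasCompactSupport h) (h0 : ∀ x, 0 ≤ h x) (t : ℝ) (x : Euc d) :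
    ∫⁻ y, ENNReal.ofReal (h (x - t • y)) ∂(sphereMeasure d) = ‖sphAvg (fun z => (h z : ℂ)) t x‖ₑ := by
  obtain ⟨M, _, hM⟩ := cc_bdd hc hcc
  have hi : Integrable (fun y => h (x - t • y)) (sphereMeasure d) :=
    Integrable.of_bound (by fun_prop : Continuous _).aestronglyMeasurable M (Filter.Eventually.of_forall fun y => hM _)
  rw [← ofReal_integral_eq_lintegral_ofReal hi (Filter.Eventually.of_forall fun y => h0 _)]
  have e : sphAvg (fun z => (h z : ℂ)) t x = ((∫ y, h (x - t • y) ∂(sphereMeasure d) : ℝ) : ℂ) := integral_ofReal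
  rw [e, ← ofReal_norm_eq_enorm, Complex.norm_real, Real.norm_of_nonneg (integral_nonneg fun y => h0 _)]

lemma Mx_cc {d : ℕ} {r : ℝ} (hr : 0 < r) {h : Euc d → ℝ} (hc : Continuous h) (hcc : HasCompactSupport h) (h0 : ∀ x, 0 ≤ h x) (x : Euc d) :
    Mx (fun z => ENNReal.ofReal (h z)) x ≤ VrIA r (fun z => (h z : ℂ)) x +
      ∫⁻ t in Icc (1:ℝ) 2, (∫⁻ y, ENNReal.ofReal (h (x - t • y)) ∂(sphereMeasure d)) := by
  refine iSup₂_le fun t ht => ?_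
  simp_rw [sph_lint_real hc hcc h0]
  have hv : volume (Icc (1:ℝ) 2) = 1 := by rw [Real.volume_Icc]; norm_num
  calc ‖sphAvg (fun z => (h z : ℂ)) t x‖ₑ = ∫⁻ s in Icc (1:ℝ) 2, ‖sphAvg (fun z => (h z : ℂ)) t x‖ₑ := by
        rw [setLIntegral_const, hv, mul_one]
    _ ≤ ∫⁻ s in Icc (1:ℝ) 2, (VrIA r (fun z => (h z : ℂ)) x + ‖sphAvg (fun z => (h z : ℂ)) s x‖ₑ) := by
        refine setLIntegral_mono' measurableSet_Icc fun s hs => ?_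
        have := diff_le_rVar hr (fun t => sphAvg (fun z => (h z : ℂ)) t x) hs ht
        refine le_trans ?_ (add_le_add this le_rfl)
        have e : sphAvg (fun z => (h z : ℂ)) t x = (sphAvg (fun z => (h z : ℂ)) t x - sphAvg (fun z => (h z : ℂ)) s x) + sphAvg (fun z => (h z : ℂ)) s x := by ring
        conv_lhs => rw [e]
        exact enorm_add_le _ _
    _ = _ := by
        rw [lintegral_add_left measurable_const, setLIntegral_const, hv, mul_one]

lemma Mx_meas {d : ℕ} {h : Euc d → ℝ} (hc : Continuous h) (hcc : HasCompactSupport h) (h0 : ∀ x, 0 ≤ h x) :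
    Measurable (Mx (fun z => ENNReal.ofReal (h z))) := by
  have hl : LowerSemicontinuous (Mx (fun z => ENNReal.ofReal (h z))) := by
    unfold Mx
    simp_rw [sph_lint_real hc hcc h0]
    refine lowerSemicontinuous_iSup fun t => lowerSemicontinuous_iSup fun _ => ?_
    refine Continuous.lowerSemicontinuous ?_
    have hcs : HasCompactSupport (fun z => (h z : ℂ)) := hcc.comp_left (g := fun u : ℝ => (u:ℂ)) (by simp)
    have := (sphAvg_cont (g := fun z => (h z : ℂ)) (by fun_prop) hcs).comp (by fun_prop : Continuous fun x : Euc d => (t, x))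
    exact this.enorm
  exact hl.measurable

lemma Mx_iSup {d : ℕ} {h : ℕ → Euc d → ℝ} (hc : ∀ n, Continuous (h n)) (hmono : ∀ x, Monotone fun n => h n x) (x : Euc d) :
    Mx (fun z => ⨆ n, ENNReal.ofReal (h n z)) x = ⨆ n, Mx (fun z => ENNReal.ofReal (h n z)) x := by
  unfold Mx
  have : ∀ t : ℝ, ∫⁻ y, (⨆ n, ENNReal.ofReal (h n (x - t • y))) ∂(sphereMeasure d) = ⨆ n, ∫⁻ y, ENNReal.ofReal (h n (x - t • y)) ∂(sphereMeasure d) := by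
    intro t
    refine lintegral_iSup (fun n => ?_) (fun m n hmn y => ENNReal.ofReal_le_ofReal (hmono _ hmn))
    have := hc n
    exact (ENNReal.continuous_ofReal.comp (by fun_prop : Continuous fun y => h n (x - t • y))).measurable
  simp_rw [this]
  rw [iSup_comm]
  refine iSup_congr fun t => ?_
  rw [iSup_comm]

lemma Mx_iSup_meas {d : ℕ} {h : ℕ → Euc d → ℝ} (hc : ∀ n, Continuous (h n)) (hcc : ∀ n, HasCompactSupport (h n)) (h0 : ∀ n x, 0 ≤ h n x)
    (hmono : ∀ x, Monotone fun n => h n x) : Measurable (Mx (fun z => ⨆ n, ENNReal.ofReal (h n z))) := by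
  rw [funext (Mx_iSup hc hmono)]
  exact Measurable.iSup fun n => Mx_meas (hc n) (hcc n) (h0 n)

lemma Mx_bound {d : ℕ} (hd : 0 < d) {r p q : ℝ} (hr : 1 ≤ r) (hp : 1 ≤ p) (hpq : p ≤ q) (hG : GlobBd d r p q) :
    ∃ C : ℝ≥0∞, C ≠ ∞ ∧ ∀ h : ℕ → Euc d → ℝ, (∀ n, Continuous (h n)) → (∀ n, HasCompactSupport (h n)) → (∀ n x, 0 ≤ h n x) →
    (∀ x, Monotone fun n => h n x) → ∀ K : ℝ≥0∞, (∀ n, ∫⁻ x, ENNReal.ofReal (h n x) ^ p ≤ K) →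
    ∫⁻ x, Mx (fun z => ⨆ n, ENNReal.ofReal (h n z)) x ^ q ≤ C * K ^ (q / p) := by
  obtain ⟨C1, hC1, H1⟩ := hG
  obtain ⟨C2, hC2, H2⟩ := U_bound hd hp hpq
  have hp0 : 0 < p := by linarith
  have hq0 : 0 < q := by linarith
  have hq1 : 1 ≤ q := by linarith
  have hqt : (2:ℝ≥0∞) ^ (q - 1) ≠ ∞ := ENNReal.rpow_ne_top_of_nonneg (by linarith) (by simp)
  refine ⟨2 ^ (q - 1) * (C1 + C2), by finiteness, fun h hc hcc h0 hmono K hK => ?_⟩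
  have single : ∀ n, ∫⁻ x, Mx (fun z => ENNReal.ofReal (h n z)) x ^ q ≤ 2 ^ (q - 1) * (C1 + C2) * K ^ (q / p) := by
    intro n
    have hcs : HasCompactSupport (fun z => (h n z : ℂ)) := (hcc n).comp_left (g := fun u : ℝ => (u:ℂ)) (by simp)
    have hcn := hc n
    have hcc' : Continuous (fun z => (h n z : ℂ)) := by fun_prop
    have hm := rVar_lsc_meas (r := r) (by linarith) hcc' hcs
    have e : ∀ x, ‖(h n x : ℂ)‖ₑ = ENNReal.ofReal (h n x) := fun x => by
      rw [← ofReal_norm_eq_enorm, Complex.norm_real, Real.norm_of_nonneg (h0 n x)]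
    have hfin := cc_Lp_fin hcc' hcs hp0
    have i1 := H1 _ hcc' hcs
    simp_rw [e] at i1 hfin
    have i2 := H2 (fun z => ENNReal.ofReal (h n z)) (by fun_prop) hfin
    have hKq : (∫⁻ x, ENNReal.ofReal (h n x) ^ p) ^ (q / p) ≤ K ^ (q / p) := ENNReal.rpow_le_rpow (hK n) (by positivity)
    calc _ ≤ ∫⁻ x, 2 ^ (q - 1) * (VrIA r (fun z => (h n z : ℂ)) x ^ q +
          (∫⁻ t in Icc (1:ℝ) 2, (∫⁻ y, ENNReal.ofReal (h n (x - t • y)) ∂(sphereMeasure d))) ^ q) := by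
          refine lintegral_mono fun x => (ENNReal.rpow_le_rpow (Mx_cc (r := r) (by linarith) hcn (hcc n) (h0 n) x) hq0.le).trans ?_
          exact ENNReal.rpow_add_le_mul_rpow_add_rpow _ _ hq1
      _ ≤ 2 ^ (q - 1) * (C1 * K ^ (q / p) + C2 * K ^ (q / p)) := by
          rw [lintegral_const_mul' _ _ hqt, lintegral_add_left (hm.pow_const q)]
          exact mul_le_mul' le_rfl (add_le_add (i1.trans (mul_le_mul' le_rfl hKq)) (i2.trans (mul_le_mul' le_rfl hKq)))
      _ = _ := by ring
  have hsup := Mx_iSup hc hmono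
  have hpow : ∀ x, Mx (fun z => ⨆ n, ENNReal.ofReal (h n z)) x ^ q = ⨆ n, Mx (fun z => ENNReal.ofReal (h n z)) x ^ q := by
    intro x
    rw [hsup]
    exact (ENNReal.orderIsoRpow q hq0).map_iSup _
  simp_rw [hpow]
  rw [lintegral_iSup (fun n => (Mx_meas (hc n) (hcc n) (h0 n)).pow_const q)]
  · exact iSup_le single
  · intro m n hmn x
    refine ENNReal.rpow_le_rpow ?_ hq0.le
    exact iSup₂_mono fun t _ => lintegral_mono fun y => ENNReal.ofReal_le_ofReal (hmono _ hmn)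

/-! ## P16: null sets and the extension -/

def obump {d : ℕ} (O : Set (Euc d)) (n : ℕ) (x : Euc d) : ℝ := min 1 (n * infDist x Oᶜ) * max 0 (min 1 (n - ‖x‖))

lemma obump_nonneg {d : ℕ} (O : Set (Euc d)) (n : ℕ) (x : Euc d) : 0 ≤ obump O n x := by
  have := infDist_nonneg (x := x) (s := Oᶜ)
  unfold obump; positivity

lemma obump_cont {d : ℕ} (O : Set (Euc d)) (n : ℕ) : Continuous (obump O n) := by
  have := continuous_infDist_pt (Oᶜ)
  unfold obump; fun_prop

lemma obump_cs {d : ℕ} (O : Set (Euc d)) (n : ℕ) : HasCompactSupport (obump O n) := by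
  refine HasCompactSupport.of_support_subset_isCompact (isCompact_closedBall (0 : Euc d) n) fun x hx => ?_
  by_contra h
  apply hx
  simp only [mem_closedBall, dist_zero_right, not_le] at h
  unfold obump
  rw [max_eq_left, mul_zero]
  exact (min_le_right _ _).trans (by linarith)

lemma obump_mono {d : ℕ} (O : Set (Euc d)) (x : Euc d) : Monotone fun n => obump O n x := by
  intro m n hmn
  have h : (m:ℝ) ≤ n := by exact_mod_cast hmn
  have := infDist_nonneg (x := x) (s := Oᶜ)
  simp only [obump]
  gcongr

lemma obump_le {d : ℕ} (O : Set (Euc d)) (n : ℕ) (x : Euc d) : ENNReal.ofReal (obump O n x) ≤ O.indicator 1 x := by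
  by_cases hx : x ∈ O
  · rw [indicator_of_mem hx, Pi.one_apply, ENNReal.ofReal_le_one]
    unfold obump
    exact mul_le_one₀ (min_le_left _ _) (le_max_left _ _) (max_le zero_le_one (min_le_left _ _))
  · have : obump O n x = 0 := by
      unfold obump
      rw [infDist_zero_of_mem (show x ∈ Oᶜ from hx)]; simp
    rw [this]; simp

lemma obump_sup {d : ℕ} {O : Set (Euc d)} (hO : IsOpen O) (hne : Oᶜ.Nonempty) (x : Euc d) : O.indicator 1 x ≤ ⨆ n, ENNReal.ofReal (obump O n x) := by
  by_cases hx : x ∈ O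
  · rw [indicator_of_mem hx, Pi.one_apply]
    have hpos : 0 < infDist x Oᶜ := (hO.isClosed_compl.notMem_iff_infDist_pos hne).1 (by simpa using hx)
    obtain ⟨n1, h1⟩ := exists_nat_ge (1 / infDist x Oᶜ)
    obtain ⟨n2, h2⟩ := exists_nat_ge (1 + ‖x‖)
    refine le_iSup_of_le (max n1 n2) ?_
    have i1 : 1 ≤ ((max n1 n2 : ℕ):ℝ) * infDist x Oᶜ := by
      rw [← div_le_iff₀ hpos]; exact h1.trans (by simp)
    have i2 : 1 ≤ ((max n1 n2 : ℕ):ℝ) - ‖x‖ := by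
      have : (n2:ℝ) ≤ ((max n1 n2 : ℕ):ℝ) := by simp
      linarith
    unfold obump
    rw [min_eq_left i1, min_eq_left i2]; simp
  · simp [hx]

lemma Mx_mono {d : ℕ} {h g : Euc d → ℝ≥0∞} (hg : ∀ x, h x ≤ g x) (x : Euc d) : Mx h x ≤ Mx g x :=
  iSup₂_mono fun _ _ => lintegral_mono fun _ => hg _

lemma Mx_null {d : ℕ} (hd : 0 < d) {r p q : ℝ} (hr : 1 ≤ r) (hp : 1 ≤ p) (hpq : p ≤ q) (hG : GlobBd d r p q) {Z : Set (Euc d)} (hZ : volume Z = 0) :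
    ∀ᵐ x : Euc d, ∀ t ∈ Icc (1:ℝ) 2, ∀ᵐ y ∂(sphereMeasure d), x - t • y ∉ Z := by
  obtain ⟨C, hC, H⟩ := Mx_bound hd hr hp hpq hG
  have hp0 : 0 < p := by linarith
  have hq0 : 0 < q := by linarith
  haveI : Nonempty (Fin d) := ⟨⟨0, hd⟩⟩
  have hun : volume (univ : Set (Euc d)) = ∞ := measure_univ_of_isAddLeftInvariant _
  have hO : ∀ k : ℕ, ∃ O ⊇ Z, IsOpen O ∧ volume O ≤ ((k:ℝ≥0∞) + 1)⁻¹ := by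
    intro k
    obtain ⟨O, h1, h2, h3⟩ := Set.exists_isOpen_le_add Z volume (ε := ((k:ℝ≥0∞) + 1)⁻¹) (by simp)
    exact ⟨O, h1, h2, by rwa [hZ, zero_add] at h3⟩
  choose O hOZ hOo hOv using hO
  have hne : ∀ k, (O k)ᶜ.Nonempty := by
    intro k
    rw [nonempty_compl]
    intro h
    have := hOv k
    rw [h, hun, top_le_iff] at this
    simp at this
  have hb : ∀ k, ∫⁻ x, Mx (fun z => ⨆ n, ENNReal.ofReal (obump (O k) n z)) x ^ q ≤ C * (((k:ℝ≥0∞) + 1)⁻¹) ^ (q / p) := by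
    intro k
    refine H _ (obump_cont _) (obump_cs _) (obump_nonneg _) (obump_mono _) _ fun n => ?_
    refine le_trans ?_ (hOv k)
    rw [← lintegral_indicator_one (hOo k).measurableSet]
    refine lintegral_mono fun x => ?_
    refine (ENNReal.rpow_le_rpow (obump_le (O k) n x) hp0.le).trans ?_
    by_cases hx : x ∈ O k
    · simp [hx]
    · simp [hx, hp0]
  have hm : Measurable fun x => ⨅ k, Mx (fun z => ⨆ n, ENNReal.ofReal (obump (O k) n z)) x :=
    Measurable.iInf fun k => Mx_iSup_meas (obump_cont _) (obump_cs _) (obump_nonneg _) (obump_mono _)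
  have hz : ∫⁻ x, (⨅ k, Mx (fun z => ⨆ n, ENNReal.ofReal (obump (O k) n z)) x) ^ q = 0 := by
    refine le_antisymm ?_ zero_le
    have ht : Filter.Tendsto (fun k : ℕ => C * (((k:ℝ≥0∞) + 1)⁻¹) ^ (q / p)) Filter.atTop (nhds 0) := by
      have h1 : Filter.Tendsto (fun k : ℕ => ((k:ℝ≥0∞) + 1)⁻¹) Filter.atTop (nhds 0) := by
        have := (Filter.tendsto_add_atTop_iff_nat 1).2 ENNReal.tendsto_inv_nat_nhds_zero
        simpa using this
      have h2 := (ENNReal.continuous_rpow_const (y := q / p)).tendsto 0 |>.comp h1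
      rw [ENNReal.zero_rpow_of_pos (by positivity)] at h2
      have h3 := ENNReal.Tendsto.const_mul h2 (Or.inr hC)
      simpa using h3
    refine ge_of_tendsto ht (Filter.Eventually.of_forall fun k => le_trans (lintegral_mono fun x => ?_) (hb k))
    exact ENNReal.rpow_le_rpow (iInf_le _ k) hq0.le
  rw [lintegral_eq_zero_iff (hm.pow_const q)] at hz
  filter_upwards [hz] with x hx t ht
  have hx0 : ⨅ k, Mx (fun z => ⨆ n, ENNReal.ofReal (obump (O k) n z)) x = 0 := by
    simpa [ENNReal.rpow_eq_zero_iff, hq0, not_lt.2 hq0.le] using hx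
  rw [ae_iff]
  refine le_antisymm ?_ zero_le
  rw [← hx0]
  refine le_iInf fun k => ?_
  have hmO : MeasurableSet {y : Euc d | x - t • y ∈ O k} := (by fun_prop : Measurable fun y : Euc d => x - t • y) (hOo k).measurableSet
  calc (sphereMeasure d) {y | ¬ (x - t • y ∉ Z)} ≤ (sphereMeasure d) {y | x - t • y ∈ O k} := by
        refine measure_mono fun y hy => hOZ k ?_
        simpa using hy
    _ = ∫⁻ y, (O k).indicator 1 (x - t • y) ∂(sphereMeasure d) := by
        rw [← lintegral_indicator_one hmO]; rfl
    _ ≤ ∫⁻ y, (⨆ n, ENNReal.ofReal (obump (O k) n (x - t • y))) ∂(sphereMeasure d) :=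
        lintegral_mono fun y => obump_sup (hOo k) (hne k) _
    _ ≤ _ := le_iSup₂_of_le (f := fun t (_ : t ∈ Icc (1:ℝ) 2) => ∫⁻ y, (⨆ n, ENNReal.ofReal (obump (O k) n (x - t • y))) ∂(sphereMeasure d)) t ht le_rfl

lemma eLp_real {d : ℕ} {F : Type*} [NormedAddCommGroup F] {p : ℝ} (hp : 0 < p) (f : Euc d → F) : eLpNorm f (ENNReal.ofReal p) volume = (∫⁻ x, ‖f x‖ₑ ^ p) ^ (1 / p) := by
  rw [eLpNorm_eq_lintegral_rpow_enorm_toReal (by simpa using hp) (by simp), ENNReal.toReal_ofReal hp.le]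

lemma sph_tendsto {d : ℕ} {F : ℕ → Euc d → ℂ} {f : Euc d → ℂ} (hc : ∀ n, Continuous (F n)) (hcs : ∀ n, HasCompactSupport (F n))
    {x : Euc d} {t : ℝ} (hae : ∀ᵐ y ∂(sphereMeasure d), Filter.Tendsto (fun n => F n (x - t • y)) Filter.atTop (nhds (f (x - t • y))))
    (hfin : ∫⁻ y, (⨆ n, ENNReal.ofReal (∑ k ∈ Finset.range n, ‖F (k+1) (x - t • y) - F k (x - t • y)‖)) ∂(sphereMeasure d) ≠ ∞) :
    Filter.Tendsto (fun n => sphAvg (F n) t x) Filter.atTop (nhds (sphAvg f t x)) := by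
  have hm : Measurable fun y : Euc d => (⨆ n, ENNReal.ofReal (∑ k ∈ Finset.range n, ‖F (k+1) (x - t • y) - F k (x - t • y)‖)) := by
    refine Measurable.iSup fun n => ENNReal.measurable_ofReal.comp (Continuous.measurable ?_)
    refine continuous_finsetSum _ fun k _ => ?_
    have := hc k; have := hc (k+1); fun_prop
  unfold sphAvg
  refine tendsto_integral_of_dominated_convergence (fun y => ‖F 0 (x - t • y)‖ + (⨆ n, ENNReal.ofReal (∑ k ∈ Finset.range n, ‖F (k+1) (x - t • y) - F k (x - t • y)‖)).toReal) ?_ ?_ ?_ hae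
  · intro n
    exact (sph_int_cc (hc n) (hcs n) t x).aestronglyMeasurable
  · exact (sph_int_cc (hc 0) (hcs 0) t x).norm.add (integrable_toReal_of_lintegral_ne_top hm.aemeasurable hfin)
  · intro n
    filter_upwards [ae_lt_top hm hfin] with y hy
    have h1 : ‖F n (x - t • y) - F 0 (x - t • y)‖ ≤ ∑ k ∈ Finset.range n, ‖F (k+1) (x - t • y) - F k (x - t • y)‖ := by
      rw [← Finset.sum_range_sub (fun k => F k (x - t • y))]
      exact norm_sum_le _ _
    have h2 : ∑ k ∈ Finset.range n, ‖F (k+1) (x - t • y) - F k (x - t • y)‖ ≤ (⨆ n, ENNReal.ofReal (∑ k ∈ Finset.range n, ‖F (k+1) (x - t • y) - F k (x - t • y)‖)).toReal := by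
      rw [← ENNReal.ofReal_le_iff_le_toReal hy.ne]
      exact le_iSup (fun n => ENNReal.ofReal (∑ k ∈ Finset.range n, ‖F (k+1) (x - t • y) - F k (x - t • y)‖)) n
    have h3 := norm_add_le (F 0 (x - t • y)) (F n (x - t • y) - F 0 (x - t • y))
    rw [add_sub_cancel] at h3
    linarith

lemma ext_bd {d : ℕ} (hd : 0 < d) {r p q : ℝ} (hr : 1 ≤ r) (hp : 1 ≤ p) (hpq : p ≤ q) (hG : GlobBd d r p q) : IsBddR d r p q := by
  have hp0 : 0 < p := by linarith
  have hq0 : 0 < q := by linarith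
  have hpt : ENNReal.ofReal p ≠ ∞ := by simp
  have hp1 : 1 ≤ ENNReal.ofReal p := by simpa using hp
  obtain ⟨C, hC, H⟩ := id hG
  obtain ⟨C', hC', H'⟩ := Mx_bound hd hr hp hpq hG
  refine ⟨(C ^ (1 / q)).toNNReal, fun f hf => ?_⟩
  rw [ENNReal.coe_toNNReal (ENNReal.rpow_ne_top_of_nonneg (by positivity) hC)]
  unfold lqNorm
  rw [if_neg (by simp), ENNReal.toReal_ofReal hq0.le]
  suffices hs : ∫⁻ x, VrIA r f x ^ q ≤ C * eLpNorm f (ENNReal.ofReal p) volume ^ q by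
    refine (ENNReal.rpow_le_rpow hs (by positivity)).trans (le_of_eq ?_)
    rw [ENNReal.mul_rpow_of_nonneg _ _ (by positivity), ← ENNReal.rpow_mul, mul_one_div_cancel hq0.ne', ENNReal.rpow_one]
  have hex : ∀ n : ℕ, ∃ g : Euc d → ℂ, HasCompactSupport g ∧ eLpNorm (f - g) (ENNReal.ofReal p) volume ≤ (2⁻¹ : ℝ≥0∞) ^ n ∧ Continuous g ∧ MemLp g (ENNReal.ofReal p) volume :=
    fun n => hf.exists_hasCompactSupport_eLpNorm_sub_le hpt (by simp)
  choose g hgcs hgd hgc hgm using hex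
  have hpow0 : Filter.Tendsto (fun n : ℕ => (2⁻¹ : ℝ≥0∞) ^ n) Filter.atTop (nhds 0) := ENNReal.tendsto_pow_atTop_nhds_zero_of_lt_one (by simp)
  have htm : TendstoInMeasure volume g Filter.atTop f := by
    refine tendstoInMeasure_of_tendsto_eLpNorm (p := ENNReal.ofReal p) (by simpa using hp0) (fun n => (hgm n).1) hf.1 ?_
    refine tendsto_of_tendsto_of_tendsto_of_le_of_le tendsto_const_nhds hpow0 (fun _ => zero_le) fun n => ?_
    change eLpNorm (g n - f) _ _ ≤ _
    rw [eLpNorm_sub_comm]; exact hgd n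
  obtain ⟨ns, hns, hae⟩ := htm.exists_seq_tendsto_ae
  obtain ⟨F, hF⟩ : ∃ F : ℕ → Euc d → ℂ, F = fun k => g (ns k) := ⟨_, rfl⟩
  have hFcs : ∀ n, HasCompactSupport (F n) := fun n => by rw [hF]; exact hgcs _
  have hFc : ∀ n, Continuous (F n) := fun n => by rw [hF]; exact hgc _
  have hFm : ∀ n, MemLp (F n) (ENNReal.ofReal p) volume := fun n => by rw [hF]; exact hgm _
  have hFd : ∀ n, eLpNorm (f - F n) (ENNReal.ofReal p) volume ≤ (2⁻¹ : ℝ≥0∞) ^ n := fun n => by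
    rw [hF]; exact (hgd _).trans (pow_le_pow_right_of_le_one' (by simp) (hns.id_le n))
  have haeF : ∀ᵐ x : Euc d, Filter.Tendsto (fun n => F n x) Filter.atTop (nhds (f x)) := by rw [hF]; exact hae
  clear hF hae htm hgcs hgd hgc hgm
  have hZ := Mx_null hd hr hp hpq hG (ae_iff.1 haeF)
  -- partial sums
  have hS : ∀ n, ∫⁻ x, ENNReal.ofReal (∑ k ∈ Finset.range n, ‖F (k+1) x - F k x‖) ^ p ≤ 4 ^ p := by
    intro n
    have h1 : eLpNorm (∑ k ∈ Finset.range n, fun x => ‖F (k+1) x - F k x‖) (ENNReal.ofReal p) volume ≤ 4 := by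
      refine (eLpNorm_sum_le (fun k _ => ((hFm (k+1)).1.sub (hFm k).1).norm) hp1).trans ?_
      have h2 : ∀ k ∈ Finset.range n, eLpNorm (fun x => ‖F (k+1) x - F k x‖) (ENNReal.ofReal p) volume ≤ 2 * (2⁻¹ : ℝ≥0∞) ^ k := by
        intro k _
        rw [eLpNorm_norm]
        have e : (fun x => F (k+1) x - F k x) = (f - F k) - (f - F (k+1)) := by ext x; simp
        rw [e]
        refine (eLpNorm_sub_le (hf.1.sub (hFm k).1) (hf.1.sub (hFm (k+1)).1) hp1).trans ?_
        rw [two_mul]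
        exact add_le_add (hFd k) ((hFd (k+1)).trans (pow_le_pow_right_of_le_one' (by simp) (by omega)))
      refine (Finset.sum_le_sum h2).trans ?_
      rw [← Finset.mul_sum]
      calc _ ≤ 2 * ∑' k : ℕ, (2⁻¹ : ℝ≥0∞) ^ k := mul_le_mul' le_rfl (ENNReal.sum_le_tsum _)
        _ = 4 := by rw [ENNReal.tsum_geometric, ENNReal.one_sub_inv_two, inv_inv]; norm_num
    rw [eLp_real hp0] at h1
    have h2 := ENNReal.rpow_le_rpow h1 hp0.le
    rw [← ENNReal.rpow_mul, one_div_mul_cancel hp0.ne', ENNReal.rpow_one] at h2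
    refine le_trans (le_of_eq (lintegral_congr fun x => ?_)) h2
    rw [Finset.sum_apply, ← ofReal_norm_eq_enorm, Real.norm_of_nonneg (Finset.sum_nonneg fun _ _ => norm_nonneg _)]
  have hc' : ∀ n, Continuous fun x => ∑ k ∈ Finset.range n, ‖F (k+1) x - F k x‖ := fun n =>
    continuous_finsetSum _ fun k _ => ((hFc (k+1)).sub (hFc k)).norm
  have hcs' : ∀ n, HasCompactSupport fun x => ∑ k ∈ Finset.range n, ‖F (k+1) x - F k x‖ := by
    intro n
    induction n with
    | zero => simp only [Finset.range_zero, Finset.sum_empty]; exact HasCompactSupport.zero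
    | succ n ih =>
      simp only [Finset.sum_range_succ]
      exact ih.add ((hFcs (n+1)).sub (hFcs n)).norm
  have h0' : ∀ n x, 0 ≤ ∑ k ∈ Finset.range n, ‖F (k+1) x - F k x‖ := fun n x => Finset.sum_nonneg fun _ _ => norm_nonneg _
  have hmono' : ∀ x, Monotone fun n => ∑ k ∈ Finset.range n, ‖F (k+1) x - F k x‖ := fun x =>
    monotone_nat_of_le_succ fun n => by rw [Finset.sum_range_succ]; linarith [norm_nonneg (F (n+1) x - F n x)]
  have hMb := H' (fun n x => ∑ k ∈ Finset.range n, ‖F (k+1) x - F k x‖) hc' hcs' h0' hmono' _ hS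
  have hMm := Mx_iSup_meas (h := fun n x => ∑ k ∈ Finset.range n, ‖F (k+1) x - F k x‖) hc' hcs' h0' hmono'
  have hMf := ae_lt_top (hMm.pow_const q) (ne_top_of_le_ne_top (by
    refine ENNReal.mul_ne_top hC' (ENNReal.rpow_ne_top_of_nonneg (by positivity) (ENNReal.rpow_ne_top_of_nonneg hp0.le (by simp)))) hMb)
  have hpt : ∀ᵐ x : Euc d, VrIA r f x ^ q ≤ Filter.liminf (fun n => VrIA r (F n) x ^ q) Filter.atTop := by
    filter_upwards [hZ, hMf] with x h1 h2
    have h3 : Mx (fun z => ⨆ n, ENNReal.ofReal (∑ k ∈ Finset.range n, ‖F (k+1) z - F k z‖)) x ≠ ∞ := by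
      intro h
      rw [h, ENNReal.top_rpow_of_pos hq0] at h2
      exact absurd h2 (by simp)
    have h4 : VrIA r f x ≤ Filter.liminf (fun n => VrIA r (F n) x) Filter.atTop := by
      refine rVar_lsc (by linarith) _ _ _ fun t ht => sph_tendsto hFc hFcs ?_ ?_
      · filter_upwards [h1 t ht] with y hy
        simpa using hy
      · refine ne_top_of_le_ne_top h3 ?_
        exact le_iSup₂_of_le (f := fun t (_ : t ∈ Icc (1:ℝ) 2) => ∫⁻ y, (⨆ n, ENNReal.ofReal (∑ k ∈ Finset.range n, ‖F (k+1) (x - t • y) - F k (x - t • y)‖)) ∂(sphereMeasure d)) t ht le_rfl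
    refine (ENNReal.rpow_le_rpow h4 hq0.le).trans (le_of_eq ?_)
    exact (ENNReal.orderIsoRpow q hq0).liminf_apply
  refine (lintegral_mono_ae hpt).trans ((lintegral_liminf_le fun n => (rVar_lsc_meas (by linarith) (hFc n) (hFcs n)).pow_const q).trans ?_)
  have hlim : Filter.Tendsto (fun n : ℕ => C * (eLpNorm f (ENNReal.ofReal p) volume + (2⁻¹ : ℝ≥0∞) ^ n) ^ q) Filter.atTop (nhds (C * eLpNorm f (ENNReal.ofReal p) volume ^ q)) := by
    have h1 := (tendsto_const_nhds (x := eLpNorm f (ENNReal.ofReal p) volume)).add hpow0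
    rw [add_zero] at h1
    exact ENNReal.Tendsto.const_mul ((ENNReal.continuous_rpow_const (y := q)).tendsto _ |>.comp h1) (Or.inr hC)
  rw [← hlim.liminf_eq]
  refine Filter.liminf_le_liminf (Filter.Eventually.of_forall fun n => ?_)
  refine (H (F n) (hFc n) (hFcs n)).trans (mul_le_mul' le_rfl ?_)
  have e : (∫⁻ x, ‖F n x‖ₑ ^ p) ^ (q / p) = eLpNorm (F n) (ENNReal.ofReal p) volume ^ q := by
    rw [eLp_real hp0, ← ENNReal.rpow_mul]; congr 1; ring
  rw [e]
  refine ENNReal.rpow_le_rpow ?_ hq0.le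
  have e2 : F n = f - (f - F n) := by ext x; simp
  conv_lhs => rw [e2]
  exact (eLpNorm_sub_le hf.1 (hf.1.sub (hFm n).1) hp1).trans (add_le_add le_rfl (hFd n))

/-! ## P17: geometry of the pentagon and the positive results -/

lemma rbasic {d : ℕ} (hd : 3 ≤ d) {r : ℝ} (hr1 : (d : ℝ) / ((d : ℝ) - 1) < r)
    (hr2 : r ≤ ((d : ℝ) ^ 2 + 1) / ((d : ℝ) * ((d : ℝ) - 1))) :
    (3:ℝ) ≤ d ∧ 1 < r ∧ r ≤ 2 ∧ (d:ℝ) < r * (d - 1) ∧ r * (d * (d - 1)) ≤ d ^ 2 + 1 := by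
  have hD : (3:ℝ) ≤ d := by exact_mod_cast hd
  generalize (d:ℝ) = D at *
  rw [div_lt_iff₀ (by linarith)] at hr1
  rw [le_div_iff₀ (by nlinarith)] at hr2
  refine ⟨hD, ?_, ?_, hr1, hr2⟩
  · by_contra h; nlinarith
  · by_contra h; nlinarith

lemma key_lt {D r p q : ℝ} (hD : 3 ≤ D) (r1 : 1 < r) (r2 : r ≤ 2) (r3 : D < r * (D - 1)) (r4 : r * (D * (D - 1)) ≤ D ^ 2 + 1) (hq : 0 < q)
    (i1 : 1 / q ≤ 1 / p) (i2 : 1 / (r * D) < 1 / q) (i3 : 1 / p < 1 - 1 / D) (i4 : (D + 1) * (1 / p) < (D - 1) * (1 + 1 / q))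
    (i5 : 1 / p - 1 / q < 1 - 2 / (r * (D - 1))) :
    max (1 / p) (max (1 / 2) (1 - (D + 1) / (D - 1) * (1 / q))) < min (1 - 1 / D) (min ((D - 1) / (D + 1) * (1 + 1 / q)) (1 + 1 / q - 2 / (r * (D - 1)))) := by
  have hD1 : 0 < D - 1 := by linarith
  have hD0 : 0 < D := by linarith
  have hr0 : 0 < r := by linarith
  have hy0 : 0 < 1 / q := by positivity
  have hyr : 1 < (1 / q) * (r * D) := by
    rw [div_lt_iff₀ (by positivity)] at i2; linarith
  generalize 1 / q = y at *
  generalize 1 / p = x at *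
  have gy2 : (D - 1) < y * (D ^ 2 + 1) := by
    have h1 : y * (r * (D * (D - 1))) ≤ y * (D ^ 2 + 1) := mul_le_mul_of_nonneg_left r4 hy0.le
    have h2 := mul_lt_mul_of_pos_right hyr hD1
    nlinarith
  have gy : (D - 1) < y * (D * (D + 1)) := by
    have : y * (D ^ 2 + 1) ≤ y * (D * (D + 1)) := mul_le_mul_of_nonneg_left (by nlinarith) hy0.le
    linarith
  have h6 : D - 1 < y * (r * (D - 1)) * D := by
    have h2 := mul_lt_mul_of_pos_right hyr hD1
    nlinarith
  have h3 : D * D < r * (D - 1) * D := mul_lt_mul_of_pos_right r3 hD0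
  refine lt_min (max_lt ?_ (max_lt ?_ ?_)) (lt_min (max_lt ?_ (max_lt ?_ ?_)) (max_lt ?_ (max_lt ?_ ?_)))
  · exact i3
  · rw [lt_sub_iff_add_lt, ← lt_sub_iff_add_lt', div_lt_iff₀ hD0]; linarith
  · rw [sub_lt_sub_iff_left, div_mul_eq_mul_div, div_lt_div_iff₀ hD0 hD1]; linarith
  · rw [div_mul_eq_mul_div, lt_div_iff₀ (by linarith)]; linarith
  · rw [div_mul_eq_mul_div, lt_div_iff₀ (by linarith)]
    have : 0 < (D - 1) * y := mul_pos hD1 hy0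
    linarith
  · have h7 : (1 - (D + 1) / (D - 1) * y) * ((D + 1) * (D - 1)) = (D + 1) * (D - 1) - (D + 1) ^ 2 * y := by field_simp
    have h8 : ((D - 1) / (D + 1) * (1 + y)) * ((D + 1) * (D - 1)) = (D - 1) ^ 2 * (1 + y) := by field_simp
    refine lt_of_mul_lt_mul_right (a := (D + 1) * (D - 1)) ?_ (by positivity)
    rw [h7, h8]; linarith
  · linarith
  · rw [lt_sub_iff_add_lt, ← lt_sub_iff_add_lt', div_lt_iff₀ (by positivity)]
    by_contra h; push Not at h
    have h7 := mul_le_mul_of_nonneg_right h hD0.le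
    nlinarith
  · have : 2 / (r * (D - 1)) < y + (D + 1) / (D - 1) * y := by
      rw [show y + (D + 1) / (D - 1) * y = (2 * D * y) / (D - 1) by field_simp; ring, div_lt_div_iff₀ (by positivity) hD1]
      linarith
    linarith

lemma Q14 {D r : ℝ} (hD : 3 ≤ D) (r1 : 1 < r) (r3 : D < r * (D - 1)) : 1 / (r * D) < 1 - (D + 1) / (r * D * (D - 1)) := by
  have hD1 : 0 < D - 1 := by linarith
  have e : 1 / (r * D) + (D + 1) / (r * D * (D - 1)) = 2 / (r * (D - 1)) := by field_simp; ring
  have : 2 / (r * (D - 1)) < 1 := by rw [div_lt_one (by positivity)]; linarith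
  linarith

lemma pos_int {d : ℕ} (hd : 3 ≤ d) {r : ℝ} (hr1 : (d : ℝ) / ((d : ℝ) - 1) < r)
    (hr2 : r ≤ ((d : ℝ) ^ 2 + 1) / ((d : ℝ) * ((d : ℝ) - 1))) {p q : ℝ} (hp : 0 < p) (hq : 0 < q)
    (i1 : 1 / q ≤ 1 / p) (i2 : 1 / (r * d) < 1 / q) (i3 : 1 / p < 1 - 1 / d) (i4 : (d + 1) * (1 / p) < (d - 1) * (1 + 1 / q))
    (i5 : 1 / p - 1 / q < 1 - 2 / (r * (d - 1))) : IsBddR d r p q := by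
  obtain ⟨hD, r1, r2, r3, r4⟩ := rbasic hd hr1 hr2
  have hD1 : (0:ℝ) < d - 1 := by linarith
  have hD0 : (0:ℝ) < d := by linarith
  have hr0 : 0 < r := by linarith
  have hy0 : 0 < 1 / q := by positivity
  have key : ∃ x0 : ℝ, 1 / p < x0 ∧ 1 / 2 < x0 ∧ 1 - ((d:ℝ) + 1) / (d - 1) * (1 / q) < x0 ∧ x0 < 1 - 1 / d ∧
      x0 < (d - 1) / (d + 1) * (1 + 1 / q) ∧ x0 < 1 + 1 / q - 2 / (r * (d - 1)) := by
    have := key_lt hD r1 r2 r3 r4 hq i1 i2 i3 i4 i5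
    obtain ⟨x0, h1, h2⟩ := exists_between this
    simp only [max_lt_iff, lt_min_iff] at h1 h2
    exact ⟨x0, h1.1, h1.2.1, h1.2.2, h2.1, h2.2.1, h2.2.2⟩
  obtain ⟨x0, k1, k2, k3, k4, k5, k6⟩ := key
  have hx1 : x0 < 1 := by have : (0:ℝ) < 1 / d := by positivity
                          linarith
  have hpx : 1 < p * x0 := by rw [div_lt_iff₀ hp] at k1; linarith
  have hpq : p ≤ q := by rwa [one_div_le_one_div hq hp] at i1
  have hp1 : 1 ≤ p := by nlinarith
  have eθ : 1 - 2 * (1 - x0) / 2 = x0 := by ring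
  have k4' : 1 < (1 - x0) * d := by
    rw [lt_sub_iff_add_lt, ← lt_sub_iff_add_lt', div_lt_iff₀ hD0] at k4; linarith
  have hqx : 1 ≤ q * x0 := by
    have := mul_lt_mul_of_pos_left (lt_of_le_of_lt i1 k1) hq
    rw [mul_one_div_cancel hq.ne'] at this; exact this.le
  have hM : MBound d r q (2 * (1 - x0)) := by
    clear hr1 hr2 i1 i2 i3 i4 i5 hpx hpq hp1
    refine M_main hd r1.le r2 (by linarith) (by linarith) hq ?_ ?_ ?_ ?_ ?_ ?_
    · rw [eθ]; exact hqx
    · have : (1 - x0) < ((d:ℝ) + 1) / (d - 1) * (1 / q) := by linarith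
      have h := mul_lt_mul_of_pos_right this hq
      rw [mul_assoc, one_div_mul_cancel hq.ne'] at h
      linarith
    · rw [div_lt_iff₀ hr0]
      have : r * ((d:ℝ) - 1) * (1 - x0) > d * (1 - x0) := by nlinarith
      nlinarith
    · rw [eθ]; nlinarith
    · have h : 2 / (r * ((d:ℝ) - 1)) < 1 / q + 1 - x0 := by linarith
      rw [div_lt_iff₀ (by positivity)] at h
      rw [div_lt_iff₀ hr0]; nlinarith
    · rw [div_mul_eq_mul_div, lt_div_iff₀ (by linarith)] at k5
      rw [eθ]; nlinarith
  exact ext_bd (by omega) r1.le hp1 hpq (glob_of_loc r1.le hp hpq (loc_bd hd r1.le (by linarith) (by linarith) (by linarith) hp (by rw [eθ]; exact hpx) hM))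

lemma pos_end {d : ℕ} (hd : 3 ≤ d) {r : ℝ} (hr1 : (d : ℝ) / ((d : ℝ) - 1) < r)
    (hr2 : r ≤ ((d : ℝ) ^ 2 + 1) / ((d : ℝ) * ((d : ℝ) - 1))) {p : ℝ} (hp : 0 < p)
    (i1 : 1 / (r * d) ≤ 1 / p) (i2 : 1 / p < 1 - ((d : ℝ) + 1) / (r * (d : ℝ) * ((d : ℝ) - 1))) : IsBddR d r p (r * d) := by
  obtain ⟨hD, r1, r2, r3, r4⟩ := rbasic hd hr1 hr2
  have hD1 : (0:ℝ) < d - 1 := by linarith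
  have hD0 : (0:ℝ) < d := by linarith
  have hr0 : 0 < r := by linarith
  have hq : 0 < r * d := by positivity
  have hhalf : 1 / 2 < 1 - ((d : ℝ) + 1) / (r * (d : ℝ) * ((d : ℝ) - 1)) := by
    rw [lt_sub_iff_add_lt, ← lt_sub_iff_add_lt', div_lt_iff₀ (by positivity)]; nlinarith
  obtain ⟨x0, h1, h2⟩ := exists_between (max_lt i2 hhalf)
  obtain ⟨k1, k2⟩ := max_lt_iff.1 h1
  have hc : 1 - ((d : ℝ) + 1) / (r * (d : ℝ) * ((d : ℝ) - 1)) ≤ 1 / r := by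
    rw [sub_le_iff_le_add, div_add_div _ _ hr0.ne' (by positivity), le_div_iff₀ (by positivity)]; nlinarith
  have hx1 : x0 < 1 := by have : 0 < ((d : ℝ) + 1) / (r * (d : ℝ) * ((d : ℝ) - 1)) := by positivity
                          linarith
  have hpx : 1 < p * x0 := by rw [div_lt_iff₀ hp] at k1; linarith
  have hpq : p ≤ r * d := by rwa [one_div_le_one_div hq hp] at i1
  have hp1 : 1 ≤ p := by nlinarith
  have eθ : 1 - 2 * (1 - x0) / 2 = x0 := by ring
  have hM : MBound d r (r * d) (2 * (1 - x0)) := by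
    refine M_end hd r1.le r2 (by linarith) (by rw [eθ]; linarith) ?_
    have : ((d : ℝ) + 1) / (r * (d : ℝ) * ((d : ℝ) - 1)) < 1 - x0 := by linarith
    rw [div_lt_iff₀ (by positivity)] at this
    rw [div_lt_iff₀ hD1]; nlinarith
  exact ext_bd (by omega) r1.le hp1 hpq (glob_of_loc r1.le hp hpq (loc_bd hd r1.le (by linarith) (by linarith) (by linarith) hp (by rw [eθ]; exact hpx) hM))

lemma pos_diag {d : ℕ} (hd : 3 ≤ d) {r : ℝ} (hr1 : (d : ℝ) / ((d : ℝ) - 1) < r)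
    (hr2 : r ≤ ((d : ℝ) ^ 2 + 1) / ((d : ℝ) * ((d : ℝ) - 1))) {p : ℝ} (hp : 0 < p)
    (i1 : 1 / (r * d) ≤ 1 / p) (i2 : 1 / p < ((d : ℝ) - 1) / d) : IsBddR d r p p := by
  obtain ⟨hD, r1, r2, r3, r4⟩ := rbasic hd hr1 hr2
  have hD1 : (0:ℝ) < d - 1 := by linarith
  have hD0 : (0:ℝ) < d := by linarith
  have hr0 : 0 < r := by linarith
  rcases eq_or_lt_of_le i1 with h | h
  · have e : p = r * d := by
      rw [one_div, one_div, inv_inj] at h; exact h.symm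
    have := pos_end hd hr1 hr2 hp i1 (by
      rw [← h]; exact Q14 hD r1 r3)
    rwa [← e] at this
  · refine pos_int hd hr1 hr2 hp hp le_rfl h (by rwa [sub_div, div_self hD0.ne'] at i2) ?_ ?_
    · have : 1 / p < 1 := i2.trans (by rw [div_lt_one hD0]; linarith)
      nlinarith
    · rw [sub_self, sub_pos, div_lt_one (by positivity)]; linarith

lemma seg_end {d : ℕ} (hd : 3 ≤ d) {r : ℝ} (hr1 : (d : ℝ) / ((d : ℝ) - 1) < r)
    (hr2 : r ≤ ((d : ℝ) ^ 2 + 1) / ((d : ℝ) * ((d : ℝ) - 1))) {p q : ℝ} (hp : 0 < p) (hq : 0 < q)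
    (h : (1 / p, 1 / q) ∈
          segment ℝ ((1 - ((d : ℝ) + 1) / (r * (d : ℝ) * ((d : ℝ) - 1)), 1 / (r * (d : ℝ))))
            ((1 / (r * (d : ℝ)), 1 / (r * (d : ℝ)))) \
            {((1 - ((d : ℝ) + 1) / (r * (d : ℝ) * ((d : ℝ) - 1)), 1 / (r * (d : ℝ))))}) : IsBddR d r p q := by
  obtain ⟨⟨a, b, ha, hb, hab, he⟩, hne⟩ := h
  obtain ⟨hD, r1, r2, r3, r4⟩ := rbasic hd hr1 hr2
  have hD1 : (0:ℝ) < d - 1 := by linarith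
  have hD0 : (0:ℝ) < d := by linarith
  have hr0 : 0 < r := by linarith
  have hlt : 1 / (r * d) < 1 - ((d : ℝ) + 1) / (r * (d : ℝ) * ((d : ℝ) - 1)) := by
    exact Q14 hD r1 r3
  simp only [Prod.smul_mk, Prod.mk_add_mk, Prod.mk.injEq, smul_eq_mul, mem_singleton_iff, not_and] at he hne
  obtain ⟨e1, e2⟩ := he
  have e2' : 1 / q = 1 / (r * d) := by rw [← e2, ← add_mul, hab, one_mul]
  have eq : q = r * d := by rw [one_div, one_div, inv_inj] at e2'; exact e2'
  rw [eq]
  have hb0 : 0 < b := by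
    rcases eq_or_lt_of_le hb with h | h
    · exfalso
      have : a = 1 := by linarith
      refine hne ?_ e2'
      rw [← e1, this, ← h]; ring
    · exact h
  have hab' : a = 1 - b := by linarith
  refine pos_end hd hr1 hr2 hp ?_ ?_
  · clear hr1 hr2 r3 r4 hne; generalize 1 - ((d : ℝ) + 1) / (r * (d : ℝ) * ((d : ℝ) - 1)) = c at *
    rw [← e1, hab']; nlinarith
  · clear hr1 hr2 r3 r4 hne; generalize 1 - ((d : ℝ) + 1) / (r * (d : ℝ) * ((d : ℝ) - 1)) = c at *
    rw [← e1, hab']; nlinarith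

lemma seg_diag {d : ℕ} (hd : 3 ≤ d) {r : ℝ} (hr1 : (d : ℝ) / ((d : ℝ) - 1) < r)
    (hr2 : r ≤ ((d : ℝ) ^ 2 + 1) / ((d : ℝ) * ((d : ℝ) - 1))) {p q : ℝ} (hp : 0 < p) (hq : 0 < q)
    (h : (1 / p, 1 / q) ∈
          segment ℝ ((1 / (r * (d : ℝ)), 1 / (r * (d : ℝ))))
            ((((d : ℝ) - 1) / d, ((d : ℝ) - 1) / d)) \
            {((((d : ℝ) - 1) / d, ((d : ℝ) - 1) / d))}) : IsBddR d r p q := by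
  obtain ⟨⟨a, b, ha, hb, hab, he⟩, hne⟩ := h
  obtain ⟨hD, r1, r2, r3, r4⟩ := rbasic hd hr1 hr2
  have hD1 : (0:ℝ) < d - 1 := by linarith
  have hD0 : (0:ℝ) < d := by linarith
  have hr0 : 0 < r := by linarith
  have hlt : 1 / (r * d) < ((d : ℝ) - 1) / d := by
    rw [div_lt_div_iff₀ (by positivity) hD0]; nlinarith
  simp only [Prod.smul_mk, Prod.mk_add_mk, Prod.mk.injEq, smul_eq_mul, mem_singleton_iff, not_and] at he hne
  obtain ⟨e1, e2⟩ := he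
  have e2' : 1 / q = 1 / p := by rw [← e2, ← e1]
  have eq : q = p := by rw [one_div, one_div, inv_inj] at e2'; exact e2'
  rw [eq]
  have ha0 : 0 < a := by
    rcases eq_or_lt_of_le ha with h | h
    · exfalso
      have : b = 1 := by linarith
      refine hne ?_ ?_
      · rw [← e1, this, ← h]; ring
      · rw [← e2, this, ← h]; ring
    · exact h
  have hab' : b = 1 - a := by linarith
  refine pos_diag hd hr1 hr2 hp ?_ ?_
  · rw [← e1, hab']; nlinarith
  · rw [← e1, hab']; nlinarith

lemma int_half {S : Set (ℝ × ℝ)} {a b c : ℝ} (h : ∀ z ∈ S, a * z.1 + b * z.2 ≤ c) (hab : 0 < a ^ 2 + b ^ 2) {z : ℝ × ℝ}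
    (hz : z ∈ interior S) : a * z.1 + b * z.2 < c := by
  have hc : Filter.Tendsto (fun t : ℝ => z + t • (a, b)) (nhdsWithin 0 (Ioi 0)) (nhds z) := by
    have : Continuous fun t : ℝ => z + t • (a, b) := by fun_prop
    have h2 := (this.tendsto 0).mono_left (nhdsWithin_le_nhds (s := Ioi 0))
    simpa using h2
  have h1 := hc.eventually (mem_interior_iff_mem_nhds.1 hz)
  obtain ⟨t, ht, ht0⟩ := (h1.and self_mem_nhdsWithin).exists
  have h2 := h _ ht
  simp only [Prod.fst_add, Prod.snd_add, Prod.smul_fst, Prod.smul_snd, smul_eq_mul] at h2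
  have : 0 < t * (a ^ 2 + b ^ 2) := mul_pos ht0 hab
  nlinarith

lemma pent_sub {d : ℕ} (hd : 3 ≤ d) {r : ℝ} (hr1 : (d : ℝ) / ((d : ℝ) - 1) < r)
    (hr2 : r ≤ ((d : ℝ) ^ 2 + 1) / ((d : ℝ) * ((d : ℝ) - 1))) {a b c : ℝ}
    (h1 : a * (1 / (r * d)) + b * (1 / (r * d)) ≤ c)
    (h2 : a * (((d : ℝ) - 1) / d) + b * (((d : ℝ) - 1) / d) ≤ c)
    (h3 : a * (((d : ℝ) - 1) / d) + b * (1 / d) ≤ c)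
    (h4 : a * (1 / r) + b * (((d : ℝ) + 1 - r * ((d : ℝ) - 1)) / (r * ((d : ℝ) - 1))) ≤ c)
    (h5 : a * (1 - ((d : ℝ) + 1) / (r * (d : ℝ) * ((d : ℝ) - 1))) + b * (1 / (r * (d : ℝ))) ≤ c) :
    ∀ z ∈ pentagonMid d r, a * z.1 + b * z.2 ≤ c := by
  have hcv : Convex ℝ {z : ℝ × ℝ | a * z.1 + b * z.2 ≤ c} := by
    have := convex_halfSpace_le (𝕜 := ℝ) (f := fun z : ℝ × ℝ => a * z.1 + b * z.2) ⟨by intro x y; simp; ring, by intro k x; simp; ring⟩ c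
    exact this
  have : pentagonMid d r ⊆ {z : ℝ × ℝ | a * z.1 + b * z.2 ≤ c} := by
    refine convexHull_min ?_ hcv
    intro z hz
    simp only [mem_insert_iff, mem_singleton_iff] at hz
    rcases hz with rfl | rfl | rfl | rfl | rfl
    · exact h1
    · exact h2
    · exact h3
    · exact h4
    · exact h5
  exact this

lemma rep {d : ℕ} (hd : 3 ≤ d) {r : ℝ} (hr1 : (d : ℝ) / ((d : ℝ) - 1) < r)
    (hr2 : r ≤ ((d : ℝ) ^ 2 + 1) / ((d : ℝ) * ((d : ℝ) - 1))) : ∃ R δ η : ℝ, R = 1 / r ∧ δ = 1 / (d:ℝ) ∧ 1 / (r * d) = R * δ ∧ ((d:ℝ) - 1) / d = 1 - δ ∧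
    ((d : ℝ) + 1 - r * ((d : ℝ) - 1)) / (r * ((d : ℝ) - 1)) = R * (1 + 2 * η) - 1 ∧
    ((d : ℝ) + 1) / (r * (d : ℝ) * ((d : ℝ) - 1)) = R * (2 * η - δ) ∧ 2 / (r * ((d:ℝ) - 1)) = 2 * R * η ∧
    0 < R ∧ 0 < δ ∧ 0 < η ∧ δ ≤ 1 / 3 ∧ η ≤ 1 / 2 ∧ η = δ + δ * η ∧ R < 1 - δ ∧ 1 ≤ R * (1 + 2 * η - δ) ∧ (d:ℝ) + 1 = d * (1 + δ) ∧
    (d:ℝ) - 1 = d * (1 - δ) ∧ 2 * R * η ≤ 1 ∧ R * η ≤ δ ∧ δ ≤ R * (2 * η - δ) ∧ δ ≤ R * (2 * η - δ - δ ^ 2) ∧ R * δ ≤ δ ∧ R * η * δ = R * η - R * δ := by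
  obtain ⟨hD, r1, r2, r3, r4⟩ := rbasic hd hr1 hr2
  have hD1 : (0:ℝ) < d - 1 := by linarith
  have hD0 : (0:ℝ) < d := by linarith
  have hr0 : 0 < r := by linarith
  -- clear denominators
  obtain ⟨R, hR⟩ : ∃ R, R = 1 / r := ⟨_, rfl⟩
  obtain ⟨δ, hδ⟩ : ∃ δ, δ = 1 / (d:ℝ) := ⟨_, rfl⟩
  obtain ⟨η, hη⟩ : ∃ η, η = 1 / ((d:ℝ) - 1) := ⟨_, rfl⟩
  have a1 : 1 / (r * d) = R * δ := by rw [hR, hδ]; field_simp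
  have a2 : ((d:ℝ) - 1) / d = 1 - δ := by rw [hδ]; field_simp
  have a3 : ((d : ℝ) + 1 - r * ((d : ℝ) - 1)) / (r * ((d : ℝ) - 1)) = R * (1 + 2 * η) - 1 := by rw [hR, hη]; field_simp; ring
  have a4 : ((d : ℝ) + 1) / (r * (d : ℝ) * ((d : ℝ) - 1)) = R * (2 * η - δ) := by rw [hR, hη, hδ]; field_simp; ring
  have a5 : 2 / (r * ((d:ℝ) - 1)) = 2 * R * η := by rw [hR, hη]; field_simp
  have b1 : R * r = 1 := by rw [hR]; field_simp
  have b2 : δ * d = 1 := by rw [hδ]; field_simp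
  have b3 : η * (d - 1) = 1 := by rw [hη]; field_simp
  have R0 : 0 < R := by rw [hR]; positivity
  have δ0 : 0 < δ := by rw [hδ]; positivity
  have η0 : 0 < η := by rw [hη]; positivity
  have c1 : δ ≤ 1 / 3 := by nlinarith
  have c2 : η ≤ 1 / 2 := by nlinarith
  have c3 : η = δ + δ * η := by
    have : η * (d - 1) * δ = δ := by rw [b3, one_mul]
    nlinarith
  have c4 : R < 1 - δ := by
    have h5 := mul_lt_mul_of_pos_left r3 (mul_pos R0 δ0)
    have e1 : R * δ * d = R := by rw [mul_assoc, b2, mul_one]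
    have e2 : R * δ * (r * (d - 1)) = 1 - δ := by
      calc _ = (R * r) * (δ * d - δ) := by ring
        _ = _ := by rw [b1, b2, one_mul]
    linarith
  have c5 : 1 ≤ R * (1 + 2 * η - δ) := by
    have h5 := mul_le_mul_of_nonneg_left r4 (mul_pos (mul_pos R0 δ0) η0).le
    have e1 : R * δ * η * (r * (d * (d - 1))) = 1 := by
      calc _ = (R * r) * (δ * d) * (η * (d - 1)) := by ring
        _ = _ := by rw [b1, b2, b3]; ring
    have e3 : η * d = 1 + η := by linarith
    have e2 : R * δ * η * (d ^ 2 + 1) = R * (1 + 2 * η - δ) := by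
      calc _ = R * ((δ * d) * (η * d) + δ * η) := by ring
        _ = _ := by rw [b2, e3]; rw [show δ * η = η - δ by linarith]; ring
    linarith
  have dh : (d:ℝ) + 1 = d * (1 + δ) := by linarith
  have f1 : 2 * R * η ≤ 1 := by nlinarith
  have f2 : R * η ≤ δ := by
    have := mul_lt_mul_of_pos_right c4 η0
    linarith
  have f3 : δ ≤ R * (2 * η - δ) := by linarith
  have f4 : δ ≤ R * (2 * η - δ - δ ^ 2) := by
    have h5 := mul_le_mul_of_nonneg_left c5 δ0.le
    have e : δ * (R * (1 + 2 * η - δ)) = R * (2 * η - δ - δ ^ 2) := by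
      calc _ = R * (δ + 2 * (δ * η) - δ ^ 2) := by ring
        _ = _ := by rw [show δ * η = η - δ by linarith]; ring
    linarith
  have f5 : R * δ ≤ δ := by nlinarith
  have f6 : R * η * δ = R * η - R * δ := by
    rw [mul_assoc, mul_comm η, show δ * η = η - δ by linarith]; ring
  have dh' : (d:ℝ) - 1 = d * (1 - δ) := by linarith
  exact ⟨R, δ, η, hR, hδ, a1, a2, a3, a4, a5, R0, δ0, η0, c1, c2, c3, c4, c5, dh, dh', f1, f2, f3, f4, f5, f6⟩

lemma interior_ineq {d : ℕ} (hd : 3 ≤ d) {r : ℝ} (hr1 : (d : ℝ) / ((d : ℝ) - 1) < r)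
    (hr2 : r ≤ ((d : ℝ) ^ 2 + 1) / ((d : ℝ) * ((d : ℝ) - 1))) {x y : ℝ} (h : (x, y) ∈ interior (pentagonMid d r)) :
    y < x ∧ 1 / (r * d) < y ∧ x < 1 - 1 / d ∧ (d + 1) * x < (d - 1) * (1 + y) ∧ x - y < 1 - 2 / (r * (d - 1)) := by
  obtain ⟨R, δ, η, hR', hδ, a1, a2, a3, a4, a5', R0, δ0, η0, c1, c2, c3, c4, c5, dh, dh', f1, f2, f3, f4, f5, f6⟩ := rep hd hr1 hr2
  have hD0 : (0:ℝ) < d := by exact_mod_cast (by omega : 0 < d)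
  have key : ∀ {a b c : ℝ}, 0 < a ^ 2 + b ^ 2 → (∀ z ∈ pentagonMid d r, a * z.1 + b * z.2 ≤ c) → a * x + b * y < c :=
    fun hab hh => int_half hh hab h
  have g1 : (1 + δ) * (R * δ) + -(1 - δ) * (R * δ) ≤ 1 - δ := by
    have : R * δ * δ ≤ δ * δ := mul_le_mul_of_nonneg_right f5 δ0.le
    nlinarith
  have g2 : (1 + δ) * (1 - δ) + -(1 - δ) * (1 - δ) ≤ 1 - δ := by nlinarith
  refine ⟨?_, ?_, ?_, ?_, ?_⟩
  · have := key (a := -1) (b := 1) (c := 0) (by norm_num) (pent_sub hd hr1 hr2 (by linarith) (by linarith) (by rw [a2, ← hδ]; linarith)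
      (by rw [a3, ← hR']; linarith) (by rw [a4, a1]; linarith))
    linarith
  · have := key (a := 0) (b := -1) (c := -(R * δ)) (by norm_num) (pent_sub hd hr1 hr2 (by rw [a1]; linarith) (by rw [a2]; linarith) (by rw [a2, ← hδ]; linarith)
      (by rw [a3, ← hR']; linarith) (by rw [a4, a1]; linarith))
    rw [a1]; linarith
  · have := key (a := 1) (b := 0) (c := 1 - δ) (by norm_num) (pent_sub hd hr1 hr2 (by rw [a1]; linarith) (by rw [a2]; linarith) (by rw [a2, ← hδ]; linarith)
      (by rw [a3, ← hR']; linarith) (by rw [a4, a1]; linarith))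
    rw [← hδ]; linarith
  · have := key (a := 1 + δ) (b := -(1 - δ)) (c := 1 - δ) (by positivity) (pent_sub hd hr1 hr2 (by rw [a1]; exact g1) (by rw [a2]; exact g2) (by rw [a2, ← hδ]; linarith)
      (by rw [a3, ← hR']; linarith) (by rw [a4, a1]; linarith))
    have e := mul_lt_mul_of_pos_left this hD0
    have e2 : (d:ℝ) * ((1 + δ) * x + -(1 - δ) * y) = (d + 1) * x - (d - 1) * y := by rw [dh, dh']; ring
    have e3 : (d:ℝ) * (1 - δ) = d - 1 := dh'.symm
    rw [e2, e3] at e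
    linarith
  · have := key (a := 1) (b := -1) (c := 1 - 2 * R * η) (by norm_num) (pent_sub hd hr1 hr2 (by rw [a1]; linarith) (by rw [a2]; linarith) (by rw [a2, ← hδ]; linarith)
      (by rw [a3, ← hR']; linarith) (by rw [a4, a1]; linarith))
    rw [a5']; linarith

/-! ## P18: half-planes description and the positive part -/

lemma cvx_line {S : Set (ℝ × ℝ)} (hS : Convex ℝ S) {α β γ x1 y1 x2 y2 y : ℝ} (h1 : (x1, y1) ∈ S) (h2 : (x2, y2) ∈ S)
    (e1 : α * x1 + β * y1 = γ) (e2 : α * x2 + β * y2 = γ) (hy1 : y1 ≤ y) (hy2 : y ≤ y2) : ∃ R, (R, y) ∈ S ∧ α * R + β * y = γ := by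
  rcases eq_or_lt_of_le (hy1.trans hy2) with h | h
  · have : y = y1 := le_antisymm (by linarith) hy1
    subst this
    exact ⟨x1, h1, e1⟩
  · have hd : 0 < y2 - y1 := by linarith
    refine ⟨((y2 - y) / (y2 - y1)) * x1 + ((y - y1) / (y2 - y1)) * x2, ?_, ?_⟩
    · have := hS h1 h2 (a := (y2 - y) / (y2 - y1)) (b := (y - y1) / (y2 - y1)) (div_nonneg (by linarith) hd.le) (div_nonneg (by linarith) hd.le)
        (by rw [← add_div, div_eq_one_iff_eq hd.ne']; ring)
      convert this using 1
      ext
      · simp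
      · simp only [Prod.smul_mk, Prod.mk_add_mk, smul_eq_mul]
        field_simp; ring
    · have h3 : α * x1 = γ - β * y1 := by linarith
      have h4 : α * x2 = γ - β * y2 := by linarith
      calc _ = ((y2 - y) / (y2 - y1)) * (α * x1) + ((y - y1) / (y2 - y1)) * (α * x2) + β * y := by ring
        _ = γ := by rw [h3, h4]; field_simp; ring

lemma cvx_hor {S : Set (ℝ × ℝ)} (hS : Convex ℝ S) {x1 x2 x y : ℝ} (h1 : (x1, y) ∈ S) (h2 : (x2, y) ∈ S) (i1 : x1 ≤ x) (i2 : x ≤ x2) : (x, y) ∈ S := by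
  rcases eq_or_lt_of_le (i1.trans i2) with h | h
  · have : x = x1 := le_antisymm (by linarith) i1
    rwa [this]
  · have hd : 0 < x2 - x1 := by linarith
    have := hS h1 h2 (a := (x2 - x) / (x2 - x1)) (b := (x - x1) / (x2 - x1)) (div_nonneg (by linarith) hd.le) (div_nonneg (by linarith) hd.le)
        (by rw [← add_div, div_eq_one_iff_eq hd.ne']; ring)
    convert this using 1
    ext
    · simp only [Prod.smul_mk, Prod.mk_add_mk, smul_eq_mul]
      field_simp; ring
    · simp only [Prod.smul_mk, Prod.mk_add_mk, smul_eq_mul]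
      field_simp; ring

lemma pent_of_ineq {d : ℕ} (hd : 3 ≤ d) {r : ℝ} (hr1 : (d : ℝ) / ((d : ℝ) - 1) < r)
    (hr2 : r ≤ ((d : ℝ) ^ 2 + 1) / ((d : ℝ) * ((d : ℝ) - 1))) {x y : ℝ} (k1 : y ≤ x) (k2 : 1 / (r * d) ≤ y) (k3 : x ≤ 1 - 1 / d)
    (k4 : (d + 1) * x ≤ (d - 1) * (1 + y)) (k5 : x - y ≤ 1 - 2 / (r * (d - 1))) : (x, y) ∈ pentagonMid d r := by
  obtain ⟨R, δ, η, hR', hδ, a1, a2, a3, a4, a5', R0, δ0, η0, c1, c2, c3, c4, c5, dh, dh', f1, f2, f3, f4, f5, f6⟩ := rep hd hr1 hr2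
  have hD0 : (0:ℝ) < d := by exact_mod_cast (by omega : 0 < d)
  have hS : Convex ℝ (pentagonMid d r) := convex_convexHull ℝ _
  have v1 : (R * δ, R * δ) ∈ pentagonMid d r := by rw [← a1]; exact subset_convexHull ℝ _ (by simp)
  have v2 : (1 - δ, 1 - δ) ∈ pentagonMid d r := by rw [← a2]; exact subset_convexHull ℝ _ (by simp)
  have v3 : (1 - δ, δ) ∈ pentagonMid d r := by rw [← a2, hδ]; exact subset_convexHull ℝ _ (by simp)
  have v4 : (R, R * (1 + 2 * η) - 1) ∈ pentagonMid d r := by rw [← a3, hR']; exact subset_convexHull ℝ _ (by simp)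
  have v5 : (1 - R * (2 * η - δ), R * δ) ∈ pentagonMid d r := by rw [← a4, ← a1]; exact subset_convexHull ℝ _ (by simp)
  have k4' : (1 + δ) * x ≤ (1 - δ) * (1 + y) := by
    rw [dh, dh'] at k4
    refine le_of_mul_le_mul_left (a := (d:ℝ)) ?_ hD0
    linarith
  rw [a1] at k2
  rw [← hδ] at k3
  rw [a5'] at k5
  clear a1 a2 a3 a4 a5' dh dh' hδ hR' k4 hr1 hr2
  obtain ⟨L, hL, eL⟩ := cvx_line hS v1 v2 (α := 1) (β := -1) (γ := 0) (by ring) (by ring) k2 (k1.trans k3)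
  have eL' : L = y := by linarith
  subst eL'
  rcases le_total δ L with h | h
  · obtain ⟨M, hM, eM⟩ := cvx_line hS v3 v2 (α := 1) (β := 0) (γ := 1 - δ) (by ring) (by ring) h (k1.trans k3)
    exact cvx_hor hS hL hM k1 (by linarith)
  rcases le_total (R * (1 + 2 * η) - 1) L with h' | h'
  · obtain ⟨M, hM, eM⟩ := cvx_line hS v4 v3 (α := 1 + δ) (β := -(1 - δ)) (γ := 1 - δ) (by linarith) (by ring) h' h
    refine cvx_hor hS hL hM k1 ?_
    refine le_of_mul_le_mul_left (a := 1 + δ) ?_ (by linarith)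
    linarith
  · obtain ⟨M, hM, eM⟩ := cvx_line hS v5 v4 (α := 1) (β := -1) (γ := 1 - 2 * R * η) (by ring) (by ring) k2 h'
    exact cvx_hor hS hL hM k1 (by linarith)

lemma ennreal_of_inv_pos {p : ℝ≥0∞} (hp : 1 ≤ p) (h : 0 < p⁻¹.toReal) : ∃ P : ℝ, 0 < P ∧ p = ENNReal.ofReal P ∧ p⁻¹.toReal = 1 / P := by
  have hpt : p ≠ ∞ := by rintro rfl; simp at h
  have hp0 : p ≠ 0 := by rintro rfl; simp at hp
  refine ⟨p.toReal, ENNReal.toReal_pos hp0 hpt, (ENNReal.ofReal_toReal hpt).symm, ?_⟩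
  rw [ENNReal.toReal_inv, one_div]

lemma interior_bdd {d : ℕ} (hd : 3 ≤ d) {r : ℝ} (hr1 : (d : ℝ) / ((d : ℝ) - 1) < r)
    (hr2 : r ≤ ((d : ℝ) ^ 2 + 1) / ((d : ℝ) * ((d : ℝ) - 1))) {p q : ℝ≥0∞} (hp : 1 ≤ p) (hq : 1 ≤ q)
    (h : (p⁻¹.toReal, q⁻¹.toReal) ∈ interior (pentagonMid d r)) : IsBddLpLq d p q (VrIA r) := by
  obtain ⟨k1, k2, k3, k4, k5⟩ := interior_ineq hd hr1 hr2 h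
  obtain ⟨hD, r1, r2, r3, r4⟩ := rbasic hd hr1 hr2
  have hy : 0 < q⁻¹.toReal := lt_trans (by positivity) k2
  obtain ⟨P, hP, eP, eP'⟩ := ennreal_of_inv_pos hp (hy.trans k1)
  obtain ⟨Q, hQ, eQ, eQ'⟩ := ennreal_of_inv_pos hq hy
  rw [eP', eQ'] at k1 k4 k5
  rw [eQ'] at k2
  rw [eP'] at k3
  have := pos_int hd hr1 hr2 hP hQ k1.le k2 k3 k4 k5
  rw [eP, eQ]
  exact this

/-! ## P19: tools for counterexamples -/

lemma test_ineq {d : ℕ} {r : ℝ} {p q : ℝ≥0∞} (hp : 1 ≤ p) (hq : 1 ≤ q) (h : IsBddLpLq d p q (VrIA r)) :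
    ∃ C : ℝ, 0 ≤ C ∧ ∀ S T : Set (Euc d), MeasurableSet S → MeasurableSet T → ∀ l τ s : ℝ, 0 ≤ l → 0 < τ → 0 ≤ s →
    ENNReal.ofReal τ ≤ volume T → volume S ≤ ENNReal.ofReal s →
    (∀ x ∈ T, ENNReal.ofReal l ≤ VrIA r (S.indicator fun _ => (1:ℂ)) x) → l * τ ^ q⁻¹.toReal ≤ C * s ^ p⁻¹.toReal := by
  obtain ⟨C, hC⟩ := h
  refine ⟨C, C.2, fun S T hS hT l τ s hl hτ hs hτT hSs hV => ?_⟩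
  have hSfin : volume S ≠ ∞ := ne_top_of_le_ne_top ENNReal.ofReal_ne_top hSs
  have hf : MemLp (S.indicator fun _ => (1:ℂ)) p volume := memLp_indicator_const p hS 1 (Or.inr hSfin)
  have h1 := hC _ hf
  have h2 : eLpNorm (S.indicator fun _ => (1:ℂ)) p volume ≤ ENNReal.ofReal (s ^ p⁻¹.toReal) := by
    refine (eLpNorm_indicator_const_le (1:ℂ) p).trans ?_
    rw [enorm_one, one_mul, ← ENNReal.ofReal_rpow_of_nonneg hs (by positivity), ENNReal.toReal_inv, one_div]
    exact ENNReal.rpow_le_rpow hSs (by positivity)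
  have h3 : ENNReal.ofReal (l * τ ^ q⁻¹.toReal) ≤ lqNorm q (VrIA r (S.indicator fun _ => (1:ℂ))) volume := by
    unfold lqNorm
    split_ifs with hqt
    · subst hqt
      simp only [ENNReal.inv_top, ENNReal.toReal_zero, Real.rpow_zero, mul_one]
      by_contra hlt
      push Not at hlt
      have h4 := ae_lt_of_essSup_lt hlt
      have h5 : volume T = 0 := measure_mono_null (fun x hx => not_lt.2 (hV x hx)) (ae_iff.1 h4)
      rw [h5] at hτT
      simp at hτT
      linarith
    · have hq0 : 0 < q.toReal := ENNReal.toReal_pos (by rintro rfl; simp at hq) hqt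
      have h4 : ENNReal.ofReal l ^ q.toReal * ENNReal.ofReal τ ≤ ∫⁻ x, VrIA r (S.indicator fun _ => (1:ℂ)) x ^ q.toReal := by
        calc _ ≤ ENNReal.ofReal l ^ q.toReal * volume T := mul_le_mul' le_rfl hτT
          _ = ∫⁻ x, T.indicator (fun _ => ENNReal.ofReal l ^ q.toReal) x := by rw [lintegral_indicator_const hT]
          _ ≤ _ := by
            refine lintegral_mono fun x => ?_
            by_cases hx : x ∈ T
            · rw [indicator_of_mem hx]; exact ENNReal.rpow_le_rpow (hV x hx) hq0.le
            · rw [indicator_of_notMem hx]; exact zero_le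
      refine le_trans (le_of_eq ?_) (ENNReal.rpow_le_rpow h4 (by positivity))
      rw [ENNReal.mul_rpow_of_nonneg _ _ (by positivity), ← ENNReal.rpow_mul, mul_one_div_cancel hq0.ne', ENNReal.rpow_one,
        ENNReal.ofReal_mul hl, ENNReal.toReal_inv, one_div, ENNReal.ofReal_rpow_of_pos hτ]
  have h6 := h3.trans (h1.trans (mul_le_mul' le_rfl h2))
  rw [← ENNReal.ofReal_coe_nnreal, ← ENNReal.ofReal_mul C.coe_nonneg] at h6
  exact (ENNReal.ofReal_le_ofReal_iff (mul_nonneg C.coe_nonneg (by positivity))).1 h6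

lemma pow_cmp {A B a b : ℝ} (hA : 0 < A) (h : ∀ M : ℕ, 1 ≤ M → A * (M:ℝ) ^ a ≤ B * (M:ℝ) ^ b) : a ≤ b := by
  by_contra hab
  push Not at hab
  have ht : Filter.Tendsto (fun M : ℕ => A * (M:ℝ) ^ (a - b)) Filter.atTop Filter.atTop :=
    ((tendsto_rpow_atTop (by linarith : 0 < a - b)).comp tendsto_natCast_atTop_atTop).const_mul_atTop hA
  obtain ⟨M, hM, hM1⟩ := ((ht.eventually_gt_atTop B).and (Filter.eventually_ge_atTop 1)).exists
  have hM0 : (0:ℝ) < M := by exact_mod_cast hM1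
  have h1 := h M hM1
  have hb : 0 < (M:ℝ) ^ b := by positivity
  have h2 := mul_lt_mul_of_pos_right hM hb
  rw [mul_assoc, ← Real.rpow_add hM0, sub_add_cancel] at h2
  linarith

lemma rVar_alt {r : ℝ} (hr : 0 < r) {E : Set ℝ} (a : ℝ → ℂ) (N : ℕ) (t : ℕ → ℝ) (ht : StrictMono t) (hE : ∀ j ≤ N, t j ∈ E) {l : ℝ} (hl : 0 ≤ l)
    (h : ∀ j < N, ENNReal.ofReal l ≤ ‖a (t (j+1)) - a (t j)‖ₑ) : ENNReal.ofReal ((N:ℝ) ^ (1 / r) * l) ≤ rVar r E a := by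
  refine le_trans ?_ (le_rVar (r := r) (E := E) (a := a) N (fun i => t i) (fun i j hij => ht hij) (fun i => hE i (by omega)))
  have : ((N:ℝ≥0∞) * ENNReal.ofReal l ^ r) ^ (1 / r) ≤ (∑ i : Fin N, ‖a (t (i.succ : Fin (N+1))) - a (t (i.castSucc : Fin (N+1)))‖ₑ ^ r) ^ (1 / r) := by
    refine ENNReal.rpow_le_rpow ?_ (by positivity)
    calc _ = ∑ i : Fin N, ENNReal.ofReal l ^ r := by simp
      _ ≤ _ := Finset.sum_le_sum fun i _ => ENNReal.rpow_le_rpow (h i i.2) hr.le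
  refine le_trans (le_of_eq ?_) this
  rw [ENNReal.mul_rpow_of_nonneg _ _ (by positivity), ← ENNReal.rpow_mul, mul_one_div_cancel hr.ne', ENNReal.rpow_one, ENNReal.ofReal_mul (by positivity),
    ← ENNReal.ofReal_rpow_of_nonneg (by positivity) (by positivity), ENNReal.ofReal_natCast]

lemma sphAvg_ind {d : ℕ} {S : Set (Euc d)} (hS : MeasurableSet S) (t : ℝ) (x : Euc d) :
    sphAvg (S.indicator fun _ => (1:ℂ)) t x = (((sphereMeasure d).real {y | x - t • y ∈ S} : ℝ) : ℂ) := by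
  have hm : MeasurableSet {y : Euc d | x - t • y ∈ S} := (by fun_prop : Measurable fun y : Euc d => x - t • y) hS
  have e : (fun y => (S.indicator fun _ => (1:ℂ)) (x - t • y)) = {y : Euc d | x - t • y ∈ S}.indicator fun _ => (1:ℂ) := rfl
  unfold sphAvg
  rw [e, integral_indicator_const _ hm]
  simp

lemma sphAvg_ind_zero {d : ℕ} {S : Set (Euc d)} (hS : MeasurableSet S) {t : ℝ} {x : Euc d} (h : ∀ y : Euc d, ‖y‖ = 1 → x - t • y ∉ S) :
    sphAvg (S.indicator fun _ => (1:ℂ)) t x = 0 := by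
  rw [sphAvg_ind hS, Complex.ofReal_eq_zero, measureReal_eq_zero_iff]
  refine measure_mono_null ?_ (ae_iff.1 (sphM_ae_norm d))
  intro y hy hy1
  exact h y hy1 hy

lemma sphAvg_ind_ge {d : ℕ} {S : Set (Euc d)} (hS : MeasurableSet S) {t : ℝ} {x : Euc d} {U : Set (Euc d)} {l : ℝ}
    (hU : ENNReal.ofReal l ≤ sphereMeasure d U) (h : ∀ y ∈ U, ‖y‖ = 1 → x - t • y ∈ S) :
    ENNReal.ofReal l ≤ ‖sphAvg (S.indicator fun _ => (1:ℂ)) t x‖ₑ := by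
  rw [sphAvg_ind hS, ← ofReal_norm_eq_enorm, Complex.norm_real, Real.norm_of_nonneg measureReal_nonneg, ofReal_measureReal]
  refine hU.trans (measure_mono_ae ?_)
  filter_upwards [sphM_ae_norm d] with y hy hyU
  exact h y hyU hy

lemma cap_ball {d : ℕ} (hd : 0 < d) : ∃ c : ℝ, 0 < c ∧ ∀ ω : Euc d, ‖ω‖ = 1 → ∀ ρ : ℝ, 0 < ρ → ρ ≤ 1 →
    ENNReal.ofReal (c * ρ ^ (d - 1)) ≤ sphereMeasure d (closedBall ω ρ) := by
  let i : Fin d := ⟨0, hd⟩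
  obtain ⟨c, hc, H⟩ := cap_lower i
  have hd0 : (0:ℝ) < d := by exact_mod_cast hd
  have hd1 : (1:ℝ) ≤ d := by exact_mod_cast hd
  refine ⟨c * (1 / (2 * d)) ^ (d - 1), by have : (0:ℝ) < c := hc
                                          positivity, fun ω hω ρ hρ hρ1 => ?_⟩
  have h1 := H (ρ / (2 * d)) (by positivity) (by
    rw [div_le_div_iff₀ (by positivity) hd0]; nlinarith)
  have e : ENNReal.ofReal (c * (1 / (2 * d)) ^ (d - 1) * ρ ^ (d - 1)) = c * ENNReal.ofReal (ρ / (2 * d)) ^ (d - 1) := by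
    rw [mul_assoc, ← mul_pow, ENNReal.ofReal_mul c.coe_nonneg, ENNReal.ofReal_coe_nnreal, ← ENNReal.ofReal_pow (by positivity)]
    congr 3; ring
  rw [e]
  refine h1.trans ?_
  obtain ⟨L, hL⟩ := exists_isometry (v := e0 d i) (w := ω) (by rw [norm_e0, hω])
  have hm := sphM_map_isometry L
  have hB : sphereMeasure d (closedBall ω ρ) = sphereMeasure d (L ⁻¹' closedBall ω ρ) := by
    conv_lhs => rw [← hm, Measure.map_apply L.continuous.measurable measurableSet_closedBall]
  rw [hB]
  refine measure_mono_ae ?_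
  filter_upwards [sphM_ae_norm d] with y hy hyU
  obtain ⟨hy0, hyk⟩ := hyU
  change L y ∈ closedBall ω ρ
  rw [mem_closedBall, dist_eq_norm, ← hL, ← map_sub, L.norm_map]
  have hs := norm_sub_e0_sq i y
  have hsp := norm_sq_split i y
  rw [hy] at hs hsp
  have hsum : ∑ k ∈ Finset.univ.erase i, y k ^ 2 ≤ d * (ρ / (2 * d)) ^ 2 := by
    calc _ ≤ ∑ k ∈ Finset.univ.erase i, (ρ / (2 * d)) ^ 2 := Finset.sum_le_sum fun k hk => by
          have := hyk k (Finset.ne_of_mem_erase hk)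
          rw [← sq_abs]; exact pow_le_pow_left₀ (abs_nonneg _) this 2
      _ ≤ _ := by
          rw [Finset.sum_const, nsmul_eq_mul]
          gcongr
          calc (Finset.univ.erase i).card ≤ (Finset.univ : Finset (Fin d)).card := Finset.card_erase_le
            _ = d := by simp
  have hle1 : y i ≤ 1 := (le_abs_self _).trans (hy ▸ abs_coord_le y i)
  have e3 : d * (ρ / (2 * d)) ^ 2 = ρ ^ 2 / (4 * d) := by field_simp; ring
  have e4 : ρ ^ 2 / (4 * d) ≤ ρ ^ 2 / 4 := by
    apply div_le_div_of_nonneg_left (by positivity) (by positivity); linarith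
  have hy0' : 0 < y i := hy0
  refine abs_le_of_sq_le_sq' ?_ hρ.le |>.2
  nlinarith

/-! ## P20: counterexamples -/

lemma vol_cb {d : ℕ} : ∃ κ : ℝ, 0 < κ ∧ ∀ (x : Euc d) (ρ : ℝ), 0 ≤ ρ → volume (closedBall x ρ) = ENNReal.ofReal (κ * ρ ^ d) := by
  refine ⟨(volume (ball (0 : Euc d) 1)).toReal, ENNReal.toReal_pos (measure_ball_pos volume _ one_pos).ne' measure_ball_lt_top.ne, fun x ρ hρ => ?_⟩
  rw [Measure.addHaar_closedBall volume x hρ, mul_comm, ENNReal.ofReal_mul (by positivity), ENNReal.ofReal_toReal measure_ball_lt_top.ne]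
  simp

lemma VrIA_two {d : ℕ} {r : ℝ} (hr : 0 < r) {f : Euc d → ℂ} {x : Euc d} {s t l : ℝ} (hs : s ∈ Icc (1:ℝ) 2) (ht : t ∈ Icc (1:ℝ) 2)
    (h0 : sphAvg f s x = 0) (h1 : ENNReal.ofReal l ≤ ‖sphAvg f t x‖ₑ) : ENNReal.ofReal l ≤ VrIA r f x := by
  have := diff_le_rVar hr (fun t => sphAvg f t x) hs ht
  simp only [h0, sub_zero] at this
  exact h1.trans this

lemma VrIA_alt {d : ℕ} {r : ℝ} (hr : 0 < r) {f : Euc d → ℂ} {x : Euc d} (n : ℕ) {t0 δ l : ℝ} (hδ : 0 < δ) (hl : 0 ≤ l) (h1 : 1 ≤ t0) (h2 : t0 + n * δ ≤ 2)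
    (hev : ∀ k : ℕ, 2 * k ≤ n → ENNReal.ofReal l ≤ ‖sphAvg f (t0 + ((2 * k : ℕ) : ℝ) * δ) x‖ₑ)
    (hod : ∀ k : ℕ, 2 * k + 1 ≤ n → sphAvg f (t0 + ((2 * k + 1 : ℕ) : ℝ) * δ) x = 0) :
    ENNReal.ofReal ((n:ℝ) ^ (1 / r) * l) ≤ VrIA r f x := by
  refine rVar_alt hr (fun t => sphAvg f t x) n (fun j => t0 + j * δ) ?_ ?_ hl ?_
  · intro i j hij
    have : (i:ℝ) < j := by exact_mod_cast hij
    have := mul_lt_mul_of_pos_right this hδ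
    change t0 + i * δ < t0 + j * δ
    linarith
  · intro j hj
    have : (j:ℝ) ≤ n := by exact_mod_cast hj
    have := mul_le_mul_of_nonneg_right this hδ.le
    have : 0 ≤ (j:ℝ) * δ := by positivity
    change 1 ≤ t0 + j * δ ∧ t0 + j * δ ≤ 2
    constructor <;> linarith
  · intro j hj
    rcases Nat.even_or_odd' j with ⟨k, rfl | rfl⟩
    · rw [hod k (by omega), zero_sub, enorm_neg]
      exact hev k (by omega)
    · rw [hod k (by omega), sub_zero]
      exact hev (k + 1) (by omega)

lemma div_pow_rpow {M k : ℝ} (hM : 0 < M) (n : ℕ) : (k / M) ^ n = k ^ n * M ^ (-(n:ℝ)) := by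
  rw [div_pow, Real.rpow_neg hM.le, Real.rpow_natCast]; rfl

lemma kdiv_rpow {M k κ : ℝ} (hM : 0 < M) (hk : 0 ≤ k) (hκ : 0 ≤ κ) (n : ℕ) (X : ℝ) :
    (κ * (k / M) ^ n) ^ X = (κ * k ^ n) ^ X * M ^ (-(n * X)) := by
  rw [div_pow_rpow hM, ← mul_assoc, Real.mul_rpow (by positivity) (by positivity), ← Real.rpow_mul hM.le, neg_mul]

lemma nec_x {d : ℕ} (hd : 3 ≤ d) {r : ℝ} (hr : 0 < r) {p q : ℝ≥0∞} (hp : 1 ≤ p) (hq : 1 ≤ q) (h : IsBddLpLq d p q (VrIA r)) :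
    p⁻¹.toReal ≤ 1 - 1 / (d:ℝ) := by
  obtain ⟨C, hC, H⟩ := test_ineq hp hq h
  obtain ⟨c, hc, hcap⟩ := cap_ball (d := d) (by omega)
  obtain ⟨κ, hκ, hvol⟩ := vol_cb (d := d)
  set X := p⁻¹.toReal
  set Y := q⁻¹.toReal
  have hX : 0 ≤ X := ENNReal.toReal_nonneg
  let i : Fin d := ⟨0, by omega⟩
  have hd0 : (0:ℝ) < d := by exact_mod_cast (by omega : 0 < d)
  have key : -((d - 1 : ℕ) : ℝ) ≤ -(d * X) := by
    refine pow_cmp (A := c * (1/4) ^ (d-1) * (κ * (1/8) ^ d) ^ Y) (B := C * (κ * (1/2) ^ d) ^ X) (by positivity) fun M hM => ?_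
    have hM0 : (0:ℝ) < M := by exact_mod_cast hM
    have hM1 : (1:ℝ) ≤ M := by exact_mod_cast hM
    set δ : ℝ := (1/2) / M with hδ
    have hδ0 : 0 < δ := by positivity
    have hδ1 : δ ≤ 1/2 := by rw [hδ, div_le_iff₀ hM0]; linarith
    have := H (closedBall 0 δ) (closedBall ((9/8:ℝ) • e0 d i) (1/8)) measurableSet_closedBall measurableSet_closedBall
      (c * (δ/2) ^ (d-1)) (κ * (1/8) ^ d) (κ * δ ^ d) (by positivity) (by positivity) (by positivity)
      (hvol _ _ (by norm_num)).ge (hvol _ _ hδ0.le).le ?_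
    · have e1 : δ / 2 = (1/4) / M := by rw [hδ]; ring
      rw [e1, div_pow_rpow hM0, hδ, kdiv_rpow hM0 (by norm_num) hκ.le] at this
      nlinarith
    · intro x hx
      rw [mem_closedBall, dist_eq_norm] at hx
      have hn : ‖(9/8:ℝ) • e0 d i‖ = 9/8 := by rw [norm_smul, norm_e0]; norm_num
      have hx1 : ‖x‖ ≤ 5/4 := by
        have := norm_le_norm_add_norm_sub' x ((9/8:ℝ) • e0 d i)
        linarith
      have hx2 : 1 ≤ ‖x‖ := by
        have := norm_le_norm_add_norm_sub ((9/8:ℝ) • e0 d i) x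
        rw [norm_sub_rev] at this
        have := norm_sub_norm_le ((9/8:ℝ) • e0 d i) x
        rw [norm_sub_rev] at this
        linarith
      refine VrIA_two hr (s := 2) (t := ‖x‖) (by norm_num) ⟨hx2, by linarith⟩ (sphAvg_ind_zero measurableSet_closedBall ?_)
        (sphAvg_ind_ge measurableSet_closedBall (hcap (‖x‖⁻¹ • x) ?_ (δ/2) (by positivity) (by linarith)) ?_)
      · intro y hy hmem
        rw [mem_closedBall_zero_iff] at hmem
        have := norm_sub_norm_le ((2:ℝ) • y) x
        rw [norm_sub_rev, norm_smul, hy] at this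
        norm_num at this
        linarith
      · rw [norm_smul, norm_inv, norm_norm, inv_mul_cancel₀ (by linarith)]
      · intro y hy _
        rw [mem_closedBall_zero_iff]
        rw [mem_closedBall, dist_eq_norm] at hy
        have e : x - ‖x‖ • y = -(‖x‖ • (y - ‖x‖⁻¹ • x)) := by
          rw [smul_sub, smul_smul, mul_inv_cancel₀ (by linarith), one_smul]; abel
        rw [e, norm_neg, norm_smul, norm_norm]
        have := norm_nonneg (y - ‖x‖⁻¹ • x)
        nlinarith
  rw [Nat.cast_sub (by omega)] at key
  have : X * d ≤ d - 1 := by push_cast at key; linarith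
  rw [← le_div_iff₀ hd0] at this
  refine this.trans (le_of_eq ?_)
  field_simp

lemma nec_diag {d : ℕ} (hd : 3 ≤ d) {r : ℝ} (hr : 0 < r) {p q : ℝ≥0∞} (hp : 1 ≤ p) (hq : 1 ≤ q) (h : IsBddLpLq d p q (VrIA r)) :
    q⁻¹.toReal ≤ p⁻¹.toReal := by
  obtain ⟨C, hC, H⟩ := test_ineq hp hq h
  obtain ⟨c, hc, hcap⟩ := cap_ball (d := d) (by omega)
  obtain ⟨κ, hκ, hvol⟩ := vol_cb (d := d)
  set X := p⁻¹.toReal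
  set Y := q⁻¹.toReal
  let i : Fin d := ⟨0, by omega⟩
  set e := e0 d i with he
  have hen : ‖e‖ = 1 := norm_e0 i
  have hmul : ∀ a : ℝ, ‖a • e‖ = |a| := fun a => by rw [norm_smul, hen, mul_one, Real.norm_eq_abs]
  refine pow_cmp (A := c * (1/4) ^ (d-1) * (κ * (1/100) ^ d) ^ Y) (B := C * (κ * (1/2) ^ d) ^ X) (by positivity) fun M hM => ?_
  have hM0 : (0:ℝ) < M := by exact_mod_cast hM
  have := H (⋃ j ∈ Finset.range M, closedBall ((10 * (j:ℝ)) • e) (1/2)) (⋃ j ∈ Finset.range M, closedBall ((10 * (j:ℝ) + 1) • e) (1/100))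
    (Finset.measurableSet_biUnion _ fun _ _ => measurableSet_closedBall) (Finset.measurableSet_biUnion _ fun _ _ => measurableSet_closedBall)
    (c * (1/4) ^ (d-1)) (M * (κ * (1/100) ^ d)) (M * (κ * (1/2) ^ d)) (by positivity) (by positivity) (by positivity) ?_ ?_ ?_
  · rw [Real.mul_rpow hM0.le (by positivity), Real.mul_rpow hM0.le (by positivity)] at this
    nlinarith
  · rw [measure_biUnion_finset ?_ (fun _ _ => measurableSet_closedBall)]
    · simp only [hvol _ (1/100) (by norm_num), Finset.sum_const, Finset.card_range, nsmul_eq_mul]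
      rw [ENNReal.ofReal_mul hM0.le, ENNReal.ofReal_natCast]
    · intro j _ k _ hjk
      refine Set.disjoint_left.2 fun x hx hx' => ?_
      rw [mem_closedBall, dist_eq_norm] at hx hx'
      have h1 : ‖((10 * (j:ℝ) + 1) • e) - ((10 * (k:ℝ) + 1) • e)‖ ≤ 1/50 := by
        have := norm_sub_le (x - (10 * (k:ℝ) + 1) • e) (x - (10 * (j:ℝ) + 1) • e)
        rw [sub_sub_sub_cancel_left] at this
        linarith
      rw [← sub_smul, hmul] at h1
      have h2 : (1:ℝ) ≤ |(j:ℝ) - k| := by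
        have : (1:ℤ) ≤ |(j:ℤ) - k| := Int.one_le_abs (by omega)
        exact_mod_cast this
      have e2 : (10 * (j:ℝ) + 1) - (10 * (k:ℝ) + 1) = 10 * (j - k) := by ring
      rw [e2, abs_mul] at h1
      norm_num at h1
      linarith
  · refine (measure_biUnion_finset_le _ _).trans ?_
    simp only [hvol _ (1/2) (by norm_num), Finset.sum_const, Finset.card_range, nsmul_eq_mul]
    rw [ENNReal.ofReal_mul hM0.le, ENNReal.ofReal_natCast]
  · intro x hx
    simp only [mem_iUnion] at hx
    obtain ⟨j, hj, hx⟩ := hx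
    rw [mem_closedBall, dist_eq_norm] at hx
    have hmS : MeasurableSet (⋃ j ∈ Finset.range M, closedBall ((10 * (j:ℝ)) • e) (1/2)) := Finset.measurableSet_biUnion _ fun _ _ => measurableSet_closedBall
    refine VrIA_two hr (s := 2) (t := 1) (by norm_num) (by norm_num) (sphAvg_ind_zero hmS ?_)
        (sphAvg_ind_ge hmS (hcap e hen (1/4) (by norm_num) (by norm_num)) ?_)
    · intro y hy hmem
      simp only [mem_iUnion] at hmem
      obtain ⟨k, hk, hmem⟩ := hmem
      rw [mem_closedBall, dist_eq_norm] at hmem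
      set u := x - (10 * (j:ℝ) + 1) • e with hu
      have e1 : x - (2:ℝ) • y - (10 * (k:ℝ)) • e = (10 * ((j:ℝ) - k) + 1) • e + u - (2:ℝ) • y := by
        rw [hu]; module
      rw [e1] at hmem
      have hy2 : ‖(2:ℝ) • y‖ = 2 := by rw [norm_smul, hy]; norm_num
      by_cases hjk : j = k
      · subst hjk
        have h1 := norm_sub_norm_le ((2:ℝ) • y) ((10 * ((j:ℝ) - j) + 1) • e + u)
        rw [norm_sub_rev, hy2] at h1
        have h2 := norm_add_le ((10 * ((j:ℝ) - j) + 1) • e) u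
        rw [hmul] at h2
        norm_num at h2 h1 hmem hx
        linarith
      · have h1 := norm_sub_norm_le ((10 * ((j:ℝ) - k) + 1) • e + u) ((2:ℝ) • y)
        rw [hy2] at h1
        have h2 := norm_sub_norm_le ((10 * ((j:ℝ) - k) + 1) • e) (-u)
        rw [hmul, sub_neg_eq_add, norm_neg] at h2
        have h3 : (9:ℝ) ≤ |10 * ((j:ℝ) - k) + 1| := by
          have : (9:ℤ) ≤ |10 * ((j:ℤ) - k) + 1| := by
            rcases lt_or_gt_of_ne hjk with h | h
            · rw [le_abs]; right; omega
            · rw [le_abs]; left; omega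
          exact_mod_cast this
        linarith
    · intro y hy _
      simp only [mem_iUnion]
      refine ⟨j, hj, ?_⟩
      rw [mem_closedBall, dist_eq_norm] at hy ⊢
      have e1 : x - (1:ℝ) • y - (10 * (j:ℝ)) • e = (x - (10 * (j:ℝ) + 1) • e) - (y - e) := by module
      rw [e1]
      have := norm_sub_le (x - (10 * (j:ℝ) + 1) • e) (y - e)
      linarith

lemma nec_low {d : ℕ} (hd : 3 ≤ d) {r : ℝ} (hr : 0 < r) {p q : ℝ≥0∞} (hp : 1 ≤ p) (hq : 1 ≤ q) (h : IsBddLpLq d p q (VrIA r)) :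
    1 / (r * d) ≤ q⁻¹.toReal := by
  obtain ⟨C, hC, H⟩ := test_ineq hp hq h
  obtain ⟨κ, hκ, hvol⟩ := vol_cb (d := d)
  set X := p⁻¹.toReal
  set Y := q⁻¹.toReal
  have hd0 : (0:ℝ) < d := by exact_mod_cast (by omega : 0 < d)
  have key : 1 / r + -(d * Y) ≤ 0 := by
    refine pow_cmp (A := (κ * (1/8) ^ d) ^ Y) (B := C * (κ * 2 ^ d) ^ X) (by positivity) fun n hn => ?_
    have hn0 : (0:ℝ) < n := by exact_mod_cast hn
    have hn1 : (1:ℝ) ≤ n := by exact_mod_cast hn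
    set δ : ℝ := (1/2) / n with hδ
    have hδ0 : 0 < δ := by positivity
    have hδ1 : δ ≤ 1/2 := by rw [hδ, div_le_iff₀ hn0]; linarith
    have hnδ : n * δ = 1/2 := by rw [hδ]; field_simp
    have hmS : MeasurableSet (⋃ k ∈ Finset.range n, {z : Euc d | ‖z‖ ∈ Icc (1 + 2 * k * δ) (1 + (2 * k + 1) * δ)}) :=
      Finset.measurableSet_biUnion _ fun k _ => measurable_norm measurableSet_Icc
    have := H _ (closedBall 0 (δ/4)) hmS measurableSet_closedBall
      ((n:ℝ) ^ (1 / r) * 1) (κ * (δ/4) ^ d) (κ * 2 ^ d) (by positivity) (by positivity) (by positivity)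
      (hvol _ _ (by positivity)).ge ?_ ?_
    · have e1 : δ / 4 = (1/8) / n := by rw [hδ]; ring
      rw [e1, kdiv_rpow hn0 (by norm_num) hκ.le] at this
      rw [Real.rpow_add hn0, Real.rpow_zero]
      nlinarith
    · rw [← hvol 0 2 (by norm_num)]
      refine measure_mono fun z hz => ?_
      simp only [mem_iUnion] at hz
      obtain ⟨k, hk, hz⟩ := hz
      have hk' : (k:ℝ) + 1 ≤ n := by exact_mod_cast Finset.mem_range.1 hk
      have h2 := hz.2
      rw [mem_closedBall_zero_iff]
      nlinarith
    · intro x hx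
      rw [mem_closedBall_zero_iff] at hx
      have hbd : ∀ (t : ℝ) (y : Euc d), 0 ≤ t → ‖y‖ = 1 → t - δ/4 ≤ ‖x - t • y‖ ∧ ‖x - t • y‖ ≤ t + δ/4 := by
        intro t y ht hy
        have hy' : ‖t • y‖ = t := by rw [norm_smul, hy, mul_one, Real.norm_of_nonneg ht]
        have h1 := norm_sub_norm_le (t • y) x
        have h2 := norm_sub_le x (t • y)
        rw [norm_sub_rev] at h1
        constructor <;> linarith
      refine VrIA_alt hr n (t0 := 1 + δ/2) hδ0 zero_le_one (by linarith) (by linarith) ?_ ?_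
      · intro k hk
        refine sphAvg_ind_ge hmS (U := univ) (by rw [(sphM_prob (by omega : 0 < d)).measure_univ]; simp) fun y _ hy => ?_
        obtain ⟨h1, h2⟩ := hbd (1 + δ/2 + ((2 * k : ℕ):ℝ) * δ) y (by positivity) hy
        simp only [mem_iUnion]
        refine ⟨k, Finset.mem_range.2 (by omega), ?_⟩
        push_cast at h1 h2 ⊢
        constructor <;> linarith
      · intro k hk
        refine sphAvg_ind_zero hmS fun y hy hmem => ?_
        obtain ⟨h1, h2⟩ := hbd (1 + δ/2 + ((2 * k + 1 : ℕ):ℝ) * δ) y (by positivity) hy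
        simp only [mem_iUnion] at hmem
        obtain ⟨m, hm, h3, h4⟩ := hmem
        push_cast at h1 h2 h3 h4
        rcases le_or_gt m k with hmk | hmk
        · have : (m:ℝ) ≤ k := by exact_mod_cast hmk
          nlinarith
        · have : (k:ℝ) + 1 ≤ m := by exact_mod_cast hmk
          nlinarith
  rw [div_le_iff₀ (by positivity)]
  have h1 : 1 / r ≤ d * Y := by linarith
  rw [div_le_iff₀ hr] at h1
  linarith

/-! ## P21: Knapp examples -/

lemma knapp_geo {d : ℕ} (i : Fin d) {ρ δ t : ℝ} (hρδ : 18 * d * ρ ^ 2 ≤ δ) {x y : Euc d} (hxk : ∀ k, k ≠ i → x k ∈ Icc (-(ρ/2)) (ρ/2))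
    (ht1 : 1 ≤ t) (ht2 : t ≤ 2) (hy : ‖y‖ = 1) (hy0 : 0 < y i) (hz : ∀ k, k ≠ i → (x - t • y) k ∈ Icc (-ρ) ρ) :
    x i - t ≤ (x - t • y) i ∧ (x - t • y) i ≤ x i - t + δ / 4 := by
  have hsp := norm_sq_split i y
  rw [hy] at hsp
  have hle1 : y i ≤ 1 := (le_abs_self _).trans (hy ▸ abs_coord_le y i)
  have hsum : ∑ k ∈ Finset.univ.erase i, y k ^ 2 ≤ d * (3 * ρ / 2) ^ 2 := by
    calc _ ≤ ∑ k ∈ Finset.univ.erase i, (3 * ρ / 2) ^ 2 := Finset.sum_le_sum fun k hk => by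
          have h1 := hz k (Finset.ne_of_mem_erase hk)
          have h2 := hxk k (Finset.ne_of_mem_erase hk)
          simp only [PiLp.sub_apply, PiLp.smul_apply, smul_eq_mul, mem_Icc] at h1 h2
          have h3 : |t * y k| ≤ 3 * ρ / 2 := abs_le.2 ⟨by linarith [h1.2], by linarith [h1.1]⟩
          rw [abs_mul, abs_of_pos (by linarith)] at h3
          have h4 : |y k| ≤ 3 * ρ / 2 := by nlinarith [abs_nonneg (y k)]
          rw [← sq_abs]; exact pow_le_pow_left₀ (abs_nonneg _) h4 2
      _ ≤ _ := by
          rw [Finset.sum_const, nsmul_eq_mul]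
          gcongr
          calc (Finset.univ.erase i).card ≤ (Finset.univ : Finset (Fin d)).card := Finset.card_erase_le
            _ = d := by simp
  simp only [PiLp.sub_apply, PiLp.smul_apply, smul_eq_mul]
  have h5 : 1 - y i ≤ δ / 8 := by nlinarith
  constructor <;> nlinarith

lemma knapp_main {d : ℕ} (hd : 3 ≤ d) {r : ℝ} (hr : 0 < r) {p q : ℝ≥0∞} (hp : 1 ≤ p) (hq : 1 ≤ q) (h : IsBddLpLq d p q (VrIA r)) :
    ∃ c C : ℝ, 0 < c ∧ 0 ≤ C ∧ ∀ ρ δ : ℝ, ∀ n : ℕ, 1 ≤ n → 0 < ρ → 0 < δ → 18 * d * ρ ^ 2 ≤ δ → ρ ≤ 1 / d → n * δ ≤ 1 / 4 → δ ≤ 1 / 4 →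
    (n:ℝ) ^ (1 / r) * (c * (ρ / 4) ^ (d-1)) * (1/4 * ρ ^ (d - 1)) ^ q⁻¹.toReal ≤ C * (n * δ * (2 * ρ) ^ (d-1)) ^ p⁻¹.toReal := by
  obtain ⟨C, hC, H⟩ := test_ineq hp hq h
  let i : Fin d := ⟨0, by omega⟩
  obtain ⟨c, hc, hcap⟩ := cap_lower i
  have hc' : (0:ℝ) < c := hc
  refine ⟨c, C, hc, hC, fun ρ δ n hn hρ hδ hρδ hρd hnδ hδ4 => ?_⟩
  have hd1 : (1:ℝ) ≤ d := by exact_mod_cast (by omega : 1 ≤ d)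
  have hmB : ∀ a b ρ : ℝ, MeasurableSet {z : Euc d | z i ∈ Icc a b ∧ ∀ k, k ≠ i → z k ∈ Icc (-ρ) ρ} := by
    intro a b ρ
    refine IsClosed.measurableSet ?_
    refine IsClosed.and (isClosed_Icc.preimage (by fun_prop)) ?_
    simp only [setOf_forall]
    exact isClosed_iInter fun k => isClosed_iInter fun _ => isClosed_Icc.preimage (by fun_prop : Continuous fun z : Euc d => z k)
  have hmS : MeasurableSet (⋃ k ∈ Finset.range n, {z : Euc d | z i ∈ Icc (-(2 * k + 1) * δ) (-(2 * k) * δ) ∧ ∀ k, k ≠ i → z k ∈ Icc (-ρ) ρ}) :=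
    Finset.measurableSet_biUnion _ fun k _ => hmB _ _ _
  have hn0 : (0:ℝ) < n := by exact_mod_cast hn
  refine H _ {z : Euc d | z i ∈ Icc 1 (5/4) ∧ ∀ k, k ≠ i → z k ∈ Icc (-(ρ/2)) (ρ/2)} hmS (hmB _ _ _)
    _ _ _ (by positivity) (by positivity) (by positivity) ?_ ?_ ?_
  · rw [vol_box, ENNReal.ofReal_mul (by norm_num), ← ENNReal.ofReal_pow (by positivity), mul_div_cancel₀ _ (by norm_num : (2:ℝ) ≠ 0)]
    norm_num
  · refine (measure_biUnion_finset_le _ _).trans ?_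
    have e : ∀ k : ℕ, volume {z : Euc d | z i ∈ Icc (-(2 * k + 1) * δ) (-(2 * k) * δ) ∧ ∀ k, k ≠ i → z k ∈ Icc (-ρ) ρ} = ENNReal.ofReal (δ * (2 * ρ) ^ (d-1)) := by
      intro k
      rw [vol_box, ENNReal.ofReal_mul hδ.le, ENNReal.ofReal_pow (by positivity)]
      congr 2; ring
    simp only [e, Finset.sum_const, Finset.card_range, nsmul_eq_mul]
    rw [mul_assoc, ENNReal.ofReal_mul hn0.le, ENNReal.ofReal_natCast]
  · rintro x ⟨hx, hxk⟩
    refine VrIA_alt hr n (t0 := x i + 3 * δ / 4) hδ (by positivity) (by linarith [hx.1]) (by linarith [hx.2]) ?_ ?_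
    · intro k hk
      have hkn : ((2 * k : ℕ):ℝ) ≤ n := by exact_mod_cast hk
      have ht2 : x i + 3 * δ / 4 + ((2 * k : ℕ):ℝ) * δ ≤ 2 := by nlinarith [hx.2]
      have ht1 : 1 ≤ x i + 3 * δ / 4 + ((2 * k : ℕ):ℝ) * δ := by
        have : 0 ≤ ((2 * k : ℕ):ℝ) * δ := by positivity
        linarith [hx.1]
      have e : x i + 3 * δ / 4 + ((2 * k : ℕ):ℝ) * δ = x i + 3 * δ / 4 + 2 * k * δ := by push_cast; ring
      refine sphAvg_ind_ge hmS (U := {y | 0 < y i ∧ ∀ k, k ≠ i → |y k| ≤ ρ/4}) ?_ ?_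
      · refine le_trans (le_of_eq ?_) (hcap (ρ/4) (by positivity) (by linarith))
        rw [ENNReal.ofReal_mul c.coe_nonneg, ENNReal.ofReal_coe_nnreal, ENNReal.ofReal_pow (by positivity)]
      · rintro y ⟨hy0, hyk⟩ hy
        have hz : ∀ m, m ≠ i → (x - (x i + 3 * δ / 4 + ((2 * k : ℕ):ℝ) * δ) • y) m ∈ Icc (-ρ) ρ := by
          intro m hm
          have h1 := hxk m hm
          have h2 : |(x i + 3 * δ / 4 + ((2 * k : ℕ):ℝ) * δ) * y m| ≤ ρ/2 := by
            rw [abs_mul, abs_of_pos (by linarith)]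
            nlinarith [hyk m hm, abs_nonneg (y m)]
          rw [abs_le] at h2
          simp only [PiLp.sub_apply, PiLp.smul_apply, smul_eq_mul]
          constructor <;> linarith [h1.1, h1.2]
        have hg := knapp_geo i hρδ hxk ht1 ht2 hy hy0 hz
        simp only [mem_iUnion]
        refine ⟨k, Finset.mem_range.2 (by omega), ?_, hz⟩
        rw [e] at hg ⊢
        constructor <;> linarith [hg.1, hg.2]
    · intro k hk
      have hkn : ((2 * k + 1 : ℕ):ℝ) ≤ n := by exact_mod_cast hk
      have ht2 : x i + 3 * δ / 4 + ((2 * k + 1 : ℕ):ℝ) * δ ≤ 2 := by nlinarith [hx.2]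
      have ht1 : 1 ≤ x i + 3 * δ / 4 + ((2 * k + 1 : ℕ):ℝ) * δ := by
        have : 0 ≤ ((2 * k + 1 : ℕ):ℝ) * δ := by positivity
        linarith [hx.1]
      have e : x i + 3 * δ / 4 + ((2 * k + 1 : ℕ):ℝ) * δ = x i + 3 * δ / 4 + (2 * k + 1) * δ := by push_cast; ring
      refine sphAvg_ind_zero hmS fun y hy hmem => ?_
      simp only [mem_iUnion] at hmem
      obtain ⟨m, hm, hzi, hz⟩ := hmem
      have hy0 : 0 < y i := by
        by_contra hy0
        push Not at hy0
        have h1 := hzi.2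
        have h2 : -(2 * (m:ℝ)) * δ ≤ 0 := by
          have : 0 ≤ (2 * (m:ℝ)) * δ := by positivity
          linarith
        simp only [PiLp.sub_apply, PiLp.smul_apply, smul_eq_mul] at h1
        nlinarith [hx.1]
      have hg := knapp_geo i hρδ hxk ht1 ht2 hy hy0 hz
      obtain ⟨h1, h2⟩ := hg
      obtain ⟨h3, h4⟩ := hzi
      rw [e] at h1 h2 h3 h4
      rcases le_or_gt m k with hmk | hmk
      · have : (m:ℝ) ≤ k := by exact_mod_cast hmk
        nlinarith
      · have : (k:ℝ) + 1 ≤ m := by exact_mod_cast hmk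
        nlinarith

lemma nec_knapp {d : ℕ} (hd : 3 ≤ d) {r : ℝ} (hr : 0 < r) {p q : ℝ≥0∞} (hp : 1 ≤ p) (hq : 1 ≤ q) (h : IsBddLpLq d p q (VrIA r))
    (m : ℕ) (hm : m ≤ 2) :
    m / r - (d - 1) * (1 + q⁻¹.toReal) ≤ (m - 2 - (d - 1)) * p⁻¹.toReal := by
  obtain ⟨c, C, hc, hC, H⟩ := knapp_main hd hr hp hq h
  set X := p⁻¹.toReal
  set Y := q⁻¹.toReal
  have hd1 : (1:ℝ) ≤ d := by exact_mod_cast (by omega : 1 ≤ d)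
  have hd0 : (0:ℝ) < d := by linarith
  set D := d - 1 with hD
  have hDr : (D:ℝ) = d - 1 := by rw [hD, Nat.cast_sub (by omega)]; simp
  rw [← hDr]
  set ρ0 : ℝ := 1 / (9 * d) with hρ0
  have hρp : 0 < ρ0 := by positivity
  refine pow_cmp (A := c * (ρ0 / 4) ^ D * (1/4 * ρ0 ^ D) ^ Y) (B := C * (1/4 * (2 * ρ0) ^ D) ^ X) (by positivity) fun M hM => ?_
  have hM0 : (0:ℝ) < M := by exact_mod_cast hM
  have hM1 : (1:ℝ) ≤ M := by exact_mod_cast hM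
  have hρle : ρ0 / M ≤ 1 / d := by
    rw [hρ0, div_div, div_le_div_iff₀ (by positivity) hd0]; nlinarith
  have h1 := H (ρ0 / M) ((1/4) / M ^ 2) (M ^ m) (Nat.one_le_pow _ _ hM) (by positivity) (by positivity) (by
      rw [hρ0, div_pow, div_pow, mul_div_assoc', div_le_div_iff_of_pos_right (by positivity), one_pow, mul_one_div, div_le_iff₀ (by positivity)]
      nlinarith) hρle (by
      rw [mul_div_assoc', div_le_iff₀ (by positivity)]
      push_cast
      have : (M:ℝ) ^ m ≤ M ^ 2 := pow_le_pow_right₀ hM1 hm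
      linarith) (by
      rw [div_le_iff₀ (by positivity)]; nlinarith)
  have e1 : (((M ^ m : ℕ) : ℝ)) ^ (1 / r) = (M:ℝ) ^ (m / r) := by
    rw [Nat.cast_pow, ← Real.rpow_natCast, ← Real.rpow_mul hM0.le, mul_one_div]
  have e2 : ((M ^ m : ℕ) : ℝ) * ((1/4) / M ^ 2) * (2 * (ρ0 / M)) ^ D = (1/4 * (2 * ρ0) ^ D) * (M:ℝ) ^ ((m:ℝ) - 2 - D) := by
    rw [Real.rpow_sub hM0, Real.rpow_sub hM0, Real.rpow_natCast, Real.rpow_natCast, Nat.cast_pow, ← mul_div_assoc 2, div_pow]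
    norm_num
    ring
  have e3 : ρ0 / M / 4 = (ρ0 / 4) / M := by ring
  rw [e1, e2, e3, kdiv_rpow hM0 hρp.le (by norm_num), div_pow_rpow hM0,
    Real.mul_rpow (x := 1/4 * (2 * ρ0) ^ D) (by positivity) (by positivity), ← Real.rpow_mul hM0.le] at h1
  have e4 : (M:ℝ) ^ (m / r - D * (1 + Y)) = (M:ℝ) ^ (m / r) * M ^ (-(D:ℝ)) * M ^ (-(D * Y)) := by
    rw [← Real.rpow_add hM0, ← Real.rpow_add hM0]; congr 1; ring
  rw [e4]
  refine le_trans (le_of_eq ?_) (h1.trans (le_of_eq ?_)) <;> ring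

lemma outside_unbdd {d : ℕ} (hd : 3 ≤ d) {r : ℝ} (hr1 : (d : ℝ) / ((d : ℝ) - 1) < r)
    (hr2 : r ≤ ((d : ℝ) ^ 2 + 1) / ((d : ℝ) * ((d : ℝ) - 1))) {p q : ℝ≥0∞} (hp : 1 ≤ p) (hq : 1 ≤ q)
    (h : (p⁻¹.toReal, q⁻¹.toReal) ∉ pentagonMid d r) : ¬ IsBddLpLq d p q (VrIA r) := by
  intro hb
  obtain ⟨hD, r1, r2, r3, r4⟩ := rbasic hd hr1 hr2
  have hr : 0 < r := by linarith
  refine h (pent_of_ineq hd hr1 hr2 (nec_diag hd hr hp hq hb) (nec_low hd hr hp hq hb) (nec_x hd hr hp hq hb) ?_ ?_)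
  · have := nec_knapp hd hr hp hq hb 0 (by norm_num)
    rw [Nat.cast_zero, zero_div] at this
    linarith
  · have := nec_knapp hd hr hp hq hb 2 le_rfl
    rw [Nat.cast_ofNat, sub_self] at this
    have hd1 : (0:ℝ) < d - 1 := by linarith
    rw [← div_div, le_sub_iff_add_le, ← le_sub_iff_add_le', div_le_iff₀ hd1]
    nlinarith

/-- Theorem 1.4: let `d ≥ 3` and `d/(d-1) < r ≤ (d²+1)/(d(d-1))`. Then `V_r^I A` is
`L^p → L^q` bounded in the interior of `𝔓_d(r)`, unbounded outside `𝔓_d(r)`, and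
bounded on the half-open segments `(Q_4(r), Q_1(r)]` and `[Q_1(r), Q_2)`. -/
theorem local_variation_pentagon_mid (d : ℕ) (hd : 3 ≤ d) (r : ℝ)
    (hr1 : (d : ℝ) / ((d : ℝ) - 1) < r)
    (hr2 : r ≤ ((d : ℝ) ^ 2 + 1) / ((d : ℝ) * ((d : ℝ) - 1))) :
    (∀ p q : ℝ≥0∞, 1 ≤ p → 1 ≤ q →
      (((p⁻¹.toReal, q⁻¹.toReal) ∈ interior (pentagonMid d r)) →
          IsBddLpLq d p q (VrIA r)) ∧
      (((p⁻¹.toReal, q⁻¹.toReal) ∉ pentagonMid d r) →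
          ¬ IsBddLpLq d p q (VrIA r))) ∧
    (∀ p q : ℝ, 0 < p → 0 < q →
      ((1 / p, 1 / q) ∈
          segment ℝ ((1 - ((d : ℝ) + 1) / (r * (d : ℝ) * ((d : ℝ) - 1)), 1 / (r * (d : ℝ))))
            ((1 / (r * (d : ℝ)), 1 / (r * (d : ℝ)))) \
            {((1 - ((d : ℝ) + 1) / (r * (d : ℝ) * ((d : ℝ) - 1)), 1 / (r * (d : ℝ))))} →
        IsBddR d r p q) ∧
      ((1 / p, 1 / q) ∈
          segment ℝ ((1 / (r * (d : ℝ)), 1 / (r * (d : ℝ))))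
            ((((d : ℝ) - 1) / d, ((d : ℝ) - 1) / d)) \
            {((((d : ℝ) - 1) / d, ((d : ℝ) - 1) / d))} →
        IsBddR d r p q)) := by
  exact ⟨fun p q hp hq => ⟨interior_bdd hd hr1 hr2 hp hq, outside_unbdd hd hr1 hr2 hp hq⟩,
    fun p q hp hq => ⟨seg_end hd hr1 hr2 hp hq, seg_diag hd hr1 hr2 hp hq⟩⟩
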